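/- Let l > 5 be a prime with l ≡ 3 (mod 4). Put τ₁ = (5 + i·√(5l))/10 ∈ ℂ and q = exp(2πi·τ₁), so that 0 < |q| < 1 and 1 − qⁿ ≠ 0 for all n ≥ 1. Let χ(n) denote the Legendre symbol (n/5) ∈ {0,1,−1}. Then the infinite product ρ₁ = q·∏_{n=1}^{∞} (1 − qⁿ)^{5·χ(n)} (with integer exponents 5χ(n); the product is multipliable) is a real number, is algebraic over ℚ, and its degree over ℚ, i.e. the degree of its minimal polynomial over ℚ, is exactly 2·h(−5l). -/

import Mathlib

set_option linter.unusedVariables false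

namespace RR
open Filter Topology Complex


/-! ## Removable singularities and Liouville -/

/-- `f` has a removable singularity (or is regular) at `z`. -/
def Rem (f : ℂ → ℂ) (z : ℂ) : Prop := ∃ g : ℂ → ℂ, AnalyticAt ℂ g z ∧ f =ᶠ[𝓝[≠] z] g

lemma Rem.of_analytic {f : ℂ → ℂ} {z : ℂ} (h : AnalyticAt ℂ f z) : Rem f z :=
  ⟨f, h, EventuallyEq.rfl⟩

lemma Rem.mul {f g : ℂ → ℂ} {z : ℂ} (hf : Rem f z) (hg : Rem g z) :
    Rem (fun x => f x * g x) z := by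
  obtain ⟨f', hf', ef⟩ := hf
  obtain ⟨g', hg', eg⟩ := hg
  exact ⟨fun x => f' x * g' x, hf'.mul hg', ef.mul eg⟩

lemma Rem.add {f g : ℂ → ℂ} {z : ℂ} (hf : Rem f z) (hg : Rem g z) :
    Rem (fun x => f x + g x) z := by
  obtain ⟨f', hf', ef⟩ := hf
  obtain ⟨g', hg', eg⟩ := hg
  exact ⟨fun x => f' x + g' x, hf'.add hg', ef.add eg⟩

lemma Rem.sub {f g : ℂ → ℂ} {z : ℂ} (hf : Rem f z) (hg : Rem g z) :
    Rem (fun x => f x - g x) z := by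
  obtain ⟨f', hf', ef⟩ := hf
  obtain ⟨g', hg', eg⟩ := hg
  exact ⟨fun x => f' x - g' x, hf'.sub hg', ef.sub eg⟩

lemma Rem.congr {f g : ℂ → ℂ} {z : ℂ} (hf : Rem f z) (h : g =ᶠ[𝓝[≠] z] f) : Rem g z := by
  obtain ⟨f', hf', ef⟩ := hf
  exact ⟨f', hf', h.trans ef⟩

lemma tendsto_add_punctured (z l : ℂ) :
    Tendsto (fun x => x + l) (𝓝[≠] z) (𝓝[≠] (z + l)) := by
  refine tendsto_nhdsWithin_iff.2 ⟨?_, ?_⟩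
  · exact ((continuous_id.add continuous_const).tendsto z).mono_left nhdsWithin_le_nhds
  · filter_upwards [self_mem_nhdsWithin] with x hx h
    exact hx (by simpa using h)

lemma Rem.comp_add {f : ℂ → ℂ} {z : ℂ} (l : ℂ) (hf : Rem f (z + l)) :
    Rem (fun x => f (x + l)) z := by
  obtain ⟨g, hg, e⟩ := hf
  refine ⟨fun x => g (x + l), ?_, ?_⟩
  · have : AnalyticAt ℂ (fun x : ℂ => x + l) z := by fun_prop
    exact AnalyticAt.comp (g := g) hg this
  · exact (tendsto_add_punctured z l).eventually e

lemma Rem.translate {f : ℂ → ℂ} {z : ℂ} (l : ℂ) (hp : ∀ x, f (x + l) = f x)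
    (hf : Rem f (z + l)) : Rem f z := by
  have := hf.comp_add
  simpa [hp] using this

lemma Rem.comp_neg {f : ℂ → ℂ} {z : ℂ} (hf : Rem f (-z)) :
    Rem (fun x => f (-x)) z := by
  obtain ⟨g, hg, e⟩ := hf
  refine ⟨fun x => g (-x), ?_, ?_⟩
  · have : AnalyticAt ℂ (fun x : ℂ => -x) z := by fun_prop
    exact AnalyticAt.comp (g := g) hg this
  · have : Tendsto (fun x : ℂ => -x) (𝓝[≠] z) (𝓝[≠] (-z)) := by
      refine tendsto_nhdsWithin_iff.2 ⟨?_, ?_⟩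
      · exact (continuous_neg.tendsto z).mono_left nhdsWithin_le_nhds
      · filter_upwards [self_mem_nhdsWithin] with x hx h
        exact hx (by simpa using h)
    exact this.eventually e

/-- Quotient of a function vanishing at `z` by one with a simple zero at `z`. -/
lemma rem_div {N D : ℂ → ℂ} {z : ℂ} (hN : AnalyticAt ℂ N z) (hD : AnalyticAt ℂ D z)
    (hN0 : N z = 0) (hD0 : D z = 0) (hD1 : deriv D z ≠ 0) :
    ∃ g : ℂ → ℂ, AnalyticAt ℂ g z ∧ (fun x => N x / D x) =ᶠ[𝓝[≠] z] g ∧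
      g z = deriv N z / deriv D z := by
  have aN : AnalyticAt ℂ (dslope N z) z := by
    obtain ⟨p, hp⟩ := hN
    exact ⟨_, hp.has_fpower_series_dslope_fslope⟩
  have aD : AnalyticAt ℂ (dslope D z) z := by
    obtain ⟨p, hp⟩ := hD
    exact ⟨_, hp.has_fpower_series_dslope_fslope⟩
  refine ⟨fun x => dslope N z x / dslope D z x, aN.div aD (by simpa using hD1), ?_, by simp⟩
  filter_upwards [self_mem_nhdsWithin] with x hx
  have hx' : x - z ≠ 0 := sub_ne_zero.2 hx
  rw [dslope_of_ne _ hx, dslope_of_ne _ hx, slope_def_field, slope_def_field, hN0, hD0]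
  field_simp
  simp

lemma rem_eq {f g : ℂ → ℂ} {z c : ℂ} (hg : ContinuousAt g z) (e : f =ᶠ[𝓝[≠] z] g)
    (h : f =ᶠ[𝓝[≠] z] fun _ => c) : g z = c := by
  have h1 : Tendsto g (𝓝[≠] z) (𝓝 (g z)) := hg.mono_left nhdsWithin_le_nhds
  have h2 : Tendsto g (𝓝[≠] z) (𝓝 c) :=
    tendsto_const_nhds.congr' ((h.symm.trans e))
  exact tendsto_nhds_unique h1 h2

/-- Liouville for doubly periodic functions with removable singularities. -/
theorem liouville (L : PeriodPair) (f : ℂ → ℂ) (hr : ∀ z, Rem f z)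
    (hp : ∀ z, ∀ l ∈ L.lattice, f (z + l) = f z) :
    ∃ c : ℂ, ∀ z, f =ᶠ[𝓝[≠] z] fun _ => c := by
  choose g hg e using hr
  let F : ℂ → ℂ := fun z => g z z
  have key : ∀ z, F =ᶠ[𝓝 z] g z := by
    intro z
    have h1 : ∀ᶠ x in 𝓝[≠] z, F x = g z x := by
      have := eventually_eventually_nhdsWithin.2 (e z)
      have h2 : ∀ᶠ x in 𝓝[≠] z, AnalyticAt ℂ (g z) x :=
        (hg z).eventually_analyticAt.filter_mono nhdsWithin_le_nhds
      have h3 := (eventually_nhdsWithin_iff.1 (e z)).eventually_nhds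
      have h3' : ∀ᶠ y in 𝓝[≠] z, ∀ᶠ x in 𝓝 y, x ∈ ({z}ᶜ : Set ℂ) → f x = g z x :=
        h3.filter_mono nhdsWithin_le_nhds
      filter_upwards [h2, h3', self_mem_nhdsWithin] with y hy2 hy3 hy
      have h4 : f =ᶠ[𝓝[≠] y] g z := by
        apply Filter.Eventually.filter_mono nhdsWithin_le_nhds
        filter_upwards [hy3, isOpen_compl_singleton.mem_nhds hy] with x hx hx2
        exact hx hx2
      have t1 : Tendsto (g y) (𝓝[≠] y) (𝓝 (g y y)) :=
        (hg y).continuousAt.mono_left nhdsWithin_le_nhds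
      have t2 : Tendsto (g z) (𝓝[≠] y) (𝓝 (g z y)) :=
        hy2.continuousAt.mono_left nhdsWithin_le_nhds
      exact tendsto_nhds_unique (t1.congr' ((e y).symm.trans h4)) t2
    have := eventually_nhdsWithin_iff.1 h1
    filter_upwards [this] with x hx
    by_cases h : x = z
    · subst h; rfl
    · exact hx h
  have hF : Differentiable ℂ F := fun z =>
    ((hg z).congr (key z).symm).differentiableAt
  have hFp : ∀ z, ∀ l ∈ L.lattice, F (z + l) = F z := by
    intro z l hl
    have t1 : Tendsto (g (z + l)) (𝓝[≠] (z + l)) (𝓝 (g (z + l) (z + l))) :=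
        (hg (z + l)).continuousAt.mono_left nhdsWithin_le_nhds
    have t1' : Tendsto f (𝓝[≠] (z + l)) (𝓝 (F (z + l))) := t1.congr' (e (z + l)).symm
    have t2 : Tendsto f (𝓝[≠] z) (𝓝 (F z)) :=
      Tendsto.congr' (e z).symm ((hg z).continuousAt.mono_left nhdsWithin_le_nhds)
    have t3 := t1'.comp (tendsto_add_punctured z l)
    have : f ∘ (fun x => x + l) = f := by
      funext x; exact hp x l hl
    rw [this] at t3
    exact tendsto_nhds_unique t3 t2
  have hb : Bornology.IsBounded (Set.range F) := by
    have := IsZLattice.isCompact_range_of_periodic L.lattice F hF.continuous (by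
      intro z w hw
      exact hFp z w hw)
    exact this.isBounded
  refine ⟨F 0, fun z => ?_⟩
  have h1 : f =ᶠ[𝓝[≠] z] F := (e z).trans ((key z).symm.filter_mono nhdsWithin_le_nhds)
  refine h1.trans (Eventually.of_forall fun x => ?_)
  exact hF.apply_eq_apply_of_bounded hb x 0

end RR

namespace RR
open Filter Topology Complex


/-! ## Infinite products -/

/-- locally uniform convergence of a product of `1 + f n`. -/
lemma hasProdLU {U : Set ℂ} (hU : IsOpen U) (f : ℕ → ℂ → ℂ)
    (hf : ∀ n, DifferentiableOn ℂ (f n) U)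
    (hb : ∀ K ⊆ U, IsCompact K → ∃ u : ℕ → ℝ, Summable u ∧ ∀ n, ∀ x ∈ K, ‖f n x‖ ≤ u n) :
    HasProdLocallyUniformlyOn (fun n x => 1 + f n x) (fun x => ∏' n, (1 + f n x)) U := by
  apply hasProdLocallyUniformlyOn_of_forall_compact hU
  intro K hK hcK
  obtain ⟨u, hu, hb⟩ := hb K hK hcK
  exact hu.hasProdUniformlyOn_nat_one_add hcK (.of_forall hb)
    (fun n => ((hf n).mono hK).continuousOn)

lemma differentiableOn_prodLU {U : Set ℂ} (hU : IsOpen U) (f : ℕ → ℂ → ℂ)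
    (hf : ∀ n, DifferentiableOn ℂ (f n) U)
    (hb : ∀ K ⊆ U, IsCompact K → ∃ u : ℕ → ℝ, Summable u ∧ ∀ n, ∀ x ∈ K, ‖f n x‖ ≤ u n) :
    DifferentiableOn ℂ (fun x => ∏' n, (1 + f n x)) U :=
  (hasProdLU hU f hf hb).differentiableOn
    (.of_forall fun s => by
      simpa [Finset.prod_fn] using
        DifferentiableOn.finsetProd (fun n _ => (differentiableOn_const 1).add (hf n))) hU

/-- `E x w = ∏_{n ≥ 1} (1 - x^n w)`. -/
noncomputable def E (x w : ℂ) : ℂ := ∏' n : ℕ, (1 + -(x ^ (n + 1) * w))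

lemma summable_E {x : ℂ} (hx : ‖x‖ < 1) (w : ℂ) :
    Summable fun n : ℕ => ‖-(x ^ (n + 1) * w)‖ := by
  have : Summable fun n : ℕ => ‖x‖ ^ (n + 1) * ‖w‖ :=
    ((summable_nat_add_iff 1).mpr (summable_geometric_of_lt_one (norm_nonneg _) hx)).mul_right _
  simpa using this

lemma multipliable_E {x : ℂ} (hx : ‖x‖ < 1) (w : ℂ) :
    Multipliable fun n : ℕ => (1 + -(x ^ (n + 1) * w)) :=
  multipliable_one_add_of_summable (summable_E hx w)

lemma differentiable_E {x : ℂ} (hx : ‖x‖ < 1) : Differentiable ℂ (E x) := by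
  rw [← differentiableOn_univ]
  refine differentiableOn_prodLU isOpen_univ (fun n w => -(x ^ (n + 1) * w))
    (fun n => by fun_prop) ?_
  intro K _ hK
  obtain ⟨C, hC⟩ := hK.isBounded.exists_norm_le
  refine ⟨fun n => ‖x‖ ^ (n + 1) * C, ((summable_nat_add_iff 1).mpr
    (summable_geometric_of_lt_one (norm_nonneg _) hx)).mul_right _, ?_⟩
  intro n w hw
  simp only [norm_neg, norm_mul, norm_pow]
  gcongr
  exact hC w hw

/-- continuity of `E` in the nome at fixed `w`. -/
lemma differentiableOn_E_nome (w : ℂ) :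
    DifferentiableOn ℂ (fun x => E x w) (Metric.ball 0 1) := by
  refine differentiableOn_prodLU Metric.isOpen_ball (fun n x => -(x ^ (n + 1) * w))
    (fun n => by fun_prop) ?_
  intro K hKs hK
  rcases K.eq_empty_or_nonempty with hN | hN
  · exact ⟨fun _ => 0, summable_zero, by simp [hN]⟩
  obtain ⟨q₀, hq₀, HB⟩ := hK.exists_isMaxOn hN
      (show ContinuousOn (fun q : ℂ ↦ ‖q‖) K by fun_prop)
  have hq : ‖q₀‖ < 1 := by simpa using hKs hq₀
  refine ⟨fun n => ‖q₀‖ ^ (n + 1) * ‖w‖, ((summable_nat_add_iff 1).mpr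
    (summable_geometric_of_lt_one (norm_nonneg _) hq)).mul_right _, ?_⟩
  intro n x hx
  simp only [norm_neg, norm_mul, norm_pow]
  gcongr
  exact HB hx

lemma E_zero_left (w : ℂ) : E 0 w = 1 := by simp [E]

lemma E_ne_zero {x w : ℂ} (hx : ‖x‖ < 1) (h : ∀ n : ℕ, x ^ (n + 1) * w ≠ 1) : E x w ≠ 0 := by
  refine tprod_one_add_ne_zero_of_summable (f := fun n : ℕ => -(x ^ (n + 1) * w)) ?_
    (summable_E hx w)
  intro n hn
  exact h n (by linear_combination -hn)

lemma E_step {x : ℂ} (hx : ‖x‖ < 1) (w : ℂ) : E x w = (1 - x * w) * E x (x * w) := by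
  have h := (multipliable_E hx (x * w))
  have hstep : ∀ n : ℕ, (1 + -(x ^ (n + 1) * (x * w))) = (1 + -(x ^ (n + 1 + 1) * w)) := by
    intro n; ring
  unfold E
  rw [tprod_eq_zero_mul' (f := fun n : ℕ => (1 + -(x ^ (n + 1) * w)))]
  · simp only [hstep]
    ring
  · simpa only [hstep] using h

/-- multiplicative theta function -/
noncomputable def Th (x w : ℂ) : ℂ := (1 - w) * (E x w * E x w⁻¹)

lemma Th_step {x w : ℂ} (hx : ‖x‖ < 1) (hx0 : x ≠ 0) (hw : w ≠ 0) :
    Th x (x * w) = -w⁻¹ * Th x w := by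
  unfold Th
  have h1 := E_step hx w
  have h2 := E_step hx (x * w)⁻¹
  have h3 : x * (x * w)⁻¹ = w⁻¹ := by field_simp
  rw [h3] at h2
  rw [h1, h2]
  field_simp
  ring

lemma Th_inv {x w : ℂ} (hw : w ≠ 0) : Th x w⁻¹ = -w⁻¹ * Th x w := by
  unfold Th
  rw [inv_inv]
  field_simp
  ring

lemma Th_one (x : ℂ) : Th x 1 = 0 := by simp [Th]

lemma E_one_ne_zero {x : ℂ} (hx : ‖x‖ < 1) : E x 1 ≠ 0 := by
  apply E_ne_zero hx
  intro n h
  have : ‖x‖ ^ (n + 1) = 1 := by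
    have := congrArg norm h
    simpa using this
  exact absurd this (pow_lt_one₀ (norm_nonneg _) hx (by omega)).ne

/-- zeros of `Th` -/
lemma Th_eq_zero {x w : ℂ} (hx : ‖x‖ < 1) (hx0 : x ≠ 0) (hw : w ≠ 0) (h : Th x w = 0) :
    ∃ n : ℤ, w = x ^ n := by
  unfold Th at h
  rcases mul_eq_zero.1 h with h | h
  · exact ⟨0, by simpa using (sub_eq_zero.1 h).symm⟩
  rcases mul_eq_zero.1 h with h | h
  · by_contra hn
    push Not at hn
    refine E_ne_zero hx ?_ h
    intro n hn2
    apply hn (-((n : ℤ) + 1))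
    rw [zpow_neg]
    have : x ^ ((n : ℤ) + 1) = x ^ (n + 1) := by exact_mod_cast zpow_natCast x (n + 1)
    rw [this]
    have h3 := pow_ne_zero (n + 1) hx0
    field_simp
    linear_combination hn2
  · by_contra hn
    push Not at hn
    refine E_ne_zero hx ?_ h
    intro n hn2
    apply hn ((n : ℤ) + 1)
    have : x ^ ((n : ℤ) + 1) = x ^ (n + 1) := by exact_mod_cast zpow_natCast x (n + 1)
    rw [this]
    field_simp at hn2
    exact hn2.symm

/-! ## Additive theta function -/

noncomputable def ex (z : ℂ) : ℂ := Complex.exp (2 * Real.pi * I * z)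

lemma ex_add (z w : ℂ) : ex (z + w) = ex z * ex w := by
  unfold ex; rw [← Complex.exp_add]; ring_nf

lemma ex_neg (z : ℂ) : ex (-z) = (ex z)⁻¹ := by
  unfold ex; rw [← Complex.exp_neg]; ring_nf

lemma ex_ne_zero (z : ℂ) : ex z ≠ 0 := Complex.exp_ne_zero _

lemma ex_zero : ex 0 = 1 := by simp [ex]

lemma ex_nat_mul (n : ℕ) (z : ℂ) : ex (n * z) = ex z ^ n := by
  unfold ex; rw [← Complex.exp_nat_mul]; ring_nf

lemma ex_int_mul (n : ℤ) (z : ℂ) : ex (n * z) = ex z ^ n := by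
  unfold ex; rw [← Complex.exp_int_mul]; ring_nf

lemma ex_eq_one {z : ℂ} : ex z = 1 ↔ ∃ n : ℤ, z = n := by
  unfold ex
  rw [Complex.exp_eq_one_iff]
  have : (2 * Real.pi * I : ℂ) ≠ 0 := Complex.two_pi_I_ne_zero
  constructor
  · rintro ⟨n, hn⟩
    exact ⟨n, by apply mul_left_cancel₀ this; linear_combination hn⟩
  · rintro ⟨n, hn⟩
    exact ⟨n, by rw [hn]; ring⟩

lemma ex_int (n : ℤ) : ex n = 1 := ex_eq_one.2 ⟨n, rfl⟩

lemma norm_ex (z : ℂ) : ‖ex z‖ = Real.exp (-2 * Real.pi * z.im) := by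
  unfold ex
  rw [Complex.norm_exp]
  simp

lemma norm_ex_lt_one {z : ℂ} (hz : 0 < z.im) : ‖ex z‖ < 1 := by
  rw [norm_ex, Real.exp_lt_one_iff]
  have := Real.pi_pos
  nlinarith [mul_pos this hz]

lemma differentiable_ex : Differentiable ℂ ex := by
  unfold ex; fun_prop

lemma deriv_ex (z : ℂ) : deriv ex z = 2 * Real.pi * I * ex z := by
  have : HasDerivAt ex (Complex.exp (2 * Real.pi * I * z) * (2 * Real.pi * I)) z := by
    have h := ((hasDerivAt_id z).const_mul (2 * Real.pi * I : ℂ)).cexp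
    simp only [id_eq, mul_one] at h
    exact h
  rw [this.deriv]; unfold ex; ring

/-- additive theta function for the lattice `ℤ + τ ℤ`. -/
noncomputable def th (τ z : ℂ) : ℂ := Th (ex τ) (ex z)

lemma th_add_tau {τ : ℂ} (hτ : 0 < τ.im) (z : ℂ) : th τ (z + τ) = -(ex z)⁻¹ * th τ z := by
  unfold th
  rw [ex_add, mul_comm, Th_step (norm_ex_lt_one hτ) (ex_ne_zero _) (ex_ne_zero _)]

lemma th_add_one {τ : ℂ} (z : ℂ) : th τ (z + 1) = th τ z := by
  unfold th
  rw [ex_add]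
  have := ex_int 1
  simp only [Int.cast_one] at this
  rw [this, mul_one]

lemma th_neg {τ : ℂ} (z : ℂ) : th τ (-z) = -(ex z)⁻¹ * th τ z := by
  unfold th
  rw [ex_neg, Th_inv (ex_ne_zero _)]

lemma th_zero {τ : ℂ} : th τ 0 = 0 := by simp [th, ex_zero, Th_one]

lemma differentiable_th {τ : ℂ} (hτ : 0 < τ.im) : Differentiable ℂ (th τ) := by
  unfold th Th
  have h1 := differentiable_E (norm_ex_lt_one hτ)
  have h2 := differentiable_ex
  have h3 : Differentiable ℂ (fun z => E (ex τ) (ex z)⁻¹) := by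
    have : (fun z => E (ex τ) (ex z)⁻¹) = fun z => E (ex τ) (ex (-z)) := by
      funext z; rw [ex_neg]
    rw [this]
    exact h1.comp (h2.comp differentiable_neg)
  exact ((differentiable_const 1).sub h2).mul ((h1.comp h2).mul h3)

lemma analyticAt_th {τ : ℂ} (hτ : 0 < τ.im) (z : ℂ) : AnalyticAt ℂ (th τ) z := (differentiable_th hτ).analyticAt z

lemma th_eq_zero {τ : ℂ} (hτ : 0 < τ.im) {z : ℂ} (h : th τ z = 0) : ∃ m n : ℤ, z = m + n * τ := by
  obtain ⟨n, hn⟩ := Th_eq_zero (norm_ex_lt_one hτ) (ex_ne_zero _) (ex_ne_zero _) h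
  have : ex (z - n * τ) = 1 := by
    rw [sub_eq_add_neg, ex_add, ex_neg, ex_int_mul, hn]
    exact mul_inv_cancel₀ (zpow_ne_zero _ (ex_ne_zero _))
  obtain ⟨m, hm⟩ := ex_eq_one.1 this
  exact ⟨m, n, by linear_combination hm⟩

lemma deriv_th_zero {τ : ℂ} (hτ : 0 < τ.im) : deriv (th τ) 0 ≠ 0 := by
  have e : th τ = fun z => (1 - ex z) * (E (ex τ) (ex z) * E (ex τ) (ex (-z))) := by
    funext z; simp [th, Th, ex_neg]
  have h1 := differentiable_E (norm_ex_lt_one hτ)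
  have h2 := differentiable_ex
  have h3 : HasDerivAt (fun z => 1 - ex z) (-(2 * Real.pi * I)) 0 := by
    have := (h2 0).hasDerivAt.const_sub 1
    rw [deriv_ex, ex_zero, mul_one] at this
    exact this
  have h4 : DifferentiableAt ℂ (fun z => E (ex τ) (ex z) * E (ex τ) (ex (-z))) 0 :=
    ((h1.comp h2).mul (h1.comp (h2.comp differentiable_neg))) 0
  have h5 := h3.mul h4.hasDerivAt
  rw [e]
  have h6 := h5.deriv
  have h7 : ((fun z => 1 - ex z) * fun z => E (ex τ) (ex z) * E (ex τ) (ex (-z))) =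
    fun z => (1 - ex z) * (E (ex τ) (ex z) * E (ex τ) (ex (-z))) := rfl
  rw [h7] at h6
  rw [h6]
  have := E_one_ne_zero (norm_ex_lt_one hτ)
  simp [ex_zero, this, Real.pi_ne_zero]

end RR

namespace RR
open Filter Topology Complex


/-! ## The lattice `ℤ + τ ℤ` -/

lemma indep_one_tau {τ : ℂ} (hτ : 0 < τ.im) : LinearIndependent ℝ ![(1 : ℂ), τ] := by
  rw [LinearIndependent.pair_iff]
  intro s t h
  have h1 := congrArg Complex.im h
  have h2 := congrArg Complex.re h
  simp at h1 h2
  have ht : t = 0 := by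
    rcases h1 with h | h
    · exact h
    · exact absurd h hτ.ne'
  subst ht
  simpa using h2

/-- the period pair `(1, τ)` -/
noncomputable def pp {τ : ℂ} (hτ : 0 < τ.im) : PeriodPair := ⟨1, τ, indep_one_tau hτ⟩

section
variable {τ : ℂ} (hτ : 0 < τ.im)

lemma mem_pp {x : ℂ} : x ∈ (pp hτ).lattice ↔ ∃ m n : ℤ, (m : ℂ) + n * τ = x := by
  rw [PeriodPair.mem_lattice]; simp [pp]

lemma periodic_pp {f : ℂ → ℂ} (h1 : ∀ z, f (z + 1) = f z) (h2 : ∀ z, f (z + τ) = f z) :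
    ∀ z, ∀ l ∈ (pp hτ).lattice, f (z + l) = f z := by
  intro z l hl
  obtain ⟨m, n, rfl⟩ := (mem_pp hτ).1 hl
  have p1 : Function.Periodic f ((m : ℤ) * 1) := (show Function.Periodic f 1 from h1).int_mul m
  have p2 : Function.Periodic f ((n : ℤ) * τ) := (show Function.Periodic f τ from h2).int_mul n
  have := p1.add_period p2 z
  simpa using this

lemma th_mem {z : ℂ} (hz : z ∈ (pp hτ).lattice) : th τ z = 0 := by
  let f : ℂ → ℂ := fun z => if th τ z = 0 then 1 else 0
  have hf : ∀ z, ∀ l ∈ (pp hτ).lattice, f (z + l) = f z := by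
    apply periodic_pp
    · intro z; simp only [f, th_add_one]
    · intro z; simp only [f, th_add_tau hτ]
      simp [ex_ne_zero]
  have := hf 0 z hz
  by_contra h
  simp [f, th_zero, h] at this

lemma th_ne_zero {z : ℂ} (hz : z ∉ (pp hτ).lattice) : th τ z ≠ 0 := by
  intro h
  obtain ⟨m, n, e⟩ := th_eq_zero hτ h
  exact hz ((mem_pp hτ).2 ⟨m, n, e.symm⟩)

lemma th_eq_zero_iff {z : ℂ} : th τ z = 0 ↔ z ∈ (pp hτ).lattice :=
  ⟨fun h => by by_contra hz; exact th_ne_zero hτ hz h, th_mem hτ⟩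

lemma analyticAt_th_shift {τ : ℂ} (hτ : 0 < τ.im) (a z : ℂ) : AnalyticAt ℂ (fun x => th τ (x + a)) z :=
  ((differentiable_th hτ).comp (differentiable_id.add_const a)).analyticAt z

lemma analyticAt_th_shift' {τ : ℂ} (hτ : 0 < τ.im) (a z : ℂ) : AnalyticAt ℂ (fun x => th τ (x - a)) z :=
  ((differentiable_th hτ).comp (differentiable_id.sub_const a)).analyticAt z

lemma deriv_th_shift (a z : ℂ) : deriv (fun x => th τ (x + a)) z = deriv (th τ) (z + a) :=
  deriv_comp_add_const _ _ _

lemma deriv_th_shift' (a z : ℂ) : deriv (fun x => th τ (x - a)) z = deriv (th τ) (z - a) :=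
  deriv_comp_sub_const _ _ _

/-- the main elliptic function for the product formula is constant -/
lemma prod_const {w : ℂ} (hw : w ∉ (pp hτ).lattice) (hw2 : 2 * w ∉ (pp hτ).lattice) :
    (∀ z, z ∉ (pp hτ).lattice → z - w ∉ (pp hτ).lattice → z + w ∉ (pp hτ).lattice →
      ((pp hτ).weierstrassP z - (pp hτ).weierstrassP w) * th τ z ^ 2 /
        (th τ (z - w) * th τ (z + w)) = deriv (th τ) 0 ^ 2 / (th τ (-w) * th τ w)) ∧
    (pp hτ).derivWeierstrassP w / deriv (th τ) 0 * (th τ w ^ 2 / th τ (2 * w)) =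
      deriv (th τ) 0 ^ 2 / (th τ (-w) * th τ w) := by
  set L := pp hτ with hL
  set f : ℂ → ℂ := fun z => (L.weierstrassP z - L.weierstrassP w) * th τ z ^ 2 /
        (th τ (z - w) * th τ (z + w)) with hf
  have hnw : -w ∉ L.lattice := fun h => hw (by simpa using L.lattice.neg_mem h)
  have hper : ∀ z, ∀ l ∈ L.lattice, f (z + l) = f z := by
    apply periodic_pp hτ
    · intro z
      have e1 : L.weierstrassP (z + 1) = L.weierstrassP z :=
        L.weierstrassP_add_coe z ⟨1, (mem_pp hτ).2 ⟨1, 0, by simp⟩⟩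
      simp only [hf, e1, th_add_one]
      rw [show z + 1 - w = z - w + 1 by ring, show z + 1 + w = z + w + 1 by ring,
        th_add_one, th_add_one]
    · intro z
      have e1 : L.weierstrassP (z + τ) = L.weierstrassP z :=
        L.weierstrassP_add_coe z ⟨τ, (mem_pp hτ).2 ⟨0, 1, by simp⟩⟩
      simp only [hf, e1, th_add_tau hτ]
      rw [show z + τ - w = z - w + τ by ring, show z + τ + w = z + w + τ by ring,
        th_add_tau hτ, th_add_tau hτ, sub_eq_add_neg z w, ex_add, ex_add, ex_neg]
      have h1 := ex_ne_zero z
      have h2 := ex_ne_zero w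
      by_cases h3 : th τ (z + -w) = 0
      · simp [h3]
      by_cases h4 : th τ (z + w) = 0
      · simp [h4]
      field_simp
  -- analyticity facts
  have aP : ∀ z ∉ L.lattice, AnalyticAt ℂ L.weierstrassP z := fun z hz =>
    L.analyticOnNhd_weierstrassP z hz
  have aw : ∀ z, AnalyticAt ℂ (fun x => th τ (x - w)) z := analyticAt_th_shift' hτ w
  have aw' : ∀ z, AnalyticAt ℂ (fun x => th τ (x + w)) z := analyticAt_th_shift hτ w
  have at0 : ∀ z, AnalyticAt ℂ (th τ) z := analyticAt_th hτ
  -- at 0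
  have r0 : ∃ g : ℂ → ℂ, AnalyticAt ℂ g 0 ∧ f =ᶠ[𝓝[≠] 0] g ∧
      g 0 = deriv (th τ) 0 ^ 2 / (th τ (-w) * th τ w) := by
    have ad : AnalyticAt ℂ (dslope (th τ) 0) 0 := by
      obtain ⟨p, hp⟩ := at0 0
      exact ⟨_, hp.has_fpower_series_dslope_fslope⟩
    have aE : AnalyticAt ℂ (L.weierstrassPExcept 0) 0 := L.analyticAt_weierstrassPExcept 0
    refine ⟨fun x => ((L.weierstrassPExcept 0 x - L.weierstrassP w) * x ^ 2 + 1) *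
      dslope (th τ) 0 x ^ 2 / (th τ (x - w) * th τ (x + w)), ?_, ?_, ?_⟩
    · refine AnalyticAt.div ?_ ((aw 0).mul (aw' 0)) ?_
      · exact (((aE.sub analyticAt_const).mul (analyticAt_id.pow 2)).add analyticAt_const).mul
          (ad.pow 2)
      · simp only [zero_sub, zero_add]
        exact mul_ne_zero (th_ne_zero hτ hnw) (th_ne_zero hτ hw)
    · filter_upwards [self_mem_nhdsWithin] with x hx
      have hx0 : x ≠ 0 := hx
      have e1 := L.weierstrassPExcept_add 0 x
      simp only [ZeroMemClass.coe_zero, sub_zero] at e1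
      simp only [hf]
      rw [← e1, dslope_of_ne _ hx, slope_def_field, th_zero]
      congr 1
      field_simp
      simp only [sub_zero, ne_eq, OfNat.ofNat_ne_zero, not_false_eq_true, zero_pow, div_zero]
      field_simp
      ring
    · simp
  -- at w
  have rw1 : ∃ g : ℂ → ℂ, AnalyticAt ℂ g w ∧ f =ᶠ[𝓝[≠] w] g ∧
      g w = L.derivWeierstrassP w / deriv (th τ) 0 * (th τ w ^ 2 / th τ (2 * w)) := by
    obtain ⟨g, hg, e, v⟩ := rem_div (N := fun x => L.weierstrassP x - L.weierstrassP w)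
      (D := fun x => th τ (x - w)) (z := w) ((aP w hw).sub analyticAt_const) (aw w)
      (by simp) (by simp [th_zero]) (by rw [deriv_th_shift']; simpa using deriv_th_zero hτ)
    refine ⟨fun x => g x * (th τ x ^ 2 / th τ (x + w)), ?_, ?_, ?_⟩
    · refine hg.mul (((at0 w).pow 2).div (aw' w) ?_)
      rw [← two_mul]; exact th_ne_zero hτ hw2
    · filter_upwards [e] with x hx
      rw [← hx]
      simp only [hf]
      rw [div_mul_div_comm]
    · simp only [v]
      rw [deriv_th_shift', sub_self, ← two_mul]
      have : deriv (fun x => L.weierstrassP x - L.weierstrassP w) w = L.derivWeierstrassP w := by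
        rw [deriv_sub_const, L.deriv_weierstrassP]
      rw [this]
  have rw2 : Rem f (-w) := by
    obtain ⟨g, hg, e, v⟩ := rem_div (N := fun x => L.weierstrassP x - L.weierstrassP w)
      (D := fun x => th τ (x + w)) (z := -w) ((aP _ hnw).sub analyticAt_const) (aw' (-w))
      (by simp) (by simp [th_zero]) (by rw [deriv_th_shift]; simpa using deriv_th_zero hτ)
    refine ⟨fun x => g x * (th τ x ^ 2 / th τ (x - w)), ?_, ?_⟩
    · refine hg.mul (((at0 _).pow 2).div (aw _) ?_)
      refine th_ne_zero hτ fun h => hw2 ?_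
      have := L.lattice.neg_mem h
      convert this using 1; ring
    · filter_upwards [e] with x hx
      rw [← hx]
      simp only [hf]
      rw [div_mul_div_comm, mul_comm (th τ (x - w))]
  have hreg : ∀ z, z ∉ L.lattice → z - w ∉ L.lattice → z + w ∉ L.lattice → AnalyticAt ℂ f z := by
    intro z h1 h2 h3
    exact (((aP z h1).sub analyticAt_const).mul ((at0 z).pow 2)).div ((aw z).mul (aw' z))
      (mul_ne_zero (th_ne_zero hτ h2) (th_ne_zero hτ h3))
  have hrem : ∀ z, Rem f z := by
    intro z
    have trans : ∀ a, z - a ∈ L.lattice → Rem f a → Rem f z := by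
      intro a ha hr
      have h := L.lattice.neg_mem ha
      refine Rem.translate (-(z - a)) (fun x => hper x _ h) ?_
      convert hr using 1; ring
    by_cases h1 : z ∈ L.lattice
    · obtain ⟨g, hg, e, _⟩ := r0
      exact trans 0 (by simpa using h1) ⟨g, hg, e⟩
    by_cases h2 : z - w ∈ L.lattice
    · obtain ⟨g, hg, e, _⟩ := rw1
      exact trans w h2 ⟨g, hg, e⟩
    by_cases h3 : z + w ∈ L.lattice
    · exact trans (-w) (by simpa using h3) rw2
    exact Rem.of_analytic (hreg z h1 h2 h3)
  obtain ⟨c, hc⟩ := liouville L f hrem hper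
  obtain ⟨g, hg, e, v⟩ := r0
  obtain ⟨g', hg', e', v'⟩ := rw1
  have hc0 := rem_eq hg.continuousAt e (hc 0)
  have hc1 := rem_eq hg'.continuousAt e' (hc w)
  refine ⟨?_, ?_⟩
  · intro z h1 h2 h3
    have := rem_eq (hreg z h1 h2 h3).continuousAt EventuallyEq.rfl (hc z)
    rw [← v, hc0, ← this]
  · rw [← v, hc0, ← v', hc1]

lemma derivP_formula {w : ℂ} (hw : w ∉ (pp hτ).lattice) :
    (pp hτ).derivWeierstrassP w =
      deriv (th τ) 0 ^ 3 * th τ (2 * w) / (th τ w ^ 3 * th τ (-w)) := by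
  have hnw : -w ∉ (pp hτ).lattice := fun h => hw (by simpa using (pp hτ).lattice.neg_mem h)
  by_cases hw2 : 2 * w ∈ (pp hτ).lattice
  · rw [th_mem hτ hw2]
    have h1 := (pp hτ).derivWeierstrassP_sub_coe w ⟨2 * w, hw2⟩
    simp only at h1
    rw [show w - 2 * w = -w by ring, PeriodPair.derivWeierstrassP_neg] at h1
    have : (pp hτ).derivWeierstrassP w = 0 := by
      have h2 : (2 : ℂ) * (pp hτ).derivWeierstrassP w = 0 := by linear_combination -h1
      simpa using h2
    rw [this]; simp
  · have h := (prod_const hτ hw hw2).2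
    have d0 := deriv_th_zero hτ
    have h1 := th_ne_zero hτ hw
    have h2 := th_ne_zero hτ hnw
    have h3 := th_ne_zero hτ hw2
    field_simp at h ⊢
    linear_combination h

lemma P_sub_formula {z w : ℂ} (hz : z ∉ (pp hτ).lattice) (hw : w ∉ (pp hτ).lattice)
    (hw2 : 2 * w ∉ (pp hτ).lattice) :
    (pp hτ).weierstrassP z - (pp hτ).weierstrassP w =
      deriv (th τ) 0 ^ 2 * th τ (z - w) * th τ (z + w) / (th τ z ^ 2 * th τ w * th τ (-w)) := by
  have hnw : -w ∉ (pp hτ).lattice := fun h => hw (by simpa using (pp hτ).lattice.neg_mem h)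
  have h0 := th_ne_zero hτ hz
  have h1 := th_ne_zero hτ hw
  have h2 := th_ne_zero hτ hnw
  by_cases ha : z - w ∈ (pp hτ).lattice
  · have := (pp hτ).weierstrassP_add_coe w ⟨_, ha⟩
    simp only [add_sub_cancel] at this
    rw [this, th_mem hτ ha]; simp
  by_cases hb : z + w ∈ (pp hτ).lattice
  · have := (pp hτ).weierstrassP_add_coe (-w) ⟨_, hb⟩
    simp only [neg_add_cancel_comm, PeriodPair.weierstrassP_neg] at this
    rw [show -w + (z + w) = z by ring] at this
    rw [this, th_mem hτ hb]; simp
  · have h := (prod_const hτ hw hw2).1 z hz ha hb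
    have h3 := th_ne_zero hτ ha
    have h4 := th_ne_zero hτ hb
    field_simp at h ⊢
    linear_combination h

lemma P_eq_iff {z w : ℂ} (hz : z ∉ (pp hτ).lattice) (hw : w ∉ (pp hτ).lattice)
    (hw2 : 2 * w ∉ (pp hτ).lattice) (h : (pp hτ).weierstrassP z = (pp hτ).weierstrassP w) :
    z - w ∈ (pp hτ).lattice ∨ z + w ∈ (pp hτ).lattice := by
  have hnw : -w ∉ (pp hτ).lattice := fun h => hw (by simpa using (pp hτ).lattice.neg_mem h)
  have e := P_sub_formula hτ hz hw hw2
  rw [h, sub_self] at e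
  by_contra hcon
  push Not at hcon
  have := deriv_th_zero hτ
  have h0 := th_ne_zero hτ hz
  have h1 := th_ne_zero hτ hw
  have h2 := th_ne_zero hτ hnw
  have h3 := th_ne_zero hτ hcon.1
  have h4 := th_ne_zero hτ hcon.2
  have : deriv (th τ) 0 ^ 2 * th τ (z - w) * th τ (z + w) /
    (th τ z ^ 2 * th τ w * th τ (-w)) ≠ 0 := by positivity
  exact this e.symm

end

end RR

namespace RR
open Filter Topology Complex


/-! ## The invariants determine the lattice -/

lemma countable_lattice (L : PeriodPair) : (L.lattice : Set ℂ).Countable := by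
  have : (L.lattice : Set ℂ) ⊆ Set.range (fun p : ℤ × ℤ => (p.1 : ℂ) * L.ω₁ + p.2 * L.ω₂) := by
    intro x hx
    obtain ⟨m, n, e⟩ := PeriodPair.mem_lattice.1 hx
    exact ⟨(m, n), e⟩
  exact (Set.countable_range _).mono this

lemma eventually_notMem_lattice (L : PeriodPair) (a : ℂ) : ∀ᶠ x in 𝓝[≠] a, x ∉ L.lattice := by
  by_cases ha : a ∈ L.lattice
  · have h1 := (L.analyticOnNhd_weierstrassPExcept a) a (by simp)
    have hc : IsClosed ((L.lattice : Set ℂ) \ {a}) := L.isClosed_of_subset_lattice Set.sdiff_subset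
    have : ((L.lattice : Set ℂ) \ {a})ᶜ ∈ 𝓝 a := hc.isOpen_compl.mem_nhds (by simp)
    filter_upwards [mem_nhdsWithin_of_mem_nhds this, self_mem_nhdsWithin] with x h1 h2 h3
    exact h1 ⟨h3, h2⟩
  · have : (L.lattice : Set ℂ)ᶜ ∈ 𝓝 a := L.isClosed_lattice.isOpen_compl.mem_nhds ha
    exact mem_nhdsWithin_of_mem_nhds this

lemma P_eq_of_invariants_near (L₁ L₂ : PeriodPair) (h2 : L₁.g₂ = L₂.g₂) (h3 : L₁.g₃ = L₂.g₃) :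
    ∀ᶠ z in 𝓝[≠] (0 : ℂ), L₁.weierstrassP z = L₂.weierstrassP z := by
  set u₁ := L₁.weierstrassPExcept 0
  set u₂ := L₂.weierstrassPExcept 0
  have a1 : AnalyticAt ℂ u₁ 0 := (L₁.analyticOnNhd_weierstrassPExcept 0) 0 (by simp)
  have a2 : AnalyticAt ℂ u₂ 0 := (L₂.analyticOnNhd_weierstrassPExcept 0) 0 (by simp)
  have e1 : ∀ z, L₁.weierstrassP z = u₁ z + 1 / z ^ 2 := by
    intro z
    have := L₁.weierstrassPExcept_add ⟨0, L₁.lattice.zero_mem⟩ z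
    rw [← this]; simp [u₁]
  have e2 : ∀ z, L₂.weierstrassP z = u₂ z + 1 / z ^ 2 := by
    intro z
    have := L₂.weierstrassPExcept_add ⟨0, L₂.lattice.zero_mem⟩ z
    rw [← this]; simp [u₂]
  have dd : ∀ (L : PeriodPair) (u : ℂ → ℂ) (z : ℂ), (∀ z, L.weierstrassP z = u z + 1 / z ^ 2) →
      AnalyticAt ℂ u z → z ≠ 0 →
      L.derivWeierstrassP z = deriv u z - 2 / z ^ 3 := by
    intro L u z e ha hz
    rw [← L.deriv_weierstrassP]
    have : L.weierstrassP = fun z => u z + 1 / z ^ 2 := funext e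
    rw [this]
    have h : HasDerivAt (fun z : ℂ => u z + 1 / z ^ 2)
        (deriv u z + (0 * z ^ 2 - 1 * ((2 : ℕ) * z ^ (2 - 1))) / (z ^ 2) ^ 2) z :=
      ha.differentiableAt.hasDerivAt.add ((hasDerivAt_const z (1 : ℂ)).div (hasDerivAt_pow 2 z)
        (by positivity))
    rw [h.deriv]
    field_simp
    push_cast
    ring
  set d := fun z => u₁ z - u₂ z with hd
  have ad : AnalyticAt ℂ d 0 := a1.sub a2
  have key : ∀ᶠ z in 𝓝[≠] (0 : ℂ), z * deriv d z * (z ^ 3 * (deriv u₁ z + deriv u₂ z) - 4) =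
      d z * (4 * ((z ^ 2 * u₁ z + 1) ^ 2 + (z ^ 2 * u₁ z + 1) * (z ^ 2 * u₂ z + 1) +
        (z ^ 2 * u₂ z + 1) ^ 2) - L₁.g₂ * z ^ 4) := by
    filter_upwards [eventually_notMem_lattice L₁ 0, eventually_notMem_lattice L₂ 0,
      self_mem_nhdsWithin, mem_nhdsWithin_of_mem_nhds a1.eventually_analyticAt,
      mem_nhdsWithin_of_mem_nhds a2.eventually_analyticAt] with z n1 n2 hz b1 b2
    have hz : z ≠ 0 := hz
    have o1 := L₁.derivWeierstrassP_sq z n1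
    have o2 := L₂.derivWeierstrassP_sq z n2
    rw [dd L₁ u₁ z e1 b1 hz, e1] at o1
    rw [dd L₂ u₂ z e2 b2 hz, e2, ← h2, ← h3] at o2
    have : deriv d z = deriv u₁ z - deriv u₂ z :=
      deriv_sub b1.differentiableAt b2.differentiableAt
    rw [this]
    simp only [hd]
    field_simp at o1 o2
    have hz2 : z ^ 2 ≠ 0 := by positivity
    refine mul_left_cancel₀ hz2 ?_
    linear_combination o1 - o2
  by_contra hne
  have hnz : ¬ ∀ᶠ z in 𝓝 (0 : ℂ), d z = 0 := by
    intro h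
    apply hne
    filter_upwards [mem_nhdsWithin_of_mem_nhds h] with z hz
    rw [e1, e2, sub_eq_zero.1 hz]
  obtain ⟨n, h, ah, h0, hh⟩ := (ad.exists_eventuallyEq_pow_smul_nonzero_iff).2 hnz
  simp only [sub_zero, smul_eq_mul] at hh
  have hdd : ∀ᶠ z in 𝓝 (0 : ℂ), z * deriv d z = z ^ n * (n * h z + z * deriv h z) := by
    filter_upwards [hh.eventually_nhds, ah.eventually_analyticAt] with z hz hb
    have hz' : d =ᶠ[𝓝 z] fun z => z ^ n * h z := hz
    rw [hz'.deriv_eq, deriv_fun_mul (by fun_prop) hb.differentiableAt]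
    rcases n with _ | n
    · simp
    · simp; ring
  have key2 : ∀ᶠ z in 𝓝[≠] (0 : ℂ), (n * h z + z * deriv h z) *
      (z ^ 3 * (deriv u₁ z + deriv u₂ z) - 4) =
      h z * (4 * ((z ^ 2 * u₁ z + 1) ^ 2 + (z ^ 2 * u₁ z + 1) * (z ^ 2 * u₂ z + 1) +
        (z ^ 2 * u₂ z + 1) ^ 2) - L₁.g₂ * z ^ 4) := by
    filter_upwards [key, mem_nhdsWithin_of_mem_nhds hdd, mem_nhdsWithin_of_mem_nhds hh,
      self_mem_nhdsWithin] with z k1 k2 k3 hz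
    have hz : z ^ n ≠ 0 := pow_ne_zero _ hz
    rw [k2, k3] at k1
    refine mul_left_cancel₀ hz ?_
    linear_combination k1
  have c1 : ContinuousAt (fun z => (n * h z + z * deriv h z) *
      (z ^ 3 * (deriv u₁ z + deriv u₂ z) - 4)) 0 := by
    have := a1.deriv; have := a2.deriv; have := ah.deriv
    exact AnalyticAt.continuousAt (𝕜 := ℂ) (by fun_prop)
  have c2 : ContinuousAt (fun z => h z * (4 * ((z ^ 2 * u₁ z + 1) ^ 2 +
      (z ^ 2 * u₁ z + 1) * (z ^ 2 * u₂ z + 1) +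
        (z ^ 2 * u₂ z + 1) ^ 2) - L₁.g₂ * z ^ 4)) 0 := by
    exact AnalyticAt.continuousAt (𝕜 := ℂ) (by fun_prop)
  have := tendsto_nhds_unique_of_eventuallyEq (c1.tendsto.mono_left nhdsWithin_le_nhds)
    (c2.tendsto.mono_left (nhdsWithin_le_nhds (s := {0}ᶜ))) key2
  simp at this
  have h4 : h 0 * (4 * n + 12) = 0 := by linear_combination -this
  rcases mul_eq_zero.1 h4 with h5 | h5
  · exact h0 h5
  · have : ((4 * n + 12 : ℕ) : ℂ) = 0 := by push_cast; exact h5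
    norm_cast at this

lemma P_eq_of_invariants (L₁ L₂ : PeriodPair) (h2 : L₁.g₂ = L₂.g₂) (h3 : L₁.g₃ = L₂.g₃)
    (z : ℂ) (hz1 : z ∉ L₁.lattice) (hz2 : z ∉ L₂.lattice) :
    L₁.weierstrassP z = L₂.weierstrassP z := by
  set U : Set ℂ := ((L₁.lattice : Set ℂ) ∪ L₂.lattice)ᶜ with hU
  have hUo : IsOpen U := (L₁.isClosed_lattice.union L₂.isClosed_lattice).isOpen_compl
  have hconn : IsPreconnected U := by
    refine (Set.Countable.isConnected_compl_of_one_lt_rank ?_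
      ((countable_lattice L₁).union (countable_lattice L₂))).isPreconnected
    rw [Complex.rank_real_complex]; norm_num
  have an1 : AnalyticOnNhd ℂ L₁.weierstrassP U := L₁.analyticOnNhd_weierstrassP.mono
    (Set.compl_subset_compl.2 Set.subset_union_left)
  have an2 : AnalyticOnNhd ℂ L₂.weierstrassP U := L₂.analyticOnNhd_weierstrassP.mono
    (Set.compl_subset_compl.2 Set.subset_union_right)
  have near := P_eq_of_invariants_near L₁ L₂ h2 h3
  have near' := near.and ((eventually_notMem_lattice L₁ 0).and (eventually_notMem_lattice L₂ 0))
  have near'' : ∀ᶠ x in 𝓝[≠] (0 : ℂ), ∀ᶠ y in 𝓝 x, L₁.weierstrassP y = L₂.weierstrassP y := by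
    rw [eventually_nhdsWithin_iff] at near ⊢
    filter_upwards [near.eventually_nhds] with x hx hx0
    filter_upwards [hx, isOpen_compl_singleton.mem_nhds hx0] with y hy hy0
    exact hy hy0
  obtain ⟨x, hx, hx1, hx2⟩ := (near''.and ((eventually_notMem_lattice L₁ 0).and
    (eventually_notMem_lattice L₂ 0))).exists
  have hxU : x ∈ U := by simp [hU, hx1, hx2]
  exact an1.eqOn_of_preconnected_of_eventuallyEq an2 hconn hxU hx (by simp [hU, hz1, hz2])

lemma lattice_le_of_invariants (L₁ L₂ : PeriodPair) (h2 : L₁.g₂ = L₂.g₂) (h3 : L₁.g₃ = L₂.g₃) :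
    L₁.lattice ≤ L₂.lattice := by
  intro l hl
  by_contra hl2
  have e := P_eq_of_invariants L₁ L₂ h2 h3
  have c2 : ContinuousAt L₂.weierstrassP l := (L₂.analyticOnNhd_weierstrassP l hl2).continuousAt
  have c1 : ContinuousAt (L₁.weierstrassPExcept l) l :=
    ((L₁.analyticOnNhd_weierstrassPExcept l) l (by simp)).continuousAt
  have key : ∀ᶠ z in 𝓝[≠] l, (1 : ℂ) =
      (z - l) ^ 2 * (L₂.weierstrassP z - L₁.weierstrassPExcept l z + 1 / l ^ 2) := by
    filter_upwards [eventually_notMem_lattice L₁ l, eventually_notMem_lattice L₂ l,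
      self_mem_nhdsWithin] with z n1 n2 hz
    have hz : z - l ≠ 0 := sub_ne_zero.2 hz
    rw [← e z n1 n2, ← L₁.weierstrassPExcept_add ⟨l, hl⟩ z]
    simp only
    rw [show ∀ a b c : ℂ, a + (b - c) - a + c = b by intros; ring]
    field_simp
  have cc : ContinuousAt (fun z => (z - l) ^ 2 *
      (L₂.weierstrassP z - L₁.weierstrassPExcept l z + 1 / l ^ 2)) l := by fun_prop
  have := tendsto_nhds_unique_of_eventuallyEq (tendsto_const_nhds)
    (cc.tendsto.mono_left (nhdsWithin_le_nhds (s := {l}ᶜ))) key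
  simp at this

lemma lattice_eq_of_invariants (L₁ L₂ : PeriodPair) (h2 : L₁.g₂ = L₂.g₂) (h3 : L₁.g₃ = L₂.g₃) :
    L₁.lattice = L₂.lattice :=
  le_antisymm (lattice_le_of_invariants L₁ L₂ h2 h3)
    (lattice_le_of_invariants L₂ L₁ h2.symm h3.symm)

end RR

namespace RR
open Filter Topology Complex


/-! ## Homotheties -/

/-- the lattice `a Λ` -/
noncomputable def sc (a : ℂ) (Λ : Submodule ℤ ℂ) : Submodule ℤ ℂ := Λ.map (LinearMap.mulLeft ℤ a)

lemma mem_sc {a : ℂ} {Λ : Submodule ℤ ℂ} {x : ℂ} : x ∈ sc a Λ ↔ ∃ y ∈ Λ, a * y = x := by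
  simp [sc]

lemma mul_mem_sc {a : ℂ} (ha : a ≠ 0) {Λ : Submodule ℤ ℂ} {x : ℂ} : a * x ∈ sc a Λ ↔ x ∈ Λ := by
  rw [mem_sc]
  constructor
  · rintro ⟨y, hy, e⟩
    rwa [← mul_left_cancel₀ ha e]
  · intro h; exact ⟨x, h, rfl⟩

lemma mem_sc_iff {a : ℂ} (ha : a ≠ 0) {Λ : Submodule ℤ ℂ} {x : ℂ} : x ∈ sc a Λ ↔ a⁻¹ * x ∈ Λ := by
  rw [← mul_mem_sc ha (x := a⁻¹ * x), mul_inv_cancel_left₀ ha]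

lemma sc_sc (a b : ℂ) (Λ : Submodule ℤ ℂ) : sc a (sc b Λ) = sc (a * b) Λ := by
  ext x; simp only [mem_sc]
  constructor
  · rintro ⟨y, ⟨z, hz, rfl⟩, rfl⟩; exact ⟨z, hz, by ring⟩
  · rintro ⟨z, hz, rfl⟩; exact ⟨b * z, ⟨z, hz, rfl⟩, by ring⟩

lemma sc_one (Λ : Submodule ℤ ℂ) : sc 1 Λ = Λ := by
  ext x; simp [mem_sc]

lemma sc_mono (a : ℂ) {Λ Λ' : Submodule ℤ ℂ} (h : Λ ≤ Λ') : sc a Λ ≤ sc a Λ' :=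
  Submodule.map_mono h

/-- the lattice generated by `a, b` -/
def latt (a b : ℂ) : Submodule ℤ ℂ := Submodule.span ℤ {a, b}

lemma mem_latt {a b x : ℂ} : x ∈ latt a b ↔ ∃ m n : ℤ, (m : ℂ) * a + n * b = x := by
  simp [latt, Submodule.mem_span_pair]

lemma sc_latt (c a b : ℂ) : sc c (latt a b) = latt (c * a) (c * b) := by
  simp [sc, latt, Submodule.map_span, Set.image_pair]

/-- being a lattice -/
def Lat (Λ : Submodule ℤ ℂ) : Prop := ∃ L : PeriodPair, L.lattice = Λ

/-- scaled period pair -/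
noncomputable def scale (L : PeriodPair) {a : ℂ} (ha : a ≠ 0) : PeriodPair :=
  ⟨a * L.ω₁, a * L.ω₂, by
    have h := L.indep
    rw [LinearIndependent.pair_iff] at h ⊢
    intro s t e
    apply h s t
    apply mul_left_cancel₀ ha
    rw [mul_add, mul_smul_comm, mul_smul_comm, e, mul_zero]⟩

lemma scale_lattice (L : PeriodPair) {a : ℂ} (ha : a ≠ 0) : (scale L ha).lattice = sc a L.lattice :=
  (sc_latt a L.ω₁ L.ω₂).symm

lemma Lat.sc {Λ : Submodule ℤ ℂ} (h : Lat Λ) {a : ℂ} (ha : a ≠ 0) : Lat (sc a Λ) := by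
  obtain ⟨L, rfl⟩ := h
  exact ⟨scale L ha, scale_lattice L ha⟩

lemma tsum_sc {a : ℂ} (ha : a ≠ 0) (Λ : Submodule ℤ ℂ) (f : ℂ → ℂ) :
    ∑' l : sc a Λ, f l = ∑' l : Λ, f (a * l) := by
  let e : Λ ≃ sc a Λ := Equiv.ofBijective (fun l => ⟨a * l, (mul_mem_sc ha).2 l.2⟩) (by
    constructor
    · intro x y h
      have := congrArg Subtype.val h
      exact Subtype.ext (mul_left_cancel₀ ha this)
    · rintro ⟨x, hx⟩
      obtain ⟨y, hy, rfl⟩ := mem_sc.1 hx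
      exact ⟨⟨y, hy⟩, rfl⟩)
  rw [← e.tsum_eq]
  rfl

/-- derivative of the Weierstrass function of a lattice -/
noncomputable def wp' (Λ : Submodule ℤ ℂ) (z : ℂ) : ℂ := -∑' l : Λ, 2 / (z - l) ^ 3

noncomputable def wpf (Λ : Submodule ℤ ℂ) (z : ℂ) : ℂ :=
  ∑' l : Λ, (1 / (z - l) ^ 2 - 1 / (l : ℂ) ^ 2)

noncomputable def GG (Λ : Submodule ℤ ℂ) (n : ℕ) : ℂ := ∑' l : Λ, ((l : ℂ) ^ n)⁻¹

lemma wp'_eq (L : PeriodPair) : wp' L.lattice = L.derivWeierstrassP := rfl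
lemma wpf_eq (L : PeriodPair) : wpf L.lattice = L.weierstrassP := rfl
lemma GG_eq (L : PeriodPair) : GG L.lattice = L.G := by
  rfl

lemma wp'_sc {a : ℂ} (ha : a ≠ 0) (Λ : Submodule ℤ ℂ) (z : ℂ) :
    wp' (sc a Λ) (a * z) = a⁻¹ ^ 3 * wp' Λ z := by
  unfold wp'
  rw [tsum_sc ha Λ (fun l => 2 / (a * z - l) ^ 3), mul_neg, ← tsum_mul_left]
  congr 1
  refine tsum_congr fun l => ?_
  rw [← mul_sub, mul_pow, inv_pow, div_mul_eq_div_div_swap, div_eq_inv_mul]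

lemma wpf_sc {a : ℂ} (ha : a ≠ 0) (Λ : Submodule ℤ ℂ) (z : ℂ) :
    wpf (sc a Λ) (a * z) = a⁻¹ ^ 2 * wpf Λ z := by
  unfold wpf
  rw [tsum_sc ha Λ (fun l => 1 / (a * z - l) ^ 2 - 1 / l ^ 2), ← tsum_mul_left]
  refine tsum_congr fun l => ?_
  rw [← mul_sub, mul_pow, mul_pow, inv_pow, one_div, one_div, one_div, one_div, mul_inv, mul_inv]
  ring

lemma GG_sc {a : ℂ} (ha : a ≠ 0) (Λ : Submodule ℤ ℂ) (n : ℕ) :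
    GG (sc a Λ) n = a⁻¹ ^ n * GG Λ n := by
  unfold GG
  rw [tsum_sc ha Λ (fun l => (l ^ n)⁻¹), ← tsum_mul_left]
  refine tsum_congr fun l => ?_
  rw [mul_pow, mul_inv, inv_pow]

lemma g₂_scale (L : PeriodPair) {a : ℂ} (ha : a ≠ 0) : (scale L ha).g₂ = a⁻¹ ^ 4 * L.g₂ := by
  simp only [PeriodPair.g₂]
  rw [← GG_eq, ← GG_eq, scale_lattice, GG_sc ha]; ring

lemma g₃_scale (L : PeriodPair) {a : ℂ} (ha : a ≠ 0) : (scale L ha).g₃ = a⁻¹ ^ 6 * L.g₃ := by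
  simp only [PeriodPair.g₃]
  rw [← GG_eq, ← GG_eq, scale_lattice, GG_sc ha]; ring

/-- the basic function on lattices with a point -/
noncomputable def T (Λ : Submodule ℤ ℂ) (z : ℂ) : ℂ := wp' Λ (2 * z) / wp' Λ z

lemma T_sc {a : ℂ} (ha : a ≠ 0) (Λ : Submodule ℤ ℂ) (z : ℂ) : T (sc a Λ) (a * z) = T Λ z := by
  unfold T
  rw [show 2 * (a * z) = a * (2 * z) by ring, wp'_sc ha, wp'_sc ha]
  exact mul_div_mul_left _ _ (by positivity)

lemma wp'_add {Λ : Submodule ℤ ℂ} (h : Lat Λ) {l : ℂ} (hl : l ∈ Λ) (z : ℂ) :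
    wp' Λ (z + l) = wp' Λ z := by
  obtain ⟨L, rfl⟩ := h
  exact L.derivWeierstrassP_add_coe z ⟨l, hl⟩

lemma wp'_neg {Λ : Submodule ℤ ℂ} (h : Lat Λ) (z : ℂ) :
    wp' Λ (-z) = - wp' Λ z := by
  obtain ⟨L, rfl⟩ := h
  exact L.derivWeierstrassP_neg z

lemma T_neg {Λ : Submodule ℤ ℂ} (h : Lat Λ) (z : ℂ) : T Λ (-z) = T Λ z := by
  unfold T
  rw [show 2 * -z = -(2 * z) by ring, wp'_neg h, wp'_neg h, neg_div_neg_eq]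

lemma T_add {Λ : Submodule ℤ ℂ} (h : Lat Λ) {l : ℂ} (hl : l ∈ Λ) (z : ℂ) : T Λ (z + l) = T Λ z := by
  unfold T
  rw [mul_add, two_mul l, wp'_add h hl, wp'_add h (Λ.add_mem hl hl)]

lemma T_congr {Λ : Submodule ℤ ℂ} (h : Lat Λ) {z z' : ℂ} (hl : z' - z ∈ Λ) : T Λ z' = T Λ z := by
  rw [← T_add h hl z, add_sub_cancel]

lemma T_congr_neg {Λ : Submodule ℤ ℂ} (h : Lat Λ) {z z' : ℂ} (hl : z' + z ∈ Λ) :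
    T Λ z' = T Λ z := by
  rw [← T_neg h z]
  exact T_congr h (by simpa using hl)

lemma coprime5 {n : ℤ} (h : ¬ (5 : ℤ) ∣ n) : IsCoprime (5 : ℤ) n :=
  (Prime.coprime_iff_not_dvd (Int.prime_iff_natAbs_prime.2 (by norm_num))).2 h

/-- a lattice with a point of exact order 5 -/
structure Pt (Λ : Submodule ℤ ℂ) (z : ℂ) : Prop where
  lat : Lat Λ
  five : 5 * z ∈ Λ
  notMem : z ∉ Λ

lemma Pt.sc {Λ : Submodule ℤ ℂ} {z : ℂ} (h : Pt Λ z) {a : ℂ} (ha : a ≠ 0) :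
    Pt (sc a Λ) (a * z) :=
  ⟨h.lat.sc ha, by rw [show 5 * (a * z) = a * (5 * z) by ring, mul_mem_sc ha]; exact h.five,
    by rw [mul_mem_sc ha]; exact h.notMem⟩

lemma Pt.int_mul_mem {Λ : Submodule ℤ ℂ} {z : ℂ} (h : Pt Λ z) (n : ℤ) :
    (n : ℂ) * z ∈ Λ ↔ (5 : ℤ) ∣ n := by
  constructor
  · intro hn
    by_contra h5
    have : IsCoprime (5 : ℤ) n := coprime5 h5
    obtain ⟨u, v, e⟩ := this
    apply h.notMem
    have h1 := Λ.smul_mem u h.five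
    have h2 := Λ.smul_mem v hn
    have := Λ.add_mem h1 h2
    simp only [zsmul_eq_mul] at this
    have e' : (u : ℂ) * 5 + v * n = 1 := by exact_mod_cast e
    convert this using 1
    linear_combination -z * e'
  · rintro ⟨k, rfl⟩
    have := Λ.smul_mem k h.five
    simp only [zsmul_eq_mul] at this
    convert this using 1
    push_cast; ring

lemma Pt.mul {Λ : Submodule ℤ ℂ} {z : ℂ} (h : Pt Λ z) {n : ℤ} (hn : ¬ (5 : ℤ) ∣ n) :
    Pt Λ (n * z) :=
  ⟨h.lat, by
    have := Λ.smul_mem n h.five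
    simp only [zsmul_eq_mul] at this
    convert this using 1
    ring, fun h' => hn ((h.int_mul_mem n).1 h')⟩

lemma Pt.add {Λ : Submodule ℤ ℂ} {z l : ℂ} (h : Pt Λ z) (hl : l ∈ Λ) : Pt Λ (z + l) :=
  ⟨h.lat, by
    have := Λ.smul_mem (5 : ℤ) hl
    simp only [zsmul_eq_mul] at this
    rw [mul_add]; exact Λ.add_mem h.five (by exact_mod_cast this),
    fun hmem => h.notMem (by simpa using Λ.sub_mem hmem hl)⟩

/-! ## Normal form -/

lemma lat_one {τ : ℂ} (hτ : 0 < τ.im) : Lat (latt 1 τ) := ⟨pp hτ, rfl⟩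

lemma im5 {τ : ℂ} (hτ : 0 < τ.im) : 0 < (5 * τ).im := by simpa using hτ

lemma pt_normal {τ : ℂ} (hτ : 0 < τ.im) : Pt (latt 1 (5 * τ)) τ := by
  refine ⟨lat_one (im5 hτ), mem_latt.2 ⟨0, 1, by simp⟩, ?_⟩
  intro h
  obtain ⟨m, n, e⟩ := mem_latt.1 h
  have := congrArg Complex.im e
  simp at this
  have h5 : (n : ℝ) * 5 = 1 := by
    apply mul_right_cancel₀ hτ.ne'
    linear_combination this
  have : n * 5 = 1 := by exact_mod_cast h5
  omega

lemma latt_of_det {a b : ℂ} {p q r s : ℤ} (h : p * s - q * r = 1 ∨ p * s - q * r = -1) :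
    latt (p * a + q * b) (r * a + s * b) = latt a b := by
  apply le_antisymm
  · intro x hx
    obtain ⟨m, n, rfl⟩ := mem_latt.1 hx
    exact mem_latt.2 ⟨m * p + n * r, m * q + n * s, by push_cast; ring⟩
  · intro x hx
    obtain ⟨m, n, rfl⟩ := mem_latt.1 hx
    rcases h with h | h
    · have h' : (p : ℂ) * s - q * r = 1 := by exact_mod_cast h
      exact mem_latt.2 ⟨m * s - n * r, n * p - m * q, by
        push_cast; linear_combination (m * a + n * b) * h'⟩
    · have h' : (p : ℂ) * s - q * r = -1 := by exact_mod_cast h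
      exact mem_latt.2 ⟨-(m * s - n * r), -(n * p - m * q), by
        push_cast; linear_combination -(m * a + n * b) * h'⟩

lemma latt_neg_left (a b : ℂ) : latt (-a) b = latt a b := by
  have := latt_of_det (a := a) (b := b) (p := -1) (q := 0) (r := 0) (s := 1) (by simp)
  simpa using this

lemma latt_comm (a b : ℂ) : latt a b = latt b a := by
  unfold latt; rw [Set.pair_comm]

lemma exists_coprime_lift {m n : ℤ} (h : ¬ ((5 : ℤ) ∣ m ∧ (5 : ℤ) ∣ n)) :
    ∃ k j : ℤ, IsCoprime (m + 5 * k) (n + 5 * j) := by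
  have key : ∀ m n : ℤ, ¬ (5 : ℤ) ∣ m → ∃ j : ℤ, IsCoprime m (n + 5 * j) := by
    intro m n hm
    obtain ⟨u, v, e⟩ : IsCoprime (5 : ℤ) m := coprime5 hm
    refine ⟨u * (1 - n), v * (1 - n), 1, ?_⟩
    linear_combination (1 - n) * e
  by_cases hm : (5 : ℤ) ∣ m
  · obtain ⟨k, hk⟩ := key n m (fun hn => h ⟨hm, hn⟩)
    exact ⟨k, 0, by simpa using hk.symm⟩
  · obtain ⟨j, hj⟩ := key m n hm
    exact ⟨0, j, by simpa using hj⟩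

/-- a basis adapted to the point of order five -/
lemma Pt.normal {Λ : Submodule ℤ ℂ} {z : ℂ} (h : Pt Λ z) :
    ∃ a τ : ℂ, a ≠ 0 ∧ 0 < τ.im ∧ Λ = RR.sc a (latt 1 (5 * τ)) ∧ z - a * τ ∈ Λ := by
  obtain ⟨L, hL⟩ := h.lat
  have hL' : Λ = latt L.ω₁ L.ω₂ := hL.symm
  obtain ⟨m, n, e⟩ := mem_latt.1 (hL' ▸ h.five)
  have hmn : ¬ ((5 : ℤ) ∣ m ∧ (5 : ℤ) ∣ n) := by
    rintro ⟨⟨m', rfl⟩, ⟨n', rfl⟩⟩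
    apply h.notMem
    rw [hL', mem_latt]
    refine ⟨m', n', ?_⟩
    apply mul_left_cancel₀ (show (5 : ℂ) ≠ 0 by norm_num)
    rw [← e]; push_cast; ring
  obtain ⟨k, j, u, v, huv⟩ := exists_coprime_lift hmn
  set M := m + 5 * k
  set N := n + 5 * j
  set b : ℂ := M * L.ω₁ + N * L.ω₂ with hb
  set a : ℂ := (-v : ℤ) * L.ω₁ + u * L.ω₂ with ha
  have hlat : latt b a = Λ := by
    rw [hL']; exact latt_of_det (Or.inl (by linear_combination huv))
  have hzb : z - b / 5 ∈ Λ := by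
    rw [hL', mem_latt]
    refine ⟨-k, -j, ?_⟩
    simp only [hb, M, N]; push_cast
    linear_combination (1 / 5 : ℂ) * e
  have hind := L.indep
  rw [LinearIndependent.pair_iff] at hind
  have hind2 : ∀ s t : ℝ, (s : ℂ) * a + t * b = 0 → s = 0 ∧ t = 0 := by
    intro s t e
    have huv' : (u : ℝ) * M + v * N = 1 := by exact_mod_cast huv
    have := hind (s * (-v) + t * M) (s * u + t * N) (by
      simp only [real_smul]
      rw [← e, ha, hb]; push_cast; ring)
    obtain ⟨h1, h2⟩ := this
    constructor
    · linear_combination -s * huv' + M * h2 - N * h1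
    · linear_combination -t * huv' + v * h2 + u * h1
  have ha0 : a ≠ 0 := by
    intro h0
    have := (hind2 1 0 (by simp [h0])).1
    norm_num at this
  have him : (b / a).im ≠ 0 := by
    intro h0
    have hre : ((b / a).re : ℂ) = b / a := by
      apply Complex.ext <;> simp [h0]
    have := (hind2 (-(b / a).re) 1 (by push_cast; rw [hre]; field_simp; ring)).2
    norm_num at this
  rcases lt_or_gt_of_ne him with hlt | hgt
  · refine ⟨-a, b / (5 * (-a)), neg_ne_zero.2 ha0, ?_, ?_, ?_⟩
    · have : b / (5 * (-a)) = ((-1 / 5 : ℝ) : ℂ) * (b / a) := by push_cast; field_simp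
      rw [this, Complex.im_ofReal_mul]; nlinarith
    · rw [sc_latt, ← hlat, latt_comm, ← latt_neg_left]
      congr 1
      · ring
      · field_simp
    · have : -a * (b / (5 * -a)) = b / 5 := by field_simp
      rw [this]; exact hzb
  · refine ⟨a, b / (5 * a), ha0, ?_, ?_, ?_⟩
    · have : b / (5 * a) = ((1 / 5 : ℝ) : ℂ) * (b / a) := by push_cast; field_simp
      rw [this, Complex.im_ofReal_mul]
      positivity
    · rw [sc_latt, ← hlat, latt_comm]
      congr 1
      · ring
      · field_simp
    · have : a * (b / (5 * a)) = b / 5 := by field_simp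
      rw [this]; exact hzb

end RR

namespace RR
open Filter Topology Complex


section
variable {τ : ℂ} (hτ : 0 < τ.im)

lemma logDeriv_ex (z : ℂ) : logDeriv ex z = 2 * Real.pi * I := by
  rw [logDeriv_apply, deriv_ex, mul_div_assoc, div_self (ex_ne_zero z), mul_one]

lemma logDeriv_th_neg {τ : ℂ} (hτ : 0 < τ.im) {z : ℂ} (h : th τ z ≠ 0) :
    logDeriv (th τ) (-z) = 2 * Real.pi * I - logDeriv (th τ) z := by
  have h1 : logDeriv (fun z => th τ (-z)) z = logDeriv (th τ) (-z) * (-1) := by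
    have := logDeriv_comp (f := th τ) (g := fun z : ℂ => -z) (x := z)
      (differentiable_th hτ _) (differentiable_neg _)
    simpa [Function.comp_def] using this
  have h2 : (fun z => th τ (-z) * ex z) = fun z => (-1) * th τ z := by
    funext x; rw [th_neg]; have := ex_ne_zero x; field_simp
  have h3 : logDeriv (fun z => th τ (-z) * ex z) z = logDeriv (th τ) z := by
    rw [h2]; exact logDeriv_const_mul _ _ (by norm_num)
  have hne : th τ (-z) ≠ 0 := by
    rw [th_neg]; exact mul_ne_zero (neg_ne_zero.2 (inv_ne_zero (ex_ne_zero _))) h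
  rw [logDeriv_mul (f := fun z => th τ (-z)) (g := ex) z hne (ex_ne_zero z) ((differentiable_th hτ).comp differentiable_neg z)
    (differentiable_ex z), h1, logDeriv_ex] at h3
  linear_combination -h3

lemma logDeriv_derivP {w : ℂ} (hw : w ∉ (pp hτ).lattice) (hw2 : 2 * w ∉ (pp hτ).lattice) :
    deriv (pp hτ).derivWeierstrassP w / (pp hτ).derivWeierstrassP w =
      2 * Real.pi * I + 2 * logDeriv (th τ) (2 * w) - 4 * logDeriv (th τ) w := by
  have h1 := th_ne_zero hτ hw
  have h2 := th_ne_zero hτ hw2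
  have d0 := deriv_th_zero hτ
  have e : (pp hτ).derivWeierstrassP =ᶠ[𝓝 w] fun z =>
      (-deriv (th τ) 0 ^ 3) * ((ex z * th τ (2 * z)) / th τ z ^ 4) := by
    have : ((pp hτ).lattice : Set ℂ)ᶜ ∈ 𝓝 w :=
      (pp hτ).isClosed_lattice.isOpen_compl.mem_nhds hw
    filter_upwards [this] with z hz
    have h1 := th_ne_zero hτ hz
    have := ex_ne_zero z
    rw [derivP_formula hτ hz, th_neg]
    field_simp
  have e2 : deriv (pp hτ).derivWeierstrassP w / (pp hτ).derivWeierstrassP w = logDeriv (fun z =>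
      (-deriv (th τ) 0 ^ 3) * ((ex z * th τ (2 * z)) / th τ z ^ 4)) w := by
    rw [logDeriv_apply, e.deriv_eq, e.eq_of_nhds]
  have dth := differentiable_th hτ
  have dth2 : Differentiable ℂ (fun z => th τ (2 * z)) := dth.comp (differentiable_id.const_mul 2)
  have h3 : logDeriv (fun z => th τ (2 * z)) w = logDeriv (th τ) (2 * w) * 2 := by
    have := logDeriv_comp (f := th τ) (g := fun z : ℂ => 2 * z) (x := w)
      (dth _) (by fun_prop)
    rw [show deriv (fun z : ℂ => 2 * z) w = 2 by simp] at this
    simpa [Function.comp_def] using this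
  rw [e2, logDeriv_const_mul _ _ (neg_ne_zero.2 (pow_ne_zero _ d0)),
    logDeriv_div (f := fun z => ex z * th τ (2 * z)) (g := fun z => th τ z ^ 4) w
      (mul_ne_zero (ex_ne_zero _) h2) (pow_ne_zero _ h1) ((differentiable_ex w).mul (dth2 w))
      ((dth w).pow 4),
    logDeriv_mul (f := ex) (g := fun z => th τ (2 * z)) w (ex_ne_zero _) h2 (differentiable_ex w)
      (dth2 w), logDeriv_ex, h3, logDeriv_fun_pow (dth w)]
  push_cast; ring

lemma logDeriv_P_sub {z w : ℂ} (hz : z ∉ (pp hτ).lattice) (hw : w ∉ (pp hτ).lattice)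
    (hw2 : 2 * w ∉ (pp hτ).lattice) (h1 : z - w ∉ (pp hτ).lattice) (h2 : z + w ∉ (pp hτ).lattice) :
    (pp hτ).derivWeierstrassP z / ((pp hτ).weierstrassP z - (pp hτ).weierstrassP w) =
      logDeriv (th τ) (z - w) + logDeriv (th τ) (z + w) - 2 * logDeriv (th τ) z := by
  have d0 := deriv_th_zero hτ
  have hnw : -w ∉ (pp hτ).lattice := fun h => hw (by simpa using (pp hτ).lattice.neg_mem h)
  have n0 := th_ne_zero hτ hz
  have n1 := th_ne_zero hτ hw
  have n2 := th_ne_zero hτ hnw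
  have n3 := th_ne_zero hτ h1
  have n4 := th_ne_zero hτ h2
  have e : (fun z => (pp hτ).weierstrassP z - (pp hτ).weierstrassP w) =ᶠ[𝓝 z] fun z =>
      (deriv (th τ) 0 ^ 2 / (th τ w * th τ (-w))) * (th τ (z - w) * th τ (z + w) / th τ z ^ 2) := by
    have : ((pp hτ).lattice : Set ℂ)ᶜ ∈ 𝓝 z :=
      (pp hτ).isClosed_lattice.isOpen_compl.mem_nhds hz
    filter_upwards [this] with x hx
    have := th_ne_zero hτ hx
    rw [P_sub_formula hτ hx hw hw2]
    field_simp
  have e2 : (pp hτ).derivWeierstrassP z / ((pp hτ).weierstrassP z - (pp hτ).weierstrassP w) =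
      logDeriv (fun z => (deriv (th τ) 0 ^ 2 / (th τ w * th τ (-w))) *
        (th τ (z - w) * th τ (z + w) / th τ z ^ 2)) z := by
    rw [logDeriv_apply, ← e.deriv_eq, ← e.eq_of_nhds, deriv_sub_const, PeriodPair.deriv_weierstrassP]
  have dth := differentiable_th hτ
  have da : Differentiable ℂ (fun z => th τ (z - w)) := dth.comp (differentiable_id.sub_const w)
  have db : Differentiable ℂ (fun z => th τ (z + w)) := dth.comp (differentiable_id.add_const w)
  have l1 : logDeriv (fun z => th τ (z - w)) z = logDeriv (th τ) (z - w) := by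
    rw [logDeriv_apply, deriv_th_shift', logDeriv_apply]
  have l2 : logDeriv (fun z => th τ (z + w)) z = logDeriv (th τ) (z + w) := by
    rw [logDeriv_apply, deriv_th_shift, logDeriv_apply]
  rw [e2, logDeriv_const_mul _ _ (div_ne_zero (pow_ne_zero _ d0) (mul_ne_zero n1 n2)),
    logDeriv_div (f := fun z => th τ (z - w) * th τ (z + w)) (g := fun z => th τ z ^ 2) z
      (mul_ne_zero n3 n4) (pow_ne_zero _ n0) ((da z).mul (db z)) ((dth z).pow 2),
    logDeriv_mul (f := fun z => th τ (z - w)) (g := fun z => th τ (z + w)) z n3 n4 (da z)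
      (db z), l1, l2, logDeriv_fun_pow (dth z)]
  push_cast; ring

/-- the slope of the tangent -/
lemma tangent {P : ℂ} (h1 : P ∉ (pp hτ).lattice) (h2 : 2 * P ∉ (pp hτ).lattice)
    (h3 : 3 * P ∉ (pp hτ).lattice) (h4 : 4 * P ∉ (pp hτ).lattice) :
    deriv (pp hτ).derivWeierstrassP P / (pp hτ).derivWeierstrassP P =
    ((pp hτ).derivWeierstrassP P + (pp hτ).derivWeierstrassP (2 * P)) /
     ((pp hτ).weierstrassP P - (pp hτ).weierstrassP (2 * P)) := by
  have hn : -P ∉ (pp hτ).lattice := fun h => h1 (by simpa using (pp hτ).lattice.neg_mem h)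
  have e1 := logDeriv_P_sub hτ (z := P) (w := 2 * P) h1 h2 (by convert h4 using 1; ring_nf)
    (by convert hn using 1; ring_nf) (by convert h3 using 1; ring_nf)
  have e2 := logDeriv_P_sub hτ (z := 2 * P) (w := P) h2 h1 h2
    (by convert h1 using 1; ring_nf) (by convert h3 using 1; ring_nf)
  rw [show P - 2 * P = -P by ring, logDeriv_th_neg hτ (th_ne_zero hτ h1),
    show P + 2 * P = 3 * P by ring] at e1
  rw [show 2 * P - P = P by ring, show 2 * P + P = 3 * P by ring] at e2
  have e3 : (pp hτ).derivWeierstrassP (2 * P) /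
      ((pp hτ).weierstrassP P - (pp hτ).weierstrassP (2 * P)) = -((pp hτ).derivWeierstrassP (2 * P) /
      ((pp hτ).weierstrassP (2 * P) - (pp hτ).weierstrassP P)) := by
    rw [← neg_sub, div_neg]
  rw [logDeriv_derivP hτ h1 h2, add_div, e3, e1, e2]
  ring

end

/-! ## Special values in normal form -/

section
variable {τ : ℂ} (hτ : 0 < τ.im)

lemma th3 {τ : ℂ} (hτ : 0 < τ.im) : th (5 * τ) (3 * τ) = th (5 * τ) (2 * τ) := by
  have := th_add_tau (im5 hτ) (-(2 * τ))
  rw [show -(2 * τ) + 5 * τ = 3 * τ by ring, th_neg, ex_neg] at this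
  rw [this]; have := ex_ne_zero (2 * τ); field_simp

lemma th4 {τ : ℂ} (hτ : 0 < τ.im) : th (5 * τ) (4 * τ) = th (5 * τ) τ := by
  have := th_add_tau (im5 hτ) (-τ)
  rw [show -τ + 5 * τ = 4 * τ by ring, th_neg, ex_neg] at this
  rw [this]; have := ex_ne_zero τ; field_simp

lemma nm (n : ℤ) (hn : ¬ (5 : ℤ) ∣ n) : (n : ℂ) * τ ∉ (pp (im5 hτ)).lattice := fun h =>
  hn (((pt_normal hτ).int_mul_mem n).1 h)

lemma nm1 : τ ∉ (pp (im5 hτ)).lattice := by simpa using nm hτ 1 (by norm_num)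
lemma nm2 : 2 * τ ∉ (pp (im5 hτ)).lattice := by simpa using nm hτ 2 (by norm_num)
lemma nm3 : 3 * τ ∉ (pp (im5 hτ)).lattice := by simpa using nm hτ 3 (by norm_num)
lemma nm4 : 4 * τ ∉ (pp (im5 hτ)).lattice := by simpa using nm hτ 4 (by norm_num)

lemma y1_eq : (pp (im5 hτ)).derivWeierstrassP τ =
    -(ex τ * deriv (th (5 * τ)) 0 ^ 3 * th (5 * τ) (2 * τ) / th (5 * τ) τ ^ 4) := by
  rw [derivP_formula _ (nm1 hτ), th_neg]
  have := ex_ne_zero τ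
  have := th_ne_zero _ (nm1 hτ)
  field_simp

lemma y2_eq : (pp (im5 hτ)).derivWeierstrassP (2 * τ) =
    -(ex τ ^ 2 * deriv (th (5 * τ)) 0 ^ 3 * th (5 * τ) τ / th (5 * τ) (2 * τ) ^ 4) := by
  have e2 : ex (2 * τ) = ex τ ^ 2 := by exact_mod_cast ex_nat_mul 2 τ
  rw [derivP_formula _ (nm2 hτ), th_neg, ← mul_assoc, show (2 : ℂ) * 2 = 4 by norm_num, th4 hτ, e2]
  have := ex_ne_zero τ
  have := th_ne_zero _ (nm2 hτ)
  field_simp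

lemma x12_eq : (pp (im5 hτ)).weierstrassP τ - (pp (im5 hτ)).weierstrassP (2 * τ) =
    deriv (th (5 * τ)) 0 ^ 2 * ex τ / (th (5 * τ) τ * th (5 * τ) (2 * τ)) := by
  have e2 : ex (2 * τ) = ex τ ^ 2 := by exact_mod_cast ex_nat_mul 2 τ
  rw [P_sub_formula _ (nm1 hτ) (nm2 hτ) (by convert nm4 hτ using 1; ring_nf),
    show τ - 2 * τ = -τ by ring, show τ + 2 * τ = 3 * τ by ring, th_neg, th_neg, th3 hτ, e2]
  have := ex_ne_zero τ
  have := th_ne_zero _ (nm1 hτ)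
  have := th_ne_zero _ (nm2 hτ)
  field_simp

/-- the function `t` -/
noncomputable def t (τ : ℂ) : ℂ := T (latt 1 (5 * τ)) τ

lemma t_eq_div : t τ = (pp (im5 hτ)).derivWeierstrassP (2 * τ) /
  (pp (im5 hτ)).derivWeierstrassP τ := rfl

lemma t_eq {τ : ℂ} (hτ : 0 < τ.im) : t τ = ex τ * th (5 * τ) τ ^ 5 / th (5 * τ) (2 * τ) ^ 5 := by
  rw [t_eq_div hτ, y1_eq hτ, y2_eq hτ]
  have := ex_ne_zero τ
  have := th_ne_zero _ (nm1 hτ)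
  have := th_ne_zero _ (nm2 hτ)
  have := deriv_th_zero (im5 hτ)
  field_simp

lemma t_ne_zero {τ : ℂ} (hτ : 0 < τ.im) : t τ ≠ 0 := by
  rw [t_eq hτ]
  have := ex_ne_zero τ
  have := th_ne_zero _ (nm1 hτ)
  have := th_ne_zero _ (nm2 hτ)
  positivity

/-- all quantities in terms of `t`, `s` and the abscissa -/
lemma param : ∃ s : ℂ, s ≠ 0 ∧
    (pp (im5 hτ)).weierstrassP τ - (pp (im5 hτ)).weierstrassP (2 * τ) = t τ / s ^ 2 ∧
    (pp (im5 hτ)).derivWeierstrassP τ = t τ / s ^ 3 ∧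
    (pp (im5 hτ)).derivWeierstrassP (2 * τ) = t τ ^ 2 / s ^ 3 ∧
    deriv (pp (im5 hτ)).derivWeierstrassP τ = (t τ) * (1 + t τ) / s ^ 4 := by
  have h0 := ex_ne_zero τ
  have h1 := th_ne_zero _ (nm1 hτ)
  have h2 := th_ne_zero _ (nm2 hτ)
  have h3 := deriv_th_zero (im5 hτ)
  have tg := tangent (im5 hτ) (nm1 hτ) (nm2 hτ) (nm3 hτ) (nm4 hτ)
  set s := -(th (5 * τ) τ ^ 3 / (deriv (th (5 * τ)) 0 * th (5 * τ) (2 * τ) ^ 2)) with hs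
  have hs0 : s ≠ 0 := by
    rw [hs]; exact neg_ne_zero.2 (div_ne_zero (pow_ne_zero _ h1) (mul_ne_zero h3 (pow_ne_zero _ h2)))
  have e1 : (pp (im5 hτ)).weierstrassP τ - (pp (im5 hτ)).weierstrassP (2 * τ) = t τ / s ^ 2 := by
    rw [x12_eq hτ, t_eq hτ, hs]; field_simp
  have e2 : (pp (im5 hτ)).derivWeierstrassP τ = t τ / s ^ 3 := by
    rw [y1_eq hτ, t_eq hτ, hs]; field_simp
  have e3 : (pp (im5 hτ)).derivWeierstrassP (2 * τ) = t τ ^ 2 / s ^ 3 := by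
    rw [y2_eq hτ, t_eq hτ, hs]; field_simp
  refine ⟨s, hs0, e1, e2, e3, ?_⟩
  rw [e1, e2, e3] at tg
  have ht := t_ne_zero hτ
  field_simp at tg
  field_simp
  linear_combination tg

lemma ode2 : 2 * deriv (pp (im5 hτ)).derivWeierstrassP τ =
    12 * (pp (im5 hτ)).weierstrassP τ ^ 2 - (pp (im5 hτ)).g₂ := by
  set L := pp (im5 hτ)
  have e : (fun z => L.derivWeierstrassP z ^ 2) =ᶠ[𝓝 τ]
      fun z => 4 * L.weierstrassP z ^ 3 - L.g₂ * L.weierstrassP z - L.g₃ := by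
    have : (L.lattice : Set ℂ)ᶜ ∈ 𝓝 τ := L.isClosed_lattice.isOpen_compl.mem_nhds (nm1 hτ)
    filter_upwards [this] with z hz
    exact L.derivWeierstrassP_sq z hz
  have a1 : HasDerivAt L.weierstrassP (L.derivWeierstrassP τ) τ := by
    rw [← L.deriv_weierstrassP]
    exact (L.analyticOnNhd_weierstrassP τ (nm1 hτ)).differentiableAt.hasDerivAt
  have a2 : HasDerivAt L.derivWeierstrassP (deriv L.derivWeierstrassP τ) τ :=
    (L.analyticOnNhd_derivWeierstrassP τ (nm1 hτ)).differentiableAt.hasDerivAt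
  have d1 := (a2.pow 2).deriv
  have d2 := ((((a1.pow 3).const_mul 4).sub (a1.const_mul L.g₂)).sub_const L.g₃).deriv
  have d3 := e.deriv_eq
  have : deriv (fun z => L.derivWeierstrassP z ^ 2) τ =
    deriv (L.derivWeierstrassP ^ 2) τ := rfl
  have y0 : L.derivWeierstrassP τ ≠ 0 := by
    obtain ⟨s, hs, -, e, -⟩ := param hτ
    rw [e]; exact div_ne_zero (t_ne_zero hτ) (pow_ne_zero _ hs)
  have key : (2 : ℂ) * L.derivWeierstrassP τ * deriv L.derivWeierstrassP τ =
      4 * (3 * L.weierstrassP τ ^ 2 * L.derivWeierstrassP τ) - L.g₂ * L.derivWeierstrassP τ := by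
    have d4 := d1.symm.trans (d3.trans d2)
    simpa using d4
  apply mul_left_cancel₀ y0
  linear_combination key

end

lemma injectivity_aux {x x' δ δ' g g' h h' y y' Y Y' m m' : ℂ} (k : ℂ) (hk : k ≠ 0)
    (hδ0 : δ ≠ 0)
    (hδ : δ' = k ^ 2 * δ) (hy : y' = k ^ 3 * y) (hY : Y' = k ^ 3 * Y) (hm : m' = k ^ 4 * m)
    (e1 : y ^ 2 = 4 * x ^ 3 - g * x - h) (e1' : y' ^ 2 = 4 * x' ^ 3 - g' * x' - h')
    (e2 : Y ^ 2 = 4 * (x - δ) ^ 3 - g * (x - δ) - h)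
    (e2' : Y' ^ 2 = 4 * (x' - δ') ^ 3 - g' * (x' - δ') - h')
    (e3 : 2 * m = 12 * x ^ 2 - g) (e3' : 2 * m' = 12 * x' ^ 2 - g') :
    x' = k ^ 2 * x ∧ g' = k ^ 4 * g ∧ h' = k ^ 6 * h := by
  subst hδ hy hY hm
  have hx : x' = k ^ 2 * x := by
    have h1 : Y ^ 2 - y ^ 2 + 2 * m * δ = 12 * x * δ ^ 2 - 4 * δ ^ 3 := by
      linear_combination e2 - e1 + δ * e3
    have h2 : k ^ 6 * (Y ^ 2 - y ^ 2 + 2 * m * δ) =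
        12 * x' * (k ^ 4 * δ ^ 2) - 4 * k ^ 6 * δ ^ 3 := by
      linear_combination e2' - e1' + k ^ 2 * δ * e3'
    have : (12 * k ^ 4 * δ ^ 2) * x' = (12 * k ^ 4 * δ ^ 2) * (k ^ 2 * x) := by
      linear_combination k ^ 6 * h1 - h2
    exact mul_left_cancel₀ (mul_ne_zero (mul_ne_zero (by norm_num) (pow_ne_zero _ hk)) (pow_ne_zero _ hδ0)) this
  subst hx
  have hg : g' = k ^ 4 * g := by linear_combination e3' - k ^ 4 * e3
  subst hg
  exact ⟨rfl, rfl, by linear_combination e1' - k ^ 6 * e1⟩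

lemma injectivity_normal {τ τ' : ℂ} (hτ : 0 < τ.im) (hτ' : 0 < τ'.im) (h : t τ = t τ') :
    ∃ c : ℂ, c ≠ 0 ∧ latt 1 (5 * τ') = sc c (latt 1 (5 * τ)) ∧
      (τ' - c * τ ∈ latt 1 (5 * τ') ∨ τ' + c * τ ∈ latt 1 (5 * τ')) := by
  obtain ⟨s, hs, a1, a2, a3, a4⟩ := param hτ
  obtain ⟨s', hs', b1, b2, b3, b4⟩ := param hτ'
  rw [← h] at b1 b2 b3 b4
  have ht := t_ne_zero hτ
  set L := pp (im5 hτ)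
  set L' := pp (im5 hτ')
  have key := injectivity_aux (k := s / s') (x := L.weierstrassP τ) (x' := L'.weierstrassP τ')
    (δ := L.weierstrassP τ - L.weierstrassP (2 * τ))
    (δ' := L'.weierstrassP τ' - L'.weierstrassP (2 * τ'))
    (g := L.g₂) (g' := L'.g₂) (h := L.g₃) (h' := L'.g₃) (y := L.derivWeierstrassP τ)
    (y' := L'.derivWeierstrassP τ') (Y := L.derivWeierstrassP (2 * τ))
    (Y' := L'.derivWeierstrassP (2 * τ')) (m := deriv L.derivWeierstrassP τ)
    (m' := deriv L'.derivWeierstrassP τ') (div_ne_zero hs hs')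
    (by rw [a1]; exact div_ne_zero ht (pow_ne_zero _ hs))
    (by rw [a1, b1]; field_simp) (by rw [a2, b2]; field_simp) (by rw [a3, b3]; field_simp)
    (by rw [a4, b4]; field_simp) (L.derivWeierstrassP_sq _ (nm1 hτ))
    (L'.derivWeierstrassP_sq _ (nm1 hτ'))
    (by rw [sub_sub_cancel]; exact L.derivWeierstrassP_sq _ (nm2 hτ))
    (by rw [sub_sub_cancel]; exact L'.derivWeierstrassP_sq _ (nm2 hτ')) (ode2 hτ) (ode2 hτ')
  obtain ⟨kx, kg, kh⟩ := key
  set c := s' / s with hc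
  have hc0 : c ≠ 0 := div_ne_zero hs' hs
  have hci : c⁻¹ = s / s' := by rw [hc, inv_div]
  have E2 : (scale L hc0).g₂ = L'.g₂ := by rw [g₂_scale, hci, kg]
  have E3 : (scale L hc0).g₃ = L'.g₃ := by rw [g₃_scale, hci, kh]
  have El := lattice_eq_of_invariants _ _ E2 E3
  rw [scale_lattice] at El
  have El' : sc c (latt 1 (5 * τ)) = latt 1 (5 * τ') := El
  refine ⟨c, hc0, El'.symm, ?_⟩
  have hcm : c * τ ∉ L'.lattice := by
    rw [← El, mul_mem_sc hc0]; exact nm1 hτ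
  have e1 : L'.weierstrassP (c * τ) = L'.weierstrassP τ' := by
    rw [kx, ← wpf_eq, ← wpf_eq, ← El, wpf_sc hc0, hci]
  rcases P_eq_iff (im5 hτ') hcm (nm1 hτ') (nm2 hτ') e1 with h | h
  · left
    have := L'.lattice.neg_mem h
    rw [neg_sub] at this; exact this
  · right
    rw [add_comm] at h; exact h

lemma Pt.exists_t {Λ : Submodule ℤ ℂ} {z : ℂ} (h : Pt Λ z) :
    ∃ a τ : ℂ, a ≠ 0 ∧ 0 < τ.im ∧ Λ = RR.sc a (latt 1 (5 * τ)) ∧ z - a * τ ∈ Λ ∧ T Λ z = t τ := by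
  obtain ⟨a, τ, ha, hτ, e, hz⟩ := h.normal
  refine ⟨a, τ, ha, hτ, e, hz, ?_⟩
  rw [T_congr h.lat hz, e, T_sc ha, t]

lemma injectivity {Λ Λ' : Submodule ℤ ℂ} {z z' : ℂ} (h : Pt Λ z) (h' : Pt Λ' z')
    (e : T Λ z = T Λ' z') : ∃ c : ℂ, c ≠ 0 ∧ Λ' = sc c Λ ∧ (z' - c * z ∈ Λ' ∨ z' + c * z ∈ Λ') := by
  obtain ⟨a, τ, ha, hτ, hl, hz, ht⟩ := h.exists_t
  obtain ⟨a', τ', ha', hτ', hl', hz', ht'⟩ := h'.exists_t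
  obtain ⟨c, hc, h1, h2⟩ := injectivity_normal hτ hτ' (by rw [← ht, ← ht', e])
  have hL : Λ' = sc (a' * c / a) Λ := by
    rw [hl, hl', h1, sc_sc, sc_sc]; congr 1; field_simp
  have hk : a' * c / a ≠ 0 := by positivity
  refine ⟨a' * c / a, hk, hL, ?_⟩
  have m1 : (a' * c / a) * (z - a * τ) ∈ Λ' := by rw [hL, mul_mem_sc hk]; exact hz
  rw [← mul_mem_sc ha' (x := τ' - _), ← mul_mem_sc ha' (x := τ' + _), ← hl'] at h2
  rcases h2 with h2 | h2
  · left
    have := Λ'.sub_mem (Λ'.add_mem hz' h2) m1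
    convert this using 1
    field_simp; ring
  · right
    have := Λ'.add_mem (Λ'.add_mem hz' h2) m1
    convert this using 1
    field_simp; ring

lemma T_two {Λ : Submodule ℤ ℂ} {z : ℂ} (h : Pt Λ z) : T Λ (2 * z) = -(T Λ z)⁻¹ := by
  unfold T
  have : wp' Λ (2 * (2 * z)) = - wp' Λ z := by
    rw [← wp'_neg h.lat, ← wp'_add h.lat h.five (-z)]; ring_nf
  rw [this, inv_div, neg_div]

lemma T_ne_zero {Λ : Submodule ℤ ℂ} {z : ℂ} (h : Pt Λ z) : T Λ z ≠ 0 := by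
  obtain ⟨a, τ, ha, hτ, e, hz, ht⟩ := h.exists_t
  rw [ht]; exact t_ne_zero hτ

end RR

namespace RR
open Filter Topology Complex


lemma hasSum_of_eq {ι : Type*} {f g : ι → ℂ} {x : ℂ} (h : HasSum f x) (e : ∀ n, f n = g n) :
    HasSum g x := by
  rwa [← funext e]

/-- `∑ aₙ wⁿ` converges to `g w` on the unit disc. -/
def Ev (a : ℕ → ℂ) (g : ℂ → ℂ) : Prop :=
  ∀ w : ℂ, ‖w‖ < 1 → HasSum (fun n => a n * w ^ n) (g w)

lemma Ev.fps {a : ℕ → ℂ} {g : ℂ → ℂ} (h : Ev a g) :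
    HasFPowerSeriesOnBall g (FormalMultilinearSeries.ofScalars ℂ a) 0 1 := by
  refine ⟨?_, by norm_num, ?_⟩
  · refine ENNReal.le_of_forall_nnreal_lt fun r hr => ?_
    apply FormalMultilinearSeries.le_radius_of_summable_norm
    have hr1 : ‖((r : ℝ) : ℂ)‖ < 1 := by
      rw [Complex.norm_real]; simpa using hr
    have := (h _ hr1).summable.norm
    refine this.of_nonneg_of_le (fun n => by positivity) fun n => ?_
    rw [norm_mul, norm_pow, Complex.norm_real]
    simp
  · intro y hy
    have hy1 : ‖y‖ < 1 := by
      have : ‖y‖ₑ < 1 := by simpa using hy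
      rwa [← ofReal_norm, ENNReal.ofReal_lt_one] at this
    have := h y hy1
    simpa [FormalMultilinearSeries.ofScalars_apply_eq, smul_eq_mul, mul_comm] using this

lemma Ev.differentiableOn {a : ℕ → ℂ} {g : ℂ → ℂ} (h : Ev a g) :
    DifferentiableOn ℂ g (Metric.ball 0 1) := by
  have := h.fps.differentiableOn
  rwa [show (1 : ENNReal) = ENNReal.ofReal 1 by simp, Metric.eball_ofReal] at this

lemma Ev.apply_zero {a : ℕ → ℂ} {g : ℂ → ℂ} (h : Ev a g) : g 0 = a 0 := by
  have h1 := h 0 (by simp)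
  have h2 := hasSum_single (f := fun n => a n * (0 : ℂ) ^ n) 0 (fun n hn => by simp [hn])
  simpa using h1.unique h2

/-- uniqueness, only on the punctured disc -/
lemma Ev.unique {a b : ℕ → ℂ} {g f : ℂ → ℂ} (h : Ev a g) (h' : Ev b f)
    (he : ∀ w : ℂ, w ≠ 0 → ‖w‖ < 1 → g w = f w) : a = b := by
  have hb : Metric.ball (0 : ℂ) 1 ∈ 𝓝 (0 : ℂ) := Metric.ball_mem_nhds _ one_pos
  have c1 : ContinuousAt g 0 := (h.differentiableOn.continuousOn).continuousAt hb
  have c2 : ContinuousAt f 0 := (h'.differentiableOn.continuousOn).continuousAt hb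
  have e : g =ᶠ[𝓝[≠] 0] f := by
    filter_upwards [self_mem_nhdsWithin, nhdsWithin_le_nhds hb] with w h1 h2
    exact he w h1 (by simpa using h2)
  have e0 : g 0 = f 0 := by
    have t1 : Tendsto g (𝓝[≠] 0) (𝓝 (g 0)) := c1.mono_left nhdsWithin_le_nhds
    have t2 : Tendsto f (𝓝[≠] 0) (𝓝 (f 0)) := c2.mono_left nhdsWithin_le_nhds
    exact tendsto_nhds_unique t1 (t2.congr' e.symm)
  have e' : f =ᶠ[𝓝 0] g := by
    filter_upwards [hb] with w h2
    by_cases hw : w = 0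
    · rw [hw, e0]
    · exact (he w hw (by simpa using h2)).symm
  have := h.fps.hasFPowerSeriesAt.eq_formalMultilinearSeries
    (h'.fps.hasFPowerSeriesAt.congr e')
  funext n
  have := congrArg (fun p => p.coeff n) this
  simpa [FormalMultilinearSeries.coeff_ofScalars] using this

lemma Ev.exists_of_differentiableOn {g : ℂ → ℂ} (h : DifferentiableOn ℂ g (Metric.ball 0 1)) :
    ∃ a, Ev a g := by
  refine ⟨fun n => ((n.factorial : ℂ))⁻¹ * iteratedDeriv n g 0, fun w hw => ?_⟩
  have := Complex.hasSum_taylorSeries_on_ball (c := (0 : ℂ)) (r := 1) (f := g) (z := w)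
    (by simpa using h) (by simpa using hw)
  refine hasSum_of_eq this fun n => ?_
  · simp only [sub_zero, smul_eq_mul]; ring

lemma hasSum_mul_ps {a b : ℕ → ℂ} {w x y : ℂ} (h : HasSum (fun n => a n * w ^ n) x)
    (h' : HasSum (fun n => b n * w ^ n) y) :
    HasSum (fun n => (∑ ij ∈ Finset.HasAntidiagonal.antidiagonal n, a ij.1 * b ij.2) * w ^ n) (x * y) := by
  have s1 := h.summable.norm
  have s2 := h'.summable.norm
  have e : (fun n => ∑ ij ∈ Finset.HasAntidiagonal.antidiagonal n, (a ij.1 * w ^ ij.1) * (b ij.2 * w ^ ij.2)) =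
      fun n => (∑ ij ∈ Finset.HasAntidiagonal.antidiagonal n, a ij.1 * b ij.2) * w ^ n := by
    funext n
    rw [Finset.sum_mul]
    refine Finset.sum_congr rfl fun ij hij => ?_
    rw [← Finset.HasAntidiagonal.mem_antidiagonal.1 hij, pow_add]; ring
  have h1 := tsum_mul_tsum_eq_tsum_sum_antidiagonal_of_summable_norm s1 s2
  have h2 := (summable_norm_sum_mul_antidiagonal_of_summable_norm s1 s2).of_norm.hasSum
  rw [← h1, h.tsum_eq, h'.tsum_eq, e] at h2
  exact h2

/-- integer power series -/
def EvZ (p : PowerSeries ℤ) (g : ℂ → ℂ) : Prop := Ev (fun n => ((p.coeff n : ℤ) : ℂ)) g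

lemma EvZ.mul {p r : PowerSeries ℤ} {g f : ℂ → ℂ} (h : EvZ p g) (h' : EvZ r f) :
    EvZ (p * r) (fun w => g w * f w) := by
  intro w hw
  have := hasSum_mul_ps (h w hw) (h' w hw)
  refine hasSum_of_eq this fun n => ?_
  · simp only [PowerSeries.coeff_mul]; push_cast; rfl

lemma EvZ.one : EvZ 1 (fun _ => 1) := by
  intro w _
  have h2 := hasSum_single (f := fun n => (((1 : PowerSeries ℤ).coeff n : ℤ) : ℂ) * w ^ n) 0
    (fun n hn => by simp [PowerSeries.coeff_one, hn])
  simpa using h2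

lemma EvZ.pow {p : PowerSeries ℤ} {g : ℂ → ℂ} (h : EvZ p g) (k : ℕ) :
    EvZ (p ^ k) (fun w => g w ^ k) := by
  induction k with
  | zero => simpa using EvZ.one
  | succ k ih => simp only [pow_succ]; exact ih.mul h

lemma EvZ.inv {p : PowerSeries ℤ} {g : ℂ → ℂ} (h : EvZ p g) (h1 : p.constantCoeff = 1)
    (h0 : ∀ w : ℂ, ‖w‖ < 1 → g w ≠ 0) :
    EvZ (p.invOfUnit 1) (fun w => (g w)⁻¹) := by
  obtain ⟨b, hb⟩ := Ev.exists_of_differentiableOn (g := fun w => (g w)⁻¹)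
    (h.differentiableOn.inv fun w hw => h0 w (by simpa using hw))
  have hm : Ev (fun n => ∑ ij ∈ Finset.HasAntidiagonal.antidiagonal n,
      ((p.coeff ij.1 : ℤ) : ℂ) * b ij.2) (fun _ => 1) := by
    intro w hw
    have := hasSum_mul_ps (h w hw) (hb w hw)
    rwa [mul_inv_cancel₀ (h0 w hw)] at this
  have he := hm.unique EvZ.one (fun _ _ _ => rfl)
  have e2 : PowerSeries.map (Int.castRingHom ℂ) p * PowerSeries.mk b = 1 := by
    ext n
    have := congrFun he n
    rw [PowerSeries.coeff_mul]
    simp only [PowerSeries.coeff_map, PowerSeries.coeff_mk]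
    simp only [eq_intCast]
    rw [this]
    simp [PowerSeries.coeff_one]
  have e3 : p * p.invOfUnit 1 = 1 := PowerSeries.mul_invOfUnit p 1 (by simpa using h1)
  have e4 : PowerSeries.map (Int.castRingHom ℂ) p *
      PowerSeries.map (Int.castRingHom ℂ) (p.invOfUnit 1) = 1 := by
    rw [← map_mul, e3, map_one]
  have e5 : PowerSeries.mk b = PowerSeries.map (Int.castRingHom ℂ) (p.invOfUnit 1) := by
    calc PowerSeries.mk b = PowerSeries.mk b * (PowerSeries.map (Int.castRingHom ℂ) p *
          PowerSeries.map (Int.castRingHom ℂ) (p.invOfUnit 1)) := by rw [e4, mul_one]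
      _ = (PowerSeries.map (Int.castRingHom ℂ) p * PowerSeries.mk b) *
          PowerSeries.map (Int.castRingHom ℂ) (p.invOfUnit 1) := by ring
      _ = _ := by rw [e2, one_mul]
  have e6 : (fun n => (((p.invOfUnit 1).coeff n : ℤ) : ℂ)) = b := by
    funext n
    have := congrArg (PowerSeries.coeff n) e5
    simpa using this.symm
  unfold EvZ
  rw [e6]; exact hb

/-- Frobenius congruence -/
lemma EvZ.frob {p : ℕ} (hp : p.Prime) {r : PowerSeries ℤ} {g : ℂ → ℂ} (h : EvZ r g) :
    ∃ c : PowerSeries ℤ, (∀ n, (p : ℤ) ∣ c.coeff n) ∧ EvZ c (fun w => g w ^ p - g (w ^ p)) := by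
  have : Fact p.Prime := ⟨hp⟩
  refine ⟨r ^ p - r.expand p hp.ne_zero, fun n => ?_, ?_⟩
  · rw [← ZMod.intCast_zmod_eq_zero_iff_dvd]
    have : PowerSeries.map (Int.castRingHom (ZMod p)) (r ^ p - r.expand p hp.ne_zero) = 0 := by
      rw [map_sub, map_pow, PowerSeries.map_expand, sub_eq_zero]
      have := MvPowerSeries.map_frobenius_expand (R := ZMod p) p hp.ne_zero
        (f := PowerSeries.map (Int.castRingHom (ZMod p)) r)
      rw [ZMod.frobenius_zmod, MvPowerSeries.map_id] at this
      exact this.symm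
    have := congrArg (PowerSeries.coeff n) this
    rw [PowerSeries.coeff_map] at this
    simpa only [eq_intCast, map_zero] using this
  · intro w hw
    have h1 := h.pow p w hw
    have hwp : ‖w ^ p‖ < 1 := by
      rw [norm_pow]; exact pow_lt_one₀ (norm_nonneg _) hw hp.ne_zero
    have h2 := h (w ^ p) hwp
    have h3 : HasSum (fun n => ((((r.expand p hp.ne_zero).coeff n : ℤ)) : ℂ) * w ^ n) (g (w ^ p)) := by
      have inj : Function.Injective (fun m : ℕ => p * m) := fun a b hab =>
        Nat.eq_of_mul_eq_mul_left hp.pos hab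
      rw [← inj.hasSum_iff]
      · convert h2 using 2 with m
        simp [PowerSeries.coeff_expand_mul, pow_mul]
      · intro n hn
        rw [PowerSeries.coeff_expand_of_not_dvd]
        · simp
        · rintro ⟨m, rfl⟩; exact hn ⟨m, rfl⟩
    refine hasSum_of_eq (h1.sub h3) fun n => ?_
    simp only [map_sub]; push_cast; ring

noncomputable def H (k : ℕ) (q : ℂ) : ℂ := ∏' n : ℕ, (1 + -(q ^ (5 * n + k)))

lemma summable_H {q : ℂ} (hq : ‖q‖ < 1) (k : ℕ) : Summable fun n : ℕ => ‖-(q ^ (5 * n + k))‖ := by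
  have hq5 : ‖q‖ ^ 5 < 1 := pow_lt_one₀ (norm_nonneg _) hq (by norm_num)
  have := (summable_geometric_of_lt_one (by positivity) hq5).mul_right (‖q‖ ^ k)
  refine this.congr fun n => ?_
  rw [norm_neg, norm_pow, pow_add, pow_mul]

lemma H_ne_zero {q : ℂ} (hq : ‖q‖ < 1) {k : ℕ} (hk : 1 ≤ k) : H k q ≠ 0 := by
  refine tprod_one_add_ne_zero_of_summable (f := fun n : ℕ => -(q ^ (5 * n + k))) ?_
    (summable_H hq k)
  intro n hn
  have h1 : q ^ (5 * n + k) = 1 := by linear_combination -hn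
  have : ‖q‖ ^ (5 * n + k) = 1 := by rw [← norm_pow, h1, norm_one]
  exact absurd this (pow_lt_one₀ (norm_nonneg _) hq (by omega)).ne

lemma H_eq {q : ℂ} (hq : ‖q‖ < 1) (k : ℕ) : H k q = (1 - q ^ k) * E (q ^ 5) (q ^ k) := by
  have hm : Multipliable fun n : ℕ => (1 + -(q ^ (5 * (n + 1) + k))) := by
    apply multipliable_one_add_of_summable
    exact (summable_nat_add_iff 1).mpr (summable_H hq k)
  unfold H
  rw [tprod_eq_zero_mul' (f := fun n : ℕ => (1 + -(q ^ (5 * n + k)))) hm]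
  congr 1
  · simp [sub_eq_add_neg]
  · unfold E
    refine tprod_congr fun n => ?_
    ring

lemma H_eq' {q : ℂ} (hq0 : q ≠ 0) {k m : ℕ} (hk : k + m = 5) :
    H k q = E (q ^ 5) (q ^ m)⁻¹ := by
  unfold H E
  refine tprod_congr fun n => ?_
  have : q ^ (5 * n + k) * q ^ m = (q ^ 5) ^ (n + 1) := by
    rw [← pow_add, ← pow_mul]; congr 1; omega
  rw [← this, mul_assoc, mul_inv_cancel₀ (pow_ne_zero _ hq0), mul_one]

lemma th_tau {τ : ℂ} (hτ : 0 < τ.im) : th (5 * τ) τ = H 1 (ex τ) * H 4 (ex τ) := by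
  have h5 : ex (5 * τ) = ex τ ^ 5 := by exact_mod_cast ex_nat_mul 5 τ
  rw [th, Th, h5, H_eq (norm_ex_lt_one hτ) 1, H_eq' (ex_ne_zero τ) (k := 4) (m := 1) rfl]
  simp only [pow_one]; ring

lemma th_two_tau {τ : ℂ} (hτ : 0 < τ.im) : th (5 * τ) (2 * τ) = H 2 (ex τ) * H 3 (ex τ) := by
  have h5 : ex (5 * τ) = ex τ ^ 5 := by exact_mod_cast ex_nat_mul 5 τ
  have h2 : ex (2 * τ) = ex τ ^ 2 := by exact_mod_cast ex_nat_mul 2 τ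
  rw [th, Th, h5, h2, H_eq (norm_ex_lt_one hτ) 2, H_eq' (ex_ne_zero τ) (k := 3) (m := 2) rfl]
  ring

/-- integer coefficients of `H` -/
lemma EvZ_H {k : ℕ} (hk : 1 ≤ k) : ∃ p : PowerSeries ℤ, p.constantCoeff = 1 ∧ EvZ p (H k) := by
  classical
  let wt : Finset ℕ → ℕ := fun s => ∑ n ∈ s, (5 * n + k)
  have hwt : ∀ m s, wt s = m → s ⊆ Finset.range (m + 1) := by
    intro m s hs n hn
    have : 5 * n + k ≤ wt s := Finset.single_le_sum (f := fun n => 5 * n + k) (fun _ _ => Nat.zero_le _) hn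
    simp; omega
  let F : ℕ → Finset (Finset ℕ) := fun m => (Finset.range (m + 1)).powerset.filter (fun s => wt s = m)
  have hF : ∀ m s, s ∈ F m ↔ wt s = m := by
    intro m s
    simp only [F, Finset.mem_filter, Finset.mem_powerset]
    exact ⟨fun h => h.2, fun h => ⟨hwt m s h, h⟩⟩
  have hF0 : F 0 = {∅} := by
    ext s
    rw [hF, Finset.mem_singleton]
    constructor
    · intro h
      by_contra hne
      obtain ⟨n, hn⟩ := Finset.nonempty_iff_ne_empty.2 hne
      have : 5 * n + k ≤ wt s := Finset.single_le_sum (f := fun n => 5 * n + k) (fun _ _ => Nat.zero_le _) hn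
      omega
    · rintro rfl; simp [wt]
  refine ⟨PowerSeries.mk fun m => ∑ s ∈ F m, (-1) ^ s.card, ?_, ?_⟩
  · rw [← PowerSeries.coeff_zero_eq_constantCoeff_apply, PowerSeries.coeff_mk, hF0]; simp
  · intro q hq
    have hs := summable_finsetProd_of_summable_norm (summable_H hq k)
    have h1 : HasSum (fun s : Finset ℕ => ∏ n ∈ s, -(q ^ (5 * n + k))) (H k q) := by
      unfold H; rw [tprod_one_add hs]; exact hs.hasSum
    have h2 := (Equiv.sigmaFiberEquiv wt).hasSum_iff.mpr h1
    have h3 : ∀ m, HasSum (fun s : {s // wt s = m} => ∏ n ∈ s.1, -(q ^ (5 * n + k)))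
        ((∑ s ∈ F m, (-1) ^ s.card) * q ^ m) := by
      intro m
      have e : ∀ s : {s // wt s = m}, ∏ n ∈ s.1, -(q ^ (5 * n + k)) = (-1) ^ s.1.card * q ^ m := by
        rintro ⟨s, rfl⟩
        rw [Finset.prod_neg]
        simp only [wt]
        rw [Finset.prod_pow_eq_pow_sum]
      simp_rw [e]
      rw [Finset.sum_mul]
      have hf : Fintype {s // wt s = m} := Fintype.subtype (F m) (fun s => hF m s)
      rw [Finset.sum_subtype (F m) (fun s => hF m s)]
      exact hasSum_fintype _
    have h4 := h2.sigma h3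
    simpa using h4

/-- `t τ = q * tB q` -/
noncomputable def tB (q : ℂ) : ℂ := (H 1 q * H 4 q) ^ 5 * ((H 2 q * H 3 q) ^ 5)⁻¹

lemma t_eq_tB {τ : ℂ} (hτ : 0 < τ.im) : t τ = ex τ * tB (ex τ) := by
  rw [t_eq hτ, th_tau hτ, th_two_tau hτ, tB]; ring

lemma tB_ne_zero {q : ℂ} (hq : ‖q‖ < 1) : tB q ≠ 0 := by
  have := H_ne_zero hq (k := 1) le_rfl
  have := H_ne_zero hq (k := 2) (by norm_num)
  have := H_ne_zero hq (k := 3) (by norm_num)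
  have := H_ne_zero hq (k := 4) (by norm_num)
  unfold tB; positivity

lemma EvZ_tB : ∃ p : PowerSeries ℤ, p.constantCoeff = 1 ∧ EvZ p tB := by
  obtain ⟨p1, c1, e1⟩ := EvZ_H (k := 1) le_rfl
  obtain ⟨p2, c2, e2⟩ := EvZ_H (k := 2) (by norm_num)
  obtain ⟨p3, c3, e3⟩ := EvZ_H (k := 3) (by norm_num)
  obtain ⟨p4, c4, e4⟩ := EvZ_H (k := 4) (by norm_num)
  refine ⟨_, ?_, ((e1.mul e4).pow 5).mul (((e2.mul e3).pow 5).inv (by simp [c2, c3]) ?_)⟩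
  · simp [c1, c4, PowerSeries.constantCoeff_invOfUnit]
  · intro w hw
    have := H_ne_zero hw (k := 2) (by norm_num)
    have := H_ne_zero hw (k := 3) (by norm_num)
    positivity

lemma EvZ_tB_inv : ∃ p : PowerSeries ℤ, p.constantCoeff = 1 ∧ EvZ p (fun q => (tB q)⁻¹) := by
  obtain ⟨p, c, e⟩ := EvZ_tB
  refine ⟨_, ?_, e.inv c fun w hw => tB_ne_zero hw⟩
  simp [PowerSeries.constantCoeff_invOfUnit]

end RR

namespace RR
open Filter Topology Complex


/-- the upper half plane -/
def UU : Set ℂ := {τ | 0 < τ.im}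

lemma isOpen_UU : IsOpen UU := isOpen_lt continuous_const Complex.continuous_im

def Bdd (f : ℂ → ℂ) : Prop := ∃ B C : ℝ, ∀ τ : ℂ, B ≤ τ.im → ‖f τ‖ ≤ C

lemma Bdd.of {f : ℂ → ℂ} {B C : ℝ} (h : ∀ τ : ℂ, 0 < τ.im → B ≤ τ.im → ‖f τ‖ ≤ C) : Bdd f :=
  ⟨max B 1, C, fun τ hτ => h τ (lt_of_lt_of_le one_pos ((le_max_right _ _).trans hτ))
    ((le_max_left _ _).trans hτ)⟩

lemma Bdd.const (c : ℂ) : Bdd (fun _ => c) := ⟨0, ‖c‖, fun _ _ => le_rfl⟩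

lemma Bdd.add {f g : ℂ → ℂ} (h : Bdd f) (h' : Bdd g) : Bdd (fun τ => f τ + g τ) := by
  obtain ⟨B, C, h⟩ := h
  obtain ⟨B', C', h'⟩ := h'
  exact ⟨max B B', C + C', fun τ hτ => (norm_add_le _ _).trans
    (add_le_add (h τ ((le_max_left _ _).trans hτ)) (h' τ ((le_max_right _ _).trans hτ)))⟩

lemma Bdd.mul {f g : ℂ → ℂ} (h : Bdd f) (h' : Bdd g) : Bdd (fun τ => f τ * g τ) := by
  obtain ⟨B, C, h⟩ := h
  obtain ⟨B', C', h'⟩ := h'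
  refine ⟨max B B', C * C', fun τ hτ => ?_⟩
  have h1 := h τ ((le_max_left _ _).trans hτ)
  rw [norm_mul]
  exact mul_le_mul h1 (h' τ ((le_max_right _ _).trans hτ)) (norm_nonneg _) ((norm_nonneg _).trans h1)

lemma Bdd.congr {f g : ℂ → ℂ} (h : Bdd f) (e : ∀ τ : ℂ, 0 < τ.im → f τ = g τ) : Bdd g := by
  obtain ⟨B, C, h⟩ := h
  exact Bdd.of (B := B) (C := C) fun τ h0 h1 => by rw [← e τ h0]; exact h τ h1

lemma Bdd.prod {ι : Type*} (s : Finset ι) {f : ι → ℂ → ℂ} (h : ∀ i ∈ s, Bdd (f i)) :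
    Bdd (fun τ => ∏ i ∈ s, f i τ) := by
  classical
  induction s using Finset.induction_on with
  | empty => simpa using Bdd.const 1
  | insert a s ha ih =>
    simp only [Finset.prod_insert ha]
    exact (h a (by simp)).mul (ih fun i hi => h i (by simp [hi]))

/-- scaling/translating the argument -/
lemma Bdd.comp {f : ℂ → ℂ} (h : Bdd f) {r : ℝ} (hr : 0 < r) {c : ℝ} :
    Bdd (fun τ => f (r * τ + c)) := by
  obtain ⟨B, C, h⟩ := h
  refine ⟨B / r, C, fun τ hτ => h _ ?_⟩
  simp only [Complex.add_im, Complex.mul_im, Complex.ofReal_re, Complex.ofReal_im, zero_mul, add_zero]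
  rw [div_le_iff₀ hr] at hτ
  linarith

open UpperHalfPlane ModularForm MatrixGroups in
lemma level_one_const {g : ℂ → ℂ} (hd : DifferentiableOn ℂ g UU) (hb : Bdd g)
    (hs : ∀ (τ : ℂ) (a b c d : ℤ), 0 < τ.im → a * d - b * c = 1 →
      g ((a * τ + b) / (c * τ + d)) = g τ) : ∃ k, ∀ τ : ℂ, 0 < τ.im → g τ = k := by
  have hsl : ∀ γ : SL(2, ℤ), (fun τ : ℍ => g τ) ∣[(0 : ℤ)] γ = (fun τ : ℍ => g τ) := by
    intro γ
    funext τ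
    rw [slash_action_eq'_iff, zpow_zero, one_mul]
    have := hs τ (γ 0 0) (γ 0 1) (γ 1 0) (γ 1 1) τ.im_pos (by
      have := γ.det_coe; rw [Matrix.det_fin_two] at this; exact this)
    rw [UpperHalfPlane.coe_specialLinearGroup_apply]
    simpa using this
  let F : ModularForm 𝒮ℒ 0 :=
    { toFun := fun τ : ℍ => g τ
      slash_action_eq' := by
        rintro _ ⟨γ, rfl⟩
        exact hsl γ
      holo' := by
        rw [UpperHalfPlane.mdifferentiable_iff]
        refine hd.congr fun τ hτ => ?_
        have : 0 < τ.im := hτ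
        simp [UpperHalfPlane.ofComplex_apply_of_im_pos this]
      bdd_at_cusps' := by
        intro c hc
        rw [OnePoint.isBoundedAt_iff_forall_SL2Z hc]
        intro γ _
        have := hsl γ
        rw [this, UpperHalfPlane.isBoundedAtImInfty_iff]
        obtain ⟨B, C, h⟩ := hb
        exact ⟨C, B, fun τ hτ => h τ hτ⟩ }
  obtain ⟨k, hk⟩ := ModularFormClass.levelOne_weight_zero_const F
  refine ⟨k, fun τ hτ => ?_⟩
  exact congrFun hk ⟨τ, hτ⟩

/-- weight-zero functions of `(Λ, z)`, `z` of exact order 5, holomorphic and meromorphic at cusps,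
bounded at the cusps of type 0 -/
structure Mod (F : Submodule ℤ ℂ → ℂ → ℂ) : Prop where
  inv : ∀ {a : ℂ} {Λ : Submodule ℤ ℂ} {z : ℂ}, a ≠ 0 → Pt Λ z → F (sc a Λ) (a * z) = F Λ z
  tr : ∀ {Λ : Submodule ℤ ℂ} {z l : ℂ}, Pt Λ z → l ∈ Λ → F Λ (z + l) = F Λ z
  neg : ∀ {Λ : Submodule ℤ ℂ} {z : ℂ}, Pt Λ z → F Λ (-z) = F Λ z
  hol0 : ∀ v : ℕ, v = 1 ∨ v = 2 → DifferentiableOn ℂ (fun τ => F (latt 1 τ) (v / 5)) UU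
  hol1 : ∀ v : ℕ, v = 1 ∨ v = 2 → DifferentiableOn ℂ (fun τ => F (latt 1 (5 * τ)) (v * τ)) UU
  bd0 : ∀ v : ℕ, v = 1 ∨ v = 2 → Bdd (fun τ => F (latt 1 τ) (v / 5))
  ord : ∀ v : ℕ, v = 1 ∨ v = 2 → ∃ M : ℕ, Bdd (fun τ => ex τ ^ M * F (latt 1 (5 * τ)) (v * τ))

lemma Pt.int_mul_neg {Λ : Submodule ℤ ℂ} {z : ℂ} (h : Pt Λ z) : Pt Λ (-z) := by
  have := h.mul (n := -1) (by norm_num)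
  simpa using this

lemma coord_unique {τ : ℂ} (hτ : 0 < τ.im) {m n a b : ℝ} (h : (m : ℂ) + n * τ = a + b * τ) :
    m = a ∧ n = b := by
  have h2 := congrArg Complex.im h
  simp at h2
  have hn : n = b := by
    rcases h2 with h2 | h2
    · exact h2
    · exact absurd h2 hτ.ne'
  subst hn
  have : (m : ℂ) = a := by linear_combination h
  exact ⟨by exact_mod_cast this, rfl⟩

lemma pt_mn {τ : ℂ} (hτ : 0 < τ.im) {m n : ℤ} (h : ¬ ((5 : ℤ) ∣ m ∧ (5 : ℤ) ∣ n)) :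
    Pt (latt 1 τ) ((m + n * τ) / 5) := by
  refine ⟨lat_one hτ, mem_latt.2 ⟨m, n, by ring⟩, fun hm => h ?_⟩
  obtain ⟨a, b, hab⟩ := mem_latt.1 hm
  have h1 : ((m : ℝ) : ℂ) + ((n : ℝ) : ℂ) * τ = ((5 * a : ℝ) : ℂ) + ((5 * b : ℝ) : ℂ) * τ := by
    push_cast; linear_combination -5 * hab
  obtain ⟨h2, h3⟩ := coord_unique hτ h1
  exact ⟨⟨a, by exact_mod_cast h2⟩, ⟨b, by exact_mod_cast h3⟩⟩

lemma Mod.mn_add {F : Submodule ℤ ℂ → ℂ → ℂ} (hF : Mod F) {τ : ℂ} (hτ : 0 < τ.im) {m n m' n' : ℤ}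
    (h : ¬ ((5 : ℤ) ∣ m ∧ (5 : ℤ) ∣ n)) (hm : (5 : ℤ) ∣ m' - m) (hn : (5 : ℤ) ∣ n' - n) :
    F (latt 1 τ) ((m' + n' * τ) / 5) = F (latt 1 τ) ((m + n * τ) / 5) := by
  obtain ⟨a, ha⟩ := hm
  obtain ⟨b, hb⟩ := hn
  rw [← hF.tr (pt_mn hτ h) (l := a + b * τ) (mem_latt.2 ⟨a, b, by ring⟩)]
  congr 1
  have ha' : (m' : ℂ) = m + 5 * a := by
    have : m' = m + 5 * a := by linarith
    rw [this]; push_cast; ring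
  have hb' : (n' : ℂ) = n + 5 * b := by
    have : n' = n + 5 * b := by linarith
    rw [this]; push_cast; ring
  rw [ha', hb']; ring

lemma Mod.mn_neg {F : Submodule ℤ ℂ → ℂ → ℂ} (hF : Mod F) {τ : ℂ} (hτ : 0 < τ.im) {m n : ℤ}
    (h : ¬ ((5 : ℤ) ∣ m ∧ (5 : ℤ) ∣ n)) :
    F (latt 1 τ) (((-m : ℤ) + (-n : ℤ) * τ) / 5) = F (latt 1 τ) ((m + n * τ) / 5) := by
  rw [← hF.neg (pt_mn hτ h)]
  congr 1
  push_cast; ring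

lemma latt_add_int (τ : ℂ) (k : ℤ) : latt 1 (τ + k) = latt 1 τ := by
  have := latt_of_det (a := 1) (b := τ) (p := 1) (q := 0) (r := k) (s := 1) (by norm_num)
  simpa [add_comm] using this

/-- reduction of the components to the cusp types -/
lemma Mod.reduce {F : Submodule ℤ ℂ → ℂ → ℂ} (hF : Mod F) {m n : ℤ}
    (h : ¬ ((5 : ℤ) ∣ m ∧ (5 : ℤ) ∣ n)) :
    (∃ v : ℕ, (v = 1 ∨ v = 2) ∧ ∀ τ : ℂ, 0 < τ.im →
      F (latt 1 τ) ((m + n * τ) / 5) = F (latt 1 τ) (v / 5)) ∨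
    (∃ v : ℕ, (v = 1 ∨ v = 2) ∧ ∃ k : ℤ, ∀ τ : ℂ, 0 < τ.im →
      F (latt 1 τ) ((m + n * τ) / 5) = F (latt 1 (5 * ((τ + k) / 5))) (v * ((τ + k) / 5))) := by
  have key : ∀ x : ℤ, ¬ (5 : ℤ) ∣ x → ∃ v : ℕ, (v = 1 ∨ v = 2) ∧
      ((5 : ℤ) ∣ x - v ∨ (5 : ℤ) ∣ -x - v) := by
    intro x hx
    have h5 : x % 5 = 1 ∨ x % 5 = 2 ∨ x % 5 = 3 ∨ x % 5 = 4 := by omega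
    rcases h5 with h | h | h | h
    · exact ⟨1, Or.inl rfl, Or.inl (by push_cast; omega)⟩
    · exact ⟨2, Or.inr rfl, Or.inl (by push_cast; omega)⟩
    · exact ⟨2, Or.inr rfl, Or.inr (by push_cast; omega)⟩
    · exact ⟨1, Or.inl rfl, Or.inr (by push_cast; omega)⟩
  by_cases hn : (5 : ℤ) ∣ n
  · left
    obtain ⟨v, hv, h5⟩ := key m (fun hm => h ⟨hm, hn⟩)
    refine ⟨v, hv, fun τ hτ => ?_⟩
    have hv' : ¬ ((5 : ℤ) ∣ (v : ℤ) ∧ (5 : ℤ) ∣ 0) := by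
      rcases hv with rfl | rfl <;> norm_num
    rcases h5 with h5 | h5
    · rw [hF.mn_add hτ hv' h5 (by simpa using hn)]; simp
    · rw [← hF.mn_neg hτ h, hF.mn_add hτ hv' h5 (by simpa using hn)]; simp
  · right
    obtain ⟨v, hv, h5⟩ := key n hn
    have main : ∀ m n : ℤ, ¬ ((5 : ℤ) ∣ m ∧ (5 : ℤ) ∣ n) → (5 : ℤ) ∣ n - v →
        ∃ k : ℤ, ∀ τ : ℂ, 0 < τ.im →
        F (latt 1 τ) ((m + n * τ) / 5) = F (latt 1 (5 * ((τ + k) / 5))) (v * ((τ + k) / 5)) := by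
      intro m n hmn hnv
      obtain ⟨k, hk⟩ : ∃ k : ℤ, (5 : ℤ) ∣ m - v * k := by
        rcases hv with rfl | rfl
        · exact ⟨m, by simp⟩
        · exact ⟨3 * m, ⟨-m, by push_cast; ring⟩⟩
      refine ⟨k, fun τ hτ => ?_⟩
      have hv' : ¬ ((5 : ℤ) ∣ (v * k : ℤ) ∧ (5 : ℤ) ∣ v) := by
        rcases hv with rfl | rfl <;> norm_num
      rw [hF.mn_add hτ hv' hk hnv, show 5 * ((τ + k) / 5) = τ + k by ring, latt_add_int]
      congr 1
      push_cast; ring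
    rcases h5 with h5 | h5
    · obtain ⟨k, hk⟩ := main m n h h5
      exact ⟨v, hv, k, hk⟩
    · obtain ⟨k, hk⟩ := main (-m) (-n) (by simpa using h) h5
      exact ⟨v, hv, k, fun τ hτ => by rw [← hF.mn_neg hτ h, hk τ hτ]⟩

lemma Mod.mn_hol {F : Submodule ℤ ℂ → ℂ → ℂ} (hF : Mod F) {m n : ℤ}
    (h : ¬ ((5 : ℤ) ∣ m ∧ (5 : ℤ) ∣ n)) :
    DifferentiableOn ℂ (fun τ => F (latt 1 τ) ((m + n * τ) / 5)) UU := by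
  rcases hF.reduce h with ⟨v, hv, e⟩ | ⟨v, hv, k, e⟩
  · exact (hF.hol0 v hv).congr e
  · have := (hF.hol1 v hv).comp (s := UU) (f := fun τ : ℂ => (τ + k) / 5) (by fun_prop)
      (by intro τ hτ; have : 0 < τ.im := hτ; simp [UU]; exact this)
    exact this.congr e

lemma Mod.mn_bdd {F : Submodule ℤ ℂ → ℂ → ℂ} (hF : Mod F)
    (hB : ∀ v : ℕ, v = 1 ∨ v = 2 → Bdd (fun τ => F (latt 1 (5 * τ)) (v * τ))) {m n : ℤ}
    (h : ¬ ((5 : ℤ) ∣ m ∧ (5 : ℤ) ∣ n)) :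
    Bdd (fun τ => F (latt 1 τ) ((m + n * τ) / 5)) := by
  rcases hF.reduce h with ⟨v, hv, e⟩ | ⟨v, hv, k, e⟩
  · exact (hF.bd0 v hv).congr fun τ hτ => (e τ hτ).symm
  · have := (hB v hv).comp (r := 1 / 5) (by norm_num) (c := k / 5)
    refine this.congr fun τ hτ => ?_
    rw [e τ hτ]
    rw [show (((1 / 5 : ℝ) : ℂ) * τ + ((k / 5 : ℝ) : ℂ)) = (τ + k) / 5 by push_cast; ring]

lemma Mod.mn_act {F : Submodule ℤ ℂ → ℂ → ℂ} (hF : Mod F) {τ : ℂ} (hτ : 0 < τ.im) {m n a b c d : ℤ}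
    (h : ¬ ((5 : ℤ) ∣ m ∧ (5 : ℤ) ∣ n)) (hd : a * d - b * c = 1) :
    F (latt 1 ((a * τ + b) / (c * τ + d))) ((m + n * ((a * τ + b) / (c * τ + d))) / 5) =
      F (latt 1 τ) (((m * d + n * b : ℤ) + (m * c + n * a : ℤ) * τ) / 5) := by
  have hne : (c * τ + d : ℂ) ≠ 0 := by
    intro h0
    have h1 : ((d : ℝ) : ℂ) + ((c : ℝ) : ℂ) * τ = ((0 : ℝ) : ℂ) + ((0 : ℝ) : ℂ) * τ := by
      push_cast; linear_combination h0
    obtain ⟨h2, h3⟩ := coord_unique hτ h1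
    have h2' : d = 0 := by exact_mod_cast h2
    have h3' : c = 0 := by exact_mod_cast h3
    subst h2' h3'; simp at hd
  have hl : latt 1 ((a * τ + b) / (c * τ + d)) = sc (c * τ + d)⁻¹ (latt 1 τ) := by
    have := latt_of_det (a := 1) (b := τ) (p := d) (q := c) (r := b) (s := a)
      (Or.inl (by linarith))
    rw [← this, sc_latt]
    congr 1
    · field_simp; ring
    · field_simp; ring
  have hp : Pt (latt 1 τ) (((m * d + n * b : ℤ) + (m * c + n * a : ℤ) * τ) / 5) := by
    apply pt_mn hτ
    rintro ⟨h1, h2⟩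
    apply h
    constructor
    · have : m = a * (m * d + n * b) - b * (m * c + n * a) := by linear_combination -m * hd
      rw [this]; exact dvd_sub (dvd_mul_of_dvd_right h1 _) (dvd_mul_of_dvd_right h2 _)
    · have : n = d * (m * c + n * a) - c * (m * d + n * b) := by linear_combination -n * hd
      rw [this]; exact dvd_sub (dvd_mul_of_dvd_right h2 _) (dvd_mul_of_dvd_right h1 _)
  rw [← hF.inv (inv_ne_zero hne) hp, hl]
  congr 1
  push_cast
  linear_combination (-(m / 5 : ℂ)) * (mul_inv_cancel₀ hne)

lemma zmod5_dvd (a : ℤ) : (5 : ℤ) ∣ a ↔ (a : ZMod 5) = 0 :=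
  (ZMod.intCast_zmod_eq_zero_iff_dvd a 5).symm

lemma zmod5_nz {v : ZMod 5 × ZMod 5} (h : v ≠ 0) :
    ¬ ((5 : ℤ) ∣ ((v.1.val : ℕ) : ℤ) ∧ (5 : ℤ) ∣ ((v.2.val : ℕ) : ℤ)) := by
  rintro ⟨h1, h2⟩
  apply h
  have h1' := (ZMod.intCast_zmod_eq_zero_iff_dvd _ 5).2 h1
  have h2' := (ZMod.intCast_zmod_eq_zero_iff_dvd _ 5).2 h2
  ext
  · simpa using h1'
  · simpa using h2'

lemma Mod.const_of_bdd {F : Submodule ℤ ℂ → ℂ → ℂ} (hF : Mod F)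
    (hB : ∀ v : ℕ, v = 1 ∨ v = 2 → Bdd (fun τ => F (latt 1 (5 * τ)) (v * τ))) :
    ∃ c, ∀ Λ z, Pt Λ z → F Λ z = c := by
  classical
  let f : ZMod 5 × ZMod 5 → ℂ → ℂ := fun v τ =>
    F (latt 1 τ) ((((v.1.val : ℕ) : ℤ) + ((v.2.val : ℕ) : ℤ) * τ) / 5)
  let s : Finset (ZMod 5 × ZMod 5) := Finset.univ.filter (· ≠ 0)
  have hs : ∀ v, v ∈ s ↔ v ≠ 0 := by simp [s]
  have hmn : ∀ {m n : ℤ} {τ : ℂ}, 0 < τ.im → ¬ ((5 : ℤ) ∣ m ∧ (5 : ℤ) ∣ n) →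
      F (latt 1 τ) ((m + n * τ) / 5) = f ((m : ZMod 5), (n : ZMod 5)) τ := by
    intro m n τ hτ h
    symm
    apply hF.mn_add hτ h
    · rw [zmod5_dvd]; simp
    · rw [zmod5_dvd]; simp
  have hf : ∀ v ∈ s, DifferentiableOn ℂ (f v) UU := fun v hv => hF.mn_hol (zmod5_nz ((hs v).1 hv))
  have hb : ∀ v ∈ s, Bdd (f v) := fun v hv => hF.mn_bdd hB (zmod5_nz ((hs v).1 hv))
  have hprod : ∀ c : ℂ, ∃ k, ∀ τ : ℂ, 0 < τ.im → ∏ v ∈ s, (f v τ - c) = k := by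
    intro c
    apply level_one_const
    · exact DifferentiableOn.fun_finsetProd fun v hv => (hf v hv).sub_const c
    · apply Bdd.prod
      intro v hv
      simpa [sub_eq_add_neg] using (hb v hv).add (Bdd.const (-c))
    · intro τ a b c' d hτ hdet
      have hdet' : (a : ZMod 5) * d - b * c' = 1 := by
        have := congrArg (Int.cast : ℤ → ZMod 5) hdet
        push_cast at this; exact this
      have hmap : ∀ (a b c d : ZMod 5), a * d - b * c = 1 → ∀ v : ZMod 5 × ZMod 5, v ≠ 0 →
          (v.1 * d + v.2 * b, v.1 * c + v.2 * a) ≠ (0 : ZMod 5 × ZMod 5) := by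
        intro a b c d hd v hv h0
        apply hv
        have h1 : v.1 * d + v.2 * b = 0 := congrArg Prod.fst h0
        have h2 : v.1 * c + v.2 * a = 0 := congrArg Prod.snd h0
        ext
        · change v.1 = 0
          linear_combination a * h1 - b * h2 - v.1 * hd
        · change v.2 = 0
          linear_combination d * h2 - c * h1 - v.2 * hd
      refine Finset.prod_bij' (fun v _ => (v.1 * d + v.2 * b, v.1 * c' + v.2 * a))
        (fun v _ => (v.1 * a + v.2 * (-b), v.1 * (-c') + v.2 * d)) ?_ ?_ ?_ ?_ ?_
      · intro v hv
        exact (hs _).2 (hmap a b c' d hdet' v ((hs v).1 hv))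
      · intro v hv
        exact (hs _).2 (hmap d (-b) (-c') a (by linear_combination hdet') v ((hs v).1 hv))
      · intro v _
        ext
        · change (v.1 * d + v.2 * b) * a + (v.1 * c' + v.2 * a) * (-b) = v.1
          linear_combination v.1 * hdet'
        · change (v.1 * d + v.2 * b) * (-c') + (v.1 * c' + v.2 * a) * d = v.2
          linear_combination v.2 * hdet'
      · intro v _
        ext
        · change (v.1 * a + v.2 * (-b)) * d + (v.1 * (-c') + v.2 * d) * b = v.1
          linear_combination v.1 * hdet'
        · change (v.1 * a + v.2 * (-b)) * c' + (v.1 * (-c') + v.2 * d) * a = v.2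
          linear_combination v.2 * hdet'
      · intro v hv
        have hv' := zmod5_nz ((hs v).1 hv)
        have h1 := hF.mn_act hτ hv' hdet
        have hq : ¬ ((5 : ℤ) ∣ ((v.1.val : ℕ) : ℤ) * d + ((v.2.val : ℕ) : ℤ) * b ∧
            (5 : ℤ) ∣ ((v.1.val : ℕ) : ℤ) * c' + ((v.2.val : ℕ) : ℤ) * a) := by
          have := hmap a b c' d hdet' v ((hs v).1 hv)
          rintro ⟨g1, g2⟩
          apply this
          rw [zmod5_dvd] at g1 g2
          push_cast at g1 g2
          simp only [ZMod.natCast_val, ZMod.cast_id', id] at g1 g2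
          ext
          · exact g1
          · exact g2
        rw [hmn hτ hq] at h1
        push_cast at h1
        simp only [ZMod.natCast_val, ZMod.cast_id', id] at h1
        rw [← h1]
        simp only [f]
        push_cast
        simp only [ZMod.natCast_val]
  -- the component (0,1)
  have h01 : ((0, 1) : ZMod 5 × ZMod 5) ∈ s := (hs _).2 (by decide)
  have hI : (0 : ℝ) < (I : ℂ).im := by simp
  have hconn : IsPreconnected UU := by
    have : Convex ℝ UU := convex_halfSpace_im_gt 0
    exact this.isPreconnected
  have hfin : ∀ τ : ℂ, 0 < τ.im → f (0, 1) τ ∈ (s.image fun v => f v I) := by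
    intro τ hτ
    obtain ⟨k, hk⟩ := hprod (f (0, 1) τ)
    have h1 := hk τ hτ
    rw [Finset.prod_eq_zero h01 (by simp)] at h1
    have h2 := hk I hI
    rw [← h1] at h2
    obtain ⟨v, hv, e⟩ := Finset.prod_eq_zero_iff.1 h2
    exact Finset.mem_image.2 ⟨v, hv, by linear_combination e⟩
  have hc : ∀ τ : ℂ, 0 < τ.im → f (0, 1) τ = f (0, 1) I := by
    intro τ hτ
    have hpre : IsPreconnected (f (0, 1) '' UU) := hconn.image _ (hf _ h01).continuousOn
    have hsub : (f (0, 1) '' UU).Finite :=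
      (Finset.finite_toSet _).subset (by
        rintro _ ⟨τ, hτ, rfl⟩; exact hfin τ hτ)
    exact hsub.countable.isTotallyDisconnected _ subset_rfl hpre ⟨τ, hτ, rfl⟩ ⟨I, hI, rfl⟩
  refine ⟨f (0, 1) I, fun Λ z hz => ?_⟩
  obtain ⟨a, τ, ha, hτ, hΛ, hzz⟩ := hz.normal
  have hp := pt_normal hτ
  have e1 : F Λ z = F (latt 1 (5 * τ)) τ := by
    have h1 := hF.tr (hp.sc ha) (l := z - a * τ) (by rw [← hΛ]; exact hzz)
    rw [show a * τ + (z - a * τ) = z by ring, ← hΛ] at h1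
    rw [h1, hΛ, hF.inv ha hp]
  rw [e1, ← hc (5 * τ) (im5 hτ)]
  simp only [f]
  have : (ZMod.val (1 : ZMod 5)) = 1 := rfl
  rw [this]
  simp

end RR

namespace RR
open Filter Topology Complex


lemma nome_eventually {P : ℂ → Prop} (h : ∀ᶠ x in 𝓝 (0 : ℂ), P x) : ∃ B : ℝ, ∀ τ : ℂ, B ≤ τ.im → P (ex τ) := by
  obtain ⟨ε, hε, h⟩ := Metric.eventually_nhds_iff.1 h
  refine ⟨(1 - Real.log ε) / (2 * Real.pi), fun τ hτ => h ?_⟩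
  rw [dist_zero_right, norm_ex, ← Real.lt_log_iff_exp_lt hε]
  rw [div_le_iff₀ (by positivity)] at hτ
  linarith

lemma bdd_nome {g : ℂ → ℂ} (h : ContinuousAt g 0) : Bdd (fun τ => g (ex τ)) := by
  have h1 : ∀ᶠ x in 𝓝 (0 : ℂ), ‖g x‖ < ‖g 0‖ + 1 :=
    h.norm.eventually_lt continuousAt_const (by linarith)
  obtain ⟨B, hB⟩ := nome_eventually h1
  exact ⟨B, _, fun τ hτ => (hB τ hτ).le⟩

lemma Bdd.exp_pow (n : ℕ) : Bdd (fun τ => ex τ ^ n) :=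
  bdd_nome (g := fun x => x ^ n) (by fun_prop)

/-- meromorphic at the cusp -/
def Ord (f : ℂ → ℂ) : Prop := ∃ M : ℕ, Bdd (fun τ => ex τ ^ M * f τ)

lemma Bdd.ord {f : ℂ → ℂ} (h : Bdd f) : Ord f := ⟨0, by simpa using h⟩

lemma Ord.mul {f g : ℂ → ℂ} (h : Ord f) (h' : Ord g) : Ord (fun τ => f τ * g τ) := by
  obtain ⟨M, h⟩ := h
  obtain ⟨N, h'⟩ := h'
  exact ⟨M + N, (h.mul h').congr fun τ _ => by ring⟩

lemma Ord.add {f g : ℂ → ℂ} (h : Ord f) (h' : Ord g) : Ord (fun τ => f τ + g τ) := by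
  obtain ⟨M, h⟩ := h
  obtain ⟨N, h'⟩ := h'
  exact ⟨M + N, (((Bdd.exp_pow N).mul h).add ((Bdd.exp_pow M).mul h')).congr fun τ _ => by ring⟩

lemma Ord.congr {f g : ℂ → ℂ} (h : Ord f) (e : ∀ τ : ℂ, 0 < τ.im → f τ = g τ) : Ord g := by
  obtain ⟨M, h⟩ := h
  exact ⟨M, h.congr fun τ hτ => by rw [e τ hτ]⟩

lemma ex_real_mul_bdd {r : ℝ} (hr : 0 ≤ r) (c : ℝ) : Bdd (fun τ => ex (r * τ + c)) := by
  refine Bdd.of (B := 0) (C := 1) fun τ hτ _ => ?_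
  rw [norm_ex]
  simp only [Complex.add_im, Complex.mul_im, Complex.ofReal_re, Complex.ofReal_im, zero_mul, add_zero]
  rw [Real.exp_le_one_iff]
  have : 0 ≤ Real.pi * (r * τ.im) := by positivity
  linarith

lemma Ord.comp {f : ℂ → ℂ} (h : Ord f) {r : ℝ} (hr : 0 < r) {c : ℝ} :
    Ord (fun τ => f (r * τ + c)) := by
  obtain ⟨M, h⟩ := h
  obtain ⟨N, hN⟩ := exists_nat_ge (M * r)
  have h1 := h.comp hr (c := c)
  have h2 := ex_real_mul_bdd (r := N - M * r) (by linarith) (-(M * c))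
  refine ⟨N, (h1.mul h2).congr fun τ _ => ?_⟩
  rw [mul_right_comm, ← ex_nat_mul, ← ex_nat_mul, ← ex_add]
  congr 2
  push_cast; ring

/-- closure of a component -/
lemma Th_diff (w : ℂ) : DifferentiableOn ℂ (fun x => Th x w) (Metric.ball 0 1) := by
  unfold Th
  exact ((differentiableOn_E_nome w).mul (differentiableOn_E_nome w⁻¹)).const_mul _

lemma Th_zero (w : ℂ) : Th 0 w = 1 - w := by
  simp [Th, E_zero_left]

lemma Th_root_ne_zero {x w : ℂ} (hx : ‖x‖ < 1) (hw : ‖w‖ = 1) (h1 : w ≠ 1) : Th x w ≠ 0 := by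
  have key : ∀ u : ℂ, ‖u‖ = 1 → E x u ≠ 0 := by
    intro u hu
    refine E_ne_zero hx fun n h => ?_
    have := congrArg norm h
    rw [norm_mul, hu, norm_pow, mul_one, norm_one] at this
    exact absurd this (pow_lt_one₀ (norm_nonneg _) hx (by omega)).ne
  unfold Th
  exact mul_ne_zero (sub_ne_zero.2 h1.symm) (mul_ne_zero (key _ hw) (key _ (by simp [hw])))

noncomputable def K0 (ζ x : ℂ) : ℂ :=
  Th x (ζ ^ 4) * Th x ζ ^ 3 * Th x ζ⁻¹ / (Th x (ζ ^ 2) ^ 4 * Th x (ζ ^ 2)⁻¹)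

lemma zeta_v {v : ℕ} (hv : v = 1 ∨ v = 2) : ex (v / 5) ^ 5 = 1 ∧ ex (v / 5) ≠ 1 := by
  constructor
  · rw [← ex_nat_mul]
    exact ex_eq_one.2 ⟨v, by push_cast; ring⟩
  · intro h
    obtain ⟨n, hn⟩ := ex_eq_one.1 h
    have : (v : ℂ) = ((5 * n : ℤ) : ℂ) := by push_cast; rw [← hn]; ring
    have h2 : (v : ℤ) = 5 * n := by exact_mod_cast this
    omega

lemma root_facts {ζ : ℂ} (h5 : ζ ^ 5 = 1) (h1 : ζ ≠ 1) :
    ζ ≠ 0 ∧ ζ ^ 2 ≠ 1 ∧ ζ ^ 4 ≠ 1 ∧ ‖ζ‖ = 1 := by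
  have h0 : ζ ≠ 0 := by rintro rfl; norm_num at h5
  have h2 : ζ ^ 2 ≠ 1 := fun h => h1 (by
    have : ζ ^ 5 = (ζ ^ 2) ^ 2 * ζ := by ring
    rw [h5, h] at this; simpa using this.symm)
  refine ⟨h0, h2, fun h => h1 (by
    have : ζ ^ 5 = ζ ^ 4 * ζ := by ring
    rw [h5, h] at this; simpa using this.symm), ?_⟩
  exact norm_eq_one_of_pow_eq_one h5 (by norm_num)

lemma K0_diff {ζ : ℂ} (h5 : ζ ^ 5 = 1) (h1 : ζ ≠ 1) : DifferentiableOn ℂ (K0 ζ) (Metric.ball 0 1) := by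
  obtain ⟨h0, h2, h4, hn⟩ := root_facts h5 h1
  unfold K0
  refine (((Th_diff _).mul ((Th_diff _).pow 3)).mul (Th_diff _)).div
    (((Th_diff _).pow 4).mul (Th_diff _)) fun x hx => ?_
  rw [mem_ball_zero_iff] at hx
  exact mul_ne_zero (pow_ne_zero _ (Th_root_ne_zero hx (by simp [hn]) h2))
    (Th_root_ne_zero hx (by simp [hn]) (by simpa using h2))

lemma K0_zero {ζ : ℂ} (h5 : ζ ^ 5 = 1) (h1 : ζ ≠ 1) : K0 ζ 0 ≠ 0 ∧ K0 ζ 0 ^ 2 + 11 * K0 ζ 0 - 1 = 0 := by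
  obtain ⟨h0, h2, h4, hn⟩ := root_facts h5 h1
  have hs : ζ ^ 4 + ζ ^ 3 + ζ ^ 2 + ζ + 1 = 0 := by
    have : (ζ - 1) * (ζ ^ 4 + ζ ^ 3 + ζ ^ 2 + ζ + 1) = 0 := by linear_combination h5
    exact (mul_eq_zero.1 this).resolve_left (sub_ne_zero.2 h1)
  have hK : K0 ζ 0 = (1 - ζ ^ 4) * (1 - ζ) ^ 3 * (1 - ζ⁻¹) / ((1 - ζ ^ 2) ^ 4 * (1 - (ζ ^ 2)⁻¹)) := by
    simp only [K0, Th_zero]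
  have e1 : ζ⁻¹ = ζ ^ 4 := by
    rw [inv_eq_iff_eq_inv]; exact eq_inv_of_mul_eq_one_left (by linear_combination h5)
  have e2 : (ζ ^ 2)⁻¹ = ζ ^ 3 := by
    rw [inv_eq_iff_eq_inv]; exact eq_inv_of_mul_eq_one_left (by linear_combination h5)
  have n1 : 1 - ζ ≠ 0 := sub_ne_zero.2 h1.symm
  have n2 : 1 - ζ ^ 2 ≠ 0 := sub_ne_zero.2 (Ne.symm h2)
  have n4 : 1 - ζ ^ 4 ≠ 0 := sub_ne_zero.2 (Ne.symm h4)
  have n3 : 1 - ζ ^ 3 ≠ 0 := by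
    rw [← e2]; exact sub_ne_zero.2 fun h => h2 (inv_eq_one.1 h.symm)
  rw [e1, e2] at hK
  constructor
  · rw [hK]
    exact div_ne_zero (by simp [n1, n4]) (by simp [n2, n3])
  · have hd : (1 - ζ ^ 2) ^ 4 * (1 - ζ ^ 3) ≠ 0 := by simp [n2, n3]
    have hk2 : K0 ζ 0 = -3 - 5 * (ζ ^ 2 + ζ ^ 3) - 5 := by
      rw [hK, div_eq_iff hd]
      linear_combination ((9) * ζ ^ 0 + (-12) * ζ ^ 1 + (-21) * ζ ^ 2 + (20) * ζ ^ 3 + (30) * ζ ^ 4 + (-4) * ζ ^ 5 + (-38) * ζ ^ 6 + (-4) * ζ ^ 7 + (25) * ζ ^ 8 + (-5) * ζ ^ 10) * hs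
    rw [hk2]
    linear_combination ((-25) * ζ ^ 0 + (25) * ζ ^ 1 + (25) * ζ ^ 2) * hs

lemma type0_eq {v : ℕ} (hv : v = 1 ∨ v = 2) {τ : ℂ} (hτ : 0 < τ.im) :
    T (latt 1 τ) (v / 5) = K0 (ex (v / 5)) (ex τ) := by
  have hP : Pt (latt 1 τ) (v / 5) := by
    have := pt_mn hτ (m := v) (n := 0) (by omega)
    simpa using this
  have hz := hP.notMem
  have hz2 : 2 * ((v : ℂ) / 5) ∉ latt 1 τ := by
    have := (hP.mul (n := 2) (by norm_num)).notMem
    simpa using this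
  have e1 := derivP_formula hτ (w := v / 5) hz
  have e2 := derivP_formula hτ (w := 2 * (v / 5)) hz2
  have n1 := th_ne_zero hτ hz
  have n2 := th_ne_zero hτ hz2
  have n3 : th τ (-(v / 5)) ≠ 0 := th_ne_zero hτ hP.int_mul_neg.notMem
  have nc : deriv (th τ) 0 ≠ 0 := by
    intro h0
    have hP2 := T_ne_zero hP
    apply hP2
    show (pp hτ).derivWeierstrassP (2 * (v / 5)) / (pp hτ).derivWeierstrassP (v / 5) = 0
    rw [e2, h0]; simp
  show (pp hτ).derivWeierstrassP (2 * (v / 5)) / (pp hτ).derivWeierstrassP (v / 5) = _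
  have m2 : ex (2 * (v / 5)) = ex (v / 5) ^ 2 := by
    have := ex_nat_mul 2 (v / 5); simpa using this
  have m4 : ex (2 * (2 * (v / 5))) = ex (v / 5) ^ 4 := by
    have := ex_nat_mul 4 (v / 5)
    rw [← this]; congr 1; push_cast; ring
  rw [e1, e2, K0]
  simp only [th, ex_neg, m2, m4] at n1 n2 n3 ⊢
  field_simp

lemma type0_diff {v : ℕ} (hv : v = 1 ∨ v = 2) :
    DifferentiableOn ℂ (fun τ => T (latt 1 τ) (v / 5)) UU := by
  obtain ⟨h5, h1⟩ := zeta_v hv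
  have := (K0_diff h5 h1).comp (s := UU) differentiable_ex.differentiableOn
    (fun τ hτ => by rw [mem_ball_zero_iff]; exact norm_ex_lt_one hτ)
  exact this.congr fun τ hτ => type0_eq hv hτ

lemma K0_cont {ζ : ℂ} (h5 : ζ ^ 5 = 1) (h1 : ζ ≠ 1) : ContinuousAt (K0 ζ) 0 :=
  (K0_diff h5 h1).continuousOn.continuousAt (Metric.ball_mem_nhds _ one_pos)

lemma type0_bdd {v : ℕ} (hv : v = 1 ∨ v = 2) : Bdd (fun τ => T (latt 1 τ) (v / 5)) := by
  obtain ⟨h5, h1⟩ := zeta_v hv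
  exact (bdd_nome (K0_cont h5 h1)).congr fun τ hτ => (type0_eq hv hτ).symm

lemma tB_diff : DifferentiableOn ℂ tB (Metric.ball 0 1) := by
  obtain ⟨p, _, h⟩ := EvZ_tB
  exact Ev.differentiableOn h

lemma tB_cont : ContinuousAt tB 0 := tB_diff.continuousOn.continuousAt (Metric.ball_mem_nhds _ one_pos)

lemma tB_zero : tB 0 = 1 := by
  obtain ⟨p, hc, h⟩ := EvZ_tB
  rw [Ev.apply_zero h]
  simp [hc]

lemma t_diff : DifferentiableOn ℂ t UU := by
  have := tB_diff.comp (s := UU) differentiable_ex.differentiableOn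
    (fun τ hτ => by rw [mem_ball_zero_iff]; exact norm_ex_lt_one hτ)
  exact (differentiable_ex.differentiableOn.mul this).congr fun τ hτ => t_eq_tB hτ

lemma t_bdd : Bdd t :=
  (bdd_nome (g := fun x => x * tB x) (continuousAt_id.mul tB_cont)).congr fun τ hτ => (t_eq_tB hτ).symm

lemma t2_eq {τ : ℂ} (hτ : 0 < τ.im) : T (latt 1 (5 * τ)) (2 * τ) = -(t τ)⁻¹ := T_two (pt_normal hτ)

lemma t2_diff : DifferentiableOn ℂ (fun τ => T (latt 1 (5 * τ)) (2 * τ)) UU :=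
  ((t_diff.inv fun τ hτ => t_ne_zero hτ).neg).congr fun τ hτ => t2_eq hτ

lemma t2_ord : Ord (fun τ => T (latt 1 (5 * τ)) (2 * τ)) := by
  refine ⟨1, (bdd_nome (g := fun x => -(tB x)⁻¹) (tB_cont.inv₀ (by simp [tB_zero])).neg).congr ?_⟩
  intro τ hτ
  have h1 := ex_ne_zero τ
  have h2 := tB_ne_zero (norm_ex_lt_one hτ)
  simp only []
  rw [t2_eq hτ, t_eq_tB hτ]
  field_simp

lemma mod_T : Mod T where
  inv ha _ := T_sc ha _ _
  tr h hl := T_add h.lat hl _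
  neg h := T_neg h.lat _
  hol0 v hv := type0_diff hv
  hol1 v hv := by
    rcases hv with rfl | rfl
    · simpa using (show DifferentiableOn ℂ (fun τ => T (latt 1 (5 * τ)) τ) UU from t_diff)
    · simpa using t2_diff
  bd0 v hv := type0_bdd hv
  ord v hv := by
    rcases hv with rfl | rfl
    · simpa [Ord] using (show Ord (fun τ => T (latt 1 (5 * τ)) τ) from t_bdd.ord)
    · simpa [Ord] using t2_ord

lemma Mod.const (c : ℂ) : Mod (fun _ _ => c) where
  inv _ _ := rfl
  tr _ _ := rfl
  neg _ := rfl
  hol0 _ _ := differentiableOn_const _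
  hol1 _ _ := differentiableOn_const _
  bd0 _ _ := Bdd.const c
  ord _ _ := (Bdd.const c).ord

lemma Mod.add {F G : Submodule ℤ ℂ → ℂ → ℂ} (hF : Mod F) (hG : Mod G) :
    Mod (fun Λ z => F Λ z + G Λ z) where
  inv ha h := by rw [hF.inv ha h, hG.inv ha h]
  tr h hl := by rw [hF.tr h hl, hG.tr h hl]
  neg h := by rw [hF.neg h, hG.neg h]
  hol0 v hv := (hF.hol0 v hv).add (hG.hol0 v hv)
  hol1 v hv := (hF.hol1 v hv).add (hG.hol1 v hv)
  bd0 v hv := (hF.bd0 v hv).add (hG.bd0 v hv)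
  ord v hv := Ord.add (hF.ord v hv) (hG.ord v hv)

lemma Mod.mul {F G : Submodule ℤ ℂ → ℂ → ℂ} (hF : Mod F) (hG : Mod G) :
    Mod (fun Λ z => F Λ z * G Λ z) where
  inv ha h := by rw [hF.inv ha h, hG.inv ha h]
  tr h hl := by rw [hF.tr h hl, hG.tr h hl]
  neg h := by rw [hF.neg h, hG.neg h]
  hol0 v hv := (hF.hol0 v hv).mul (hG.hol0 v hv)
  hol1 v hv := (hF.hol1 v hv).mul (hG.hol1 v hv)
  bd0 v hv := (hF.bd0 v hv).mul (hG.bd0 v hv)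
  ord v hv := Ord.mul (hF.ord v hv) (hG.ord v hv)

lemma Mod.pow {F : Submodule ℤ ℂ → ℂ → ℂ} (hF : Mod F) (n : ℕ) : Mod (fun Λ z => F Λ z ^ n) := by
  induction n with
  | zero => simpa using Mod.const 1
  | succ n ih => simpa only [pow_succ] using ih.mul hF

/-- `F(Λ, 2z)` -/
lemma Mod.dbl {F : Submodule ℤ ℂ → ℂ → ℂ} (hF : Mod F) : Mod (fun Λ z => F Λ (2 * z)) := by
  have h2 : ∀ {Λ : Submodule ℤ ℂ} {z : ℂ}, Pt Λ z → Pt Λ (2 * z) := fun h => by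
    simpa using h.mul (n := 2) (by norm_num)
  have p0 : ∀ τ ∈ UU, F (latt 1 τ) (2 * ((2 : ℕ) / 5)) = F (latt 1 τ) ((1 : ℕ) / 5) := by
    intro τ hτ
    have hP : Pt (latt 1 τ) ((1 : ℕ) / 5) := by
      have := pt_mn (m := 1) (n := 0) hτ (by omega)
      simpa using this
    rw [← hF.neg hP, ← hF.tr hP.int_mul_neg (l := 1) (mem_latt.2 ⟨1, 0, by simp⟩)]
    congr 1; push_cast; norm_num
  have p1 : ∀ τ ∈ UU, F (latt 1 (5 * τ)) (2 * ((2 : ℕ) * τ)) = F (latt 1 (5 * τ)) ((1 : ℕ) * τ) := by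
    intro τ hτ
    have hP : Pt (latt 1 (5 * τ)) ((1 : ℕ) * τ) := by simpa using pt_normal hτ
    rw [← hF.neg hP, ← hF.tr hP.int_mul_neg (l := 5 * τ) (mem_latt.2 ⟨0, 1, by simp⟩)]
    congr 1; push_cast; ring
  have q0 : ∀ τ : ℂ, F (latt 1 τ) (2 * ((1 : ℕ) / 5)) = F (latt 1 τ) ((2 : ℕ) / 5) := fun τ => by
    congr 1; push_cast; ring
  have q1 : ∀ τ : ℂ, F (latt 1 (5 * τ)) (2 * ((1 : ℕ) * τ)) = F (latt 1 (5 * τ)) ((2 : ℕ) * τ) := fun τ => by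
    congr 1; push_cast; ring
  refine ⟨?_, ?_, ?_, ?_, ?_, ?_, ?_⟩
  · intro a Λ z ha h
    rw [← hF.inv ha (h2 h)]; congr 1; ring
  · intro Λ z l h hl
    rw [mul_add]; exact hF.tr (h2 h) (by rw [two_mul]; exact Λ.add_mem hl hl)
  · intro Λ z h
    rw [mul_neg]; exact hF.neg (h2 h)
  · rintro v (rfl | rfl)
    · exact (hF.hol0 2 (Or.inr rfl)).congr fun τ _ => q0 τ
    · exact (hF.hol0 1 (Or.inl rfl)).congr p0
  · rintro v (rfl | rfl)
    · exact (hF.hol1 2 (Or.inr rfl)).congr fun τ _ => q1 τ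
    · exact (hF.hol1 1 (Or.inl rfl)).congr p1
  · rintro v (rfl | rfl)
    · exact (hF.bd0 2 (Or.inr rfl)).congr fun τ _ => (q0 τ).symm
    · exact (hF.bd0 1 (Or.inl rfl)).congr fun τ h => (p0 τ h).symm
  · rintro v (rfl | rfl)
    · exact Ord.congr (hF.ord 2 (Or.inr rfl)) fun τ _ => (q1 τ).symm
    · exact Ord.congr (hF.ord 1 (Or.inl rfl)) fun τ h => (p1 τ h).symm

lemma Mod.congr {F G : Submodule ℤ ℂ → ℂ → ℂ} (hF : Mod F) (e : ∀ Λ z, Pt Λ z → F Λ z = G Λ z) :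
    Mod G := by
  have p0 : ∀ v : ℕ, v = 1 ∨ v = 2 → ∀ τ : ℂ, 0 < τ.im → F (latt 1 τ) (v / 5) = G (latt 1 τ) (v / 5) := by
    intro v hv τ hτ
    refine e _ _ ?_
    have := pt_mn (m := v) (n := 0) hτ (by omega)
    simpa using this
  have p1 : ∀ v : ℕ, v = 1 ∨ v = 2 → ∀ τ : ℂ, 0 < τ.im →
      F (latt 1 (5 * τ)) (v * τ) = G (latt 1 (5 * τ)) (v * τ) := by
    intro v hv τ hτ
    refine e _ _ ?_
    have := (pt_normal hτ).mul (n := v) (by omega)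
    simpa using this
  refine ⟨?_, ?_, ?_, ?_, ?_, ?_, ?_⟩
  · intro a Λ z ha h
    rw [← e _ _ h, ← e _ _ (h.sc ha), hF.inv ha h]
  · intro Λ z l h hl
    rw [← e _ _ h, ← e _ _ (h.add hl), hF.tr h hl]
  · intro Λ z h
    rw [← e _ _ h, ← e _ _ h.int_mul_neg, hF.neg h]
  · exact fun v hv => (hF.hol0 v hv).congr fun τ h => (p0 v hv τ h).symm
  · exact fun v hv => (hF.hol1 v hv).congr fun τ h => (p1 v hv τ h).symm
  · exact fun v hv => (hF.bd0 v hv).congr (p0 v hv)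
  · exact fun v hv => Ord.congr (hF.ord v hv) fun τ h => p1 v hv τ h

lemma mod_Tinv : Mod (fun Λ z => (T Λ z)⁻¹) :=
  ((Mod.const (-1)).mul mod_T.dbl).congr fun Λ z h => by rw [T_two h]; ring

end RR

namespace RR
open Filter Topology Complex


lemma exists_ex {w : ℂ} (h0 : w ≠ 0) (h1 : ‖w‖ < 1) : ∃ τ : ℂ, 0 < τ.im ∧ ex τ = w := by
  have hp : (2 * Real.pi * I : ℂ) ≠ 0 := by simp [Real.pi_ne_zero]
  have hw : ex (Complex.log w / (2 * Real.pi * I)) = w := by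
    unfold ex
    rw [mul_div_cancel₀ _ hp, Complex.exp_log h0]
  refine ⟨_, ?_, hw⟩
  by_contra h
  have := norm_ex (Complex.log w / (2 * Real.pi * I))
  rw [hw] at this
  rw [this] at h1
  have h2 : 0 ≤ -2 * Real.pi * (Complex.log w / (2 * Real.pi * I)).im := by
    have := mul_nonneg Real.pi_pos.le (neg_nonneg.2 (not_lt.1 h))
    linarith
  exact absurd h1 (not_lt.2 (Real.one_le_exp h2))

def Ser (J : AddSubgroup ℂ) (M : ℕ) (f : ℂ → ℂ) : Prop :=
  ∃ a : ℕ → ℂ, (∀ n, a n ∈ J) ∧ ∀ τ : ℂ, 0 < τ.im → HasSum (fun n => a n * ex τ ^ n) (ex τ ^ M * f τ)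

lemma ser_ev {a : ℕ → ℂ} {f : ℂ → ℂ}
    (h : ∀ τ : ℂ, 0 < τ.im → HasSum (fun n => a n * ex τ ^ n) (f τ)) :
    ∃ g, Ev a g ∧ ∀ τ : ℂ, 0 < τ.im → g (ex τ) = f τ := by
  refine ⟨fun w => ∑' n, a n * w ^ n, fun w hw => ?_, fun τ hτ => (h τ hτ).tsum_eq⟩
  by_cases h0 : w = 0
  · subst h0
    refine (summable_of_ne_finset_zero (s := {0}) fun n hn => ?_).hasSum
    rw [zero_pow (by simpa using hn), mul_zero]
  · obtain ⟨τ, hτ, rfl⟩ := exists_ex h0 hw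
    exact (h τ hτ).summable.hasSum

lemma ser_unique {a b : ℕ → ℂ} {f : ℂ → ℂ}
    (h : ∀ τ : ℂ, 0 < τ.im → HasSum (fun n => a n * ex τ ^ n) (f τ))
    (h' : ∀ τ : ℂ, 0 < τ.im → HasSum (fun n => b n * ex τ ^ n) (f τ)) : a = b := by
  obtain ⟨g, e, hg⟩ := ser_ev h
  obtain ⟨g', e', hg'⟩ := ser_ev h'
  refine e.unique e' fun w h0 h1 => ?_
  obtain ⟨τ, hτ, rfl⟩ := exists_ex h0 h1
  rw [hg τ hτ, hg' τ hτ]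

lemma ser_bdd {a : ℕ → ℂ} {f : ℂ → ℂ}
    (h : ∀ τ : ℂ, 0 < τ.im → HasSum (fun n => a n * ex τ ^ n) (f τ)) : Bdd f := by
  obtain ⟨g, e, hg⟩ := ser_ev h
  refine (bdd_nome (g := g) ?_).congr fun τ hτ => hg τ hτ
  exact e.differentiableOn.continuousOn.continuousAt (Metric.ball_mem_nhds _ one_pos)

lemma Ser.congr {J : AddSubgroup ℂ} {M : ℕ} {f g : ℂ → ℂ} (h : Ser J M f)
    (e : ∀ τ : ℂ, 0 < τ.im → f τ = g τ) : Ser J M g := by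
  obtain ⟨a, ha, h⟩ := h
  exact ⟨a, ha, fun τ hτ => by rw [← e τ hτ]; exact h τ hτ⟩

lemma Ser.mono {J K : AddSubgroup ℂ} (hJ : J ≤ K) {M : ℕ} {f : ℂ → ℂ} (h : Ser J M f) : Ser K M f := by
  obtain ⟨a, ha, h⟩ := h
  exact ⟨a, fun n => hJ (ha n), h⟩

/-- spreading of coefficients -/
lemma hasSum_spread {a : ℕ → ℂ} {w x : ℂ} {i : ℕ → ℕ} (hi : Function.Injective i)
    (h : HasSum (fun n => a n * w ^ i n) x) :
    HasSum (fun n => Function.extend i a 0 n * w ^ n) x := by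
  refine (hi.hasSum_iff ?_).1 ?_
  · intro n hn
    rw [Function.extend_apply' _ _ _ (by simpa using hn)]; simp
  · refine hasSum_of_eq h fun n => ?_
    simp [hi.extend_apply]

lemma extend_mem {J : AddSubgroup ℂ} {a : ℕ → ℂ} {i : ℕ → ℕ} (hi : Function.Injective i)
    (ha : ∀ n, a n ∈ J) (n : ℕ) : Function.extend i a 0 n ∈ J := by
  by_cases h : ∃ m, i m = n
  · obtain ⟨m, rfl⟩ := h
    rw [hi.extend_apply]; exact ha m
  · rw [Function.extend_apply' _ _ _ h]; exact J.zero_mem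

lemma Ser.raise {J : AddSubgroup ℂ} {M : ℕ} {f : ℂ → ℂ} (h : Ser J M f) (k : ℕ) : Ser J (M + k) f := by
  obtain ⟨a, ha, h⟩ := h
  have hi : Function.Injective (fun n : ℕ => n + k) := fun _ _ h => by simpa using h
  refine ⟨_, extend_mem hi ha, fun τ hτ => hasSum_spread hi ?_⟩
  have := (h τ hτ).mul_right (ex τ ^ k)
  rw [show ex τ ^ M * f τ * ex τ ^ k = ex τ ^ (M + k) * f τ by ring] at this
  exact hasSum_of_eq this fun n => by ring

lemma Ser.raise' {J : AddSubgroup ℂ} {M N : ℕ} {f : ℂ → ℂ} (h : Ser J M f) (hN : M ≤ N) : Ser J N f := by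
  obtain ⟨k, rfl⟩ := Nat.exists_eq_add_of_le hN
  exact h.raise k

lemma Ser.add {J : AddSubgroup ℂ} {M : ℕ} {f g : ℂ → ℂ} (h : Ser J M f) (h' : Ser J M g) :
    Ser J M (fun τ => f τ + g τ) := by
  obtain ⟨a, ha, h⟩ := h
  obtain ⟨b, hb, h'⟩ := h'
  refine ⟨fun n => a n + b n, fun n => J.add_mem (ha n) (hb n), fun τ hτ => ?_⟩
  rw [mul_add]
  exact hasSum_of_eq ((h τ hτ).add (h' τ hτ)) fun n => by ring

lemma Ser.neg {J : AddSubgroup ℂ} {M : ℕ} {f : ℂ → ℂ} (h : Ser J M f) :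
    Ser J M (fun τ => - f τ) := by
  obtain ⟨a, ha, h⟩ := h
  refine ⟨fun n => - a n, fun n => J.neg_mem (ha n), fun τ hτ => ?_⟩
  rw [mul_neg]
  exact hasSum_of_eq (h τ hτ).neg fun n => by ring

lemma Ser.add' {J : AddSubgroup ℂ} {M N : ℕ} {f g : ℂ → ℂ} (h : Ser J M f) (h' : Ser J N g) :
    Ser J (M + N) (fun τ => f τ + g τ) := by
  refine (h.raise N).add ?_
  rw [add_comm]; exact h'.raise M

lemma Ser.mul {J K R : AddSubgroup ℂ} (hJK : ∀ x ∈ J, ∀ y ∈ K, x * y ∈ R) {M N : ℕ} {f g : ℂ → ℂ}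
    (h : Ser J M f) (h' : Ser K N g) : Ser R (M + N) (fun τ => f τ * g τ) := by
  obtain ⟨a, ha, h⟩ := h
  obtain ⟨b, hb, h'⟩ := h'
  refine ⟨fun n => ∑ ij ∈ Finset.HasAntidiagonal.antidiagonal n, a ij.1 * b ij.2,
    fun n => R.sum_mem fun ij _ => hJK _ (ha ij.1) _ (hb ij.2), fun τ hτ => ?_⟩
  have := hasSum_mul_ps (h τ hτ) (h' τ hτ)
  rwa [show ex τ ^ M * f τ * (ex τ ^ N * g τ) = ex τ ^ (M + N) * (f τ * g τ) by ring] at this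

lemma Ser.const {J : AddSubgroup ℂ} {c : ℂ} (hc : c ∈ J) : Ser J 0 (fun _ => c) := by
  refine ⟨fun n => if n = 0 then c else 0, fun n => by
    simp only []; split_ifs; exacts [hc, J.zero_mem], fun τ hτ => ?_⟩
  have := hasSum_single (f := fun n => (if n = 0 then c else 0) * ex τ ^ n) 0
    (fun n hn => by simp [hn])
  simpa using this

lemma Ser.compMul {J : AddSubgroup ℂ} {M : ℕ} {f : ℂ → ℂ} (h : Ser J M f) {p : ℕ} (hp : 0 < p) :
    Ser J (p * M) (fun τ => f (p * τ)) := by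
  obtain ⟨a, ha, h⟩ := h
  have hi : Function.Injective (fun n : ℕ => p * n) := fun _ _ h => Nat.eq_of_mul_eq_mul_left hp h
  refine ⟨_, extend_mem hi ha, fun τ hτ => hasSum_spread hi ?_⟩
  have := h (p * τ) (by simp; positivity)
  rw [ex_nat_mul, ← pow_mul] at this
  exact hasSum_of_eq this fun n => by rw [pow_mul]

lemma Ser.shift {J K : AddSubgroup ℂ} {M : ℕ} {f : ℂ → ℂ} (h : Ser J M f) (c : ℝ)
    (hc : ∀ x ∈ J, ∀ k : ℤ, x * ex c ^ k ∈ K) : Ser K M (fun τ => f (τ + c)) := by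
  obtain ⟨a, ha, h⟩ := h
  refine ⟨fun n => a n * ex c ^ ((n : ℤ) - M), fun n => hc _ (ha n) _, fun τ hτ => ?_⟩
  have h1 := (h (τ + c) (by simpa using hτ)).mul_left ((ex c ^ M)⁻¹)
  have h0 := ex_ne_zero c
  rw [ex_add] at h1
  rw [show (ex c ^ M)⁻¹ * ((ex τ * ex c) ^ M * f (τ + c)) = ex τ ^ M * f (τ + c) by
    rw [mul_pow]; field_simp] at h1
  refine hasSum_of_eq h1 fun n => ?_
  simp only [zpow_sub₀ h0, zpow_natCast, mul_pow]
  field_simp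

lemma Ser.down {J : AddSubgroup ℂ} {M : ℕ} {f : ℂ → ℂ} {p : ℕ} (hp : 0 < p)
    (h : Ser J M (fun τ => f (p * τ))) (hf : ∀ τ : ℂ, 0 < τ.im → f (τ + 1) = f τ) : Ser J M f := by
  have h1 : Ser J (p * M) (fun τ => f (p * τ)) := h.raise' (Nat.le_mul_of_pos_left M hp)
  obtain ⟨a, ha, h1⟩ := h1
  have hpc : (p : ℂ) ≠ 0 := by exact_mod_cast hp.ne'
  set ζ := ex (1 / p) with hζ
  have hζp : ζ ^ p = 1 := by
    rw [hζ, ← ex_nat_mul, mul_one_div_cancel hpc]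
    exact ex_eq_one.2 ⟨1, by simp⟩
  have e : (fun n => a n * ζ ^ n) = a := by
    refine ser_unique (f := fun τ => ex τ ^ (p * M) * f (p * τ)) (fun τ hτ => ?_) h1
    have h2 := h1 (τ + 1 / p) (by
      have : (1 / (p : ℂ)).im = 0 := by
        rw [show (1 / (p : ℂ)) = ((1 / p : ℝ) : ℂ) by push_cast; rfl]; exact Complex.ofReal_im _
      rw [Complex.add_im, this, add_zero]; exact hτ)
    have h3 : f (p * (τ + 1 / p)) = f (p * τ) := by
      rw [mul_add, mul_one_div_cancel hpc]
      exact hf _ (by simp; positivity)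
    rw [ex_add, mul_pow, ← hζ, pow_mul ζ, hζp, one_pow, mul_one] at h2
    simp only [h3] at h2
    exact hasSum_of_eq h2 fun n => by rw [mul_pow]; ring
  have h0 : ∀ n, ¬ p ∣ n → a n = 0 := by
    intro n hn
    have h2 : a n * ζ ^ n = a n := congrFun e n
    have h3 : ζ ^ n ≠ 1 := by
      rw [hζ, ← ex_nat_mul]
      intro h4
      obtain ⟨k, hk⟩ := ex_eq_one.1 h4
      apply hn
      have : (n : ℂ) = ((p * k : ℤ) : ℂ) := by
        push_cast; rw [← hk]; field_simp
      have h5 : (n : ℤ) = p * k := by exact_mod_cast this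
      exact Int.natCast_dvd_natCast.1 ⟨k, h5⟩
    have h4 : a n * (ζ ^ n - 1) = 0 := by linear_combination h2
    exact (mul_eq_zero.1 h4).resolve_right (sub_ne_zero.2 h3)
  refine ⟨fun n => a (p * n), fun n => ha _, fun τ hτ => ?_⟩
  have h2 := h1 (τ / p) (by
    rw [show τ / p = ((1 / p : ℝ) : ℂ) * τ by push_cast; ring, Complex.im_ofReal_mul]
    positivity)
  simp only [] at h2
  rw [mul_div_cancel₀ _ hpc, pow_mul, ← ex_nat_mul, mul_div_cancel₀ _ hpc] at h2
  have hi : Function.Injective (fun n : ℕ => p * n) := fun _ _ h => Nat.eq_of_mul_eq_mul_left hp h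
  refine hasSum_of_eq ((hi.hasSum_iff (f := fun n => a n * ex (τ / p) ^ n) ?_).2 h2) fun n => ?_
  · intro n hn
    rw [h0 n (fun ⟨k, hk⟩ => hn ⟨k, hk.symm⟩), zero_mul]
  · simp only [Function.comp]
    rw [pow_mul, ← ex_nat_mul, mul_div_cancel₀ _ hpc]

lemma Ser.average {J : AddSubgroup ℂ} {M : ℕ} {f : ℂ → ℂ} {p : ℕ} (hp : 0 < p) (h : Ser J M f) :
    Ser J M (fun τ => ∑ j ∈ Finset.range p, f (τ + (j / p : ℝ))) := by
  have hpc : (p : ℂ) ≠ 0 := by exact_mod_cast hp.ne'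
  obtain ⟨a, ha, h⟩ := h
  have hsum : ∀ x : ℂ, x ^ p = 1 → ∑ j ∈ Finset.range p, x ^ j = 0 ∨ ∑ j ∈ Finset.range p, x ^ j = p := by
    intro x hx
    by_cases h1 : x = 1
    · right; simp [h1]
    · left
      have := geom_sum_mul x p
      rw [hx, sub_self] at this
      exact (mul_eq_zero.1 this).resolve_right (sub_ne_zero.2 h1)
  refine ⟨fun n => a n * ∑ j ∈ Finset.range p, (ex (1 / p) ^ ((n : ℤ) - M)) ^ j, fun n => ?_, fun τ hτ => ?_⟩
  · rcases hsum (ex (1 / p) ^ ((n : ℤ) - M)) (by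
      rw [← zpow_natCast, ← zpow_mul, mul_comm, zpow_mul, zpow_natCast, ← ex_nat_mul,
        mul_one_div_cancel hpc, ex_eq_one.2 ⟨1, by simp⟩, one_zpow]) with h | h
    · simp only [h, mul_zero]; exact J.zero_mem
    · simp only [h]; rw [mul_comm, ← nsmul_eq_mul]; exact J.nsmul_mem (ha n) p
  · rw [Finset.mul_sum]
    have : ∀ j ∈ Finset.range p, HasSum (fun n => a n * (ex (1 / p) ^ ((n : ℤ) - M)) ^ j * ex τ ^ n)
        (ex τ ^ M * f (τ + (j / p : ℝ))) := by
      intro j _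
      have h1 := (h (τ + (j / p : ℝ)) (by rw [Complex.add_im, Complex.ofReal_im, add_zero]; exact hτ)).mul_left
        ((ex (j / p : ℝ) ^ M)⁻¹)
      have h0 := ex_ne_zero ((j / p : ℝ) : ℂ)
      rw [ex_add] at h1
      rw [show (ex (j / p : ℝ) ^ M)⁻¹ * ((ex τ * ex (j / p : ℝ)) ^ M * f (τ + (j / p : ℝ)))
        = ex τ ^ M * f (τ + (j / p : ℝ)) by rw [mul_pow]; field_simp] at h1
      refine hasSum_of_eq h1 fun n => ?_
      have e : ex ((j / p : ℝ) : ℂ) = ex (1 / p) ^ j := by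
        rw [← ex_nat_mul]; congr 1; push_cast; ring
      have e2 : (ex (1 / (p : ℂ)) ^ ((n : ℤ) - M)) ^ j = ex ((j / p : ℝ) : ℂ) ^ n / ex ((j / p : ℝ) : ℂ) ^ M := by
        rw [e, zpow_sub₀ (ex_ne_zero _), zpow_natCast, zpow_natCast, div_pow, ← pow_mul, ← pow_mul,
          ← pow_mul, ← pow_mul, mul_comm n, mul_comm M]
      rw [e2, mul_pow]
      field_simp
    refine hasSum_of_eq (hasSum_sum this) fun n => ?_
    simp only [Finset.mul_sum, Finset.sum_mul]

end RR

namespace RR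
open Filter Topology Complex


def Zc : AddSubgroup ℂ := (Int.castAddHom ℂ).range

lemma int_mem_Zc (n : ℤ) : (n : ℂ) ∈ Zc := ⟨n, rfl⟩

lemma mul_Zc {J : AddSubgroup ℂ} : ∀ x ∈ J, ∀ y ∈ Zc, x * y ∈ J := by
  rintro x hx _ ⟨n, rfl⟩
  have := J.zsmul_mem hx n
  rw [zsmul_eq_mul, mul_comm] at this
  exact this

lemma EvZ.ser {r : PowerSeries ℤ} {g : ℂ → ℂ} (h : EvZ r g) {J : AddSubgroup ℂ}
    (hJ : ∀ n, ((r.coeff n : ℤ) : ℂ) ∈ J) : Ser J 0 (fun τ => g (ex τ)) :=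
  ⟨_, hJ, fun τ hτ => by simpa using h _ (norm_ex_lt_one hτ)⟩

lemma ser_ex : Ser Zc 0 ex := by
  refine ⟨fun n => if n = 1 then 1 else 0, fun n => ?_, fun τ hτ => ?_⟩
  · simp only []
    split_ifs
    · simpa using int_mem_Zc 1
    · exact Zc.zero_mem
  · have := hasSum_single (f := fun n => (if n = 1 then (1 : ℂ) else 0) * ex τ ^ n) 1
      (fun n hn => by simp [hn])
    simpa using this

lemma ser_t : Ser Zc 0 t := by
  obtain ⟨p, _, h⟩ := EvZ_tB
  exact (ser_ex.mul mul_Zc (h.ser fun n => int_mem_Zc _)).congr fun τ hτ => (t_eq_tB hτ).symm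

lemma inv_pow_series (m : ℕ) : ∃ c : ℕ → ℂ, (∀ n, c n ∈ Zc) ∧ c 0 = 1 ∧
    ∀ τ : ℂ, 0 < τ.im → HasSum (fun n => c n * ex τ ^ n) (ex τ ^ m * (t τ)⁻¹ ^ m) := by
  obtain ⟨p, hc, h⟩ := EvZ_tB_inv
  refine ⟨fun n => (((p ^ m).coeff n : ℤ) : ℂ), fun n => int_mem_Zc _, ?_, fun τ hτ => ?_⟩
  · simp [hc]
  · have := (h.pow m) _ (norm_ex_lt_one hτ)
    convert this using 1
    have h1 := ex_ne_zero τ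
    rw [t_eq_tB hτ, mul_inv, ← mul_pow, mul_inv_cancel_left₀ h1]

lemma ser_tinv : Ser Zc 1 (fun τ => (t τ)⁻¹) := by
  obtain ⟨c, hc, _, h⟩ := inv_pow_series 1
  exact ⟨c, hc, fun τ hτ => by simpa using h τ hτ⟩

lemma laurent_aux {J : AddSubgroup ℂ} (M : ℕ) : ∀ {G : Submodule ℤ ℂ → ℂ → ℂ}, Mod G →
    Bdd (fun τ => G (latt 1 (5 * τ)) (2 * τ)) → Ser J M (fun τ => G (latt 1 (5 * τ)) τ) →
    ∃ P : Polynomial ℂ, (∀ i, P.coeff i ∈ J) ∧ ∀ Λ z, Pt Λ z → G Λ z = P.eval (T Λ z)⁻¹ := by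
  induction M with
  | zero =>
    rintro G hG hB ⟨a, ha, h⟩
    obtain ⟨c, hc⟩ := hG.const_of_bdd (by
      rintro v (rfl | rfl)
      · refine (ser_bdd h).congr fun τ _ => ?_
        simp
      · simpa using hB)
    have h1 : c = a 0 := by
      have e := ser_unique (f := fun _ => c) (a := fun n => if n = 0 then c else 0) (b := a)
        (fun τ hτ => by
          have := hasSum_single (f := fun n => (if n = 0 then c else 0) * ex τ ^ n) 0
            (fun n hn => by simp [hn])
          simpa using this)
        (fun τ hτ => by
          have := h τ hτ
          simp only [pow_zero, one_mul] at this
          rwa [hc _ _ (pt_normal hτ)] at this)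
      simpa using congrFun e 0
    refine ⟨Polynomial.C c, fun i => ?_, fun Λ z hz => by rw [hc Λ z hz]; simp⟩
    rw [Polynomial.coeff_C]
    split_ifs
    · rw [h1]; exact ha 0
    · exact J.zero_mem
  | succ M ih =>
    rintro G hG hB ⟨a, ha, h⟩
    obtain ⟨c, hc, hc0, hcs⟩ := inv_pow_series (M + 1)
    have hG' : Mod (fun Λ z => G Λ z + -a 0 * (T Λ z)⁻¹ ^ (M + 1)) :=
      hG.add ((Mod.const (-a 0)).mul (mod_Tinv.pow (M + 1)))
    have hser : Ser J M (fun τ => G (latt 1 (5 * τ)) τ + -a 0 * (T (latt 1 (5 * τ)) τ)⁻¹ ^ (M + 1)) := by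
      refine ⟨fun n => a (n + 1) + -(a 0 * c (n + 1)),
        fun n => J.add_mem (ha _) (J.neg_mem (mul_Zc _ (ha _) _ (hc _))), fun τ hτ => ?_⟩
      have h1 := (h τ hτ).add ((hcs τ hτ).mul_left (-a 0))
      rw [← hasSum_nat_add_iff' 1] at h1
      have h0 := ex_ne_zero τ
      have h2 := h1.mul_left (ex τ)⁻¹
      have e : (ex τ)⁻¹ * (ex τ ^ (M + 1) * G (latt 1 (5 * τ)) τ + -a 0 * (ex τ ^ (M + 1) * (t τ)⁻¹ ^ (M + 1)) -
          ∑ i ∈ Finset.range 1, (a i * ex τ ^ i + -a 0 * (c i * ex τ ^ i)))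
          = ex τ ^ M * (G (latt 1 (5 * τ)) τ + -a 0 * (T (latt 1 (5 * τ)) τ)⁻¹ ^ (M + 1)) := by
        simp only [Finset.sum_range_one, hc0]
        have : T (latt 1 (5 * τ)) τ = t τ := rfl
        rw [this, inv_mul_eq_iff_eq_mul₀ h0]
        ring
      rw [← e]
      refine hasSum_of_eq h2 fun n => ?_
      rw [inv_mul_eq_iff_eq_mul₀ h0]
      ring
    obtain ⟨P, hP, hPe⟩ := ih hG' (by
      refine hB.add ((Bdd.const (-a 0)).mul ?_)
      have : Bdd (fun τ => ∏ i ∈ Finset.range (M + 1), (-1 * t τ)) :=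
        Bdd.prod _ fun i _ => (Bdd.const _).mul t_bdd
      refine this.congr fun τ hτ => ?_
      simp only [Finset.prod_const, Finset.card_range]
      rw [t2_eq hτ, inv_neg, inv_inv]; ring) hser
    · refine ⟨P + Polynomial.C (a 0) * Polynomial.X ^ (M + 1), fun i => ?_, fun Λ z hz => ?_⟩
      · rw [Polynomial.coeff_add, Polynomial.coeff_C_mul_X_pow]
        refine J.add_mem (hP i) ?_
        split_ifs
        exacts [ha 0, J.zero_mem]
      · have := hPe Λ z hz
        simp only [Polynomial.eval_add, Polynomial.eval_mul, Polynomial.eval_C, Polynomial.eval_pow,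
          Polynomial.eval_X, ← this]
        ring

lemma laurent {J : AddSubgroup ℂ} {F : Submodule ℤ ℂ → ℂ → ℂ} (hF : Mod F) {M : ℕ}
    (hs : Ser J M (fun τ => F (latt 1 (5 * τ)) τ)) :
    ∃ (N : ℕ) (P : Polynomial ℂ), (∀ i, P.coeff i ∈ J) ∧
      ∀ Λ z, Pt Λ z → F Λ z = T Λ z ^ N * P.eval (T Λ z)⁻¹ := by
  obtain ⟨N, hN⟩ := hF.ord 2 (Or.inr rfl)
  obtain ⟨c, hc, _, hcs⟩ := inv_pow_series N
  have hc' : Ser Zc N (fun τ => (t τ)⁻¹ ^ N) := ⟨c, hc, hcs⟩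
  obtain ⟨P, hP, hPe⟩ := laurent_aux (M + N) (hF.mul (mod_Tinv.pow N)) (J := J) (by
    have : Bdd (fun τ => ∏ i ∈ Finset.range N, (-1 * tB (ex τ))) :=
      Bdd.prod _ fun i _ => (Bdd.const _).mul (bdd_nome tB_cont)
    refine (hN.mul this).congr fun τ hτ => ?_
    simp only [Finset.prod_const, Finset.card_range]
    rw [t2_eq hτ, t_eq_tB hτ, inv_neg, inv_inv, Nat.cast_two]
    simp only [neg_one_mul, neg_pow (tB _), neg_pow (ex τ * _), mul_pow]
    ring) (hs.mul mul_Zc hc')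
  refine ⟨N, P, hP, fun Λ z hz => ?_⟩
  rw [← hPe Λ z hz]
  have := T_ne_zero hz
  rw [inv_pow, mul_left_comm, mul_inv_cancel₀ (pow_ne_zero _ this), mul_one]

lemma surj {y : ℂ} (h0 : y ≠ 0) (h1 : y ^ 2 + 11 * y - 1 ≠ 0) : ∃ Λ z, Pt Λ z ∧ T Λ z = y := by
  by_contra hcon
  push Not at hcon
  have hne : ∀ Λ z, Pt Λ z → T Λ z - y ≠ 0 := fun Λ z h => sub_ne_zero.2 (hcon Λ z h)
  have p0 : ∀ v : ℕ, v = 1 ∨ v = 2 → ∀ τ : ℂ, 0 < τ.im → Pt (latt 1 τ) (v / 5) := by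
    intro v hv τ hτ
    have := pt_mn (m := v) (n := 0) hτ (by omega)
    simpa using this
  have p1 : ∀ v : ℕ, v = 1 ∨ v = 2 → ∀ τ : ℂ, 0 < τ.im → Pt (latt 1 (5 * τ)) (v * τ) := by
    intro v hv τ hτ
    have := (pt_normal hτ).mul (n := v) (by omega)
    simpa using this
  have hb : ∀ v : ℕ, v = 1 ∨ v = 2 → Bdd (fun τ => (T (latt 1 (5 * τ)) (v * τ) - y)⁻¹) := by
    rintro v (rfl | rfl)
    · refine (bdd_nome (g := fun x => (x * tB x - y)⁻¹) ?_).congr fun τ hτ => ?_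
      · exact ((continuousAt_id.mul tB_cont).sub continuousAt_const).inv₀ (by simpa using h0)
      · rw [← t_eq_tB hτ, Nat.cast_one, one_mul]; rfl
    · refine (bdd_nome (g := fun x => -(x * tB x) * (1 + y * (x * tB x))⁻¹) ?_).congr fun τ hτ => ?_
      · exact (continuousAt_id.mul tB_cont).neg.mul
          ((continuousAt_const.add (continuousAt_const.mul (continuousAt_id.mul tB_cont))).inv₀ (by simp))
      · have h2 := hne _ _ (p1 2 (Or.inr rfl) τ hτ)
        have h3 := t_ne_zero hτ
        rw [← t_eq_tB hτ]
        rw [Nat.cast_two, t2_eq hτ] at *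
        have h4 : 1 + y * t τ ≠ 0 := by
          intro h5; apply h2; field_simp; linear_combination -h5
        rw [← div_eq_mul_inv, div_eq_iff h4, inv_mul_eq_div, eq_div_iff h2]
        field_simp
        ring
  have hM : Mod (fun Λ z => (T Λ z - y)⁻¹) := by
    refine ⟨?_, ?_, ?_, ?_, ?_, ?_, ?_⟩
    · intro a Λ z ha h
      rw [T_sc ha]
    · intro Λ z l h hl
      rw [T_add h.lat hl]
    · intro Λ z h
      rw [T_neg h.lat]
    · exact fun v hv => ((mod_T.hol0 v hv).sub_const y).inv fun τ hτ => hne _ _ (p0 v hv τ hτ)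
    · exact fun v hv => ((mod_T.hol1 v hv).sub_const y).inv fun τ hτ => hne _ _ (p1 v hv τ hτ)
    · intro v hv
      obtain ⟨h5, hz⟩ := zeta_v hv
      refine (bdd_nome (g := fun x => (K0 (ex (v / 5)) x - y)⁻¹) ?_).congr fun τ hτ => by
        simp only [type0_eq hv hτ]
      refine ((K0_cont h5 hz).sub continuousAt_const).inv₀ fun h => h1 ?_
      have h' : K0 (ex (v / 5)) 0 = y := sub_eq_zero.1 h
      rw [← h']; exact (K0_zero h5 hz).2
    · exact fun v hv => (hb v hv).ord
  obtain ⟨c, hc⟩ := hM.const_of_bdd hb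
  obtain ⟨p, _, hp⟩ := EvZ_tB
  obtain ⟨g, hg⟩ : ∃ g : ℂ → ℂ, ∀ τ : ℂ, 0 < τ.im → t τ = y + c⁻¹ := ⟨fun _ => 0, fun τ hτ => by
    rw [← hc _ _ (pt_normal hτ), inv_inv]; show t τ = y + (t τ - y); ring⟩
  obtain ⟨B, hB⟩ := nome_eventually (P := fun x => ‖x * tB x‖ < ‖y + c⁻¹‖) (by
    have h2 : y + c⁻¹ ≠ 0 := by
      rw [← hg I (by simp)]; exact t_ne_zero (by simp)
    exact ((continuousAt_id.mul tB_cont).norm.eventually_lt continuousAt_const (by simpa using h2)))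
  have hpos : 0 < (((max B 1 : ℝ) : ℂ) * I).im := by simp
  have := hB (((max B 1 : ℝ) : ℂ) * I) (by simp)
  rw [← t_eq_tB hpos, hg _ hpos] at this
  exact lt_irrefl _ this

end RR

namespace RR
open Filter Topology Complex


def Step (p : ℕ) (Λ Λ' : Submodule ℤ ℂ) : Prop :=
  ∃ x : ℂ, x ∉ Λ ∧ (p : ℂ) * x ∈ Λ ∧ ∀ y, y ∈ Λ' ↔ ∃ k : ℤ, y - k * x ∈ Λ

def Steps (p : ℕ) (Λ : Submodule ℤ ℂ) : Set (Submodule ℤ ℂ) := {Λ' | Step p Λ Λ'}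

lemma int_mul_mem {Λ : Submodule ℤ ℂ} {x : ℂ} (hx : x ∈ Λ) (n : ℤ) : (n : ℂ) * x ∈ Λ := by
  have := Λ.smul_mem n hx
  simpa using this

lemma Step.le {p : ℕ} {Λ Λ' : Submodule ℤ ℂ} (h : Step p Λ Λ') : Λ ≤ Λ' := by
  obtain ⟨x, _, _, h⟩ := h
  exact fun y hy => (h y).2 ⟨0, by simpa using hy⟩

lemma Step.mul_mem {p : ℕ} {Λ Λ' : Submodule ℤ ℂ} (h : Step p Λ Λ') {y : ℂ} (hy : y ∈ Λ') :
    (p : ℂ) * y ∈ Λ := by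
  obtain ⟨x, _, hx, h⟩ := h
  obtain ⟨k, hk⟩ := (h y).1 hy
  have h1 := Λ.add_mem (int_mul_mem hk p) (int_mul_mem hx k)
  convert h1 using 1; push_cast; ring

/-- the same step from another generator -/
lemma step_gen {p : ℕ} (hp : p.Prime) {Λ Λ' : Submodule ℤ ℂ} {x y : ℂ} (hx : x ∉ Λ) (hpx : (p : ℂ) * x ∈ Λ)
    (h : ∀ w, w ∈ Λ' ↔ ∃ k : ℤ, w - k * x ∈ Λ) (hy : y ∈ Λ') (hy' : y ∉ Λ) :
    ∀ w, w ∈ Λ' ↔ ∃ k : ℤ, w - k * y ∈ Λ := by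
  obtain ⟨a, ha⟩ := (h y).1 hy
  have hpa : ¬ (p : ℤ) ∣ a := by
    rintro ⟨b, rfl⟩
    apply hy'
    have := Λ.add_mem ha (int_mul_mem hpx b)
    convert this using 1; push_cast; ring
  have hcop : IsCoprime a (p : ℤ) :=
    ((Nat.prime_iff_prime_int.1 hp).coprime_iff_not_dvd.2 hpa).symm
  obtain ⟨u, v, huv⟩ := hcop
  have hxy : x - u * y ∈ Λ := by
    have h1 := Λ.sub_mem (int_mul_mem hpx v) (int_mul_mem ha u)
    convert h1 using 1
    have : (u : ℂ) * a + v * p = 1 := by exact_mod_cast huv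
    linear_combination (-x) * this
  intro w
  rw [h w]
  constructor
  · rintro ⟨k, hk⟩
    refine ⟨k * u, ?_⟩
    have := Λ.add_mem hk (int_mul_mem hxy k)
    convert this using 1; push_cast; ring
  · rintro ⟨k, hk⟩
    refine ⟨k * a, ?_⟩
    have := Λ.add_mem hk (int_mul_mem ha k)
    convert this using 1; push_cast; ring

lemma Step.gen {p : ℕ} (hp : p.Prime) {Λ Λ' : Submodule ℤ ℂ} (h : Step p Λ Λ') {y : ℂ}
    (hy : y ∈ Λ') (hy' : y ∉ Λ) : ∀ w, w ∈ Λ' ↔ ∃ k : ℤ, w - k * y ∈ Λ := by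
  obtain ⟨x, hx, hpx, h⟩ := h
  exact step_gen hp hx hpx h hy hy'

lemma Step.sc {p : ℕ} {Λ Λ' : Submodule ℤ ℂ} (h : Step p Λ Λ') {a : ℂ} (ha : a ≠ 0) :
    Step p (sc a Λ) (sc a Λ') := by
  obtain ⟨x, hx, hpx, h⟩ := h
  refine ⟨a * x, by rwa [mul_mem_sc ha], by rw [mul_left_comm, mul_mem_sc ha]; exact hpx, fun y => ?_⟩
  rw [mem_sc_iff ha, h]
  refine exists_congr fun k => ?_
  rw [mem_sc_iff ha]
  have : a⁻¹ * (y - k * (a * x)) = a⁻¹ * y - k * x := by field_simp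
  rw [this]

lemma sc_inv {a : ℂ} (ha : a ≠ 0) (Λ : Submodule ℤ ℂ) : sc a⁻¹ (sc a Λ) = Λ := by
  ext x
  rw [mem_sc_iff (inv_ne_zero ha), inv_inv, mul_mem_sc ha]

lemma sc_inv' {a : ℂ} (ha : a ≠ 0) (Λ : Submodule ℤ ℂ) : sc a (sc a⁻¹ Λ) = Λ := by
  have := sc_inv (inv_ne_zero ha) Λ
  rwa [inv_inv] at this

lemma steps_sc {p : ℕ} (Λ : Submodule ℤ ℂ) {a : ℂ} (ha : a ≠ 0) :
    Steps p (sc a Λ) = sc a '' Steps p Λ := by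
  ext Λ'
  constructor
  · intro h
    refine ⟨sc a⁻¹ Λ', ?_, sc_inv' ha _⟩
    have := Step.sc h (inv_ne_zero ha)
    rwa [sc_inv ha] at this
  · rintro ⟨Λ'', h, rfl⟩
    exact Step.sc h ha

lemma sc_injective {a : ℂ} (ha : a ≠ 0) : Function.Injective (sc a) := fun Λ Λ' h => by
  rw [← sc_inv ha Λ, h, sc_inv ha]

noncomputable def br (p : ℕ) (c : ℤ) (τ : ℂ) : Option (Fin p) → Submodule ℤ ℂ
  | none => latt (1 / p) τ
  | some j => latt 1 ((τ + c * (j : ℕ)) / p)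

lemma coordZ {τ : ℂ} (hτ : 0 < τ.im) {m n a b : ℤ} (h : (m : ℂ) + n * τ = a + b * τ) : m = a ∧ n = b := by
  obtain ⟨h1, h2⟩ := coord_unique hτ (m := m) (n := n) (a := a) (b := b) (by push_cast; exact h)
  exact ⟨by exact_mod_cast h1, by exact_mod_cast h2⟩

lemma br_injective {p : ℕ} (hp : p.Prime) {c : ℤ} (hc : ¬ (p : ℤ) ∣ c) {τ : ℂ} (hτ : 0 < τ.im) :
    Function.Injective (br p c τ) := by
  have hp0 : (p : ℂ) ≠ 0 := by exact_mod_cast hp.ne_zero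
  have key : ∀ j : Fin p, (1 / p : ℂ) ∉ latt 1 ((τ + c * (j : ℕ)) / p) := by
    intro j h
    obtain ⟨m, n, e⟩ := mem_latt.1 h
    have e2 : ((m * p + n * (c * (j : ℕ)) : ℤ) : ℂ) + (n : ℤ) * τ = ((1 : ℤ) : ℂ) + ((0 : ℤ) : ℂ) * τ := by
      push_cast; field_simp at e; linear_combination e
    obtain ⟨h1, h2⟩ := coordZ hτ e2
    rw [h2, zero_mul, add_zero] at h1
    have : (p : ℤ) ∣ 1 := ⟨m, by rw [← h1, mul_comm]⟩
    exact hp.one_lt.ne' (by exact_mod_cast Int.eq_one_of_dvd_one (by positivity) this)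
  have m1 : (1 / p : ℂ) ∈ latt (1 / p : ℂ) τ := mem_latt.2 ⟨1, 0, by simp⟩
  rintro (_ | i) (_ | j) h
  · rfl
  · have h : latt (1 / p : ℂ) τ = latt 1 ((τ + c * (j : ℕ)) / p) := h
    exact absurd (h ▸ m1) (key j)
  · have h : latt 1 ((τ + c * (i : ℕ)) / p) = latt (1 / p : ℂ) τ := h
    exact absurd (h ▸ m1) (key i)
  · have h : latt 1 ((τ + c * (i : ℕ)) / p) = latt 1 ((τ + c * (j : ℕ)) / p) := h
    have hm : (τ + c * (i : ℕ)) / p ∈ latt 1 ((τ + c * (j : ℕ)) / p) := by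
      rw [← h]; exact mem_latt.2 ⟨0, 1, by simp⟩
    obtain ⟨m, n, e⟩ := mem_latt.1 hm
    have e2 : ((m * p + n * (c * (j : ℕ)) : ℤ) : ℂ) + (n : ℤ) * τ = ((c * (i : ℕ) : ℤ) : ℂ) + ((1 : ℤ) : ℂ) * τ := by
      push_cast; field_simp at e; linear_combination e
    obtain ⟨h1, h2⟩ := coordZ hτ e2
    subst h2
    have hd : (p : ℤ) ∣ c * ((i : ℕ) - (j : ℕ)) := ⟨m, by linear_combination -h1⟩
    have hd2 := ((Nat.prime_iff_prime_int.1 hp).dvd_or_dvd hd).resolve_left hc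
    have : ((i : ℕ) : ℤ) - (j : ℕ) = 0 := by
      refine Int.eq_zero_of_abs_lt_dvd hd2 ?_
      have := i.2; have := j.2
      rw [abs_lt]; omega
    congr 1
    ext; omega

lemma steps_latt {p : ℕ} (hp : p.Prime) {c : ℤ} (hc : ¬ (p : ℤ) ∣ c) {τ : ℂ} (hτ : 0 < τ.im) :
    Steps p (latt 1 τ) = Set.range (br p c τ) := by
  have hp0 : (p : ℂ) ≠ 0 := by exact_mod_cast hp.ne_zero
  have hpZ : (p : ℤ) ≠ 0 := by exact_mod_cast hp.ne_zero
  have nm : ∀ {m n : ℤ}, ¬ ((p : ℤ) ∣ m ∧ (p : ℤ) ∣ n) → (m + n * τ) / p ∉ latt 1 τ := by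
    intro m n h hm
    obtain ⟨a, b, e⟩ := mem_latt.1 hm
    apply h
    have e2 : (m : ℂ) + n * τ = ((p * a : ℤ) : ℂ) + ((p * b : ℤ) : ℂ) * τ := by
      push_cast; field_simp at e; linear_combination -e
    obtain ⟨h1, h2⟩ := coordZ hτ e2
    exact ⟨⟨a, h1⟩, ⟨b, h2⟩⟩
  have p1 : ¬ (p : ℤ) ∣ 1 := fun h => hp.one_lt.ne' (by exact_mod_cast Int.eq_one_of_dvd_one (by positivity) h)
  -- each branch is a step
  have none_mem : ∀ y, y ∈ latt (1 / p : ℂ) τ ↔ ∃ k : ℤ, y - k * (1 / p) ∈ latt 1 τ := by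
    intro y
    rw [mem_latt]
    constructor
    · rintro ⟨m, n, rfl⟩
      exact ⟨m, mem_latt.2 ⟨0, n, by push_cast; ring⟩⟩
    · rintro ⟨k, hk⟩
      obtain ⟨m, n, e⟩ := mem_latt.1 hk
      exact ⟨m * p + k, n, by push_cast; field_simp at e ⊢; linear_combination e⟩
  have some_mem : ∀ (j : Fin p) y, y ∈ latt 1 ((τ + c * (j : ℕ)) / p) ↔
      ∃ k : ℤ, y - k * ((τ + c * (j : ℕ)) / p) ∈ latt 1 τ := by
    intro j y
    rw [mem_latt]
    constructor
    · rintro ⟨m, n, rfl⟩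
      exact ⟨n, mem_latt.2 ⟨m, 0, by push_cast; ring⟩⟩
    · rintro ⟨k, hk⟩
      obtain ⟨m, n, e⟩ := mem_latt.1 hk
      exact ⟨m - n * c * (j : ℕ), n * p + k, by push_cast; field_simp at e ⊢; linear_combination e⟩
  have none_step : Step p (latt 1 τ) (latt (1 / p : ℂ) τ) := by
    refine ⟨1 / p, ?_, mem_latt.2 ⟨1, 0, by field_simp; simp⟩, none_mem⟩
    have := nm (m := 1) (n := 0) (fun h => p1 h.1)
    simpa using this
  have some_step : ∀ j : Fin p, Step p (latt 1 τ) (latt 1 ((τ + c * (j : ℕ)) / p)) := by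
    intro j
    refine ⟨(τ + c * (j : ℕ)) / p, ?_, mem_latt.2 ⟨c * (j : ℕ), 1, by push_cast; field_simp; ring⟩, some_mem j⟩
    have := nm (m := c * (j : ℕ)) (n := 1) (fun h => p1 h.2)
    convert this using 2; push_cast; ring
  ext Λ'
  constructor
  · rintro ⟨x, hx, hpx, h⟩
    obtain ⟨m, n, e⟩ := mem_latt.1 hpx
    have ex : x = (m + n * τ) / p := by field_simp; linear_combination -e
    by_cases hn : (p : ℤ) ∣ n
    · obtain ⟨n', rfl⟩ := hn
      refine ⟨none, ?_⟩
      show latt (1 / p : ℂ) τ = Λ'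
      have hxm : x ∈ latt (1 / p : ℂ) τ := mem_latt.2 ⟨m, n', by rw [ex]; push_cast; field_simp⟩
      ext w
      rw [none_step.gen hp hxm hx, h]
    · obtain ⟨u, v, huv⟩ := (((Nat.prime_iff_prime_int.1 hp).coprime_iff_not_dvd.2 hn).symm : IsCoprime n (p : ℤ))
      obtain ⟨s, r, hsr⟩ := (((Nat.prime_iff_prime_int.1 hp).coprime_iff_not_dvd.2 hc).symm : IsCoprime c (p : ℤ))
      -- x = n * ((τ + c j)/p) mod Λ with c j ≡ u m
      set j0 : ℤ := (s * u * m) % p with hj0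
      have hj1 : 0 ≤ j0 := Int.emod_nonneg _ hpZ
      have hj2 : j0 < p := Int.emod_lt_of_pos _ (by exact_mod_cast hp.pos)
      have hj3 : j0 = s * u * m - p * ((s * u * m) / p) := by
        rw [hj0, Int.emod_def]
      refine ⟨some ⟨j0.toNat, by omega⟩, ?_⟩
      show latt 1 ((τ + c * ((⟨j0.toNat, _⟩ : Fin p) : ℕ)) / p) = Λ'
      have hxm : x ∈ latt 1 ((τ + c * ((⟨j0.toNat, by omega⟩ : Fin p) : ℕ)) / p) := by
        rw [some_mem]
        refine ⟨n, mem_latt.2 ⟨v * m + n * r * u * m + n * c * ((s * u * m) / p), 0, ?_⟩⟩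
        have hc1 : ((j0.toNat : ℕ) : ℂ) = (j0 : ℂ) := by
          exact_mod_cast congrArg (Int.cast : ℤ → ℂ) (Int.toNat_of_nonneg hj1)
        have hc2 : (j0 : ℂ) = s * u * m - p * (((s * u * m) / p : ℤ) : ℂ) := by
          have := congrArg (Int.cast : ℤ → ℂ) hj3
          push_cast at this ⊢
          exact this
        simp only [hc1]
        rw [hc2, ex]
        have a1 : (u : ℂ) * n + v * p = 1 := by exact_mod_cast huv
        have a2 : (s : ℂ) * c + r * p = 1 := by exact_mod_cast hsr
        push_cast
        field_simp
        linear_combination (m : ℂ) * a1 + n * u * m * a2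
      ext w
      rw [(some_step _).gen hp hxm hx, h]
  · rintro ⟨_ | j, rfl⟩
    · exact none_step
    · exact some_step j

end RR

namespace RR
open Filter Topology Complex


lemma Mod.dil {F : Submodule ℤ ℂ → ℂ → ℂ} (hF : Mod F) {n : ℤ} (hn : ¬ (5 : ℤ) ∣ n) :
    ∃ v : ℕ, (v = 1 ∨ v = 2) ∧ ∀ Λ z, Pt Λ z → F Λ (n * z) = F Λ (v * z) := by
  have key : ∃ v : ℕ, (v = 1 ∨ v = 2) ∧ ∃ k : ℤ, n = v + 5 * k ∨ n = -v + 5 * k := by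
    have h1 : n % 5 = 1 ∨ n % 5 = 2 ∨ n % 5 = 3 ∨ n % 5 = 4 := by omega
    rcases h1 with h | h | h | h
    · exact ⟨1, .inl rfl, n / 5, .inl (by push_cast; omega)⟩
    · exact ⟨2, .inr rfl, n / 5, .inl (by push_cast; omega)⟩
    · exact ⟨2, .inr rfl, n / 5 + 1, .inr (by push_cast; omega)⟩
    · exact ⟨1, .inl rfl, n / 5 + 1, .inr (by push_cast; omega)⟩
  obtain ⟨v, hv, k, hk⟩ := key
  refine ⟨v, hv, fun Λ z h => ?_⟩
  have hP : Pt Λ (v * z) := by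
    have := h.mul (n := v) (by omega)
    simpa using this
  have hl : (k : ℂ) * (5 * z) ∈ Λ := int_mul_mem h.five k
  rcases hk with rfl | rfl
  · rw [← hF.tr hP hl]; congr 1; push_cast; ring
  · rw [← hF.neg hP, ← hF.tr hP.int_mul_neg hl]; congr 1; push_cast; ring

lemma pt_type0 {v : ℕ} (hv : v = 1 ∨ v = 2) {τ : ℂ} (hτ : 0 < τ.im) : Pt (latt 1 τ) (v / 5) := by
  have := pt_mn hτ (m := v) (n := 0) (by omega)
  simpa using this

lemma pt_type1 {v : ℕ} (hv : v = 1 ∨ v = 2) {τ : ℂ} (hτ : 0 < τ.im) : Pt (latt 1 (5 * τ)) (v * τ) := by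
  have := (pt_normal hτ).mul (n := v) (by omega)
  simpa using this

lemma cast_ne {p : ℕ} (hp : p.Prime) : (p : ℂ) ≠ 0 := by exact_mod_cast hp.ne_zero

lemma p5 {p : ℕ} (hp : p.Prime) (h5 : p ≠ 5) : ¬ (5 : ℤ) ∣ p := fun h => by
  have : 5 ∣ p := by exact_mod_cast h
  exact h5 ((Nat.prime_dvd_prime_iff_eq Nat.prime_five hp).1 this).symm

lemma p5' {p : ℕ} (hp : p.Prime) (h5 : p ≠ 5) : ¬ (p : ℤ) ∣ 5 := fun h => by
  have : p ∣ 5 := by exact_mod_cast h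
  exact h5 ((Nat.prime_dvd_prime_iff_eq hp Nat.prime_five).1 this)

lemma p5v {p : ℕ} (hp : p.Prime) (h5 : p ≠ 5) {v : ℕ} (hv : v = 1 ∨ v = 2) : ¬ (5 : ℤ) ∣ p * v := by
  have := p5 hp h5
  rcases hv with rfl | rfl <;> push_cast <;> omega

lemma p1' {p : ℕ} (hp : p.Prime) : ¬ (p : ℤ) ∣ 1 := fun h => by
  have : p ∣ 1 := by exact_mod_cast h
  exact hp.one_lt.ne' (Nat.dvd_one.1 this)

lemma im_mul {p : ℕ} (hp : p.Prime) {τ : ℂ} (hτ : 0 < τ.im) : 0 < ((p : ℂ) * τ).im := by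
  have : (0 : ℝ) < p := by exact_mod_cast hp.pos
  simp; positivity

lemma im_div {p : ℕ} (hp : p.Prime) {τ : ℂ} (hτ : 0 < τ.im) (c : ℂ) (hc : c.im = 0) :
    0 < ((τ + c) / p).im := by
  have : (0 : ℝ) < p := by exact_mod_cast hp.pos
  rw [Complex.div_natCast_im, Complex.add_im, hc]
  positivity

lemma br_none {p : ℕ} (hp : p.Prime) (c : ℤ) (τ : ℂ) :
    br p c τ none = sc (1 / p : ℂ) (latt 1 (p * τ)) := by
  have := cast_ne hp
  rw [sc_latt]
  show latt (1 / p) τ = _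
  congr 1
  · simp
  · field_simp

lemma br_lat {p : ℕ} (hp : p.Prime) (c : ℤ) {τ : ℂ} (hτ : 0 < τ.im) (i : Option (Fin p)) :
    Lat (br p c τ i) := by
  cases i with
  | none =>
    rw [br_none hp]
    exact (lat_one (im_mul hp hτ)).sc (by simpa using cast_ne hp)
  | some j => exact lat_one (im_div hp hτ _ (by simp))

lemma step_lat {p : ℕ} (hp : p.Prime) (h5 : p ≠ 5) {Λ Λ' : Submodule ℤ ℂ} {z : ℂ} (h : Pt Λ z)
    (hs : Step p Λ Λ') : Lat Λ' := by
  obtain ⟨a, τ, ha, hτ, rfl, -⟩ := h.normal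
  have : Λ' ∈ Steps p (sc a (latt 1 (5 * τ))) := hs
  rw [steps_sc _ ha, steps_latt hp (p5' hp h5) (im5 hτ)] at this
  obtain ⟨_, ⟨i, rfl⟩, rfl⟩ := this
  exact (br_lat hp _ (im5 hτ) i).sc ha

lemma Pt.step {p : ℕ} (hp : p.Prime) (h5 : p ≠ 5) {Λ Λ' : Submodule ℤ ℂ} {z : ℂ} (h : Pt Λ z)
    (hs : Step p Λ Λ') : Pt Λ' z := by
  refine ⟨step_lat hp h5 h hs, hs.le h.five, fun hz => ?_⟩
  have := hs.mul_mem hz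
  exact p5 hp h5 ((h.int_mul_mem p).1 (by simpa using this))

structure Mod2 (p : ℕ) (G : Submodule ℤ ℂ → Submodule ℤ ℂ → ℂ → ℂ) : Prop where
  inv : ∀ {a : ℂ} {Λ' Λ : Submodule ℤ ℂ} {z : ℂ}, a ≠ 0 → Pt Λ z → Step p Λ Λ' →
    G (sc a Λ') (sc a Λ) (a * z) = G Λ' Λ z
  tr : ∀ {Λ' Λ : Submodule ℤ ℂ} {z l : ℂ}, Pt Λ z → Step p Λ Λ' → l ∈ Λ → G Λ' Λ (z + l) = G Λ' Λ z
  neg : ∀ {Λ' Λ : Submodule ℤ ℂ} {z : ℂ}, Pt Λ z → Step p Λ Λ' → G Λ' Λ (-z) = G Λ' Λ z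
  hol0 : ∀ v : ℕ, v = 1 ∨ v = 2 → ∀ i,
    DifferentiableOn ℂ (fun τ => G (br p 1 τ i) (latt 1 τ) (v / 5)) UU
  hol1 : ∀ v : ℕ, v = 1 ∨ v = 2 → ∀ i,
    DifferentiableOn ℂ (fun τ => G (br p 5 (5 * τ) i) (latt 1 (5 * τ)) (v * τ)) UU
  bd0 : ∀ v : ℕ, v = 1 ∨ v = 2 → ∀ i, Bdd (fun τ => G (br p 1 τ i) (latt 1 τ) (v / 5))
  ord : ∀ v : ℕ, v = 1 ∨ v = 2 → ∀ i, Ord (fun τ => G (br p 5 (5 * τ) i) (latt 1 (5 * τ)) (v * τ))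

lemma Mod2.lower {F : Submodule ℤ ℂ → ℂ → ℂ} (hF : Mod F) (p : ℕ) : Mod2 p (fun _ Λ z => F Λ z) where
  inv ha h _ := hF.inv ha h
  tr h _ hl := hF.tr h hl
  neg h _ := hF.neg h
  hol0 v hv _ := hF.hol0 v hv
  hol1 v hv _ := hF.hol1 v hv
  bd0 v hv _ := hF.bd0 v hv
  ord v hv _ := hF.ord v hv

lemma Mod2.add {p : ℕ} {F G : Submodule ℤ ℂ → Submodule ℤ ℂ → ℂ → ℂ} (hF : Mod2 p F) (hG : Mod2 p G) :
    Mod2 p (fun Λ' Λ z => F Λ' Λ z + G Λ' Λ z) where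
  inv ha h hs := by rw [hF.inv ha h hs, hG.inv ha h hs]
  tr h hs hl := by rw [hF.tr h hs hl, hG.tr h hs hl]
  neg h hs := by rw [hF.neg h hs, hG.neg h hs]
  hol0 v hv i := (hF.hol0 v hv i).add (hG.hol0 v hv i)
  hol1 v hv i := (hF.hol1 v hv i).add (hG.hol1 v hv i)
  bd0 v hv i := (hF.bd0 v hv i).add (hG.bd0 v hv i)
  ord v hv i := (hF.ord v hv i).add (hG.ord v hv i)

lemma Mod2.mul {p : ℕ} {F G : Submodule ℤ ℂ → Submodule ℤ ℂ → ℂ → ℂ} (hF : Mod2 p F) (hG : Mod2 p G) :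
    Mod2 p (fun Λ' Λ z => F Λ' Λ z * G Λ' Λ z) where
  inv ha h hs := by rw [hF.inv ha h hs, hG.inv ha h hs]
  tr h hs hl := by rw [hF.tr h hs hl, hG.tr h hs hl]
  neg h hs := by rw [hF.neg h hs, hG.neg h hs]
  hol0 v hv i := (hF.hol0 v hv i).mul (hG.hol0 v hv i)
  hol1 v hv i := (hF.hol1 v hv i).mul (hG.hol1 v hv i)
  bd0 v hv i := (hF.bd0 v hv i).mul (hG.bd0 v hv i)
  ord v hv i := (hF.ord v hv i).mul (hG.ord v hv i)

lemma Mod2.const (p : ℕ) (c : ℂ) : Mod2 p (fun _ _ _ => c) := Mod2.lower (Mod.const c) p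

lemma Mod2.pow {p : ℕ} {F : Submodule ℤ ℂ → Submodule ℤ ℂ → ℂ → ℂ} (hF : Mod2 p F) (n : ℕ) :
    Mod2 p (fun Λ' Λ z => F Λ' Λ z ^ n) := by
  induction n with
  | zero => simpa using Mod2.const p 1
  | succ n ih => simpa only [pow_succ] using ih.mul hF

lemma Mod2.sub {p : ℕ} {F G : Submodule ℤ ℂ → Submodule ℤ ℂ → ℂ → ℂ} (hF : Mod2 p F) (hG : Mod2 p G) :
    Mod2 p (fun Λ' Λ z => F Λ' Λ z - G Λ' Λ z) := by
  have := hF.add ((Mod2.const p (-1)).mul hG)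
  simpa only [neg_one_mul, ← sub_eq_add_neg] using this

lemma branch0 {p : ℕ} (hp : p.Prime) (h5 : p ≠ 5) {F : Submodule ℤ ℂ → ℂ → ℂ} (hF : Mod F) {v : ℕ}
    (hv : v = 1 ∨ v = 2) (i : Option (Fin p)) : ∃ v' : ℕ, (v' = 1 ∨ v' = 2) ∧ ∃ r c : ℝ, 0 < r ∧
      ∀ τ : ℂ, 0 < τ.im → F (br p 1 τ i) (v / 5) = F (latt 1 (r * τ + c)) (v' / 5) := by
  have hp0 := cast_ne hp
  have hpr : (0 : ℝ) < p := by exact_mod_cast hp.pos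
  cases i with
  | none =>
    obtain ⟨v', hv', e⟩ := hF.dil (n := p * v) (p5v hp h5 hv)
    refine ⟨v', hv', p, 0, hpr, fun τ hτ => ?_⟩
    have hP := pt_type0 (.inl rfl : (1 : ℕ) = 1 ∨ 1 = 2) (im_mul hp hτ)
    rw [br_none hp]
    have h1 := hF.inv (a := 1 / p) (by simpa using hp0) (hP.mul (n := p * v) (p5v hp h5 hv))
    rw [e _ _ hP] at h1
    convert h1 using 2
    · push_cast; field_simp
    · push_cast; simp
    · push_cast; ring
  | some j =>
    refine ⟨v, hv, 1 / p, j / p, by positivity, fun τ hτ => ?_⟩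
    show F (latt 1 ((τ + (1 : ℤ) * (j : ℕ)) / p)) _ = _
    congr 2
    push_cast; ring

lemma branch1 {p : ℕ} (hp : p.Prime) (h5 : p ≠ 5) {F : Submodule ℤ ℂ → ℂ → ℂ} (hF : Mod F) {v : ℕ}
    (hv : v = 1 ∨ v = 2) : (∀ τ : ℂ, 0 < τ.im → F (br p 5 (5 * τ) none) (v * τ) =
        F (latt 1 (5 * (p * τ))) (v * (p * τ))) ∧
      (∀ (j : Fin p) (τ : ℂ), 0 < τ.im → F (br p 5 (5 * τ) (some j)) (v * τ) =
        F (latt 1 (5 * ((τ + (j : ℕ)) / p))) (((p * v : ℤ) : ℂ) * ((τ + (j : ℕ)) / p))) := by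
  have hp0 := cast_ne hp
  constructor
  · intro τ hτ
    rw [br_none hp, ← hF.inv (a := 1 / p) (by simpa using hp0) (pt_type1 hv (im_mul hp hτ))]
    have e1 : (p : ℂ) * (5 * τ) = 5 * (p * τ) := by ring
    have e2 : (1 / p : ℂ) * (v * (p * τ)) = v * τ := by field_simp
    rw [e1, e2]
  · intro j τ hτ
    have hτ' : 0 < ((τ + (j : ℕ)) / p : ℂ).im := im_div hp hτ _ (by simp)
    have hP := (pt_normal hτ').mul (n := p * v) (p5v hp h5 hv)
    rw [← hF.tr hP (l := -(v * (j : ℕ))) (mem_latt.2 ⟨-(v * (j : ℕ)), 0, by push_cast; ring⟩)]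
    show F (latt 1 ((5 * τ + (5 : ℤ) * (j : ℕ)) / p)) _ = _
    congr 2
    · push_cast; ring
    · push_cast; field_simp; ring

lemma diff_comp {f : ℂ → ℂ} (h : DifferentiableOn ℂ f UU) {r c : ℝ} (hr : 0 < r) :
    DifferentiableOn ℂ (fun τ => f (r * τ + c)) UU := by
  refine h.comp (by fun_prop) fun τ (hτ : 0 < τ.im) => ?_
  show 0 < (r * τ + c : ℂ).im
  simp; positivity

lemma Mod2.upper {p : ℕ} (hp : p.Prime) (h5 : p ≠ 5) {F : Submodule ℤ ℂ → ℂ → ℂ} (hF : Mod F) :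
    Mod2 p (fun Λ' _ z => F Λ' z) := by
  have hpr : (0 : ℝ) < p := by exact_mod_cast hp.pos
  have b1 : ∀ v : ℕ, v = 1 ∨ v = 2 → ∀ i, ∃ v' : ℕ, (v' = 1 ∨ v' = 2) ∧ ∃ r c : ℝ, 0 < r ∧
      ∀ τ : ℂ, 0 < τ.im → F (br p 5 (5 * τ) i) (v * τ) =
        F (latt 1 (5 * (r * τ + c))) (v' * (r * τ + c)) := by
    intro v hv i
    obtain ⟨e1, e2⟩ := branch1 hp h5 hF hv
    cases i with
    | none =>
      refine ⟨v, hv, p, 0, hpr, fun τ hτ => ?_⟩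
      rw [e1 τ hτ]; simp
    | some j =>
      obtain ⟨v', hv', e⟩ := hF.dil (n := p * v) (p5v hp h5 hv)
      refine ⟨v', hv', 1 / p, j / p, by positivity, fun τ hτ => ?_⟩
      rw [e2 j τ hτ, e _ _ (pt_normal (im_div hp hτ _ (by simp)))]
      have : ((1 / p : ℝ) : ℂ) * τ + ((j / p : ℝ) : ℂ) = (τ + (j : ℕ)) / p := by push_cast; ring
      rw [this]
  refine ⟨fun ha h hs => hF.inv ha (h.step hp h5 hs), fun h hs hl => hF.tr (h.step hp h5 hs) (hs.le hl),
    fun h hs => hF.neg (h.step hp h5 hs), ?_, ?_, ?_, ?_⟩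
  · intro v hv i
    obtain ⟨v', hv', r, c, hr, e⟩ := branch0 hp h5 hF hv i
    exact (diff_comp (hF.hol0 v' hv') hr).congr fun τ hτ => e τ hτ
  · intro v hv i
    obtain ⟨v', hv', r, c, hr, e⟩ := b1 v hv i
    exact (diff_comp (hF.hol1 v' hv') hr).congr fun τ hτ => e τ hτ
  · intro v hv i
    obtain ⟨v', hv', r, c, hr, e⟩ := branch0 hp h5 hF hv i
    exact ((hF.bd0 v' hv').comp hr).congr fun τ hτ => (e τ hτ).symm
  · intro v hv i
    obtain ⟨v', hv', r, c, hr, e⟩ := b1 v hv i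
    exact (Ord.comp (hF.ord v' hv') hr).congr fun τ hτ => (e τ hτ).symm

end RR

namespace RR
open Filter Topology Complex


lemma prod_steps {p : ℕ} (hp : p.Prime) {c : ℤ} (hc : ¬ (p : ℤ) ∣ c) {τ : ℂ} (hτ : 0 < τ.im)
    (f : Submodule ℤ ℂ → ℂ) : ∏ᶠ Λ' ∈ Steps p (latt 1 τ), f Λ' = ∏ i, f (br p c τ i) := by
  rw [steps_latt hp hc hτ, finprod_mem_range (br_injective hp hc hτ), finprod_eq_prod_of_fintype]

lemma sum_steps {p : ℕ} (hp : p.Prime) {c : ℤ} (hc : ¬ (p : ℤ) ∣ c) {τ : ℂ} (hτ : 0 < τ.im)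
    (f : Submodule ℤ ℂ → ℂ) : ∑ᶠ Λ' ∈ Steps p (latt 1 τ), f Λ' = ∑ i, f (br p c τ i) := by
  rw [steps_latt hp hc hτ, finsum_mem_range (br_injective hp hc hτ), finsum_eq_sum_of_fintype]

lemma diff_prod {ι : Type*} [Fintype ι] {f : ι → ℂ → ℂ} (h : ∀ i, DifferentiableOn ℂ (f i) UU) :
    DifferentiableOn ℂ (fun τ => ∏ i, f i τ) UU :=
  DifferentiableOn.fun_finsetProd fun i _ => h i

lemma diff_sum {ι : Type*} [Fintype ι] {f : ι → ℂ → ℂ} (h : ∀ i, DifferentiableOn ℂ (f i) UU) :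
    DifferentiableOn ℂ (fun τ => ∑ i, f i τ) UU :=
  DifferentiableOn.fun_sum fun i _ => h i

lemma closure_prod {ι : Type*} [Fintype ι] {C : (ℂ → ℂ) → Prop} (h1 : C (fun _ => 1))
    (hm : ∀ f g, C f → C g → C (fun τ => f τ * g τ)) {f : ι → ℂ → ℂ} (h : ∀ i, C (f i)) :
    C (fun τ => ∏ i, f i τ) := by
  classical
  have : ∀ s : Finset ι, C (fun τ => ∏ i ∈ s, f i τ) := by
    intro s
    induction s using Finset.induction_on with
    | empty => simpa using h1
    | insert a s ha ih =>
      simp only [Finset.prod_insert ha]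
      exact hm _ _ (h a) ih
  exact this _

lemma closure_sum {ι : Type*} [Fintype ι] {C : (ℂ → ℂ) → Prop} (h1 : C (fun _ => 0))
    (hm : ∀ f g, C f → C g → C (fun τ => f τ + g τ)) {f : ι → ℂ → ℂ} (h : ∀ i, C (f i)) :
    C (fun τ => ∑ i, f i τ) := by
  classical
  have : ∀ s : Finset ι, C (fun τ => ∑ i ∈ s, f i τ) := by
    intro s
    induction s using Finset.induction_on with
    | empty => simpa using h1
    | insert a s ha ih =>
      simp only [Finset.sum_insert ha]
      exact hm _ _ (h a) ih
  exact this _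

lemma Mod2.prod {p : ℕ} (hp : p.Prime) (h5 : p ≠ 5) {G : Submodule ℤ ℂ → Submodule ℤ ℂ → ℂ → ℂ}
    (hG : Mod2 p G) : Mod (fun Λ z => ∏ᶠ Λ' ∈ Steps p Λ, G Λ' Λ z) where
  inv ha h := by
    rw [steps_sc _ ha, finprod_mem_image (sc_injective ha).injOn]
    exact finprod_mem_congr rfl fun Λ' hs => hG.inv ha h hs
  tr h hl := finprod_mem_congr rfl fun Λ' hs => hG.tr h hs hl
  neg h := finprod_mem_congr rfl fun Λ' hs => hG.neg h hs
  hol0 v hv := (diff_prod fun i => hG.hol0 v hv i).congr fun τ hτ => prod_steps hp (p1' hp) hτ _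
  hol1 v hv := (diff_prod fun i => hG.hol1 v hv i).congr fun τ hτ =>
    prod_steps hp (p5' hp h5) (im5 hτ) _
  bd0 v hv := (closure_prod (C := Bdd) (Bdd.const 1) (fun _ _ => Bdd.mul) fun i => hG.bd0 v hv i).congr
    fun τ hτ => (prod_steps hp (p1' hp) hτ (fun Λ' => G Λ' (latt 1 τ) (v / 5))).symm
  ord v hv := Ord.congr (closure_prod (C := Ord) (Bdd.const 1).ord (fun _ _ => Ord.mul)
    fun i => hG.ord v hv i) fun τ hτ => (prod_steps hp (p5' hp h5) (im5 hτ) (fun Λ' => G Λ' (latt 1 (5 * τ)) (v * τ))).symm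

lemma Mod2.sum {p : ℕ} (hp : p.Prime) (h5 : p ≠ 5) {G : Submodule ℤ ℂ → Submodule ℤ ℂ → ℂ → ℂ}
    (hG : Mod2 p G) : Mod (fun Λ z => ∑ᶠ Λ' ∈ Steps p Λ, G Λ' Λ z) where
  inv ha h := by
    rw [steps_sc _ ha, finsum_mem_image (sc_injective ha).injOn]
    exact finsum_mem_congr rfl fun Λ' hs => hG.inv ha h hs
  tr h hl := finsum_mem_congr rfl fun Λ' hs => hG.tr h hs hl
  neg h := finsum_mem_congr rfl fun Λ' hs => hG.neg h hs
  hol0 v hv := (diff_sum fun i => hG.hol0 v hv i).congr fun τ hτ => sum_steps hp (p1' hp) hτ _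
  hol1 v hv := (diff_sum fun i => hG.hol1 v hv i).congr fun τ hτ =>
    sum_steps hp (p5' hp h5) (im5 hτ) _
  bd0 v hv := (closure_sum (C := Bdd) (Bdd.const 0) (fun _ _ => Bdd.add) fun i => hG.bd0 v hv i).congr
    fun τ hτ => (sum_steps hp (p1' hp) hτ (fun Λ' => G Λ' (latt 1 τ) (v / 5))).symm
  ord v hv := Ord.congr (closure_sum (C := Ord) (Bdd.const 0).ord (fun _ _ => Ord.add)
    fun i => hG.ord v hv i) fun τ hτ => (sum_steps hp (p5' hp h5) (im5 hτ) (fun Λ' => G Λ' (latt 1 (5 * τ)) (v * τ))).symm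

/-- `T(⟨1,5τ⟩, pτ)` is an integral Laurent series -/
lemma ser_tp {p : ℕ} (hp : p.Prime) (h5 : p ≠ 5) :
    ∃ M, Ser Zc M (fun τ => T (latt 1 (5 * τ)) (((p * 1 : ℤ) : ℂ) * τ)) := by
  obtain ⟨v, hv, e⟩ := mod_T.dil (n := p * 1) (by simpa using p5 hp h5)
  rcases hv with rfl | rfl
  · exact ⟨0, ser_t.congr fun τ hτ => by rw [e _ _ (pt_normal hτ)]; simp [t]⟩
  · refine ⟨1, ser_tinv.neg.congr fun τ hτ => ?_⟩
    rw [e _ _ (pt_normal hτ), ← t2_eq hτ]; simp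

lemma Ser.pow {M : ℕ} {f : ℂ → ℂ} (h : Ser Zc M f) (k : ℕ) : ∃ N, Ser Zc N (fun τ => f τ ^ k) := by
  induction k with
  | zero => exact ⟨0, (Ser.const (c := 1) (by simpa using int_mem_Zc 1)).congr fun τ _ => by simp⟩
  | succ k ih =>
    obtain ⟨N, ih⟩ := ih
    exact ⟨N + M, (ih.mul mul_Zc h).congr fun τ _ => by rw [pow_succ]⟩

lemma Mod.per {F : Submodule ℤ ℂ → ℂ → ℂ} (hF : Mod F) {τ : ℂ} (hτ : 0 < τ.im) :
    F (latt 1 (5 * (τ + 1))) (τ + 1) = F (latt 1 (5 * τ)) τ := by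
  have : latt 1 (5 * (τ + 1)) = latt 1 (5 * τ) := by
    have := latt_add_int (5 * τ) 5
    rw [← this]; congr 1; push_cast; ring
  rw [this]
  exact hF.tr (pt_normal hτ) (mem_latt.2 ⟨1, 0, by simp⟩)

lemma mod_S {p : ℕ} (hp : p.Prime) (h5 : p ≠ 5) (k : ℕ) :
    Mod (fun Λ z => ∑ᶠ Λ' ∈ Steps p Λ, T Λ' z ^ k) :=
  ((Mod2.upper hp h5 mod_T).pow k).sum hp h5

lemma ser_S {p : ℕ} (hp : p.Prime) (h5 : p ≠ 5) (k : ℕ) :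
    ∃ M, Ser Zc M (fun τ => ∑ᶠ Λ' ∈ Steps p (latt 1 (5 * τ)), T Λ' τ ^ k) := by
  have hp0 := cast_ne hp
  obtain ⟨M, hM⟩ := ser_tp hp h5
  obtain ⟨N, hN⟩ := hM.pow k
  obtain ⟨N', hN'⟩ := ser_t.pow k
  have h1 := (hN'.compMul (p := p * p) (Nat.mul_pos hp.pos hp.pos)).add' (hN.average hp.pos)
  refine ⟨_, Ser.down hp.pos (h1.congr ?_) fun τ hτ => (mod_S hp h5 k).per hτ⟩
  intro τ hτ
  have hτp := im_mul hp hτ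
  obtain ⟨e1, e2⟩ := branch1 hp h5 mod_T (.inl rfl : (1 : ℕ) = 1 ∨ 1 = 2)
  have e1' := e1 _ hτp
  simp only [Nat.cast_one, one_mul] at e1'
  rw [sum_steps hp (p5' hp h5) (im5 hτp), Fintype.sum_option, e1', ← Fin.sum_univ_eq_sum_range
    (fun j => T (latt 1 (5 * (τ + ((j / p : ℝ) : ℂ)))) (((p * 1 : ℤ) : ℂ) * (τ + ((j / p : ℝ) : ℂ))) ^ k)]
  congr 1
  · rw [t]; push_cast; ring_nf
  · refine Finset.sum_congr rfl fun j _ => ?_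
    have e2' := e2 j _ hτp
    simp only [Nat.cast_one, one_mul] at e2'
    rw [e2']
    have : (p * τ + (j : ℕ)) / p = τ + ((((j : ℕ) : ℝ) / p : ℝ) : ℂ) := by push_cast; field_simp
    rw [this]

lemma zc_map {c : ℂ} (hc : c ∈ Zc) (σ : ℂ →+* ℂ) : σ c = c := by
  obtain ⟨n, rfl⟩ := hc
  simp

/-- the power sums of the `p`-steps are compatible with ring homs -/
lemma S_map {p : ℕ} (hp : p.Prime) (h5 : p ≠ 5) (k : ℕ) {Λ₁ Λ₂ : Submodule ℤ ℂ} {z₁ z₂ : ℂ}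
    (h₁ : Pt Λ₁ z₁) (h₂ : Pt Λ₂ z₂) (σ : ℂ →+* ℂ) (e : σ (T Λ₁ z₁) = T Λ₂ z₂) :
    σ (∑ᶠ Λ' ∈ Steps p Λ₁, T Λ' z₁ ^ k) = ∑ᶠ Λ' ∈ Steps p Λ₂, T Λ' z₂ ^ k := by
  obtain ⟨M, hM⟩ := ser_S hp h5 k
  obtain ⟨N, P, hP, h⟩ := laurent (mod_S hp h5 k) hM
  rw [h _ _ h₁, h _ _ h₂, map_mul, map_pow, e]
  congr 1
  rw [← Polynomial.eval₂_at_apply, map_inv₀, e, Polynomial.eval, Polynomial.eval₂_eq_sum_range,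
    Polynomial.eval₂_eq_sum_range]
  refine Finset.sum_congr rfl fun i _ => ?_
  rw [zc_map (hP i) σ]; rfl

lemma steps_finite {p : ℕ} (hp : p.Prime) (h5 : p ≠ 5) {Λ : Submodule ℤ ℂ} {z : ℂ} (h : Pt Λ z) :
    (Steps p Λ).Finite := by
  obtain ⟨a, τ, ha, hτ, rfl, -⟩ := h.normal
  rw [steps_sc _ ha, steps_latt hp (p5' hp h5) (im5 hτ)]
  exact (Set.finite_range _).image _

/-- equal power sums imply equal supports -/
lemma power_sums {α β : Type*} (s : Finset α) (s' : Finset β) (x : α → ℂ) (y : β → ℂ)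
    (h : ∀ k : ℕ, ∑ i ∈ s, x i ^ k = ∑ i ∈ s', y i ^ k) (i₀ : α) (hi : i₀ ∈ s) :
    ∃ j ∈ s', y j = x i₀ := by
  classical
  by_contra hc
  push Not at hc
  have hφ : ∀ φ : Polynomial ℂ, ∑ i ∈ s, φ.eval (x i) = ∑ j ∈ s', φ.eval (y j) := by
    intro φ
    simp only [Polynomial.eval_eq_sum_range]
    rw [Finset.sum_comm, Finset.sum_comm (s := s')]
    refine Finset.sum_congr rfl fun k _ => ?_
    rw [← Finset.mul_sum, ← Finset.mul_sum, h]
  have h2 := hφ ((∏ j ∈ s', (Polynomial.X - Polynomial.C (y j))) *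
    ∏ i ∈ s.filter (fun i => x i ≠ x i₀), (Polynomial.X - Polynomial.C (x i)))
  simp only [Polynomial.eval_mul, Polynomial.eval_prod, Polynomial.eval_sub, Polynomial.eval_X,
    Polynomial.eval_C] at h2
  rw [Finset.sum_eq_zero (s := s') (fun j hj => by
    rw [Finset.prod_eq_zero hj (sub_self _), zero_mul])] at h2
  rw [← Finset.sum_filter_add_sum_filter_not s (fun i => x i = x i₀)] at h2
  rw [Finset.sum_eq_zero (s := s.filter (fun i => ¬ x i = x i₀)) (fun j hj => by
    rw [Finset.prod_eq_zero (s := s.filter (fun i => x i ≠ x i₀)) hj (sub_self _), mul_zero]), add_zero] at h2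
  rw [Finset.sum_congr rfl (g := fun _ => (∏ j ∈ s', (x i₀ - y j)) *
    ∏ i ∈ s.filter (fun i => x i ≠ x i₀), (x i₀ - x i)) (fun i hi => by
      rw [(Finset.mem_filter.1 hi).2])] at h2
  rw [Finset.sum_const, smul_eq_zero, Finset.card_eq_zero, mul_eq_zero, Finset.prod_eq_zero_iff,
    Finset.prod_eq_zero_iff] at h2
  rcases h2 with h2 | ⟨j, hj, h2⟩ | ⟨i, hi, h2⟩
  · have : i₀ ∈ s.filter (fun i => x i = x i₀) := Finset.mem_filter.2 ⟨hi, rfl⟩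
    rw [h2] at this; simp at this
  · exact hc j hj (sub_eq_zero.1 h2).symm
  · exact (Finset.mem_filter.1 hi).2 (sub_eq_zero.1 h2).symm

lemma lift_step {p : ℕ} (hp : p.Prime) (h5 : p ≠ 5) {Λ₁ Λ₂ Λ' : Submodule ℤ ℂ} {z₁ z₂ : ℂ}
    (h₁ : Pt Λ₁ z₁) (h₂ : Pt Λ₂ z₂) (σ : ℂ →+* ℂ) (e : σ (T Λ₁ z₁) = T Λ₂ z₂)
    (hs : Step p Λ₁ Λ') : ∃ Λ'', Step p Λ₂ Λ'' ∧ σ (T Λ' z₁) = T Λ'' z₂ := by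
  have f₁ := steps_finite hp h5 h₁
  have f₂ := steps_finite hp h5 h₂
  obtain ⟨Λ'', h, e'⟩ := power_sums f₁.toFinset f₂.toFinset (fun Λ => σ (T Λ z₁)) (fun Λ => T Λ z₂)
    (fun k => by
      have := S_map hp h5 k h₁ h₂ σ e
      rw [finsum_mem_eq_finite_toFinset_sum _ f₁, finsum_mem_eq_finite_toFinset_sum _ f₂, map_sum] at this
      simpa only [map_pow] using this) Λ' (f₁.mem_toFinset.2 hs)
  exact ⟨Λ'', f₂.mem_toFinset.1 h, e'.symm⟩

end RR

namespace RR
open Filter Topology Complex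


/-- the maximal ideal of a valuation ring of `ℂ` -/
def mI (V : ValuationSubring ℂ) : AddSubgroup ℂ where
  carrier := {x | V.valuation x < 1}
  zero_mem' := by simp
  add_mem' := fun {a b} ha hb => lt_of_le_of_lt (V.valuation.map_add a b) (max_lt ha hb)
  neg_mem' := fun {a} ha => by simpa using ha

lemma mem_mI {V : ValuationSubring ℂ} {x : ℂ} : x ∈ mI V ↔ V.valuation x < 1 := Iff.rfl

lemma mI_mul {V : ValuationSubring ℂ} {x y : ℂ} (hx : x ∈ mI V) (hy : V.valuation y ≤ 1) : x * y ∈ mI V := by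
  rw [mem_mI, map_mul]
  calc V.valuation x * V.valuation y ≤ V.valuation x * 1 := by gcongr
    _ < 1 := by rw [mul_one]; exact hx

lemma val_int (V : ValuationSubring ℂ) (n : ℤ) : V.valuation (n : ℂ) ≤ 1 := by
  rw [V.valuation_le_one_iff]; exact intCast_mem V n

lemma val_one_of_pow {V : ValuationSubring ℂ} {x : ℂ} {n : ℕ} (hn : n ≠ 0) (h : x ^ n = 1) :
    V.valuation x = 1 := by
  have : V.valuation x ^ n = 1 := by rw [← map_pow, h, map_one]
  exact (pow_eq_one_iff.1 this).resolve_right hn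

lemma Ser.frob {p : ℕ} (hp : p.Prime) {J : AddSubgroup ℂ} (hJ : ∀ n : ℤ, (p : ℂ) * n ∈ J) {M : ℕ} {f : ℂ → ℂ}
    (h : Ser Zc M f) : Ser J (p * M) (fun τ => f τ ^ p - f (p * τ)) := by
  obtain ⟨a, ha, h⟩ := h
  choose b hb using ha
  obtain ⟨g, hg, e⟩ := ser_ev h
  have hg' : EvZ (PowerSeries.mk b) g := by
    intro w hw
    have := hg w hw
    refine hasSum_of_eq this fun n => ?_
    simp only [PowerSeries.coeff_mk, ← hb n]; rfl
  obtain ⟨c, hc, hc'⟩ := EvZ.frob hp hg'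
  obtain ⟨d, hd, hs⟩ := hc'.ser (J := J) fun n => by
    obtain ⟨m, hm⟩ := hc n
    rw [hm]; push_cast; exact hJ m
  refine ⟨d, hd, fun τ hτ => ?_⟩
  have h1 := hs τ hτ
  simp only [] at h1
  rw [e τ hτ, ← ex_nat_mul p, e _ (im_mul hp hτ), ex_nat_mul p] at h1
  convert h1 using 1
  ring

lemma Ser.sub' {J : AddSubgroup ℂ} {M N : ℕ} {f g : ℂ → ℂ} (h : Ser J M f) (h' : Ser J N g) :
    Ser J (M + N) (fun τ => f τ - g τ) :=
  (h.add' h'.neg).congr fun τ _ => by ring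

lemma mod_Tp {p : ℕ} (hp : p.Prime) (h5 : p ≠ 5) : Mod (fun Λ z => T Λ (((p * 1 : ℤ) : ℂ) * z)) := by
  obtain ⟨v, hv, e⟩ := mod_T.dil (n := p * 1) (by simpa using p5 hp h5)
  rcases hv with rfl | rfl
  · exact mod_T.congr fun Λ z h => by rw [e _ _ h]; simp
  · exact mod_T.dbl.congr fun Λ z h => by rw [e _ _ h]; simp

noncomputable def W (p : ℕ) (Λ' Λ : Submodule ℤ ℂ) (z : ℂ) : ℂ :=
  (T Λ' z - T Λ z ^ p) * (T Λ' z ^ p - T Λ (((p * 1 : ℤ) : ℂ) * z))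

lemma mod2_W {p : ℕ} (hp : p.Prime) (h5 : p ≠ 5) (y : ℂ) : Mod2 p (fun Λ' Λ z => 1 + y * W p Λ' Λ z) :=
  (Mod2.const p 1).add ((Mod2.const p y).mul
    (((Mod2.upper hp h5 mod_T).sub (Mod2.lower (mod_T.pow p) p)).mul
      (((Mod2.upper hp h5 mod_T).pow p).sub (Mod2.lower (mod_Tp hp h5) p))))

lemma per_nat {f : ℂ → ℂ} (hf : ∀ τ : ℂ, 0 < τ.im → f (τ + 1) = f τ) (n : ℕ) {τ : ℂ} (hτ : 0 < τ.im) :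
    f (τ + n) = f τ := by
  induction n with
  | zero => simp
  | succ n ih =>
    rw [← ih, ← hf (τ + n) (by simpa using hτ)]; congr 1; push_cast; ring

lemma ser_W {p : ℕ} (hp : p.Prime) (h5 : p ≠ 5) {V : ValuationSubring ℂ} (hV : V.valuation (p : ℂ) < 1)
    (i : Option (Fin p)) :
    ∃ M, Ser (mI V) M (fun τ => W p (br p 5 (5 * (p * τ)) i) (latt 1 (5 * (p * τ))) (p * τ)) := by
  have hp0 := cast_ne hp
  have hJ : ∀ n : ℤ, (p : ℂ) * n ∈ mI V := fun n => mI_mul hV (val_int V n)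
  obtain ⟨e1, e2⟩ := branch1 hp h5 mod_T (.inl rfl : (1 : ℕ) = 1 ∨ 1 = 2)
  simp only [Nat.cast_one, one_mul] at e1 e2
  obtain ⟨M, hM⟩ := ser_tp hp h5
  cases i with
  | none =>
    obtain ⟨N, hN⟩ := (ser_t.compMul hp.pos).pow p
    have h1 := ((ser_t.frob hp hJ).neg.mul mul_Zc (hN.sub' hM)).compMul hp.pos
    refine ⟨_, h1.congr fun τ hτ => ?_⟩
    rw [W, e1 _ (im_mul hp hτ), t, t, neg_sub]
  | some j =>
    obtain ⟨N, hN⟩ := (ser_t.compMul hp.pos).pow p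
    have h1 := (hM.frob hp hJ).mul mul_Zc (hM.sub' hN)
    have hc : ∀ x ∈ mI V, ∀ k : ℤ, x * ex ((j / p : ℝ) : ℂ) ^ k ∈ mI V := by
      intro x hx k
      refine mI_mul hx (le_of_eq ?_)
      have : V.valuation (ex ((j / p : ℝ) : ℂ)) = 1 := by
        refine val_one_of_pow hp.ne_zero ?_
        rw [← ex_nat_mul, ex_eq_one]
        exact ⟨(j : ℕ), by push_cast; field_simp⟩
      rw [map_zpow₀, this, one_zpow]
    refine ⟨_, (h1.shift _ hc).congr fun τ hτ => ?_⟩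
    have hτ' : 0 < (τ + ((j / p : ℝ) : ℂ)).im := by
      have : (0 : ℝ) < τ.im := hτ
      rw [Complex.add_im, Complex.ofReal_im]; linarith
    have ej : (p * τ + (j : ℕ)) / p = τ + ((j / p : ℝ) : ℂ) := by push_cast; field_simp
    have ek : (p : ℂ) * (τ + ((j / p : ℝ) : ℂ)) = p * τ + (j : ℕ) := by push_cast; field_simp
    rw [W, e2 j _ (im_mul hp hτ), ej, ek, mul_comm]
    rw [per_nat (f := t) (fun τ hτ => mod_T.per hτ) _ (im_mul hp hτ)]
    rw [per_nat (f := fun τ => T (latt 1 (5 * τ)) (((p * 1 : ℤ) : ℂ) * τ))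
      (fun τ hτ => (mod_Tp hp h5).per hτ) _ (im_mul hp hτ)]
    rw [t]

lemma congr_step {p : ℕ} (hp : p.Prime) (h5 : p ≠ 5) {V : ValuationSubring ℂ} (hV : V.valuation (p : ℂ) < 1)
    {Λ Λ' : Submodule ℤ ℂ} {z : ℂ} (h : Pt Λ z) (hs : Step p Λ Λ') (hu : V.valuation (T Λ z) = 1) :
    V.valuation (W p Λ' Λ z) < 1 := by
  by_contra hw
  push Not at hw
  have hw0 : W p Λ' Λ z ≠ 0 := fun h0 => by rw [h0, map_zero] at hw; exact absurd hw (by simp)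
  set y : ℂ := -(W p Λ' Λ z)⁻¹ with hy
  have hyV : V.valuation y ≤ 1 := by
    rw [hy, Valuation.map_neg, map_inv₀]
    exact inv_le_one_of_one_le₀ hw
  have hmod : Mod (fun Λ z => (∏ᶠ Λ' ∈ Steps p Λ, (1 + y * W p Λ' Λ z)) + -1) :=
    ((mod2_W hp h5 y).prod hp h5).add (Mod.const (-1))
  have hser : ∃ M, Ser (mI V) M (fun τ => (∏ᶠ Λ' ∈ Steps p (latt 1 (5 * τ)), (1 + y * W p Λ' (latt 1 (5 * τ)) τ)) + -1) := by
    have h1 : ∃ M, Ser (mI V) M (fun τ =>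
        (∏ i, (1 + y * W p (br p 5 (5 * (p * τ)) i) (latt 1 (5 * (p * τ))) (p * τ))) - 1) := by
      refine closure_prod (C := fun f => ∃ M, Ser (mI V) M (fun τ => f τ - 1)) ?_ ?_ ?_
      · exact ⟨0, (Ser.const (mI V).zero_mem).congr fun τ _ => by simp⟩
      · rintro f g ⟨M, hM⟩ ⟨N, hN⟩
        have h2 := (hM.mul (fun x hx y hy => mI_mul hx (le_of_lt hy)) hN).add' (hM.add' hN)
        exact ⟨_, h2.congr fun τ _ => by ring⟩
      · intro i
        obtain ⟨M, hM⟩ := ser_W hp h5 hV i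
        have hyc : Ser V.toSubring.toAddSubgroup 0 (fun _ => y) :=
          Ser.const ((V.valuation_le_one_iff y).1 hyV)
        exact ⟨_, (hM.mul (fun x hx y hy => mI_mul hx ((V.valuation_le_one_iff y).2 hy)) hyc).congr
          fun τ _ => by ring⟩
    obtain ⟨M, hM⟩ := h1
    refine ⟨M, Ser.down hp.pos (hM.congr fun τ hτ => ?_) fun τ hτ => hmod.per hτ⟩
    rw [prod_steps hp (p5' hp h5) (im5 (im_mul hp hτ)), sub_eq_add_neg]
  obtain ⟨M, hM⟩ := hser
  obtain ⟨N, P, hP, e⟩ := laurent hmod hM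
  have h1 := e Λ z h
  have h2 : ∏ᶠ Λ' ∈ Steps p Λ, (1 + y * W p Λ' Λ z) = 0 := by
    rw [finprod_mem_eq_finite_toFinset_prod _ (steps_finite hp h5 h)]
    refine Finset.prod_eq_zero ((Set.Finite.mem_toFinset _).2 hs) ?_
    rw [hy, neg_mul, inv_mul_cancel₀ hw0]; ring
  rw [h2, zero_add] at h1
  have h3 : P.eval (T Λ z)⁻¹ ∈ mI V := by
    rw [Polynomial.eval_eq_sum_range]
    refine (mI V).sum_mem fun i _ => mI_mul (hP i) ?_
    rw [map_pow, map_inv₀, hu]; simp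
  have h4 : (-1 : ℂ) ∈ mI V := by
    rw [h1, mul_comm]
    exact mI_mul h3 (by rw [map_pow, hu]; simp)
  rw [mem_mI, Valuation.map_neg, map_one] at h4
  exact lt_irrefl _ h4

end RR

namespace RR
open Filter Topology Complex


lemma exists_equiv_over {R K L : Type} [CommRing R] [Nontrivial R] [Field K] [Field L] [Algebra R K] [Algebra R L]
    [FaithfulSMul R K] [FaithfulSMul R L] [IsAlgClosed K] [IsAlgClosed L] [Countable R]
    (hK : Cardinal.aleph0 < Cardinal.mk K) (hL : Cardinal.aleph0 < Cardinal.mk L)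
    (hKL : Cardinal.mk K = Cardinal.mk L) :
    ∃ e : K ≃+* L, ∀ r : R, e (algebraMap R K r) = algebraMap R L r := by
  obtain ⟨s, hs⟩ := exists_isTranscendenceBasis R K
  obtain ⟨u, hu⟩ := exists_isTranscendenceBasis R L
  have hR : Cardinal.mk R ≤ Cardinal.aleph0 := Cardinal.mk_le_aleph0
  have c1 := IsAlgClosed.cardinal_eq_cardinal_transcendence_basis_of_aleph0_lt' _ hs hR hK
  have c2 := IsAlgClosed.cardinal_eq_cardinal_transcendence_basis_of_aleph0_lt' _ hu hR hL
  obtain ⟨e⟩ := Cardinal.eq.1 (c1.symm.trans (hKL.trans c2))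
  let := IsAlgClosed.isAlgClosure_of_transcendence_basis _ hs
  let := IsAlgClosed.isAlgClosure_of_transcendence_basis _ hu
  let e' : Algebra.adjoin R (Set.range ((↑) : s → K)) ≃ₐ[R] Algebra.adjoin R (Set.range ((↑) : u → L)) :=
    (hs.1.aevalEquiv.symm.trans (MvPolynomial.renameEquiv R e)).trans hu.1.aevalEquiv
  refine ⟨IsAlgClosure.equivOfEquiv K L e'.toRingEquiv, fun r => ?_⟩
  have h1 : algebraMap R K r = algebraMap (Algebra.adjoin R (Set.range ((↑) : s → K))) K
    (algebraMap R _ r) := rfl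
  rw [h1, IsAlgClosure.equivOfEquiv_algebraMap]
  show algebraMap _ L (e' (algebraMap R _ r)) = _
  rw [e'.commutes]; rfl

lemma exists_aut {x y : ℂ} (h : ∀ P : Polynomial ℚ, Polynomial.aeval x P = 0 ↔ Polynomial.aeval y P = 0) :
    ∃ σ : ℂ ≃+* ℂ, σ x = y := by
  let f : Polynomial ℚ →+* ℂ := (Polynomial.aeval x : Polynomial ℚ →ₐ[ℚ] ℂ).toRingHom
  let g : Polynomial ℚ →+* ℂ := (Polynomial.aeval y : Polynomial ℚ →ₐ[ℚ] ℂ).toRingHom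
  have hk : RingHom.ker f = RingHom.ker g := by
    ext P; exact h P
  let R := Polynomial ℚ ⧸ RingHom.ker f
  let i : R →+* ℂ := RingHom.kerLift f
  let j : R →+* ℂ := (RingHom.kerLift g).comp (Ideal.quotEquivOfEq hk).toRingHom
  have hi : Function.Injective i := RingHom.kerLift_injective f
  have hj : Function.Injective j := (RingHom.kerLift_injective g).comp (Ideal.quotEquivOfEq hk).injective
  have hR : Nontrivial R := by
    refine ⟨0, 1, fun h0 => ?_⟩
    have := congrArg i h0
    simp at this
  have : Countable (Polynomial ℚ) := by
    rw [← Cardinal.mk_le_aleph0_iff]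
    exact Polynomial.cardinalMk_le_max.trans (by simp)
  have : Countable R := Quotient.countable
  have hC : Cardinal.aleph0 < Cardinal.mk ℂ := by rw [Cardinal.mk_complex]; exact Cardinal.aleph0_lt_continuum
  obtain ⟨e, he⟩ := @exists_equiv_over R ℂ ℂ _ hR _ _ i.toAlgebra j.toAlgebra
    ((@faithfulSMul_iff_algebraMap_injective R ℂ _ _ i.toAlgebra).2 hi)
    ((@faithfulSMul_iff_algebraMap_injective R ℂ _ _ j.toAlgebra).2 hj) _ _ this hC hC rfl
  refine ⟨e, ?_⟩
  have h1 := he (Ideal.Quotient.mk _ Polynomial.X)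
  have h2 : i (Ideal.Quotient.mk _ Polynomial.X) = x := by
    show f Polynomial.X = x
    simp [f]
  have h3 : j (Ideal.Quotient.mk _ Polynomial.X) = y := by
    show g Polynomial.X = y
    simp [g]
  change e (i (Ideal.Quotient.mk _ Polynomial.X)) = j (Ideal.Quotient.mk _ Polynomial.X) at h1
  rwa [h2, h3] at h1

end RR

namespace RR
open Filter Topology Complex


open ComplexConjugate in
/-- covolume of a lattice -/
def Cov (Λ : Submodule ℤ ℂ) (A : ℝ) : Prop :=
  0 < A ∧ ∃ a b : ℂ, Λ = latt a b ∧ |(conj a * b).im| = A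

lemma Cov.le {Λ Λ' : Submodule ℤ ℂ} {A A' : ℝ} (h : Cov Λ A) (h' : Cov Λ' A') (hl : Λ ≤ Λ') :
    ∃ k : ℕ, 0 < k ∧ A = k * A' ∧ ∀ x ∈ Λ', (k : ℂ) * x ∈ Λ := by
  obtain ⟨hA, a, b, rfl, rfl⟩ := h
  obtain ⟨hA', c, d, rfl, rfl⟩ := h'
  obtain ⟨m, n, ha⟩ := mem_latt.1 (hl (mem_latt.2 ⟨1, 0, by simp⟩ : a ∈ latt a b))
  obtain ⟨r, s, hb⟩ := mem_latt.1 (hl (mem_latt.2 ⟨0, 1, by simp⟩ : b ∈ latt a b))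
  have hD : (starRingEnd ℂ a * b).im = ((m * s - n * r : ℤ) : ℝ) * (starRingEnd ℂ c * d).im := by
    rw [← ha, ← hb]
    simp
    ring
  have hk : ∀ x ∈ latt c d, ((m * s - n * r : ℤ) : ℂ) * x ∈ latt a b := by
    intro x hx
    obtain ⟨u, v, rfl⟩ := mem_latt.1 hx
    refine mem_latt.2 ⟨u * s - v * r, v * m - u * n, ?_⟩
    rw [← ha, ← hb]; push_cast; ring
  refine ⟨(m * s - n * r).natAbs, ?_, ?_, ?_⟩
  · refine Int.natAbs_pos.2 fun h0 => ?_
    rw [hD, h0] at hA; simp at hA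
  · rw [hD, abs_mul, ← Int.cast_abs, Int.abs_eq_natAbs, Int.cast_natCast]
  · intro x hx
    have e : ((m * s - n * r).natAbs : ℂ) = (((m * s - n * r).natAbs : ℤ) : ℂ) := (Int.cast_natCast _).symm
    rw [e]
    rcases Int.natAbs_eq (m * s - n * r) with h | h
    · rw [← h]; exact hk x hx
    · have : (((m * s - n * r).natAbs : ℤ) : ℂ) = -((m * s - n * r : ℤ) : ℂ) := by
        rw [h]; push_cast; simp
      rw [this, neg_mul]; exact (latt a b).neg_mem (hk x hx)

lemma Cov.unique {Λ : Submodule ℤ ℂ} {A A' : ℝ} (h : Cov Λ A) (h' : Cov Λ A') : A = A' := by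
  obtain ⟨k, hk, e, -⟩ := h.le h' le_rfl
  obtain ⟨k', hk', e', -⟩ := h'.le h le_rfl
  have h1 : (1 : ℝ) ≤ k := by exact_mod_cast hk
  have h2 : (1 : ℝ) ≤ k' := by exact_mod_cast hk'
  have := h.1; have := h'.1
  nlinarith

lemma Cov.sc {Λ : Submodule ℤ ℂ} {A : ℝ} (h : Cov Λ A) {c : ℂ} (hc : c ≠ 0) :
    Cov (sc c Λ) (normSq c * A) := by
  obtain ⟨hA, a, b, rfl, rfl⟩ := h
  have hn := normSq_pos.2 hc
  refine ⟨by positivity, c * a, c * b, sc_latt c a b, ?_⟩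
  rw [← abs_of_pos hn, ← abs_mul]
  congr 1
  simp [normSq_apply]
  ring

lemma cov_one {τ : ℂ} (hτ : 0 < τ.im) : Cov (latt 1 τ) τ.im :=
  ⟨hτ, 1, τ, rfl, by simp [abs_of_pos hτ]⟩

lemma Pt.cov {Λ : Submodule ℤ ℂ} {z : ℂ} (h : Pt Λ z) : ∃ A, Cov Λ A := by
  obtain ⟨a, τ, ha, hτ, rfl, -⟩ := h.normal
  exact ⟨_, (cov_one (im5 hτ)).sc ha⟩

lemma Cov.step {p : ℕ} (hp : p.Prime) (h5 : p ≠ 5) {Λ Λ' : Submodule ℤ ℂ} {z : ℂ} (h : Pt Λ z)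
    (hs : Step p Λ Λ') {A : ℝ} (hA : Cov Λ A) : Cov Λ' (A / p) := by
  have hp0 := cast_ne hp
  have hpr : (0 : ℝ) < p := by exact_mod_cast hp.pos
  obtain ⟨a, τ, ha, hτ, rfl, -⟩ := h.normal
  rw [hA.unique ((cov_one (im5 hτ)).sc ha), mul_div_assoc]
  have : Λ' ∈ Steps p (RR.sc a (latt 1 (5 * τ))) := hs
  rw [steps_sc _ ha, steps_latt hp (p5' hp h5) (im5 hτ)] at this
  obtain ⟨_, ⟨i, rfl⟩, rfl⟩ := this
  refine Cov.sc ?_ ha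
  cases i with
  | none =>
    rw [br_none hp]
    have := (cov_one (im_mul hp (im5 hτ))).sc (c := 1 / p) (by simpa using hp0)
    convert this using 1
    simp [normSq_apply]; field_simp
  | some j =>
    have := cov_one (im_div hp (im5 hτ) ((5 : ℤ) * (j : ℕ)) (by simp))
    convert this using 1
    · rfl
    · rw [div_natCast_im]; simp

/-- chains of prime steps -/
inductive Chain : Submodule ℤ ℂ → Submodule ℤ ℂ → ℕ → Prop
  | nil (Λ) : Chain Λ Λ 1
  | cons {p m : ℕ} {Λ Λ₁ Λ'} (hp : p.Prime) (h5 : p ≠ 5) (hs : Step p Λ Λ₁) (hc : Chain Λ₁ Λ' m) :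
    Chain Λ Λ' (p * m)

lemma Chain.cov {Λ Λ' : Submodule ℤ ℂ} {m : ℕ} (hc : Chain Λ Λ' m) : ∀ {z : ℂ}, Pt Λ z → ∀ {A A' : ℝ}, Cov Λ A →
    Cov Λ' A' → A = m * A' := by
  induction hc with
  | nil Λ => intro z h A A' hA hA'; rw [hA.unique hA']; simp
  | @cons p m Λ Λ₁ Λ' hp h5 hs hc ih =>
    intro z h A A' hA hA'
    have hpr : (0 : ℝ) < p := by exact_mod_cast hp.pos
    have h1 := ih (h.step hp h5 hs) (hA.step hp h5 h hs) hA'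
    rw [div_eq_iff hpr.ne'] at h1
    rw [h1]; push_cast; ring

lemma Chain.lift {Λ₁ Λ' : Submodule ℤ ℂ} {m : ℕ} (hc : Chain Λ₁ Λ' m) (σ : ℂ →+* ℂ) : ∀ {Λ₂ : Submodule ℤ ℂ} {z₁ z₂ : ℂ},
    Pt Λ₁ z₁ → Pt Λ₂ z₂ → σ (T Λ₁ z₁) = T Λ₂ z₂ →
    ∃ Λ'', Chain Λ₂ Λ'' m ∧ Λ₂ ≤ Λ'' ∧ Pt Λ'' z₂ ∧ σ (T Λ' z₁) = T Λ'' z₂ := by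
  induction hc with
  | nil Λ => intro Λ₂ z₁ z₂ h₁ h₂ e; exact ⟨Λ₂, Chain.nil _, le_rfl, h₂, e⟩
  | @cons p m Λ Λ₁ Λ' hp h5 hs hc ih =>
    intro Λ₂ z₁ z₂ h₁ h₂ e
    obtain ⟨Λ₃, hs₃, e₃⟩ := lift_step hp h5 h₁ h₂ σ e hs
    obtain ⟨Λ'', hc', hl, hP, e'⟩ := ih (h₁.step hp h5 hs) (h₂.step hp h5 hs₃) e₃
    exact ⟨Λ'', Chain.cons hp h5 hs₃ hc', hs₃.le.trans hl, hP, e'⟩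

lemma exists_prime_torsion {Λ Λ' : Submodule ℤ ℂ} (m : ℕ) : 0 < m → ∀ x ∈ Λ', x ∉ Λ → (m : ℂ) * x ∈ Λ →
    ∃ p : ℕ, p.Prime ∧ p ∣ m ∧ ∃ y ∈ Λ', y ∉ Λ ∧ (p : ℂ) * y ∈ Λ := by
  induction m using Nat.strong_induction_on with
  | _ m ih =>
    intro hm x hx hx' hmx
    have h1 : m ≠ 1 := by rintro rfl; simp at hmx; exact hx' hmx
    have hp := Nat.minFac_prime h1
    obtain ⟨k, hk⟩ := Nat.minFac_dvd m
    have hk0 : 0 < k := Nat.pos_of_ne_zero fun h => by rw [h] at hk; omega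
    have hkm : k < m := by
      rw [hk]; exact (Nat.lt_mul_iff_one_lt_left hk0).2 hp.one_lt
    by_cases hkx : (k : ℂ) * x ∈ Λ
    · obtain ⟨p, hp', hd, hy⟩ := ih k hkm hk0 x hx hx' hkx
      exact ⟨p, hp', hd.trans ⟨m.minFac, by rw [mul_comm]; exact hk⟩, hy⟩
    · refine ⟨m.minFac, hp, Nat.minFac_dvd m, k * x, by simpa using int_mul_mem hx k, hkx, ?_⟩
      rw [← mul_assoc]
      convert hmx using 2
      exact_mod_cast hk.symm

def adj (Λ : Submodule ℤ ℂ) (x : ℂ) : Submodule ℤ ℂ := Λ ⊔ Submodule.span ℤ {x}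

lemma mem_adj {Λ : Submodule ℤ ℂ} {x y : ℂ} : y ∈ adj Λ x ↔ ∃ k : ℤ, y - k * x ∈ Λ := by
  unfold adj
  rw [Submodule.mem_sup]
  constructor
  · rintro ⟨u, hu, v, hv, rfl⟩
    obtain ⟨k, rfl⟩ := Submodule.mem_span_singleton.1 hv
    exact ⟨k, by simpa using hu⟩
  · rintro ⟨k, hk⟩
    exact ⟨_, hk, k * x, Submodule.mem_span_singleton.2 ⟨k, by simp⟩, by ring⟩

lemma exists_chain (m : ℕ) : ∀ {Λ Λ' : Submodule ℤ ℂ} {z : ℂ} {A A' : ℝ}, Pt Λ z → Cov Λ A → Cov Λ' A' →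
    Λ ≤ Λ' → A = m * A' → ¬ 5 ∣ m → Chain Λ Λ' m := by
  induction m using Nat.strong_induction_on with
  | _ m ih =>
    intro Λ Λ' z A A' h hA hA' hl e hm5
    obtain ⟨k, hk, ek, hkx⟩ := hA.le hA' hl
    have hkm : k = m := by
      have : (k : ℝ) = m := mul_right_cancel₀ hA'.1.ne' (ek.symm.trans e)
      exact_mod_cast this
    subst hkm
    by_cases hll : Λ' ≤ Λ
    · have : Λ = Λ' := le_antisymm hl hll
      subst this
      have : (k : ℝ) = 1 := by
        have := hA.unique hA'
        subst this
        exact mul_right_cancel₀ hA.1.ne' (by rw [one_mul, ← ek])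
      have : k = 1 := by exact_mod_cast this
      subst this
      exact Chain.nil _
    · obtain ⟨x, hx, hx'⟩ := Set.not_subset.1 hll
      obtain ⟨p, hp, hpk, y, hy, hy', hpy⟩ := exists_prime_torsion k hk x hx hx' (hkx x hx)
      have h5 : p ≠ 5 := by rintro rfl; exact hm5 hpk
      have hs : Step p Λ (adj Λ y) := ⟨y, hy', hpy, fun w => mem_adj⟩
      obtain ⟨m, rfl⟩ := hpk
      have hm0 : 0 < m := Nat.pos_of_mul_pos_left hk
      have hpr : (0 : ℝ) < p := by exact_mod_cast hp.pos
      refine Chain.cons hp h5 hs (ih m ((Nat.lt_mul_iff_one_lt_left hm0).2 hp.one_lt) (h.step hp h5 hs)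
        (hA.step hp h5 h hs) hA' ?_ ?_ fun h => hm5 (h.mul_left _))
      · intro w hw
        obtain ⟨k, hk⟩ := mem_adj.1 hw
        have := Λ'.add_mem (hl hk) (int_mul_mem hy k)
        simpa using this
      · rw [e]; push_cast; field_simp

lemma T_map_dil {Λ₁ Λ₂ : Submodule ℤ ℂ} {z₁ z₂ : ℂ} (h₁ : Pt Λ₁ z₁) (h₂ : Pt Λ₂ z₂) (σ : ℂ →+* ℂ)
    (e : σ (T Λ₁ z₁) = T Λ₂ z₂) {c : ℤ} (hc : ¬ (5 : ℤ) ∣ c) : σ (T Λ₁ (c * z₁)) = T Λ₂ (c * z₂) := by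
  obtain ⟨v, hv, hd⟩ := mod_T.dil hc
  rw [hd _ _ h₁, hd _ _ h₂]
  rcases hv with rfl | rfl
  · simpa using e
  · have := T_two h₁
    have := T_two h₂
    push_cast
    simp [*]

/-- Lemma X: conjugation transports complex multiplications -/
lemma lemmaX {Λ₁ Λ₂ : Submodule ℤ ℂ} {z₁ z₂ : ℂ} (h₁ : Pt Λ₁ z₁) (h₂ : Pt Λ₂ z₂) (σ : ℂ →+* ℂ)
    (e : σ (T Λ₁ z₁) = T Λ₂ z₂) {α : ℂ} {m : ℕ} (hm : normSq α = m) (h5 : ¬ 5 ∣ m)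
    (hα : ∀ x ∈ Λ₁, α * x ∈ Λ₁) {c : ℤ} (hc : α * z₁ - c * z₁ ∈ Λ₁) :
    ∃ β : ℂ, normSq β = m ∧ (∀ x ∈ Λ₂, β * x ∈ Λ₂) ∧
      (β * z₂ - c * z₂ ∈ Λ₂ ∨ β * z₂ + c * z₂ ∈ Λ₂) := by
  have hα0 : α ≠ 0 := by
    rintro rfl
    have : m = 0 := by simpa [eq_comm] using hm
    exact h5 (by simp [this])
  obtain ⟨A, hA⟩ := h₁.cov
  have hA' := hA.sc (inv_ne_zero hα0)
  have hn : 0 < normSq α := normSq_pos.2 hα0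
  have hle : Λ₁ ≤ sc α⁻¹ Λ₁ := fun x hx => by
    rw [mem_sc_iff (inv_ne_zero hα0), inv_inv]; exact hα x hx
  have hch : Chain Λ₁ (sc α⁻¹ Λ₁) m := exists_chain m h₁ hA hA' hle (by
    rw [map_inv₀, ← hm]; field_simp) h5
  have hc5 : ¬ (5 : ℤ) ∣ c := by
    intro hd
    have h3 : α * z₁ ∈ Λ₁ := by
      have := Λ₁.add_mem hc ((h₁.int_mul_mem c).2 hd)
      simpa using this
    have h4 : z₁ ∈ sc α⁻¹ Λ₁ := by rw [mem_sc_iff (inv_ne_zero hα0), inv_inv]; exact h3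
    obtain ⟨k, hk, ek, hkx⟩ := hA.le hA' hle
    have hkm : k = m := by
      rw [map_inv₀, hm] at ek
      have hm0 : (m : ℝ) ≠ 0 := by rw [← hm]; exact hn.ne'
      have hA0 := hA.1.ne'
      field_simp at ek
      exact_mod_cast ek.symm
    subst hkm
    have := (h₁.int_mul_mem k).1 (by simpa using hkx _ h4)
    exact h5 (by exact_mod_cast this)
  obtain ⟨Λ'', hch', hle', hP, e'⟩ := hch.lift σ h₁ h₂ e
  have e1 : T (sc α⁻¹ Λ₁) z₁ = T Λ₁ (c * z₁) := by
    rw [show z₁ = α⁻¹ * (α * z₁) by field_simp, T_sc (inv_ne_zero hα0)]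
    rw [show α⁻¹ * (α * z₁) = z₁ by field_simp]
    exact T_congr h₁.lat hc
  rw [e1, T_map_dil h₁ h₂ σ e hc5] at e'
  obtain ⟨β, hβ, hΛ, hz⟩ := injectivity hP (h₂.mul hc5) e'.symm
  refine ⟨β, ?_, fun x hx => ?_, ?_⟩
  · obtain ⟨B, hB⟩ := hP.cov
    obtain ⟨C, hC⟩ := h₂.cov
    have h6 := hch'.cov h₂ hC hB
    have h7 := hB.sc hβ
    rw [← hΛ] at h7
    have h8 := hC.unique h7
    exact mul_right_cancel₀ hB.1.ne' (h8.symm.trans h6)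
  · rw [hΛ, mul_mem_sc hβ]; exact hle' hx
  · rcases hz with hz | hz
    · left; rw [← neg_sub]; exact Λ₂.neg_mem hz
    · right; rwa [add_comm]

end RR

namespace RR
open Filter Topology Complex


lemma sq_bound {x y k : ℤ} (hk : 0 ≤ k) (hk' : k ≤ 32) (h : y ^ 2 = x ^ 2 + k) (h0 : 0 < k) :
    (x.natAbs ≤ 16) ∧ y.natAbs ≤ 17 := by
  have h2 := sq_abs x; have h3 := sq_abs y
  have h1 : |x| < |y| := by apply sq_lt_sq.1; omega
  have h4 := abs_nonneg x
  have hx : |x| ≤ 16 := by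
    by_contra hc; push Not at hc; nlinarith
  have hy : |y| ≤ 17 := by
    by_contra hc; push Not at hc; nlinarith
  rw [Int.abs_eq_natAbs] at hx hy
  omega

lemma sq_diff {x y k : ℤ} (hk : k = 8 ∨ k = 12 ∨ k = 20 ∨ k = 32) (h : y ^ 2 = x ^ 2 + k) :
    (k = 8 ∧ x ^ 2 = 1) ∨ (k = 12 ∧ x ^ 2 = 4) ∨ (k = 20 ∧ x ^ 2 = 16) ∨
      (k = 32 ∧ (x ^ 2 = 4 ∨ x ^ 2 = 49)) := by
  obtain ⟨hx, hy⟩ := sq_bound (by omega) (by omega) h (by omega)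
  rw [← Int.natAbs_sq x, ← Int.natAbs_sq y] at h
  rw [← Int.natAbs_sq x]
  generalize x.natAbs = a at *
  generalize y.natAbs = b at *
  clear x y
  have h' : ((b ^ 2 : ℕ) : ℤ) = ((a ^ 2 : ℕ) : ℤ) + k := by push_cast; exact h
  have : (b ^ 2 : ℕ) = a ^ 2 + k.toNat := by omega
  have key : ∀ k' : ℕ, (k' = 8 ∨ k' = 12 ∨ k' = 20 ∨ k' = 32) → b ^ 2 = a ^ 2 + k' →
      (k' = 8 ∧ a ^ 2 = 1) ∨ (k' = 12 ∧ a ^ 2 = 4) ∨ (k' = 20 ∧ a ^ 2 = 16) ∨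
      (k' = 32 ∧ (a ^ 2 = 4 ∨ a ^ 2 = 49)) := by
    clear h h' this
    rintro k' (rfl | rfl | rfl | rfl) h <;> interval_cases a <;> interval_cases b <;> simp_all
  have := key k.toNat (by omega) this
  push_cast at *
  norm_cast
  omega

lemma y_small {M d y x : ℤ} (h : M = x ^ 2 + d * y ^ 2) (hd : 0 < d) (hM : M < 4 * d) :
    M = x ^ 2 ∨ M = x ^ 2 + d := by
  have hx := sq_nonneg x
  have : y ^ 2 < 4 := by nlinarith
  have h2 : |y| < 2 := by
    apply abs_lt_of_sq_lt_sq (by linarith) (by norm_num)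
  rw [abs_lt] at h2
  obtain ⟨a, b⟩ := h2
  interval_cases y <;> simp_all

lemma mod5sq (x : ℤ) : x ^ 2 % 5 = 0 ∨ x ^ 2 % 5 = 1 ∨ x ^ 2 % 5 = 4 := by
  have : x % 5 = 0 ∨ x % 5 = 1 ∨ x % 5 = 2 ∨ x % 5 = 3 ∨ x % 5 = 4 := by omega
  rcases this with h | h | h | h | h <;> simp [pow_two, Int.mul_emod, h]

lemma mod4sq (x : ℤ) : x ^ 2 % 4 = 0 ∨ x ^ 2 % 4 = 1 := by
  have : x % 4 = 0 ∨ x % 4 = 1 ∨ x % 4 = 2 ∨ x % 4 = 3 := by omega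
  rcases this with h | h | h | h <;> simp [pow_two, Int.mul_emod, h]

/-- a positive number determined by the numbers prime to 5 it represents -/
lemma forms_eq {D d u : ℤ} (hD : 35 ≤ D) (hD5 : 5 ∣ D) (hD4 : D % 4 = 3) (hd : 0 < d) {v : ℤ}
    (hu : d = -(u ^ 2 + 20 * v))
    (h1 : ∀ m : ℤ, ¬ 5 ∣ m → (∃ x y : ℤ, 4 * m = x ^ 2 + D * y ^ 2) → ∃ x y : ℤ, 4 * m = x ^ 2 + d * y ^ 2)
    (h2 : ∀ m : ℤ, ¬ 5 ∣ m → (∃ x y : ℤ, 4 * m = x ^ 2 + d * y ^ 2) → ∃ x y : ℤ, 4 * m = x ^ 2 + D * y ^ 2) :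
    d = D := by
  have f1 : ∀ M : ℤ, M % 4 = 0 → M % 5 ≠ 0 → (∃ x y : ℤ, M = x ^ 2 + D * y ^ 2) →
      ∃ x y : ℤ, M = x ^ 2 + d * y ^ 2 := by
    intro M h4 h5 h
    have e : M = 4 * (M / 4) := by omega
    rw [e] at h ⊢
    exact h1 _ (by omega) h
  have f2 : ∀ M : ℤ, M % 4 = 0 → M % 5 ≠ 0 → (∃ x y : ℤ, M = x ^ 2 + d * y ^ 2) →
      ∃ x y : ℤ, M = x ^ 2 + D * y ^ 2 := by
    intro M h4 h5 h
    have e : M = 4 * (M / 4) := by omega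
    rw [e] at h ⊢
    exact h2 _ (by omega) h
  have u4 := mod4sq u
  have u5 := mod5sq u
  have res : ∀ M : ℤ, (∃ x y : ℤ, M = x ^ 2 + D * y ^ 2) → M % 5 = 0 ∨ M % 5 = 1 ∨ M % 5 = 4 := by
    rintro M ⟨x, y, rfl⟩
    obtain ⟨k, rfl⟩ := hD5
    have := mod5sq x
    rw [mul_assoc]
    generalize k * y ^ 2 = j
    omega
  have hd5 : d % 5 = 0 := by
    by_contra hne
    have key : ∀ c : ℤ, (d + c ^ 2) % 4 = 0 → (d + c ^ 2) % 5 ≠ 2 ∧ (d + c ^ 2) % 5 ≠ 3 := by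
      intro c h4
      by_contra hcon
      have := res _ (f2 (d + c ^ 2) h4 (by omega) ⟨c, 1, by ring⟩)
      omega
    have a1 := key 1
    have a2 := key 2
    have a3 := key 3
    have a4 := key 4
    norm_num at a1 a2 a3 a4
    omega
  rcases lt_trichotomy d D with hlt | heq | hgt
  · exfalso
    rcases u4 with hu4 | hu4
    · obtain ⟨x, y, hx⟩ := f2 (d + 4) (by omega) (by omega) ⟨2, 1, by ring⟩
      obtain ⟨x', y', hx'⟩ := f2 (d + 16) (by omega) (by omega) ⟨4, 1, by ring⟩
      obtain ⟨x'', y'', hx''⟩ := f2 (d + 36) (by omega) (by omega) ⟨6, 1, by ring⟩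
      have g := y_small hx (by omega) (by omega)
      have g' := y_small hx' (by omega) (by omega)
      have g'' := y_small hx'' (by omega) (by omega)
      have n1 := sq_nonneg x
      have n2 := sq_nonneg x'
      have n3 := sq_nonneg x''
      have e1 : d + 4 = x ^ 2 := by omega
      have e2 : D = d + 15 := by
        rcases g' with g' | g'
        · have := sq_diff (k := 12) (by norm_num) (x := x) (y := x') (by omega)
          omega
        · have : x' ^ 2 % 4 = 0 ∨ x' ^ 2 % 4 = 1 := mod4sq x'
          omega
      rcases g'' with g'' | g''
      · have := sq_diff (k := 32) (by norm_num) (x := x) (y := x'') (by omega)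
        omega
      · have h21 : x'' ^ 2 = 21 := by omega
        have := mod5sq x''
        have hb : |x''| < 5 := abs_lt_of_sq_lt_sq (by omega) (by norm_num)
        rw [abs_lt] at hb
        obtain ⟨b1, b2⟩ := hb
        interval_cases x'' <;> omega
    · obtain ⟨x, y, hx⟩ := f2 (d + 1) (by omega) (by omega) ⟨1, 1, by ring⟩
      obtain ⟨x', y', hx'⟩ := f2 (d + 9) (by omega) (by omega) ⟨3, 1, by ring⟩
      have g := y_small hx (by omega) (by omega)
      have g' := y_small hx' (by omega) (by omega)
      have n1 := sq_nonneg x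
      have n2 := sq_nonneg x'
      rcases g' with g' | g'
      · have := sq_diff (k := 8) (by norm_num) (x := x) (y := x') (by omega)
        omega
      · omega
  · exact heq
  · exfalso
    obtain ⟨x, y, hx⟩ := f1 (D + 1) (by omega) (by omega) ⟨1, 1, by ring⟩
    obtain ⟨x', y', hx'⟩ := f1 (D + 9) (by omega) (by omega) ⟨3, 1, by ring⟩
    have g := y_small hx (by omega) (by omega)
    have g' := y_small hx' (by omega) (by omega)
    have n1 := sq_nonneg x
    have n2 := sq_nonneg x'
    rcases g' with g' | g'
    · have := sq_diff (k := 8) (by norm_num) (x := x) (y := x') (by omega)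
      omega
    · have e : d = D + 5 := by omega
      obtain ⟨x'', y'', hx''⟩ := f2 (d + 16) (by omega) (by omega) ⟨4, 1, by ring⟩
      have g'' := y_small hx'' (by omega) (by omega)
      rcases g'' with g'' | g''
      · have := sq_diff (k := 20) (by norm_num) (x := x) (y := x'') (by omega)
        omega
      · have h21 : x'' ^ 2 = 21 := by omega
        have hb : |x''| < 5 := abs_lt_of_sq_lt_sq (by omega) (by norm_num)
        rw [abs_lt] at hb
        obtain ⟨b1, b2⟩ := hb
        interval_cases x'' <;> omega

end RR

namespace RR
open Filter Topology Complex


/-- the square root of `-5l` -/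
noncomputable def θ (l : ℕ) : ℂ := I * (Real.sqrt (5 * l) : ℂ)

lemma θ_re (l : ℕ) : (θ l).re = 0 := by simp [θ]
lemma θ_im (l : ℕ) : (θ l).im = Real.sqrt (5 * l) := by simp [θ]
lemma θ_im_sq (l : ℕ) : (θ l).im ^ 2 = 5 * l := by
  rw [θ_im, Real.sq_sqrt (by positivity)]
lemma θ_im_pos {l : ℕ} (hl : 0 < l) : 0 < (θ l).im := by
  rw [θ_im]; apply Real.sqrt_pos.2; have : (0 : ℝ) < l := by exact_mod_cast hl
  positivity
lemma θ_sq (l : ℕ) : θ l ^ 2 = -(5 * l) := by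
  have : ((Real.sqrt (5 * l) : ℂ)) ^ 2 = 5 * l := by
    rw [← ofReal_pow, Real.sq_sqrt (by positivity)]; push_cast; rfl
  rw [θ, mul_pow, this]; simp

/-- pairs with complex multiplication by `ℤ[(1+√(-5l))/2]` and `z` killed by the prime above 5 -/
structure SP (l : ℕ) (Λ : Submodule ℤ ℂ) (z : ℂ) : Prop where
  pt : Pt Λ z
  w : ∀ x ∈ Λ, (1 + θ l) / 2 * x ∈ Λ
  tz : θ l * z ∈ Λ

noncomputable def τ₁ (l : ℕ) : ℂ := (5 + θ l) / 10

lemma τ₁_im {l : ℕ} (hl : 0 < l) : 0 < (τ₁ l).im := by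
  have : (τ₁ l).im = (θ l).im / 10 := by
    have : τ₁ l = (1/2 : ℝ) + ((1/10 : ℝ) : ℂ) * θ l := by rw [τ₁]; push_cast; ring
    rw [this]; simp; ring
  rw [this]; have := θ_im_pos hl; positivity

lemma sp_base {l : ℕ} (hl4 : l % 4 = 3) : SP l (latt 1 (5 * τ₁ l)) (τ₁ l) := by
  have hl0 : 0 < l := by omega
  obtain ⟨j, hj⟩ : ∃ j, l = 4 * j + 3 := ⟨l / 4, by omega⟩
  have hs := θ_sq l
  refine ⟨pt_normal (τ₁_im hl0), fun x hx => ?_, ?_⟩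
  · obtain ⟨m, n, rfl⟩ := mem_latt.1 hx
    refine mem_latt.2 ⟨-2 * m - 10 * n - 5 * j * n, m + 3 * n, ?_⟩
    rw [τ₁]; push_cast
    rw [hj] at hs ⊢
    push_cast at hs
    linear_combination (-n / 4 : ℂ) * hs
  · refine mem_latt.2 ⟨-2 * j - 4, 1, ?_⟩
    rw [τ₁]; push_cast
    rw [hj] at hs ⊢
    push_cast at hs
    linear_combination (-1 / 10 : ℂ) * hs

lemma SP.wz {l : ℕ} {Λ : Submodule ℤ ℂ} {z : ℂ} (h : SP l Λ z) :
    (1 + θ l) / 2 * z - ((3 : ℤ) : ℂ) * z ∈ Λ := by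
  set x := (1 + θ l) / 2 * z - ((3 : ℤ) : ℂ) * z with hx
  have h2 : 2 * x ∈ Λ := by
    have := Λ.sub_mem h.tz h.pt.five
    convert this using 1; rw [hx]; push_cast; ring
  have h5 : 5 * x ∈ Λ := by
    have h3 := Λ.sub_mem (h.w _ h.pt.five) (Λ.smul_mem (3 : ℤ) h.pt.five)
    convert h3 using 1; rw [hx]; simp; ring
  have := Λ.sub_mem h5 (Λ.smul_mem (2 : ℤ) h2)
  convert this using 1; simp; ring

lemma SP.ab {l : ℕ} {Λ : Submodule ℤ ℂ} {z : ℂ} (h : SP l Λ z) (a b : ℤ) :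
    (∀ x ∈ Λ, (a + b * ((1 + θ l) / 2)) * x ∈ Λ) ∧
    (a + b * ((1 + θ l) / 2)) * z - ((a + 3 * b : ℤ) : ℂ) * z ∈ Λ := by
  constructor
  · intro x hx
    have := Λ.add_mem (Λ.smul_mem a hx) (Λ.smul_mem b (h.w x hx))
    convert this using 1; simp; ring
  · have := Λ.smul_mem b h.wz
    convert this using 1; simp; ring

lemma normSq_ab (l : ℕ) (a b : ℤ) :
    4 * normSq (a + b * ((1 + θ l) / 2)) = ((2 * a + b) ^ 2 + 5 * l * b ^ 2 : ℝ) := by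
  have e : ((a : ℂ) + b * ((1 + θ l) / 2)) = ((a + b / 2 : ℝ) : ℂ) + ((b / 2 : ℝ) : ℂ) * θ l := by
    push_cast; ring
  rw [e, normSq_apply]
  have := θ_im_sq l
  simp [θ_re]
  linear_combination (b ^ 2 : ℝ) * this

lemma exists_gen (J : AddSubgroup ℤ) (hJ : ∃ n ∈ J, n ≠ 0) : ∃ g : ℤ, 0 < g ∧ g ∈ J ∧ ∀ n ∈ J, g ∣ n := by
  obtain ⟨g, hg⟩ := Int.subgroup_cyclic J
  have hmem : ∀ n, n ∈ J ↔ g ∣ n := by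
    intro n; rw [hg, ← AddSubgroup.zmultiples_eq_closure, Int.mem_zmultiples_iff]
  obtain ⟨n, hn, hn0⟩ := hJ
  have hg0 : g ≠ 0 := by rintro rfl; exact hn0 (zero_dvd_iff.1 ((hmem n).1 hn))
  refine ⟨|g|, abs_pos.2 hg0, (hmem _).2 (by simp), fun n hn => ?_⟩
  rw [abs_dvd]; exact (hmem n).1 hn

lemma conj_SP {l : ℕ} (hl5 : 5 < l) (hl4 : l % 4 = 3) (σ : ℂ ≃+* ℂ) {τ : ℂ} (hτ : 0 < τ.im)
    (e : σ (t (τ₁ l)) = t τ) : SP l (latt 1 (5 * τ)) τ := by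
  have hl0 : 0 < l := by omega
  have hb := sp_base hl4
  have h2 := pt_normal hτ
  have e' : σ.symm (t τ) = t (τ₁ l) := by rw [← e]; simp
  have hP : ∀ (m : ℕ) (a b : ℤ), (4 * m : ℤ) = (2 * a + b) ^ 2 + 5 * l * b ^ 2 → ¬ 5 ∣ m →
      ∃ (m' n' u v : ℤ), normSq (m' + n' * (5 * τ)) = m ∧ 5 * n' * τ ^ 2 = u * τ + v := by
    intro m a b hm h5
    have hm' : normSq (a + b * ((1 + θ l) / 2)) = m := by
      have h3 := normSq_ab l a b
      have h4 : (4 * m : ℝ) = (2 * a + b) ^ 2 + 5 * l * b ^ 2 := by exact_mod_cast hm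
      linarith
    obtain ⟨β, hβ, h3, h4⟩ := lemmaX hb.pt h2 σ.toRingHom e hm' h5 (hb.ab a b).1 (hb.ab a b).2
    obtain ⟨m', n', h6⟩ := mem_latt.1 (h3 1 (mem_latt.2 ⟨1, 0, by simp⟩))
    have h7 : β = m' + n' * (5 * τ) := by rw [← mul_one β, ← h6]; ring
    rcases h4 with h4 | h4
    · obtain ⟨r, s, h8⟩ := mem_latt.1 h4
      refine ⟨m', n', 5 * s + (a + 3 * b) - m', r, by rw [← h7]; exact hβ, ?_⟩
      rw [h7] at h8; push_cast at h8 ⊢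
      linear_combination -h8
    · obtain ⟨r, s, h8⟩ := mem_latt.1 h4
      refine ⟨m', n', 5 * s - (a + 3 * b) - m', r, by rw [← h7]; exact hβ, ?_⟩
      rw [h7] at h8; push_cast at h8 ⊢
      linear_combination -h8
  let J : AddSubgroup ℤ :=
    { carrier := {n | ∃ u v : ℤ, 5 * n * τ ^ 2 = u * τ + v}
      zero_mem' := ⟨0, 0, by simp⟩
      add_mem' := by
        rintro a b ⟨u, v, h⟩ ⟨u', v', h'⟩
        exact ⟨u + u', v + v', by push_cast; linear_combination h + h'⟩
      neg_mem' := by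
        rintro a ⟨u, v, h⟩
        exact ⟨-u, -v, by push_cast; linear_combination -h⟩ }
  have hJ : ∃ n ∈ J, n ≠ 0 := by
    by_contra hcon
    push Not at hcon
    have sqr : ∀ (m : ℕ) (a b : ℤ), (4 * m : ℤ) = (2 * a + b) ^ 2 + 5 * l * b ^ 2 → ¬ 5 ∣ m →
        ∃ x : ℤ, (m : ℤ) = x ^ 2 := by
      intro m a b hm h5
      obtain ⟨m', n', u, v, h3, h4⟩ := hP m a b hm h5
      have : n' = 0 := hcon n' ⟨u, v, h4⟩
      subst this
      refine ⟨m', ?_⟩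
      simp [normSq_apply] at h3
      have : (m : ℝ) = m' ^ 2 := by rw [← h3]; ring
      exact_mod_cast this
    obtain ⟨j, hj⟩ : ∃ j, l = 4 * j + 3 := ⟨l / 4, by omega⟩
    obtain ⟨x, hx⟩ := sqr (5 * j + 4) 0 1 (by rw [hj]; push_cast; ring) (by omega)
    obtain ⟨y, hy⟩ := sqr (5 * j + 6) 1 1 (by rw [hj]; push_cast; ring) (by omega)
    have := sq_diff (k := 8) (by norm_num) (x := 2 * x) (y := 2 * y) (by
      push_cast at hx hy; linear_combination 4 * hx - 4 * hy)
    have h3 : (2 * x) ^ 2 = 4 * x ^ 2 := by ring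
    omega
  obtain ⟨g, hg0, ⟨u, v, huv⟩, hgd⟩ := exists_gen J hJ
  set η : ℂ := 5 * g * τ with hη
  have hη2 : η ^ 2 = u * η + 5 * g * v := by rw [hη]; linear_combination 5 * g * huv
  have hgr : (0 : ℝ) < g := by exact_mod_cast hg0
  have hηim : 0 < η.im := by
    have : η = ((5 * g : ℝ) : ℂ) * τ := by rw [hη]; push_cast; ring
    rw [this, im_ofReal_mul]; positivity
  obtain ⟨d, hd⟩ : ∃ d : ℤ, d = -(u ^ 2 + 20 * (g * v)) := ⟨_, rfl⟩
  have hx2 : (2 * η - u) ^ 2 = ((-d : ℝ) : ℂ) := by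
    rw [hd]; push_cast; linear_combination 4 * hη2
  have hxi : (2 * η - u).im = 2 * η.im := by simp
  have hxr : (2 * η - u).re = 0 := by
    have := congrArg Complex.im hx2
    rw [ofReal_im, pow_two, mul_im, hxi] at this
    have h3 : (2 * η - u).re * (4 * η.im) = 0 := by linarith
    rcases mul_eq_zero.1 h3 with h | h
    · exact h
    · linarith
  have hdi : (d : ℝ) = 4 * η.im ^ 2 := by
    have := congrArg Complex.re hx2
    rw [ofReal_re, pow_two, mul_re, hxi, hxr] at this
    linarith
  have hηre : η.re = u / 2 := by
    simp at hxr; linarith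
  have hd0 : 0 < d := by
    have : (0 : ℝ) < d := by rw [hdi]; positivity
    exact_mod_cast this
  have hnorm : ∀ a k : ℤ, 4 * normSq (a + k * η) = ((2 * a + k * u) ^ 2 + d * k ^ 2 : ℝ) := by
    intro a k
    rw [hdi, normSq_apply]
    simp [hηre]
    ring
  have hdD : d = 5 * l := by
    refine forms_eq (u := u) (v := g * v) (by omega) (by omega) (by omega) hd0 hd ?_ ?_
    · rintro m h5 ⟨x, y, hm⟩
      have hm0 : 0 ≤ m := by have := sq_nonneg x; have := sq_nonneg y; nlinarith
      obtain ⟨j, hj⟩ : ∃ j : ℤ, (l : ℤ) = 4 * j + 3 := ⟨l / 4, by omega⟩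
      have hpar : ∃ a, x = 2 * a + y := by
        have h3 : x ^ 2 % 2 = y ^ 2 % 2 := by
          rw [hj] at hm
          have : 5 * (4 * j + 3) * y ^ 2 = 4 * (5 * j * y ^ 2) + 15 * y ^ 2 := by ring
          rw [this] at hm
          generalize 5 * j * y ^ 2 = A at hm
          omega
        have h4 : x % 2 = y % 2 := by
          rcases Int.emod_two_eq_zero_or_one x with hx | hx <;>
          rcases Int.emod_two_eq_zero_or_one y with hy | hy <;>
          simp [pow_two, Int.mul_emod, hx, hy] at h3 ⊢
        exact ⟨(x - y) / 2, by omega⟩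
      obtain ⟨a, rfl⟩ := hpar
      lift m to ℕ using hm0
      obtain ⟨m', n', u', v', h6, h7⟩ := hP m a y (by rw [hm]) (by exact_mod_cast h5)
      obtain ⟨k, hk⟩ := hgd n' ⟨u', v', h7⟩
      refine ⟨2 * m' + k * u, k, ?_⟩
      have h8 := hnorm m' k
      rw [show (m' : ℂ) + k * η = m' + n' * (5 * τ) by rw [hk, hη]; push_cast; ring, h6] at h8
      exact_mod_cast h8
    · rintro m h5 ⟨x, y, hm⟩
      have hm0 : 0 ≤ m := by have := sq_nonneg x; have := sq_nonneg y; nlinarith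
      have hpar : ∃ a, x = 2 * a + y * u := by
        have h3 : x ^ 2 % 2 = (y * u) ^ 2 % 2 := by
          rw [hd] at hm
          have : -(u ^ 2 + 20 * (g * v)) * y ^ 2 = -(y * u) ^ 2 - 20 * (g * v * y ^ 2) := by ring
          rw [this] at hm
          generalize g * v * y ^ 2 = A at hm
          omega
        have h4 : x % 2 = (y * u) % 2 := by
          generalize y * u = y at *
          rcases Int.emod_two_eq_zero_or_one x with hx | hx <;>
          rcases Int.emod_two_eq_zero_or_one y with hy | hy <;>
          simp [pow_two, Int.mul_emod, hx, hy] at h3 ⊢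
        exact ⟨(x - y * u) / 2, by omega⟩
      obtain ⟨a, rfl⟩ := hpar
      lift m to ℕ using hm0
      have h6 : normSq (a + y * η) = m := by
        have := hnorm a y
        have h7 : (4 * m : ℝ) = ((2 * a + y * u) ^ 2 + d * y ^ 2 : ℝ) := by exact_mod_cast hm
        linarith
      obtain ⟨β, hβ, h3, -⟩ := lemmaX h2 hb.pt σ.symm.toRingHom e' (c := a + y * u) h6
        (by exact_mod_cast h5) (by
          intro x hx
          obtain ⟨r, s, rfl⟩ := mem_latt.1 hx
          refine mem_latt.2 ⟨a * r + 5 * y * s * v, a * s + y * g * r + y * s * u, ?_⟩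
          rw [hη]; push_cast
          linear_combination (-5 * y * s : ℂ) * huv) (by
          refine mem_latt.2 ⟨y * v, 0, ?_⟩
          rw [hη]; push_cast
          linear_combination (-y : ℂ) * huv)
      obtain ⟨m', n', h6⟩ := mem_latt.1 (h3 1 (mem_latt.2 ⟨1, 0, by simp⟩))
      have h7 : β = ((m' + 2 * n' : ℤ) : ℂ) + n' * ((1 + θ l) / 2) := by
        rw [← mul_one β, ← h6, τ₁]; push_cast; ring
      refine ⟨2 * (m' + 2 * n') + n', n', ?_⟩
      have h8 := normSq_ab l (m' + 2 * n') n'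
      rw [← h7, hβ] at h8
      exact_mod_cast h8
  have hθ : 2 * η - u = θ l := by
    apply Complex.ext
    · rw [hxr, θ_re]
    · rw [hxi, θ_im]
      symm
      rw [Real.sqrt_eq_iff_mul_self_eq (by positivity) (by positivity)]
      have : (d : ℝ) = 5 * l := by rw [hdD]; push_cast; rfl
      rw [← this, hdi]; ring
  have hu2 : u % 2 = 1 := by
    rcases Int.emod_two_eq_zero_or_one u with h | h
    · have : u ^ 2 % 2 = 0 := by simp [pow_two, Int.mul_emod, h]
      omega
    · exact h
  have hu5 : ∃ r, u = 5 * r := by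
    have : (5 : ℤ) ∣ u ^ 2 := by omega
    exact (Int.prime_ofNat_iff.2 (by norm_num) : Prime (5 : ℤ)).dvd_of_dvd_pow this
  obtain ⟨s, hs⟩ : ∃ s, u = 2 * s + 1 := ⟨u / 2, by omega⟩
  refine ⟨h2, fun x hx => ?_, ?_⟩
  · obtain ⟨m, n, rfl⟩ := mem_latt.1 hx
    refine mem_latt.2 ⟨-s * m + n * 5 * v, m * g + n * (-s + u), ?_⟩
    rw [← hθ, hη, hs]; rw [hs] at huv; push_cast at huv ⊢
    linear_combination (-5 * n : ℂ) * huv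
  · obtain ⟨r, hr⟩ := hu5
    refine mem_latt.2 ⟨2 * v, r, ?_⟩
    rw [← hθ, hη]; rw [hr] at huv ⊢; push_cast at huv ⊢
    linear_combination (-2 : ℂ) * huv

end RR

namespace RR
open Filter Topology Complex


lemma hasProd_H {q : ℂ} (hq : ‖q‖ < 1) (k : ℕ) : HasProd (fun n : ℕ => 1 + -(q ^ (5 * n + k))) (H k q) :=
  (multipliable_one_add_of_summable (summable_H hq k)).hasProd

lemma hasProd_H' {q : ℂ} (hq : ‖q‖ < 1) (k : ℕ) :
    HasProd (fun n : ℕ => if n % 5 = k % 5 ∧ k ≤ n then 1 - q ^ (n + 1) else 1) (H (k + 1) q) := by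
  have hinj : Function.Injective (fun n : ℕ => 5 * n + k) := fun a b h => by
    simp only at h; omega
  rw [← hinj.hasProd_iff]
  · refine (hasProd_H hq (k + 1)).congr_fun ?_ |> id
    intro n
    simp only [Function.comp]
    rw [if_pos ⟨by omega, by omega⟩]
    ring
  · intro n hn
    rw [if_neg]
    rintro ⟨h1, h2⟩
    exact hn ⟨(n - k) / 5, by simp only; omega⟩

lemma hasProd_rr {q : ℂ} (hq : ‖q‖ < 1) :
    HasProd (fun n : ℕ => (1 - q ^ (n + 1)) ^ (5 * jacobiSym (n + 1) 5)) (tB q) := by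
  have h1 := (hasProd_H' hq 0).mul (hasProd_H' hq 3)
  have h2 := (hasProd_H' hq 1).mul (hasProd_H' hq 2)
  have h3 := (h1.pow 5).mul ((h2.pow 5).inv₀ (pow_ne_zero _ (mul_ne_zero
    (H_ne_zero hq (by norm_num)) (H_ne_zero hq (by norm_num)))))
  change HasProd _ (tB q) at h3
  convert h3 using 1
  funext n
  rw [jacobiSym.mod_left]
  have hn : n % 5 = 0 ∨ n % 5 = 1 ∨ n % 5 = 2 ∨ n % 5 = 3 ∨ n % 5 = 4 := by omega
  rcases hn with h | h | h | h | h
  · rw [show ((n : ℤ) + 1) % ((5 : ℕ) : ℤ) = 1 by omega, show jacobiSym 1 5 = 1 by decide +kernel]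
    rw [if_pos ⟨by omega, by omega⟩, if_neg (by omega), if_neg (by omega), if_neg (by omega)]
    simp
  · rw [show ((n : ℤ) + 1) % ((5 : ℕ) : ℤ) = 2 by omega, show jacobiSym 2 5 = -1 by decide +kernel]
    rw [if_neg (by omega), if_neg (by omega), if_pos ⟨by omega, by omega⟩, if_neg (by omega)]
    simp
  · rw [show ((n : ℤ) + 1) % ((5 : ℕ) : ℤ) = 3 by omega, show jacobiSym 3 5 = -1 by decide +kernel]
    rw [if_neg (by omega), if_neg (by omega), if_neg (by omega), if_pos ⟨by omega, by omega⟩]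
    simp
  · rw [show ((n : ℤ) + 1) % ((5 : ℕ) : ℤ) = 4 by omega, show jacobiSym 4 5 = 1 by decide +kernel]
    rw [if_neg (by omega), if_pos ⟨by omega, by omega⟩, if_neg (by omega), if_neg (by omega)]
    simp
  · rw [show ((n : ℤ) + 1) % ((5 : ℕ) : ℤ) = 0 by omega, show jacobiSym 0 5 = 0 by decide +kernel]
    rw [if_neg (by omega), if_neg (by omega), if_neg (by omega), if_neg (by omega)]
    simp

lemma im_rr {q : ℂ} (hq : ‖q‖ < 1) (hr : q.im = 0) : (q * tB q).im = 0 := by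
  have hc : (starRingEnd ℂ) q = q := conj_eq_iff_im.2 hr
  have h := hasProd_rr hq
  have h2 := h.map (starRingEnd ℂ) continuous_conj
  have e : (⇑(starRingEnd ℂ) ∘ fun n : ℕ => (1 - q ^ (n + 1)) ^ (5 * jacobiSym (n + 1) 5)) =
      fun n : ℕ => (1 - q ^ (n + 1)) ^ (5 * jacobiSym (n + 1) 5) := by
    funext n; simp [hc]
  rw [e] at h2
  apply conj_eq_iff_im.1
  rw [map_mul, hc, h2.unique h]

lemma H_bound {q : ℂ} (hq : ‖q‖ ≤ 1 / 19) (k : ℕ) : ‖H k q - 1‖ ≤ Real.exp (‖q‖ ^ k * (20/19)) - 1 := by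
  have hq1 : ‖q‖ < 1 := by linarith
  have h0 := norm_nonneg q
  have hs := summable_H hq1 k
  have hle : ∀ s : Finset ℕ, ∑ n ∈ s, ‖-(q ^ (5 * n + k))‖ ≤ ‖q‖ ^ k * (20/19) := by
    intro s
    refine (hs.sum_le_tsum s (fun _ _ => norm_nonneg _)).trans ?_
    have hq5 : ‖q‖ ^ 5 ≤ 1 / 20 := (pow_le_pow_left₀ h0 hq 5).trans (by norm_num)
    have e : (fun n : ℕ => ‖-(q ^ (5 * n + k))‖) = fun n => ‖q‖ ^ k * (‖q‖ ^ 5) ^ n := by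
      funext n; rw [norm_neg, norm_pow]; ring
    rw [e, tsum_mul_left, tsum_geometric_of_lt_one (by positivity) (by linarith)]
    refine mul_le_mul_of_nonneg_left ?_ (by positivity)
    rw [inv_le_comm₀ (by linarith) (by norm_num)]
    norm_num
    linarith
  have ht : Tendsto (fun s : Finset ℕ => ‖∏ n ∈ s, (1 + -(q ^ (5 * n + k))) - 1‖) atTop
      (𝓝 ‖H k q - 1‖) := ((hasProd_H hq1 k).sub_const 1).norm
  refine le_of_tendsto' ht fun s => ?_
  refine (Finset.norm_prod_one_add_sub_one_le s _).trans ?_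
  have := Real.exp_le_exp.2 (hle s)
  linarith

lemma exp_le_inv {x c : ℝ} (hx : x ≤ c) (hc : c < 1) : Real.exp x ≤ 1 / (1 - c) := by
  have h1 := Real.add_one_le_exp (-c)
  rw [Real.exp_neg] at h1
  have h2 : 0 < 1 - c := by linarith
  rw [le_div_iff₀ h2]
  have h3 := Real.exp_le_exp.2 hx
  have h4 := Real.exp_pos c
  have h5 : (Real.exp c)⁻¹ * Real.exp c = 1 := inv_mul_cancel₀ h4.ne'
  nlinarith

lemma rr_small {q : ℂ} (hq : ‖q‖ ≤ 1 / 19) : ‖q * tB q‖ ≤ 8 / 100 := by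
  have h0 := norm_nonneg q
  have b1 : ‖H 1 q‖ ≤ 18 / 17 := by
    have h1 := (H_bound hq 1).trans (sub_le_sub_right (exp_le_inv (c := 1 / 18) (by
      rw [pow_one]; linarith) (by norm_num)) 1)
    have := norm_sub_norm_le (H 1 q) 1
    rw [norm_one] at this
    norm_num at h1 ⊢
    linarith
  have bk : ∀ k, 2 ≤ k → ‖H k q - 1‖ ≤ 1 / 299 := by
    intro k hk
    have h2 : ‖q‖ ^ k ≤ ‖q‖ ^ 2 := pow_le_pow_of_le_one h0 (by linarith) hk
    have h3 : ‖q‖ ^ 2 ≤ (1 / 19) ^ 2 := pow_le_pow_left₀ h0 hq 2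
    have h1 := (H_bound hq k).trans (sub_le_sub_right (exp_le_inv (c := 1 / 300) (by
      norm_num at h3; linarith) (by norm_num)) 1)
    norm_num at h1 ⊢
    linarith
  have up : ∀ k, 2 ≤ k → ‖H k q‖ ≤ 300 / 299 := by
    intro k hk
    have := norm_sub_norm_le (H k q) 1
    rw [norm_one] at this
    linarith [bk k hk]
  have lo : ∀ k, 2 ≤ k → 298 / 299 ≤ ‖H k q‖ := by
    intro k hk
    have := norm_sub_norm_le 1 (H k q)
    rw [norm_one, norm_sub_rev] at this
    linarith [bk k hk]
  have h5 : ‖tB q‖ ≤ (18 / 17 * (300 / 299)) ^ 5 * ((298 / 299 * (298 / 299)) ^ 5)⁻¹ := by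
    rw [tB, norm_mul, norm_inv, norm_pow, norm_pow, norm_mul, norm_mul]
    have := lo 2 (by norm_num)
    have := lo 3 (by norm_num)
    have := up 4 (by norm_num)
    gcongr
  rw [norm_mul]
  calc ‖q‖ * ‖tB q‖ ≤ 1 / 19 * ((18 / 17 * (300 / 299)) ^ 5 * ((298 / 299 * (298 / 299)) ^ 5)⁻¹) := by gcongr
    _ ≤ _ := by norm_num

lemma disc_ne {y : ℂ} (hy : ‖y‖ ≤ 8 / 100) : y ^ 2 + 11 * y - 1 ≠ 0 := by
  intro h
  have h1 : y ^ 2 + 11 * y = 1 := by linear_combination h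
  have h2 : ‖y ^ 2 + 11 * y‖ ≤ ‖y‖ ^ 2 + 11 * ‖y‖ := by
    refine (norm_add_le _ _).trans ?_
    rw [norm_pow, norm_mul]; simp
  rw [h1, norm_one] at h2
  have := norm_nonneg y
  nlinarith

lemma q_small {l : ℕ} (hl5 : 5 < l) (hl4 : l % 4 = 3) : ‖ex (τ₁ l)‖ ≤ 1 / 19 := by
  rw [norm_ex]
  have him : (τ₁ l).im = (θ l).im / 10 := by
    have : τ₁ l = (1/2 : ℝ) + ((1/10 : ℝ) : ℂ) * θ l := by rw [τ₁]; push_cast; ring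
    rw [this]; simp; ring
  have hs : (59/10 : ℝ) ≤ (θ l).im := by
    rw [θ_im]
    apply Real.le_sqrt_of_sq_le
    have : (7 : ℝ) ≤ l := by exact_mod_cast (by omega : 7 ≤ l)
    norm_num; linarith
  have h3 : -2 * Real.pi * (τ₁ l).im ≤ -3 := by
    rw [him]
    have := Real.pi_gt_d2
    nlinarith
  refine (Real.exp_le_exp.2 h3).trans ?_
  rw [Real.exp_neg, one_div]
  apply inv_anti₀ (by norm_num)
  have : (2.7 : ℝ) ≤ Real.exp 1 := by have := Real.exp_one_gt_d9; linarith
  calc (19 : ℝ) ≤ 2.7 ^ 3 := by norm_num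
    _ ≤ Real.exp 1 ^ 3 := by gcongr
    _ = Real.exp 3 := by rw [← Real.exp_nat_mul]; norm_num

lemma q_real (l : ℕ) : (ex (τ₁ l)).im = 0 := by
  have : ex (τ₁ l) = ((-Real.exp (-(2 * Real.pi * Real.sqrt (5 * l) / 10)) : ℝ) : ℂ) := by
    rw [ex, τ₁, θ]
    push_cast
    rw [← neg_one_mul, ← Complex.exp_pi_mul_I, ← Complex.exp_add]
    congr 1
    linear_combination (2 * Real.pi * (Real.sqrt (5 * l) : ℂ) / 10) * I_sq
  rw [this, ofReal_im]

lemma t_small {l : ℕ} (hl5 : 5 < l) (hl4 : l % 4 = 3) : ‖t (τ₁ l)‖ ≤ 8 / 100 := by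
  rw [t_eq_tB (τ₁_im (by omega))]
  exact rr_small (q_small hl5 hl4)

end RR

namespace RR
open Filter Topology Complex


open Polynomial in
lemma conj_mem {l : ℕ} (hl5 : 5 < l) (hl4 : l % 4 = 3) {y : ℂ}
    (h : ∀ P : ℚ[X], aeval (t (τ₁ l)) P = 0 ↔ aeval y P = 0) :
    ∃ τ : ℂ, 0 < τ.im ∧ SP l (latt 1 (5 * τ)) τ ∧ t τ = y := by
  have hl0 : 0 < l := by omega
  have h0 : y ≠ 0 := by
    intro h0
    have := (h X).2 (by simp [h0])
    simp at this
    exact t_ne_zero (τ₁_im hl0) this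
  have h1 : y ^ 2 + 11 * y - 1 ≠ 0 := by
    intro h0
    have h2 := (h (X ^ 2 + C 11 * X - 1)).2 (by simpa using h0)
    exact disc_ne (t_small hl5 hl4) (by simpa using h2)
  obtain ⟨σ, hσ⟩ := exists_aut h
  obtain ⟨Λ, z, hP, hT⟩ := surj h0 h1
  obtain ⟨a, τ, ha, hτ, -, -, ht⟩ := hP.exists_t
  have ht' : t τ = y := by rw [← ht, hT]
  exact ⟨τ, hτ, conj_SP hl5 hl4 σ hτ (by rw [hσ, ht']), ht'⟩

open Polynomial in
lemma alg {l : ℕ} (hl5 : 5 < l) (hl4 : l % 4 = 3) : IsAlgebraic ℚ (t (τ₁ l)) := by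
  by_contra hcon
  have hl0 : 0 < l := by omega
  have key : ∀ y : ℂ, ¬ IsAlgebraic ℚ y → y ∈ t '' (Set.range fun p : ℤ × ℤ => (p.1 : ℂ) / (θ l - 5 * p.2)) := by
    intro y hy
    have hz : ∀ x : ℂ, ¬ IsAlgebraic ℚ x → ∀ P : ℚ[X], aeval x P = 0 ↔ P = 0 := by
      intro x hx P
      constructor
      · intro h; by_contra h0; exact hx ⟨P, h0, h⟩
      · rintro rfl; simp
    obtain ⟨τ, hτ, hs, ht⟩ := conj_mem hl5 hl4 (y := y) fun P => by rw [hz _ hcon, hz _ hy]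
    obtain ⟨m, n, h⟩ := mem_latt.1 hs.tz
    refine ⟨τ, ⟨(m, n), ?_⟩, ht⟩
    simp only
    have hne : θ l - 5 * n ≠ 0 := by
      intro h
      have := congrArg Complex.im h
      have h2 := θ_im_pos hl0
      simp at this
      linarith
    rw [div_eq_iff hne]; linear_combination h
  have hc : ({y : ℂ | IsAlgebraic ℚ y} ∪ t '' (Set.range fun p : ℤ × ℤ => (p.1 : ℂ) / (θ l - 5 * p.2))).Countable :=
    (Algebraic.countable ℚ ℂ).union ((Set.countable_range _).image _)
  refine not_countable_complex (hc.mono fun y _ => ?_)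
  by_cases hy : IsAlgebraic ℚ y
  · exact Or.inl hy
  · exact Or.inr (key y hy)

/-- the set of singular values -/
def S (l : ℕ) : Set ℂ := {y | ∃ Λ z, SP l Λ z ∧ T Λ z = y}

open Polynomial in
lemma root_mem_S {l : ℕ} (hl5 : 5 < l) (hl4 : l % 4 = 3) {y : ℂ}
    (hy : aeval y (minpoly ℚ (t (τ₁ l))) = 0) : y ∈ S l := by
  have hi : IsIntegral ℚ (t (τ₁ l)) := (alg hl5 hl4).isIntegral
  have e : minpoly ℚ (t (τ₁ l)) = minpoly ℚ y :=
    minpoly.eq_of_irreducible_of_monic (minpoly.irreducible hi) hy (minpoly.monic hi)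
  obtain ⟨τ, hτ, hs, ht⟩ := conj_mem hl5 hl4 (y := y) fun P => by
    rw [← minpoly.dvd_iff, ← minpoly.dvd_iff, e]
  exact ⟨_, _, hs, ht⟩

end RR

namespace RR
open Filter Topology Complex


lemma quad_of_conj {l : ℕ} (hl4 : l % 4 = 3) {Λ : Submodule ℤ ℂ} {z : ℂ} (hb : SP l Λ z)
    (σ : ℂ →+* ℂ) {τ : ℂ} (hτ : 0 < τ.im) (e : σ (T Λ z) = t τ) :
    ∃ n u v : ℤ, n ≠ 0 ∧ 5 * n * τ ^ 2 = u * τ + v := by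
  have h2 := pt_normal hτ
  by_contra hcon
  push Not at hcon
  have sqr : ∀ (m : ℕ) (a b : ℤ), (4 * m : ℤ) = (2 * a + b) ^ 2 + 5 * l * b ^ 2 → ¬ 5 ∣ m →
      ∃ x : ℤ, (m : ℤ) = x ^ 2 := by
    intro m a b hm h5
    have hm' : normSq (a + b * ((1 + θ l) / 2)) = m := by
      have h3 := normSq_ab l a b
      have h4 : (4 * m : ℝ) = (2 * a + b) ^ 2 + 5 * l * b ^ 2 := by exact_mod_cast hm
      linarith
    obtain ⟨β, hβ, h3, h4⟩ := lemmaX hb.pt h2 σ e hm' h5 (hb.ab a b).1 (hb.ab a b).2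
    obtain ⟨m', n', h6⟩ := mem_latt.1 (h3 1 (mem_latt.2 ⟨1, 0, by simp⟩))
    have h7 : β = m' + n' * (5 * τ) := by rw [← mul_one β, ← h6]; ring
    have hn : n' = 0 := by
      by_contra hn
      rcases h4 with h4 | h4
      · obtain ⟨r, s, h8⟩ := mem_latt.1 h4
        refine hcon n' (5 * s + (a + 3 * b) - m') r hn ?_
        rw [h7] at h8; push_cast at h8 ⊢
        linear_combination -h8
      · obtain ⟨r, s, h8⟩ := mem_latt.1 h4
        refine hcon n' (5 * s - (a + 3 * b) - m') r hn ?_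
        rw [h7] at h8; push_cast at h8 ⊢
        linear_combination -h8
    subst hn
    refine ⟨m', ?_⟩
    rw [h7] at hβ
    simp [normSq_apply] at hβ
    have : (m : ℝ) = m' ^ 2 := by rw [← hβ]; ring
    exact_mod_cast this
  obtain ⟨j, hj⟩ : ∃ j, l = 4 * j + 3 := ⟨l / 4, by omega⟩
  obtain ⟨x, hx⟩ := sqr (5 * j + 4) 0 1 (by rw [hj]; push_cast; ring) (by omega)
  obtain ⟨y, hy⟩ := sqr (5 * j + 6) 1 1 (by rw [hj]; push_cast; ring) (by omega)
  have := sq_diff (k := 8) (by norm_num) (x := 2 * x) (y := 2 * y) (by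
    push_cast at hx hy; linear_combination 4 * hx - 4 * hy)
  have h3 : (2 * x) ^ 2 = 4 * x ^ 2 := by ring
  omega

open Polynomial in
lemma S_alg {l : ℕ} (hl4 : l % 4 = 3) {Λ : Submodule ℤ ℂ} {z : ℂ} (hb : SP l Λ z) :
    IsAlgebraic ℚ (T Λ z) := by
  by_contra hcon
  have key : ∀ y : ℂ, ¬ IsAlgebraic ℚ y → y ∈ t '' {τ | IsAlgebraic ℚ τ} := by
    intro y hy
    have hz : ∀ x : ℂ, ¬ IsAlgebraic ℚ x → ∀ P : ℚ[X], aeval x P = 0 ↔ P = 0 := by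
      intro x hx P
      constructor
      · intro h; by_contra h0; exact hx ⟨P, h0, h⟩
      · rintro rfl; simp
    obtain ⟨σ, hσ⟩ := exists_aut (x := T Λ z) (y := y) fun P => by rw [hz _ hcon, hz _ hy]
    have h0 : y ≠ 0 := by
      rintro rfl; exact hy isAlgebraic_zero
    have h1 : y ^ 2 + 11 * y - 1 ≠ 0 := by
      intro h
      have h3 := (hz y hy (X ^ 2 + C 11 * X - 1)).1 (by simpa using h)
      have h4 := congrArg (Polynomial.eval 0) h3
      simp at h4
    obtain ⟨Λ', z', hP, hT⟩ := surj h0 h1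
    obtain ⟨a, τ, ha, hτ, -, -, ht⟩ := hP.exists_t
    have ht' : t τ = y := by rw [← ht, hT]
    obtain ⟨n, u, v, hn, huv⟩ := quad_of_conj hl4 hb σ.toRingHom hτ (show σ (T Λ z) = t τ by rw [hσ, ht'])
    refine ⟨τ, ⟨C (5 * n : ℚ) * X ^ 2 - C (u : ℚ) * X - C (v : ℚ), ?_, ?_⟩, ht'⟩
    · have hh : ∀ a b c : ℚ, a ≠ 0 → C a * X ^ 2 - C b * X - C c ≠ 0 := by
        intro a b c ha h
        have := congrArg (fun p => coeff p 2) h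
        simp [coeff_X, coeff_C] at this
        exact ha this
      exact hh _ _ _ (mul_ne_zero (by norm_num) (by exact_mod_cast hn))
    · simp
      linear_combination huv
  have hc : ({y : ℂ | IsAlgebraic ℚ y} ∪ t '' {τ | IsAlgebraic ℚ τ}).Countable :=
    (Algebraic.countable ℚ ℂ).union ((Algebraic.countable ℚ ℂ).image _)
  refine not_countable_complex (hc.mono fun y _ => ?_)
  by_cases hy : IsAlgebraic ℚ y
  · exact Or.inl hy
  · exact Or.inr (key y hy)

open Polynomial in
/-- a nonzero algebraic number is a unit at almost all primes -/
lemma exists_bad {x : ℂ} (hx : IsAlgebraic ℚ x) (h0 : x ≠ 0) : ∃ N : ℕ, 0 < N ∧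
    ∀ p : ℕ, p.Prime → ¬ p ∣ N → ∀ V : ValuationSubring ℂ, V.valuation (p : ℂ) < 1 →
      V.valuation x = 1 := by
  have key : ∀ y : ℂ, IsAlgebraic ℚ y → ∃ N : ℕ, 0 < N ∧
    ∀ p : ℕ, p.Prime → ¬ p ∣ N → ∀ V : ValuationSubring ℂ, V.valuation (p : ℂ) < 1 →
      V.valuation y ≤ 1 := by
    intro y hy
    have hy' : IsAlgebraic ℤ y := (IsFractionRing.isAlgebraic_iff ℤ ℚ ℂ).2 hy
    obtain ⟨n, hn, hi⟩ := hy'.exists_integral_multiple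
    refine ⟨n.natAbs, Int.natAbs_pos.2 hn, fun p hp hpn V hV => ?_⟩
    have hmem : (n • y) ∈ V := by
      have := hi.tower_top (A := V) 
      obtain ⟨w, hw⟩ := (IsIntegrallyClosed.isIntegral_iff (R := V) (K := ℂ)).1 this
      rw [← hw]; exact w.2
    have h1 : V.valuation (n • y) ≤ 1 := (V.valuation_le_one_iff _).2 hmem
    have h2 : V.valuation (n : ℂ) = 1 := by
      have hle : V.valuation (n : ℂ) ≤ 1 := (V.valuation_le_one_iff _).2 (by exact intCast_mem V n)
      refine le_antisymm hle (not_lt.1 fun hlt => ?_)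
      have hcop : IsCoprime (p : ℤ) n := (Nat.prime_iff_prime_int.1 hp).coprime_iff_not_dvd.2
        fun h => hpn (by simpa using Int.natAbs_dvd_natAbs.2 h)
      obtain ⟨a, b, hab⟩ := hcop
      have h3 : (1 : ℂ) = a * p + b * n := by exact_mod_cast hab.symm
      have ha : V.valuation (a : ℂ) ≤ 1 := (V.valuation_le_one_iff _).2 (by exact intCast_mem V a)
      have hb : V.valuation (b : ℂ) ≤ 1 := (V.valuation_le_one_iff _).2 (by exact intCast_mem V b)
      have h4 : V.valuation (1 : ℂ) < 1 := by
        rw [h3]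
        refine V.valuation.map_add_lt ?_ ?_
        · rw [map_mul]; exact mul_lt_one_of_nonneg_of_lt_one_right ha zero_le hV
        · rw [map_mul]; exact mul_lt_one_of_nonneg_of_lt_one_right hb zero_le hlt
      simp at h4
    rw [zsmul_eq_mul, map_mul, h2, one_mul] at h1
    exact h1
  obtain ⟨N, hN, h1⟩ := key x hx
  obtain ⟨N', hN', h2⟩ := key x⁻¹ hx.inv
  refine ⟨N * N', Nat.mul_pos hN hN', fun p hp hd V hV => ?_⟩
  refine le_antisymm (h1 p hp (fun h => hd (h.mul_right _)) V hV) ?_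
  have h3 := h2 p hp (fun h => hd (h.mul_left _)) V hV
  rw [map_inv₀] at h3
  have h4 : V.valuation x ≠ 0 := by simpa using h0
  exact (inv_le_one₀ (zero_lt_iff.2 h4)).1 h3

/-- valuation ring of `ℂ` over `p` -/
lemma exists_val {p : ℕ} (hp : p.Prime) : ∃ V : ValuationSubring ℂ, V.valuation (p : ℂ) < 1 := by
  let A : Subring ℂ := (Int.castRingHom ℂ).range
  let I : Ideal A := Ideal.span {(p : A)}
  have hI : I ≠ ⊤ := by
    intro h
    obtain ⟨⟨a, m, hm⟩, ha⟩ := Ideal.mem_span_singleton'.1 ((Ideal.eq_top_iff_one I).1 h)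
    have h1 := congrArg Subtype.val ha
    simp at h1 hm
    rw [← hm] at h1
    have h2 : m * p = 1 := by exact_mod_cast h1
    have h3 : (p : ℤ) ∣ 1 := Dvd.intro_left m h2
    exact (Nat.prime_iff_prime_int.1 hp).not_unit (isUnit_of_dvd_one h3)
  obtain ⟨V, -, hV⟩ := Ideal.image_subset_nonunits_valuationSubring I hI
  refine ⟨V, hV ⟨(p : A), Ideal.mem_span_singleton_self _, by simp⟩⟩

end RR

namespace RR
open Filter Topology Complex


open Polynomial in
lemma frob {V : ValuationSubring ℂ} {p : ℕ} (hp : p.Prime) (hV : V.valuation (p : ℂ) < 1) {x y : ℂ}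
    (hx : V.valuation x ≤ 1) (hy : V.valuation y ≤ 1) (h : V.valuation (y - x ^ p) < 1) (F : ℤ[X]) :
    V.valuation (aeval x F) < 1 ↔ V.valuation (aeval y F) < 1 := by
  let k := IsLocalRing.ResidueField V
  let r : V →+* k := IsLocalRing.residue V
  have hr : ∀ a : V, r a = 0 ↔ V.valuation (a : ℂ) < 1 := by
    intro a
    rw [← ValuationSubring.valuation_lt_one_iff]
    exact IsLocalRing.residue_eq_zero_iff a
  have hxV : x ∈ V := (V.valuation_le_one_iff _).1 hx
  have hyV : y ∈ V := (V.valuation_le_one_iff _).1 hy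
  have hpk : (p : k) = 0 := by
    have := (hr (p : V)).2 (by simpa using hV)
    simpa using this
  have : Fact p.Prime := ⟨hp⟩
  have : CharP k p := (CharP.charP_iff_prime_eq_zero hp).2 hpk
  have hxy : r ⟨y, hyV⟩ = (r ⟨x, hxV⟩) ^ p := by
    rw [← map_pow, ← sub_eq_zero, ← map_sub, hr]
    simpa using h
  have hval : ∀ (a : V), V.valuation (aeval (a : ℂ) F) < 1 ↔ eval₂ (Int.castRingHom k) (r a) F = 0 := by
    intro a
    have h1 : aeval (a : ℂ) F = ((eval₂ (Int.castRingHom V) a F : V) : ℂ) := by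
      have := hom_eval₂ F (Int.castRingHom V) V.subtype a
      rw [aeval_def]
      simp only [ValuationSubring.subtype_apply] at this
      rw [this]
      congr 1
    rw [h1, ← hr, hom_eval₂]
    have : r.comp (Int.castRingHom V) = Int.castRingHom k := RingHom.ext_int _ _
    rw [this]
  rw [hval ⟨x, hxV⟩, hval ⟨y, hyV⟩, hxy]
  have h2 : eval₂ (Int.castRingHom k) ((r ⟨x, hxV⟩) ^ p) F
      = (eval₂ (Int.castRingHom k) (r ⟨x, hxV⟩) F) ^ p := by
    have := hom_eval₂ F (Int.castRingHom k) (frobenius k p) (r ⟨x, hxV⟩)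
    rw [frobenius_def, frobenius_def] at this
    rw [this]
    congr 1
    exact RingHom.ext_int _ _
  rw [h2, pow_eq_zero_iff hp.ne_zero]

lemma SP.two {l : ℕ} {Λ : Submodule ℤ ℂ} {z : ℂ} (h : SP l Λ z) : SP l Λ (2 * z) := by
  refine ⟨?_, h.w, ?_⟩
  · have := h.pt.mul (n := 2) (by norm_num)
    simpa using this
  · have := Λ.smul_mem (2 : ℤ) h.tz
    convert this using 1; simp; ring

lemma SP.step {l : ℕ} {Λ Λ' : Submodule ℤ ℂ} {z : ℂ} (h : SP l Λ z) {p : ℕ} (hp : p.Prime) (h5 : p ≠ 5)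
    (hs : Step p Λ Λ') (hw : ∀ x ∈ Λ', (1 + θ l) / 2 * x ∈ Λ') : SP l Λ' z :=
  ⟨h.pt.step hp h5 hs, hw, hs.le h.tz⟩

open Polynomial in
/-- the property characterising good primes -/
def Good (l : ℕ) (F : ℤ[X]) (p : ℕ) : Prop := p.Prime ∧ p ≠ 5 ∧ p ≠ 2 ∧
  ∀ V : ValuationSubring ℂ, V.valuation (p : ℂ) < 1 → ∀ s ∈ S l, V.valuation s = 1 ∧
    (aeval s F ≠ 0 → V.valuation (aeval s F) = 1)

open Polynomial in
lemma exists_M {l : ℕ} (hl4 : l % 4 = 3) (hS : (S l).Finite) (F : ℤ[X]) :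
    ∃ M : ℕ, 0 < M ∧ ¬ 5 ∣ M ∧ ∀ p : ℕ, p.Prime → p ≠ 5 → ¬ p ∣ M → Good l F p := by
  have h1 : ∀ s : ℂ, ∃ N : ℕ, 0 < N ∧ (s ∈ S l → ∀ p : ℕ, p.Prime → ¬ p ∣ N →
     ∀ V : ValuationSubring ℂ, V.valuation (p : ℂ) < 1 → V.valuation s = 1 ∧
    (aeval s F ≠ 0 → V.valuation (aeval s F) = 1)) := by
    intro s
    by_cases hs : s ∈ S l
    · obtain ⟨Λ, z, h, rfl⟩ := hs
      obtain ⟨N, hN, hN'⟩ := exists_bad (S_alg hl4 h) (T_ne_zero h.pt)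
      by_cases h0 : aeval (T Λ z) F = 0
      · exact ⟨N, hN, fun _ p hp hd V hV => ⟨hN' p hp hd V hV, fun h => absurd h0 h⟩⟩
      · have hal : IsAlgebraic ℚ (aeval (T Λ z) F) := by
          have h3 : IsAlgebraic ℚ (aeval (T Λ z) (F.map (Int.castRingHom ℚ))) :=
            (show IsIntegral ℚ _ from (Algebra.adjoin_le (S := integralClosure ℚ ℂ) (by
              rw [Set.singleton_subset_iff]; exact (S_alg hl4 h).isIntegral)) (aeval_mem_adjoin_singleton ℚ (T Λ z))).isAlgebraic
          have h4 : aeval (T Λ z) (F.map (Int.castRingHom ℚ)) = aeval (T Λ z) F := by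
            exact aeval_map_algebraMap ℚ _ _
          rwa [h4] at h3
        obtain ⟨N', hN1, hN2⟩ := exists_bad hal h0
        refine ⟨N * N', Nat.mul_pos hN hN1, fun _ p hp hd V hV => ⟨?_, fun _ => ?_⟩⟩
        · exact hN' p hp (fun h => hd (h.mul_right _)) V hV
        · exact hN2 p hp (fun h => hd (h.mul_left _)) V hV
    · exact ⟨1, one_pos, fun h => absurd h hs⟩
  choose N hN hN' using h1
  have hprod : (∏ s ∈ hS.toFinset, N s) ≠ 0 := Finset.prod_ne_zero_iff.2 fun s _ => (hN s).ne'
  obtain ⟨e, m, hm, hem⟩ := Nat.exists_eq_pow_mul_and_not_dvd hprod 5 (by norm_num)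
  have hm0 : 0 < m := Nat.pos_of_ne_zero (by rintro rfl; simp at hm)
  refine ⟨2 * m, by omega, by omega, fun p hp h5 hd => ⟨hp, h5, ?_, fun V hV s hs => ?_⟩⟩
  · rintro rfl; exact hd (dvd_mul_right _ _)
  · refine hN' s hs p hp (fun h => ?_) V hV
    have h2 : p ∣ ∏ s ∈ hS.toFinset, N s := h.trans (Finset.dvd_prod_of_mem _ (by simpa using hs))
    rw [hem] at h2
    rcases hp.dvd_mul.1 h2 with h3 | h3
    · exact h5 ((Nat.prime_dvd_prime_iff_eq hp (by norm_num)).1 (hp.dvd_of_dvd_pow h3))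
    · exact hd (h3.mul_left _)

open Polynomial in
lemma step_root {l : ℕ} {F : ℤ[X]} {p : ℕ} (hg : Good l F p) {Λ Λ' : Submodule ℤ ℂ} {z : ℂ}
    (h : SP l Λ z) (h' : SP l Λ' z) (hs : Step p Λ Λ') (hF : aeval (T Λ z) F = 0) :
    aeval (T Λ' z) F = 0 ∨ ((p % 5 = 2 ∨ p % 5 = 3) ∧ aeval (T Λ' (2 * z)) F = 0) := by
  obtain ⟨hp, h5, h2, hg⟩ := hg
  obtain ⟨V, hV⟩ := exists_val hp
  have hs1 := (hg V hV _ ⟨Λ, z, h, rfl⟩).1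
  obtain ⟨hs2, hs3⟩ := hg V hV _ ⟨Λ', z, h', rfl⟩
  obtain ⟨hs4, hs5⟩ := hg V hV _ ⟨Λ', 2 * z, h'.two, rfl⟩
  have hne : ∀ s ∈ S l, V.valuation (aeval s F) < 1 → aeval s F = 0 := by
    intro s hs hlt
    by_contra hcon
    exact absurd ((hg V hV s hs).2 hcon) hlt.ne
  have hW := congr_step hp h5 hV h.pt hs hs1
  rw [W, map_mul] at hW
  have hor : V.valuation (T Λ' z - T Λ z ^ p) < 1 ∨
      V.valuation (T Λ' z ^ p - T Λ (((p * 1 : ℤ) : ℂ) * z)) < 1 := by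
    by_contra hcon
    push Not at hcon
    exact absurd hW (not_lt.2 (one_le_mul hcon.1 hcon.2))
  have hF0 : V.valuation (aeval (T Λ z) F) < 1 := by rw [hF]; simp
  rcases hor with hor | hor
  · left
    exact hne _ ⟨Λ', z, h', rfl⟩ ((frob hp hV hs1.le hs2.le hor F).1 hF0)
  have hp5 : ¬ 5 ∣ p := fun hd => h5 ((Nat.prime_dvd_prime_iff_eq (by norm_num) hp).1 hd).symm
  have hmem : ∀ n : ℤ, (5 : ℤ) ∣ n → (n : ℂ) * z ∈ Λ := fun n hn => (h.pt.int_mul_mem n).2 hn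
  by_cases hc : p % 5 = 1 ∨ p % 5 = 4
  · left
    have e : T Λ (((p * 1 : ℤ) : ℂ) * z) = T Λ z := by
      rcases hc with hc | hc
      · refine T_congr h.pt.lat ?_
        have := hmem (p - 1) (by omega)
        convert this using 1; push_cast; ring
      · refine T_congr_neg h.pt.lat ?_
        have := hmem (p + 1) (by omega)
        convert this using 1; push_cast; ring
    rw [e] at hor
    refine hne _ ⟨Λ', z, h', rfl⟩ ((frob hp hV hs2.le hs1.le ?_ F).2 hF0)
    rw [← V.valuation.map_neg]; simpa using hor
  · right
    have hc' : p % 5 = 2 ∨ p % 5 = 3 := by omega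
    refine ⟨hc', ?_⟩
    have e : T Λ (((p * 1 : ℤ) : ℂ) * z) = T Λ (2 * z) := by
      rcases hc' with hc | hc
      · refine T_congr h.pt.lat ?_
        have := hmem (p - 2) (by omega)
        convert this using 1; push_cast; ring
      · refine T_congr_neg h.pt.lat ?_
        have := hmem (p + 2) (by omega)
        convert this using 1; push_cast; ring
    rw [e, T_two h.pt] at hor
    refine hne _ ⟨Λ', 2 * z, h'.two, rfl⟩ ((frob hp hV hs4.le hs1.le ?_ F).2 hF0)
    rw [T_two h'.pt]
    have hodd : Odd p := hp.odd_of_ne_two h2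
    have h0 := T_ne_zero h.pt
    have h0' := T_ne_zero h'.pt
    have e2 : T Λ z - (-(T Λ' z)⁻¹) ^ p = (T Λ z * ((T Λ' z) ^ p)⁻¹) * (T Λ' z ^ p - -(T Λ z)⁻¹) := by
      rw [hodd.neg_pow, inv_pow]
      have h0p := pow_ne_zero p h0'
      generalize T Λ' z ^ p = w at *
      field_simp
    rw [e2, map_mul, map_mul, map_inv₀, map_pow, hs1, hs2]
    simpa using hor

end RR

namespace RR
open Filter Topology Complex


/-- two independent `p`-torsion elements generate everything -/
lemma two_gen {p : ℕ} (hp : p.Prime) {Λ : Submodule ℤ ℂ} {a b : ℂ} (hΛ : Λ = latt a b) {y y' : ℂ}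
    (hy : (p : ℂ) * y ∈ Λ) (hy' : (p : ℂ) * y' ∈ Λ) (hn : y ∉ Λ) (hn' : ∀ j : ℤ, y' - j * y ∉ Λ) :
    ∀ x, (p : ℂ) * x ∈ Λ → ∃ i j k : ℤ, ∃ x0 ∈ Λ, x = i * y + j * y' + x0 := by
  have hp0 := cast_ne hp
  have hpZ := Nat.prime_iff_prime_int.1 hp
  subst hΛ
  obtain ⟨m, n, h1⟩ := mem_latt.1 hy
  obtain ⟨r, s, h2⟩ := mem_latt.1 hy'
  have hD : ¬ (p : ℤ) ∣ m * s - n * r := by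
    rintro ⟨d, hd⟩
    by_cases hm : (p : ℤ) ∣ m
    · by_cases hn0 : (p : ℤ) ∣ n
      · obtain ⟨m', rfl⟩ := hm
        obtain ⟨n', rfl⟩ := hn0
        refine hn (mem_latt.2 ⟨m', n', ?_⟩)
        refine mul_left_cancel₀ hp0 ?_
        rw [← h1]; push_cast; ring
      · obtain ⟨u, v, huv⟩ := hpZ.coprime_iff_not_dvd.2 hn0
        -- v n = 1 - u p
        refine hn' (s * v) (mem_latt.2 ⟨r * u - v * d, s * u, ?_⟩)
        refine mul_left_cancel₀ hp0 ?_
        have h3 : (p : ℂ) * (y' - ((s * v : ℤ) : ℂ) * y) = p * y' - s * v * (p * y) := by push_cast; ring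
        rw [h3, ← h1, ← h2]
        have e1 : (u * p + v * n : ℂ) = 1 := by exact_mod_cast huv
        have e2 : (m * s - n * r : ℂ) = p * d := by exact_mod_cast hd
        push_cast
        linear_combination (r * a + s * b) * e1 + v * a * e2
    · obtain ⟨u, v, huv⟩ := hpZ.coprime_iff_not_dvd.2 hm
      refine hn' (r * v) (mem_latt.2 ⟨r * u, s * u + v * d, ?_⟩)
      refine mul_left_cancel₀ hp0 ?_
      have h3 : (p : ℂ) * (y' - ((r * v : ℤ) : ℂ) * y) = p * y' - r * v * (p * y) := by push_cast; ring
      rw [h3, ← h1, ← h2]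
      have e1 : (u * p + v * m : ℂ) = 1 := by exact_mod_cast huv
      have e2 : (m * s - n * r : ℂ) = p * d := by exact_mod_cast hd
      push_cast
      linear_combination (r * a + s * b) * e1 - v * b * e2
  obtain ⟨u, v, huv⟩ := hpZ.coprime_iff_not_dvd.2 hD
  intro x hx
  obtain ⟨g, h, h3⟩ := mem_latt.1 hx
  refine ⟨v * (g * s - h * r), v * (h * m - g * n), 0, u * (g * a + h * b), mem_latt.2 ⟨u * g, u * h, by push_cast; ring⟩, ?_⟩
  refine mul_left_cancel₀ hp0 ?_
  have e1 : (u * p + v * (m * s - n * r) : ℂ) = 1 := by exact_mod_cast huv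
  push_cast
  linear_combination -h3 - (g * a + h * b) * e1 + v * (g * s - h * r) * h1 + v * (h * m - g * n) * h2

lemma chain_ind {l : ℕ} {z : ℂ} {P : ℕ → Prop} {Q : Submodule ℤ ℂ → Prop}
    (hQ : ∀ Λ, Q Λ → SP l Λ z)
    (hstep : ∀ p Λ Λ', p.Prime → p ≠ 5 → P p → Q Λ → Step p Λ Λ' → (∀ x ∈ Λ', (1 + θ l) / 2 * x ∈ Λ') → Q Λ')
    (hscale : ∀ (p : ℕ) Λ, p.Prime → p ≠ 5 → P p → Q Λ → Q (sc (p : ℂ)⁻¹ Λ)) (k : ℕ) :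
    ∀ (Λ Λ' : Submodule ℤ ℂ) (A A' : ℝ), Q Λ → Cov Λ A → Cov Λ' A' → Λ ≤ Λ' →
      (∀ x ∈ Λ', (1 + θ l) / 2 * x ∈ Λ') → A = k * A' →
      (∀ p : ℕ, p.Prime → p ∣ k → p ≠ 5 ∧ P p) → Q Λ' := by
  induction k using Nat.strong_induction_on with
  | _ k ih =>
    intro Λ Λ' A A' hq hA hA' hle hw e hP
    have hsp := hQ Λ hq
    obtain ⟨k0, hk0, ek, hkx⟩ := hA.le hA' hle
    have hkm : k0 = k := by
      have : (k0 : ℝ) = k := mul_right_cancel₀ hA'.1.ne' (ek.symm.trans e)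
      exact_mod_cast this
    subst hkm
    by_cases heq : Λ' ≤ Λ
    · rw [← le_antisymm hle heq]; exact hq
    obtain ⟨x, hx, hxn⟩ := Set.not_subset.1 heq
    obtain ⟨p, hp, hpk, y, hy, hyn, hpy⟩ := exists_prime_torsion k0 hk0 x hx hxn (hkx x hx)
    obtain ⟨h5, hPp⟩ := hP p hp hpk
    have hp0 := cast_ne hp
    have hmem : ∀ x, x ∈ sc (p : ℂ)⁻¹ Λ ↔ (p : ℂ) * x ∈ Λ := by
      intro x; rw [mem_sc_iff (inv_ne_zero hp0), inv_inv]
    have hpr : (0 : ℝ) < p := by exact_mod_cast hp.pos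
    have hp2 : 2 ≤ p := hp.two_le
    by_cases hc : ∀ y' ∈ Λ', (p : ℂ) * y' ∈ Λ → ∃ j : ℤ, y' - j * y ∈ Λ
    · have hs : Step p Λ (Λ' ⊓ sc (p : ℂ)⁻¹ Λ) := by
        refine ⟨y, hyn, hpy, fun y' => ⟨fun h => hc y' h.1 ((hmem _).1 h.2), ?_⟩⟩
        rintro ⟨j, hj⟩
        have h3 : y' = (y' - j * y) + j * y := by ring
        rw [h3]
        refine ⟨Λ'.add_mem (hle hj) ?_, (hmem _).2 ?_⟩
        · simpa using Λ'.smul_mem j hy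
        · have := Λ.add_mem (Λ.smul_mem (p : ℤ) hj) (Λ.smul_mem j hpy)
          convert this using 1; simp; ring
      have hw1 : ∀ x ∈ Λ' ⊓ sc (p : ℂ)⁻¹ Λ, (1 + θ l) / 2 * x ∈ Λ' ⊓ sc (p : ℂ)⁻¹ Λ := by
        rintro x ⟨h1, h2⟩
        refine ⟨hw x h1, (hmem _).2 ?_⟩
        have := hsp.w _ ((hmem _).1 h2)
        convert this using 1; ring
      have hq1 := hstep p Λ _ hp h5 hPp hq hs hw1
      have hA1 := Cov.step hp h5 hsp.pt hs hA
      obtain ⟨k', hk', e', -⟩ := hA1.le hA' inf_le_left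
      have ekk : k0 = p * k' := by
        have : (k0 : ℝ) = p * k' := by
          refine mul_right_cancel₀ hA'.1.ne' ?_
          rw [← e, mul_assoc, ← e']; field_simp
        exact_mod_cast this
      refine ih k' ?_ _ Λ' _ A' hq1 hA1 hA' inf_le_left hw e' fun p' hp' hd => hP p' hp' ?_
      · rw [ekk]; nlinarith
      · rw [ekk]; exact hd.mul_left _
    · push Not at hc
      obtain ⟨y', hy'1, hy'2, hy'3⟩ := hc
      obtain ⟨-, a, b, hab, -⟩ := id hA
      have hg := two_gen hp hab hpy hy'2 hyn hy'3
      have hle1 : sc (p : ℂ)⁻¹ Λ ≤ Λ' := by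
        intro x hx
        obtain ⟨i, j, -, x0, hx0, rfl⟩ := hg x ((hmem x).1 hx)
        refine Λ'.add_mem (Λ'.add_mem ?_ ?_) (hle hx0)
        · simpa using Λ'.smul_mem i hy
        · simpa using Λ'.smul_mem j hy'1
      have hq1 := hscale p Λ hp h5 hPp hq
      have hA1 := hA.sc (inv_ne_zero hp0)
      obtain ⟨k', hk', e', -⟩ := hA1.le hA' hle1
      have ekk : k0 = p * p * k' := by
        have : (k0 : ℝ) = p * p * k' := by
          refine mul_right_cancel₀ hA'.1.ne' ?_
          rw [← e, mul_assoc, ← e']; simp [normSq_natCast]; field_simp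
        exact_mod_cast this
      refine ih k' ?_ _ Λ' _ A' hq1 hA1 hA' hle1 hw e' fun p' hp' hd => hP p' hp' ?_
      · rw [ekk]; have : 4 ≤ p * p := by nlinarith
        nlinarith
      · rw [ekk]; exact hd.mul_left _

lemma SP.sc_inv {l : ℕ} {Λ : Submodule ℤ ℂ} {z : ℂ} (h : SP l Λ z) {p : ℕ} (hp : p.Prime) (h5 : p ≠ 5) :
    SP l (RR.sc (p : ℂ)⁻¹ Λ) z := by
  have hp0 := cast_ne hp
  have hmem : ∀ x, x ∈ RR.sc (p : ℂ)⁻¹ Λ ↔ (p : ℂ) * x ∈ Λ := by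
    intro x; rw [mem_sc_iff (inv_ne_zero hp0), inv_inv]
  refine ⟨?_, ?_, ?_⟩
  · have h1 := (h.pt.mul (p5 hp h5)).sc (inv_ne_zero hp0)
    have e : (p : ℂ)⁻¹ * (((p : ℤ) : ℂ) * z) = z := by push_cast; field_simp
    rwa [e] at h1
  · intro x hx
    rw [hmem] at hx ⊢
    have := h.w _ hx
    convert this using 1; ring
  · rw [hmem]
    have := Λ.smul_mem (p : ℤ) h.tz
    convert this using 1; simp

lemma T_sc_inv {l : ℕ} {Λ : Submodule ℤ ℂ} {z : ℂ} (h : SP l Λ z) {p : ℕ} (hp : p.Prime) :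
    T (sc (p : ℂ)⁻¹ Λ) z = T Λ (p * z) := by
  have hp0 := cast_ne hp
  rw [← T_sc (inv_ne_zero hp0) Λ (p * z)]
  congr 1; field_simp

lemma T_mul_pm {l : ℕ} {Λ : Submodule ℤ ℂ} {z : ℂ} (h : SP l Λ z) {n m : ℤ}
    (hnm : (5 : ℤ) ∣ n - m ∨ (5 : ℤ) ∣ n + m) : T Λ (n * z) = T Λ (m * z) := by
  rcases hnm with hc | hc
  · refine T_congr h.pt.lat ?_
    have := (h.pt.int_mul_mem _).2 hc
    convert this using 1; push_cast; ring
  · refine T_congr_neg h.pt.lat ?_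
    have := (h.pt.int_mul_mem _).2 hc
    convert this using 1; push_cast; ring

open Polynomial in
lemma chain_one {l : ℕ} {F : ℤ[X]} {z : ℂ} {k : ℕ} {Λ Λ' : Submodule ℤ ℂ} {A A' : ℝ}
    (h : SP l Λ z) (hF : aeval (T Λ z) F = 0) (hA : Cov Λ A) (hA' : Cov Λ' A') (hle : Λ ≤ Λ')
    (hw : ∀ x ∈ Λ', (1 + θ l) / 2 * x ∈ Λ') (e : A = k * A')
    (hP : ∀ p : ℕ, p.Prime → p ∣ k → Good l F p ∧ (p % 5 = 1 ∨ p % 5 = 4)) :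
    SP l Λ' z ∧ aeval (T Λ' z) F = 0 := by
  refine chain_ind (l := l) (z := z) (P := fun p => Good l F p ∧ (p % 5 = 1 ∨ p % 5 = 4))
    (Q := fun Λ => SP l Λ z ∧ aeval (T Λ z) F = 0) (fun Λ h => h.1) ?_ ?_ k Λ Λ' A A' ⟨h, hF⟩ hA hA' hle hw e
    fun p hp hd => ⟨(hP p hp hd).1.2.1, hP p hp hd⟩
  · rintro p Λ Λ' hp h5 ⟨hg, hc⟩ ⟨h1, h2⟩ hs hw
    have h' := h1.step hp h5 hs hw
    refine ⟨h', ?_⟩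
    rcases step_root hg h1 h' hs h2 with h3 | ⟨h3, h4⟩
    · exact h3
    · omega
  · rintro p Λ hp h5 ⟨hg, hc⟩ ⟨h1, h2⟩
    refine ⟨h1.sc_inv hp h5, ?_⟩
    rw [T_sc_inv h1 hp]
    have := T_mul_pm h1 (n := p) (m := 1) (by omega)
    simp at this
    rw [this, h2]

open Polynomial in
lemma chain_two {l : ℕ} {F : ℤ[X]} {z : ℂ} {k : ℕ} {Λ Λ' : Submodule ℤ ℂ} {A A' : ℝ}
    (h : SP l Λ z) (hF : aeval (T Λ z) F = 0) (hA : Cov Λ A) (hA' : Cov Λ' A') (hle : Λ ≤ Λ')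
    (hw : ∀ x ∈ Λ', (1 + θ l) / 2 * x ∈ Λ') (e : A = k * A')
    (hP : ∀ p : ℕ, p.Prime → p ∣ k → Good l F p)
    (hι : ∀ Λ z, SP l Λ z → aeval (T Λ z) F = 0 → aeval (T Λ (2 * z)) F = 0) :
    SP l Λ' z ∧ aeval (T Λ' z) F = 0 := by
  have hι' : ∀ Λ z, SP l Λ z → aeval (T Λ (2 * z)) F = 0 → aeval (T Λ z) F = 0 := by
    intro Λ z h h0
    have h1 := hι Λ (2 * z) h.two h0
    have h2 := T_mul_pm h (n := 4) (m := 1) (by omega)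
    have e : (2 * (2 * z)) = ((4 : ℤ) : ℂ) * z := by push_cast; ring
    rw [e, h2] at h1
    simpa using h1
  refine chain_ind (l := l) (z := z) (P := fun p => Good l F p)
    (Q := fun Λ => SP l Λ z ∧ aeval (T Λ z) F = 0) (fun Λ h => h.1) ?_ ?_ k Λ Λ' A A' ⟨h, hF⟩ hA hA' hle hw e
    fun p hp hd => ⟨(hP p hp hd).2.1, hP p hp hd⟩
  · rintro p Λ Λ' hp h5 hg ⟨h1, h2⟩ hs hw
    have h' := h1.step hp h5 hs hw
    refine ⟨h', ?_⟩
    rcases step_root hg h1 h' hs h2 with h3 | ⟨h3, h4⟩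
    · exact h3
    · exact hι' _ _ h' h4
  · rintro p Λ hp h5 hg ⟨h1, h2⟩
    refine ⟨h1.sc_inv hp h5, ?_⟩
    rw [T_sc_inv h1 hp]
    have h55 := p5 hp h5
    by_cases hc : (5 : ℤ) ∣ (p : ℤ) - 1 ∨ (5 : ℤ) ∣ (p : ℤ) + 1
    · have := T_mul_pm h1 (n := p) (m := 1) hc
      simp at this
      rw [this, h2]
    · have := T_mul_pm h1 (n := p) (m := 2) (by omega)
      simp at this
      rw [this, hι _ _ h1 h2]

end RR

namespace RR
open Filter Topology Complex


lemma nsq2 : ¬ IsSquare ((2 : ℕ) : ZMod 5) := by decide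
lemma nsq3 : ¬ IsSquare ((3 : ℕ) : ZMod 5) := by decide

lemma exists_num {l M : ℕ} (hl5 : ¬ 5 ∣ l) (hM : ¬ 5 ∣ M) (h2 : 2 ∣ M) :
    ∃ (X y : ℤ) (N : ℕ), 0 < N ∧ (N : ℤ) = X ^ 2 + 5 * l * y ^ 2 ∧ (X % 5 = 2 ∨ X % 5 = 3) ∧
      ∀ p : ℕ, p.Prime → p ∣ N → p ≠ 5 ∧ ¬ p ∣ M ∧ (p % 5 = 1 ∨ p % 5 = 4) := by
  have inv : ∀ n r : ℤ, ¬ (5 : ℤ) ∣ n → ∃ a : ℤ, (n * a) % 5 = r % 5 := by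
    intro n r hn
    obtain ⟨u, v, huv⟩ := (Int.prime_iff_natAbs_prime.2 (by norm_num) : Prime (5 : ℤ)).coprime_iff_not_dvd.2 hn
    refine ⟨v * r, ?_⟩
    have : n * (v * r) = r + 5 * (-(u * r)) := by linear_combination r * huv
    rw [this]; omega
  obtain ⟨a, ha⟩ := inv M 1 (by omega)
  obtain ⟨y, hy⟩ : ∃ y : ℤ, y = M * a := ⟨_, rfl⟩
  rw [← hy] at ha
  obtain ⟨y5, hy5⟩ : ∃ y5 : ℤ, y = 5 * y5 + 1 := ⟨y / 5, by omega⟩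
  obtain ⟨W, hW⟩ : ∃ W : ℤ, W = 4 * l * y ^ 2 + 5 := ⟨_, rfl⟩
  have hW' : W = 4 * l + 5 * (4 * l * (5 * y5 ^ 2 + 2 * y5) + 1) := by rw [hW, hy5]; ring
  have hMW : ¬ (5 : ℤ) ∣ M * W := by
    intro h
    rcases (Int.prime_iff_natAbs_prime.2 (by norm_num) : Prime (5 : ℤ)).dvd_or_dvd h with h | h
    · omega
    · omega
  obtain ⟨r, hr⟩ : ∃ r : ℤ, (l + r ^ 2 + r - 1) % 5 = 2 ∨ (l + r ^ 2 + r - 1) % 5 = 3 := by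
    have : l % 5 = 1 ∨ l % 5 = 2 ∨ l % 5 = 3 ∨ l % 5 = 4 := by omega
    rcases this with h | h | h | h
    · exact ⟨1, by omega⟩
    · exact ⟨2, by omega⟩
    · exact ⟨2, by omega⟩
    · exact ⟨0, by omega⟩
  obtain ⟨c, hc⟩ := inv (M * W) r hMW
  obtain ⟨e, he⟩ : ∃ e : ℤ, e = M * W * c := ⟨_, rfl⟩
  rw [← he] at hc
  obtain ⟨e5, he5⟩ : ∃ e5 : ℤ, e = r + 5 * e5 := ⟨(e - r) / 5, by omega⟩
  obtain ⟨X, hX⟩ : ∃ X : ℤ, X = l * y ^ 2 + e ^ 2 + e - 1 := ⟨_, rfl⟩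
  have hX5 : X % 5 = 2 ∨ X % 5 = 3 := by
    have : X = (l + r ^ 2 + r - 1) + 5 * (l * (5 * y5 ^ 2 + 2 * y5) + 2 * r * e5 + 5 * e5 ^ 2 + e5) := by
      rw [hX, hy5, he5]; ring
    omega
  have hl0 : 0 < (l : ℤ) := by
    have : l ≠ 0 := by rintro rfl; simp at hl5
    omega
  have hy0 : y ≠ 0 := by rintro h; omega
  have hpos : 0 < X ^ 2 + 5 * l * y ^ 2 := by positivity
  obtain ⟨N, hN⟩ := Int.eq_ofNat_of_zero_le hpos.le
  refine ⟨X, y, N, by omega, hN.symm, hX5, fun p hp hd => ?_⟩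
  have hpZ := Nat.prime_iff_prime_int.1 hp
  have hd' : (p : ℤ) ∣ X ^ 2 + 5 * l * y ^ 2 := by rw [hN]; exact_mod_cast hd
  have hone : ¬ (p : ℤ) ∣ 1 := hpZ.not_dvd_one
  have c1 : p ≠ 5 := by
    rintro rfl
    have h3 : (5 : ℤ) ∣ X ^ 2 := by
      have := dvd_sub hd' (show ((5 : ℕ) : ℤ) ∣ 5 * l * y ^ 2 from ⟨l * y ^ 2, by push_cast; ring⟩)
      simpa using this
    have := (Int.prime_iff_natAbs_prime.2 (by norm_num) : Prime (5 : ℤ)).dvd_of_dvd_pow h3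
    omega
  have c2 : ¬ p ∣ M := by
    intro h
    have h' : (p : ℤ) ∣ M := by exact_mod_cast h
    refine hone ?_
    have : (1 : ℤ) = (X ^ 2 + 5 * l * y ^ 2) - M * (a * y * (5 * l) + (l * a * y + W * c * e + W * c) * (X - 1)) := by
      have hX' : X = M * (l * a * y + W * c * e + W * c) - 1 := by
        rw [hX]
        linear_combination l * y * hy + (e + 1) * he
      linear_combination -5 * l * y * hy - (X - 1) * hX'
    rw [this]
    exact dvd_sub hd' (h'.mul_right _)
  refine ⟨c1, c2, ?_⟩
  have hp2 : p ≠ 2 := by rintro rfl; exact c2 h2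
  have id1 : (2 * X + 5) ^ 2 - 5 * (2 * e + 1) ^ 2 = 4 * (X ^ 2 + 5 * l * y ^ 2) := by
    linear_combination 20 * hX
  have c3 : ¬ (p : ℤ) ∣ 2 * e + 1 := by
    intro h
    have h3 : (p : ℤ) ∣ (2 * X + 5) ^ 2 := by
      have : (2 * X + 5) ^ 2 = 4 * (X ^ 2 + 5 * l * y ^ 2) + (2 * e + 1) * (5 * (2 * e + 1)) := by
        linear_combination id1
      rw [this]
      exact dvd_add (hd'.mul_left _) (h.mul_right _)
    have h4 := hpZ.dvd_of_dvd_pow h3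
    have h5 : (p : ℤ) ∣ W := by
      have : W = 2 * (2 * X + 5) - (2 * e + 1) * (2 * e + 1) := by
        rw [hW]; linear_combination -4 * hX
      rw [this]
      exact dvd_sub (h4.mul_left _) (h.mul_right _)
    refine hone ?_
    have : (1 : ℤ) = (2 * e + 1) - W * (2 * M * c) := by linear_combination -2 * he
    rw [this]
    exact dvd_sub h (h5.mul_right _)
  have : Fact p.Prime := ⟨hp⟩
  have : Fact (Nat.Prime 5) := ⟨by norm_num⟩
  have hsq : IsSquare ((5 : ℕ) : ZMod p) := by
    have hb : ((2 * e + 1 : ℤ) : ZMod p) ≠ 0 := by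
      rw [Ne, ZMod.intCast_zmod_eq_zero_iff_dvd]; exact c3
    have h0 : ((X ^ 2 + 5 * l * y ^ 2 : ℤ) : ZMod p) = 0 := by
      rw [ZMod.intCast_zmod_eq_zero_iff_dvd]; exact hd'
    have h1 := congrArg (fun n : ℤ => (n : ZMod p)) id1
    rw [Int.cast_mul, h0] at h1
    refine ⟨((2 * X + 5 : ℤ) : ZMod p) / ((2 * e + 1 : ℤ) : ZMod p), ?_⟩
    field_simp
    push_cast at h1 ⊢
    linear_combination -h1
  have h3 := (ZMod.exists_sq_eq_prime_iff_of_mod_four_eq_one (p := 5) (q := p) (by norm_num) hp2).2 hsq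
  have hp5 : ¬ 5 ∣ p := fun hd => c1 ((Nat.prime_dvd_prime_iff_eq (by norm_num) hp).1 hd).symm
  have h4 : ((p : ℕ) : ZMod 5) = ((p % 5 : ℕ) : ZMod 5) := (ZMod.natCast_mod p 5).symm
  have h5 : p % 5 = 1 ∨ p % 5 = 2 ∨ p % 5 = 3 ∨ p % 5 = 4 := by omega
  rw [h4] at h3
  rcases h5 with h | h | h | h
  · exact Or.inl h
  · rw [h] at h3; exact absurd h3 nsq2
  · rw [h] at h3; exact absurd h3 nsq3
  · exact Or.inr h

open Polynomial in
lemma iota_root {l : ℕ} (hl5 : ¬ 5 ∣ l) (hl4 : l % 4 = 3) (hS : (S l).Finite) (F : ℤ[X]) {Λ : Submodule ℤ ℂ} {z : ℂ}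
    (h : SP l Λ z) (hF : aeval (T Λ z) F = 0) : aeval (T Λ (2 * z)) F = 0 := by
  obtain ⟨M, hM0, hM5, hM⟩ := exists_M hl4 hS F
  obtain ⟨X, y, N, hN0, hN, hX, hp⟩ := exists_num (M := 2 * M) hl5 (by omega) (dvd_mul_right _ _)
  -- α = X + y θ = (X - y) + 2 y ω
  obtain ⟨α, hα⟩ : ∃ α : ℂ, α = ((X - y : ℤ) : ℂ) + ((2 * y : ℤ) : ℂ) * ((1 + θ l) / 2) := ⟨_, rfl⟩
  have hn : normSq α = N := by
    have h1 := normSq_ab l (X - y) (2 * y)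
    rw [← hα] at h1
    have h2 : (N : ℝ) = X ^ 2 + 5 * l * y ^ 2 := by exact_mod_cast hN
    rw [h2]; push_cast at h1; linarith
  have hα0 : α ≠ 0 := by
    intro h0
    rw [h0, map_zero] at hn
    have : N = 0 := by exact_mod_cast hn.symm
    omega
  obtain ⟨hab, habz⟩ := h.ab (X - y) (2 * y)
  rw [← hα] at hab habz
  obtain ⟨A, hA⟩ := h.pt.cov
  have hmem : ∀ x, x ∈ sc α⁻¹ Λ ↔ α * x ∈ Λ := by
    intro x; rw [mem_sc_iff (inv_ne_zero hα0), inv_inv]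
  have hA' := hA.sc (inv_ne_zero hα0)
  obtain ⟨-, h3⟩ := chain_one (F := F) (k := N) (Λ' := sc α⁻¹ Λ) h hF hA hA' (fun x hx => (hmem x).2 (hab x hx))
    (fun x hx => by
      rw [hmem] at hx ⊢
      have := h.w _ hx
      convert this using 1; ring) (by
        rw [map_inv₀, hn]
        have : (N : ℝ) ≠ 0 := by exact_mod_cast hN0.ne'
        field_simp) fun p hpp hpd => by
      obtain ⟨h1, h2, h3⟩ := hp p hpp hpd
      exact ⟨hM p hpp h1 fun h => h2 (h.mul_left _), h3⟩
  have e1 : T (sc α⁻¹ Λ) z = T Λ (α * z) := by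
    rw [← T_sc (inv_ne_zero hα0) Λ (α * z)]
    congr 1; field_simp
  have e2 : T Λ (α * z) = T Λ (((X - y + 3 * (2 * y) : ℤ) : ℂ) * z) := T_congr h.pt.lat habz
  have e3 := T_mul_pm h (n := X - y + 3 * (2 * y)) (m := 2) (by omega)
  rw [e1, e2, e3] at h3
  simpa using h3

end RR

namespace RR
open Filter Topology Complex


open ComplexConjugate in
lemma setup {l : ℕ} (K : Type) [Field K] [NumberField K] (θK : K) (hθ : θK ^ 2 = -((5 * l : ℕ) : K)) :
    ∃ (φ : K →+* ℂ) (v : K), φ v = θ l ∧ v ^ 2 = -((5 * l : ℕ) : K) := by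
  obtain ⟨φ⟩ : Nonempty (K →+* ℂ) := inferInstance
  have h1 : (φ θK) ^ 2 = (θ l) ^ 2 := by
    rw [θ_sq, ← map_pow, hθ, map_neg, map_natCast]; push_cast; rfl
  rcases sq_eq_sq_iff_eq_or_eq_neg.1 h1 with h | h
  · exact ⟨φ, θK, h, hθ⟩
  · exact ⟨φ, -θK, by rw [map_neg, h, neg_neg], by rw [neg_sq, hθ]⟩

lemma exists_rs {l : ℕ} (hl0 : 0 < l) {K : Type} [Field K] [NumberField K] (hK : Module.finrank ℚ K = 2)
    {φ : K →+* ℂ} {v : K} (hv : φ v = θ l) (x : K) : ∃ r s : ℚ, x = r + s * v := by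
  have hli : LinearIndependent ℚ ![(1 : K), v] := by
    rw [LinearIndependent.pair_iff]
    intro s t h
    have h1 := congrArg φ h
    rw [Algebra.smul_def, Algebra.smul_def] at h1
    simp [hv] at h1
    have h2 := congrArg im h1
    simp at h2
    have h3 : (t : ℝ) = 0 := by
      rcases h2 with h2 | h2
      · exact_mod_cast h2
      · exact absurd h2 (θ_im_pos hl0).ne'
    have h4 : t = 0 := by exact_mod_cast h3
    subst h4
    simp at h1
    exact ⟨h1, rfl⟩
  let b := basisOfLinearIndependentOfCardEqFinrank hli (by simp [hK])
  have := b.sum_repr x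
  rw [Fin.sum_univ_two] at this
  refine ⟨b.repr x 0, b.repr x 1, ?_⟩
  conv_lhs => rw [← this]
  simp [b, Algebra.smul_def]

lemma rat_int {r : ℚ} {x : ℂ} (hx : IsIntegral ℤ x) (e : x = r) : ∃ n : ℤ, r = n := by
  rw [e] at hx
  have h1 : IsIntegral ℤ (algebraMap ℚ ℂ r) := by simpa using hx
  have h2 : IsIntegral ℤ r := (isIntegral_algebraMap_iff (algebraMap ℚ ℂ).injective).1 h1
  obtain ⟨n, hn⟩ := IsIntegrallyClosed.isIntegral_iff.1 h2
  exact ⟨n, by rw [← hn]; simp⟩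

open ComplexConjugate in
/-- integral elements of the quadratic field, seen in `ℂ` -/
lemma integral_ab {l : ℕ} (hl : l.Prime) (hl5 : 5 < l) (hl4 : l % 4 = 3) {r s : ℚ} {x : ℂ}
    (hx : IsIntegral ℤ x) (e : x = r + s * θ l) : ∃ a b : ℤ, x = a + b * ((1 + θ l) / 2) := by
  have hc : IsIntegral ℤ (conj x) := hx.map (conjAe.toAlgHom.restrictScalars ℤ)
  have hcθ : conj (θ l) = - θ l := by
    apply Complex.ext <;> simp [θ_re]
  have hcx : conj x = r - s * θ l := by
    rw [e]; simp [hcθ]; ring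
  obtain ⟨A, hA⟩ := rat_int (r := 2 * r) (hx.add hc) (by rw [hcx, e]; push_cast; ring)
  obtain ⟨N, hN⟩ := rat_int (r := r ^ 2 + 5 * l * s ^ 2) (hx.mul hc) (by
    rw [hcx, e]; push_cast; linear_combination -(s : ℂ) ^ 2 * θ_sq l)
  have h1 : (5 * l * (2 * s)) ^ 2 = ((5 * l * (4 * N - A ^ 2) : ℤ) : ℚ) := by
    push_cast; rw [← hA, ← hN]; ring
  obtain ⟨c, hcc⟩ : ∃ c : ℤ, 5 * l * (2 * s) = (c : ℚ) := by
    have h2 : IsIntegral ℤ (5 * l * (2 * s) : ℚ) := by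
      refine IsIntegral.of_pow (n := 2) (by norm_num) ?_
      rw [h1]; exact isIntegral_algebraMap (A := ℚ) (x := (5 * l * (4 * N - A ^ 2) : ℤ))
    obtain ⟨n, hn⟩ := IsIntegrallyClosed.isIntegral_iff.1 h2
    exact ⟨n, by rw [← hn]; simp⟩
  rw [hcc] at h1
  have h2 : c ^ 2 = 5 * l * (4 * N - A ^ 2) := by exact_mod_cast h1
  have hlZ := Nat.prime_iff_prime_int.1 hl
  have h5Z : Prime (5 : ℤ) := Int.prime_iff_natAbs_prime.2 (by norm_num)
  obtain ⟨c1, rfl⟩ := h5Z.dvd_of_dvd_pow (show (5 : ℤ) ∣ c ^ 2 from ⟨l * (4 * N - A ^ 2), by rw [h2]; ring⟩)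
  have h3 := hlZ.dvd_of_dvd_pow (show (l : ℤ) ∣ (5 * c1) ^ 2 from ⟨5 * (4 * N - A ^ 2), by rw [h2]; ring⟩)
  have h4 : (l : ℤ) ∣ c1 := by
    rcases hlZ.dvd_or_dvd h3 with h | h
    · exact absurd (Int.le_of_dvd (by norm_num) h) (by omega)
    · exact h
  obtain ⟨B, rfl⟩ := h4
  have hlq : (l : ℚ) ≠ 0 := by exact_mod_cast hl.ne_zero
  have hB : 2 * s = B := by
    have : 5 * (l : ℚ) * (2 * s) = 5 * l * B := by rw [hcc]; push_cast; ring
    exact mul_left_cancel₀ (mul_ne_zero (by norm_num) hlq) this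
  have h6 : 4 * N = A ^ 2 + 5 * l * B ^ 2 := by
    have : (4 * N : ℚ) = A ^ 2 + 5 * l * B ^ 2 := by rw [← hN, ← hA, ← hB]; ring
    exact_mod_cast this
  obtain ⟨j, hj⟩ : ∃ j, l = 4 * j + 3 := ⟨l / 4, by omega⟩
  have h7 : (2 : ℤ) ∣ A - B := by
    have h8 : 2 ∣ (A - B) * (A + B) := ⟨2 * N - 8 * B ^ 2 - 5 * 2 * j * B ^ 2, by
      rw [hj] at h6; push_cast at h6; linear_combination -h6⟩
    rcases Int.prime_two.dvd_or_dvd h8 with h | h <;> omega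
  obtain ⟨a, ha⟩ := h7
  refine ⟨a, B, ?_⟩
  have e1 : (2 * r : ℂ) = A := by exact_mod_cast hA
  have e2 : (2 * s : ℂ) = B := by exact_mod_cast hB
  have e3 : (A - B : ℂ) = 2 * a := by exact_mod_cast ha
  rw [e]
  linear_combination e1 / 2 + θ l / 2 * e2 + e3 / 2

lemma integral_ω {l : ℕ} (hl4 : l % 4 = 3) {x : ℂ} (hx : x = (1 + θ l) / 2) : IsIntegral ℤ x := by
  obtain ⟨j, hj⟩ : ∃ j, l = 4 * j + 3 := ⟨l / 4, by omega⟩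
  refine ⟨Polynomial.X ^ 2 - Polynomial.X + Polynomial.C (4 + 5 * j : ℤ), ?_, ?_⟩
  · monicity!
  · simp [hx]
    have := θ_sq l
    rw [hj] at this ⊢
    push_cast at this
    linear_combination this / 4

end RR

namespace RR
open Filter Topology Complex


open ComplexConjugate in
lemma lat_of_im {a b : ℂ} (h : 0 < (conj a * b).im) : Lat (latt a b) := by
  have ha : a ≠ 0 := by rintro rfl; simp at h
  have hn := normSq_pos.2 ha
  have hτ : 0 < (b / a).im := by
    have : b / a = ((normSq a)⁻¹ : ℝ) * (conj a * b) := by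
      rw [div_eq_mul_inv, Complex.inv_def]; push_cast; ring
    rw [this, Complex.im_ofReal_mul]; positivity
  have h2 := (lat_one hτ).sc ha
  rw [sc_latt, mul_one, mul_div_cancel₀ _ ha] at h2
  exact h2

lemma Cov.lat {Λ : Submodule ℤ ℂ} {A : ℝ} (h : Cov Λ A) : Lat Λ := by
  obtain ⟨hA, a, b, rfl, rfl⟩ := h
  rcases lt_or_gt_of_ne (abs_pos.1 hA) with h | h
  · have : latt a b = latt b a := by
      ext x; rw [mem_latt, mem_latt]
      exact ⟨fun ⟨m, n, e⟩ => ⟨n, m, by rw [← e]; ring⟩, fun ⟨m, n, e⟩ => ⟨n, m, by rw [← e]; ring⟩⟩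
    rw [this]
    refine lat_of_im ?_
    simp at h ⊢; linarith
  · exact lat_of_im h

lemma cov_sub {M Λ : Submodule ℤ ℂ} {A : ℝ} (h : Cov Λ A) (hle : M ≤ Λ) {k : ℤ} (hk : k ≠ 0)
    (hkM : ∀ x ∈ Λ, (k : ℂ) * x ∈ M) : ∃ A', Cov M A' := by
  obtain ⟨hA, a, b, rfl, rfl⟩ := h
  let J1 : AddSubgroup ℤ :=
    { carrier := {n | ∃ m : ℤ, (m : ℂ) * a + n * b ∈ M}
      zero_mem' := ⟨0, by simp⟩
      add_mem' := by
        rintro x y ⟨m, hm⟩ ⟨m', hm'⟩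
        refine ⟨m + m', ?_⟩
        have := M.add_mem hm hm'
        convert this using 1; push_cast; ring
      neg_mem' := by
        rintro x ⟨m, hm⟩
        refine ⟨-m, ?_⟩
        have := M.neg_mem hm
        convert this using 1; push_cast; ring }
  let J2 : AddSubgroup ℤ :=
    { carrier := {m | (m : ℂ) * a ∈ M}
      zero_mem' := by simp
      add_mem' := by
        intro x y hm hm'
        have := M.add_mem hm hm'
        show ((x + y : ℤ) : ℂ) * a ∈ M
        convert this using 1; push_cast; ring
      neg_mem' := by
        intro x hm
        have := M.neg_mem hm
        show ((-x : ℤ) : ℂ) * a ∈ M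
        convert this using 1; push_cast; ring }
  have ha : a ∈ latt a b := mem_latt.2 ⟨1, 0, by simp⟩
  have hb : b ∈ latt a b := mem_latt.2 ⟨0, 1, by simp⟩
  obtain ⟨g, hg, ⟨m0, hm0⟩, hg2⟩ := exists_gen J1 ⟨k, ⟨0, by simpa using hkM b hb⟩, hk⟩
  obtain ⟨e, he, he1, he2⟩ := exists_gen J2 ⟨k, hkM a ha, hk⟩
  have he1 : (e : ℂ) * a ∈ M := he1
  refine ⟨|(starRingEnd ℂ (e * a) * (m0 * a + g * b)).im|, ?_, e * a, m0 * a + g * b, ?_, rfl⟩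
  · have : (starRingEnd ℂ (e * a) * (m0 * a + g * b)).im = (e * g) * (starRingEnd ℂ a * b).im := by
      simp; ring
    rw [this, abs_mul]
    refine mul_pos (abs_pos.2 ?_) hA
    have h1 : (0 : ℝ) < e := by exact_mod_cast he
    have h2 : (0 : ℝ) < g := by exact_mod_cast hg
    positivity
  · refine le_antisymm (fun x hx => ?_) (fun x hx => ?_)
    · obtain ⟨m, n, rfl⟩ := mem_latt.1 (hle hx)
      obtain ⟨n', rfl⟩ := hg2 n ⟨m, hx⟩
      have h1 : ((m - n' * m0 : ℤ) : ℂ) * a ∈ M := by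
        have := M.sub_mem hx (M.smul_mem n' hm0)
        convert this using 1; simp; ring
      obtain ⟨m', hm'⟩ := he2 _ h1
      refine mem_latt.2 ⟨m', n', ?_⟩
      have : (m - n' * m0 : ℂ) = e * m' := by exact_mod_cast hm'
      push_cast
      linear_combination -a * this
    · obtain ⟨m, n, rfl⟩ := mem_latt.1 hx
      have := M.add_mem (M.smul_mem m he1) (M.smul_mem n hm0)
      convert this using 1; simp; ring

lemma indep {c d : ℂ} (h : 0 < |(starRingEnd ℂ c * d).im|) {m n : ℤ} (e : (m : ℂ) * c + n * d = 0) :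
    m = 0 ∧ n = 0 := by
  have h0 := abs_pos.1 h
  have e1 := congrArg re e
  have e2 := congrArg im e
  simp at e1 e2 h0
  have h1 : (m : ℝ) * (c.re * d.im + -(c.im * d.re)) = 0 := by linear_combination d.im * e1 - d.re * e2
  have h2 : (n : ℝ) * (c.re * d.im + -(c.im * d.re)) = 0 := by linear_combination c.re * e2 - c.im * e1
  constructor
  · exact_mod_cast (mul_eq_zero.1 h1).resolve_right h0
  · exact_mod_cast (mul_eq_zero.1 h2).resolve_right h0

lemma cov_index {Λ Λ' : Submodule ℤ ℂ} {A A' : ℝ} (h : Cov Λ A) (h' : Cov Λ' A') (hl : Λ ≤ Λ') {k : ℕ}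
    (e : A = k * A') {p : ℕ} (hp : p.Prime) (hs : ∀ x ∈ Λ', ∃ y ∈ Λ', ∃ w ∈ Λ, x = p * y + w) : ¬ p ∣ k := by
  obtain ⟨hA, a, b, rfl, rfl⟩ := h
  obtain ⟨hA', c, d, rfl, rfl⟩ := h'
  obtain ⟨m, n, ha⟩ := mem_latt.1 (hl (mem_latt.2 ⟨1, 0, by simp⟩ : a ∈ latt a b))
  obtain ⟨r, s, hb⟩ := mem_latt.1 (hl (mem_latt.2 ⟨0, 1, by simp⟩ : b ∈ latt a b))
  have hD : (starRingEnd ℂ a * b).im = ((m * s - n * r : ℤ) : ℝ) * (starRingEnd ℂ c * d).im := by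
    rw [← ha, ← hb]
    simp
    ring
  rw [hD, abs_mul, ← Int.cast_abs] at e
  have e1 : |m * s - n * r| = k := by exact_mod_cast mul_right_cancel₀ hA'.ne' e
  intro hd
  have hd' : (p : ℤ) ∣ m * s - n * r := by
    rw [← dvd_abs, e1]; exact_mod_cast hd
  obtain ⟨D, hD'⟩ := hd'
  obtain ⟨y, hy, w, hw, h1⟩ := hs c (mem_latt.2 ⟨1, 0, by simp⟩)
  obtain ⟨y', hy', w', hw', h2⟩ := hs d (mem_latt.2 ⟨0, 1, by simp⟩)
  obtain ⟨x1, x2, rfl⟩ := mem_latt.1 hy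
  obtain ⟨x3, x4, rfl⟩ := mem_latt.1 hy'
  obtain ⟨y1, y2, rfl⟩ := mem_latt.1 hw
  obtain ⟨y3, y4, rfl⟩ := mem_latt.1 hw'
  rw [← ha, ← hb] at h1 h2
  obtain ⟨i1, i2⟩ := indep hA' (m := p * x1 + y1 * m + y2 * r - 1) (n := p * x2 + y1 * n + y2 * s)
    (by push_cast; linear_combination -h1)
  obtain ⟨i3, i4⟩ := indep hA' (m := p * x3 + y3 * m + y4 * r) (n := p * x4 + y3 * n + y4 * s - 1)
    (by push_cast; linear_combination -h2)
  refine (Nat.prime_iff_prime_int.1 hp).not_dvd_one ?_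
  refine ⟨(y1 * y4 - y2 * y3) * D + x1 + x4 - p * x1 * x4 + p * x2 * x3, ?_⟩
  have f1 : y1 * m + y2 * r = 1 - p * x1 := by linear_combination i1
  have f2 : y1 * n + y2 * s = - p * x2 := by linear_combination i2
  have f3 : y3 * m + y4 * r = - p * x3 := by linear_combination i3
  have f4 : y3 * n + y4 * s = 1 - p * x4 := by linear_combination i4
  have : (y1 * y4 - y2 * y3) * (m * s - n * r) = (1 - p * x1) * (1 - p * x4) - (-p * x2) * (-p * x3) := by
    rw [← f1, ← f2, ← f3, ← f4]; ring
  rw [hD'] at this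
  linear_combination -this

lemma not_div {l : ℕ} (hl5 : ¬ 5 ∣ l) {Λ : Submodule ℤ ℂ} (h : ∀ y ∈ Λ, θ l * (y / 5) ∈ Λ) :
    ∀ y ∈ Λ, y / 5 ∈ Λ := by
  intro y hy
  obtain ⟨u, v, huv⟩ := (Int.prime_iff_natAbs_prime.2 (by norm_num) : Prime (5 : ℤ)).coprime_iff_not_dvd.2
    (show ¬ (5 : ℤ) ∣ l by omega)
  have h1 := h _ (h y hy)
  have := Λ.sub_mem (Λ.smul_mem u hy) (Λ.smul_mem v h1)
  convert this using 1
  have e : (u * 5 + v * l : ℂ) = 1 := by exact_mod_cast huv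
  simp
  linear_combination -y / 5 * e + v * y / 25 * θ_sq l

lemma exists_SP {l : ℕ} (hl5 : ¬ 5 ∣ l) {Λ : Submodule ℤ ℂ} {A : ℝ} (hA : Cov Λ A)
    (hw : ∀ x ∈ Λ, (1 + θ l) / 2 * x ∈ Λ) : ∃ z, SP l Λ z := by
  have hθ : ∀ x ∈ Λ, θ l * x ∈ Λ := by
    intro x hx
    have := Λ.sub_mem (Λ.smul_mem (2 : ℤ) (hw x hx)) hx
    convert this using 1; simp; ring
  by_cases hc : ∀ y ∈ Λ, θ l * (y / 5) ∈ Λ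
  · exfalso
    have h1 := not_div hl5 hc
    have h5 : (5 : ℂ)⁻¹ ≠ 0 := by norm_num
    have h2 : sc (5 : ℂ)⁻¹ Λ = Λ := by
      ext x
      rw [mem_sc_iff h5, inv_inv]
      constructor
      · intro h; have := h1 _ h; convert this using 1; ring
      · intro h; have := Λ.smul_mem (5 : ℤ) h; convert this using 1; simp
    have h3 := hA.sc h5
    rw [h2] at h3
    have h4 := hA.unique h3
    have := hA.1
    rw [map_inv₀, show (5 : ℂ) = ((5 : ℝ) : ℂ) by norm_num, normSq_ofReal] at h4
    linarith
  · push Not at hc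
    obtain ⟨y, hy, hn⟩ := hc
    refine ⟨θ l * (y / 5), ⟨hA.lat, ?_, hn⟩, hw, ?_⟩
    · have := hθ y hy
      convert this using 1; ring
    · have := Λ.smul_mem (-(l : ℤ)) hy
      convert this using 1; simp
      linear_combination y / 5 * θ_sq l

lemma SP.unique {l : ℕ} (hl5 : ¬ 5 ∣ l) {Λ : Submodule ℤ ℂ} {z z' : ℂ} (h : SP l Λ z) (h' : SP l Λ z') :
    ∃ n : ℤ, z' - n * z ∈ Λ := by
  by_contra hcon
  push Not at hcon
  obtain ⟨A, hA⟩ := h.pt.cov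
  obtain ⟨-, a, b, hab, -⟩ := id hA
  have hg := two_gen (p := 5) (by norm_num) hab (by exact_mod_cast h.pt.five) (by exact_mod_cast h'.pt.five)
    h.pt.notMem hcon
  have hθ : ∀ x ∈ Λ, θ l * x ∈ Λ := by
    intro x hx
    have := Λ.sub_mem (Λ.smul_mem (2 : ℤ) (h.w x hx)) hx
    convert this using 1; simp; ring
  have h1 := not_div hl5 (Λ := Λ) (fun y hy => by
    obtain ⟨i, j, -, x0, hx0, e⟩ := hg (y / 5) (by convert hy using 1; push_cast; ring)
    rw [e]
    have := Λ.add_mem (Λ.add_mem (Λ.smul_mem i h.tz) (Λ.smul_mem j h'.tz)) (hθ _ hx0)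
    convert this using 1; simp; ring)
  refine h.pt.notMem ?_
  have := h1 _ h.pt.five
  convert this using 1; ring

lemma SP.unique_T {l : ℕ} (hl5 : ¬ 5 ∣ l) {Λ : Submodule ℤ ℂ} {z z' : ℂ} (h : SP l Λ z) (h' : SP l Λ z') :
    T Λ z' = T Λ z ∨ T Λ z' = T Λ (2 * z) := by
  obtain ⟨n, hn⟩ := h.unique hl5 h'
  have e := T_congr h.pt.lat hn
  have h5 : ¬ (5 : ℤ) ∣ n := by
    intro hd
    refine h'.pt.notMem ?_
    have := Λ.add_mem hn ((h.pt.int_mul_mem n).2 hd)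
    convert this using 1; ring
  by_cases hc : (5 : ℤ) ∣ n - 1 ∨ (5 : ℤ) ∣ n + 1
  · left; rw [e, T_mul_pm h (m := 1) hc]; simp
  · right; rw [e, T_mul_pm h (m := 2) (by omega)]; simp

lemma SP.scale {l : ℕ} {Λ : Submodule ℤ ℂ} {z c : ℂ} (hc : c ≠ 0) (h : SP l Λ z) : SP l (RR.sc c Λ) (c * z) := by
  refine ⟨h.pt.sc hc, fun x hx => ?_, ?_⟩
  · rw [mem_sc_iff hc] at hx ⊢
    have := h.w _ hx
    convert this using 1; ring
  · rw [mem_sc_iff hc]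
    have := h.tz
    convert this using 1; field_simp

end RR

namespace RR
open Filter Topology Complex


open NumberField

/-- image of an ideal under a complex embedding -/
def L {K : Type} [Field K] (φ : K →+* ℂ) (I : Ideal (𝓞 K)) : Submodule ℤ ℂ where
  carrier := {y | ∃ x ∈ I, φ (x : K) = y}
  zero_mem' := ⟨0, I.zero_mem, by simp⟩
  add_mem' := by
    rintro _ _ ⟨x, hx, rfl⟩ ⟨y, hy, rfl⟩
    exact ⟨x + y, I.add_mem hx hy, by simp⟩
  smul_mem' := by
    rintro n _ ⟨x, hx, rfl⟩
    exact ⟨n * x, I.mul_mem_left _ hx, by simp⟩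

lemma mem_L {K : Type} [Field K] {φ : K →+* ℂ} {I : Ideal (𝓞 K)} {y : ℂ} :
    y ∈ L φ I ↔ ∃ x ∈ I, φ (x : K) = y := Iff.rfl

lemma φ_inj {K : Type} [Field K] (φ : K →+* ℂ) {x y : 𝓞 K} (h : φ (x : K) = φ (y : K)) : x = y :=
  RingOfIntegers.ext (φ.injective h)

lemma φ_mem_L {K : Type} [Field K] {φ : K →+* ℂ} {I : Ideal (𝓞 K)} {x : 𝓞 K} : φ (x : K) ∈ L φ I ↔ x ∈ I := by
  constructor
  · rintro ⟨y, hy, e⟩; rw [← φ_inj φ e]; exact hy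
  · intro h; exact ⟨x, h, rfl⟩

/-- the embedding `φ` identifies the ring of integers with `ℤ[(1+θ)/2]` -/
structure Em (l : ℕ) {K : Type} [Field K] (φ : K →+* ℂ) : Prop where
  out : ∀ x : 𝓞 K, ∃ a b : ℤ, φ (x : K) = a + b * ((1 + θ l) / 2)
  into : ∀ a b : ℤ, ∃ x : 𝓞 K, φ (x : K) = a + b * ((1 + θ l) / 2)

lemma exists_Em {l : ℕ} (hl : l.Prime) (hl5 : 5 < l) (hl4 : l % 4 = 3) (K : Type) [Field K] [NumberField K]
    (θK : K) (hθ : θK ^ 2 = -((5 * l : ℕ) : K)) (hK : Module.finrank ℚ K = 2) :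
    ∃ φ : K →+* ℂ, Em l φ := by
  obtain ⟨φ, v, hv, hv2⟩ := setup K θK hθ
  refine ⟨φ, fun x => ?_, fun a b => ?_⟩
  · obtain ⟨r, s, e⟩ := exists_rs (by omega) hK hv (x : K)
    refine integral_ab hl hl5 hl4 (r := r) (s := s) (x.isIntegral_coe.map φ.toIntAlgHom) ?_
    show φ (x : K) = _
    rw [e]; simp [hv]
  · have h1 : φ ((1 + v) / 2) = (1 + θ l) / 2 := by
      rw [map_div₀, map_add, map_one, hv, map_ofNat]
    have h2 : IsIntegral ℤ (φ ((1 + v) / 2)) := integral_ω hl4 h1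
    have h3 : IsIntegral ℤ ((1 + v) / 2) := (isIntegral_algHom_iff φ.toIntAlgHom φ.injective).1 h2
    obtain ⟨w, hw⟩ : ∃ w : 𝓞 K, (w : K) = (1 + v) / 2 := ⟨⟨_, h3⟩, rfl⟩
    refine ⟨(a : 𝓞 K) + (b : 𝓞 K) * w, ?_⟩
    have : φ (((a : 𝓞 K) + (b : 𝓞 K) * w : 𝓞 K) : K) = φ (a + b * ((1 + v) / 2)) := by
      rw [← hw]; simp
    rw [this, map_add, map_mul, h1]; simp

lemma L_w {l : ℕ} {K : Type} [Field K] {φ : K →+* ℂ} (hE : Em l φ) (I : Ideal (𝓞 K)) :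
    ∀ x ∈ L φ I, (1 + θ l) / 2 * x ∈ L φ I := by
  rintro _ ⟨x, hx, rfl⟩
  obtain ⟨w, hw⟩ := hE.into 0 1
  refine ⟨w * x, I.mul_mem_left _ hx, ?_⟩
  simp at hw ⊢
  left; exact hw

lemma L_top {l : ℕ} {K : Type} [Field K] {φ : K →+* ℂ} (hE : Em l φ) : L φ ⊤ = latt 1 (5 * τ₁ l) := by
  ext y
  rw [mem_latt]
  constructor
  · rintro ⟨x, -, rfl⟩
    obtain ⟨a, b, e⟩ := hE.out x
    refine ⟨a - 2 * b, b, ?_⟩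
    rw [e, τ₁]; push_cast; ring
  · rintro ⟨m, n, rfl⟩
    obtain ⟨x, hx⟩ := hE.into (m + 2 * n) n
    refine ⟨x, trivial, ?_⟩
    rw [hx, τ₁]; push_cast; ring

lemma L_mono {K : Type} [Field K] {φ : K →+* ℂ} {I J : Ideal (𝓞 K)} (h : I ≤ J) : L φ I ≤ L φ J := by
  rintro _ ⟨x, hx, rfl⟩; exact ⟨x, h hx, rfl⟩

lemma L_cov {l : ℕ} (hl4 : l % 4 = 3) {K : Type} [Field K] [NumberField K] {φ : K →+* ℂ} (hE : Em l φ)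
    {I : Ideal (𝓞 K)} (hI : I ≠ ⊥) : ∃ A, Cov (L φ I) A := by
  obtain ⟨A, hA⟩ := (sp_base hl4).pt.cov
  rw [← L_top hE] at hA
  have h0 : Ideal.absNorm I ≠ 0 := fun h => hI (Ideal.absNorm_eq_zero_iff.1 h)
  refine cov_sub hA (L_mono le_top) (k := (Ideal.absNorm I : ℤ)) (by exact_mod_cast h0) ?_
  rintro _ ⟨x, -, rfl⟩
  refine ⟨(Ideal.absNorm I : 𝓞 K) * x, I.mul_mem_right _ (Ideal.absNorm_mem I), ?_⟩
  simp

lemma ab_mem {l : ℕ} {Λ : Submodule ℤ ℂ} (hw : ∀ x ∈ Λ, (1 + θ l) / 2 * x ∈ Λ) {x : ℂ} (hx : x ∈ Λ) (a b : ℤ) :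
    (a + b * ((1 + θ l) / 2)) * x ∈ Λ := by
  have := Λ.add_mem (Λ.smul_mem a hx) (Λ.smul_mem b (hw x hx))
  convert this using 1; simp; ring

lemma exists_ideal {l : ℕ} (hl4 : l % 4 = 3) {K : Type} [Field K] [NumberField K] {φ : K →+* ℂ} (hE : Em l φ)
    {Λ : Submodule ℤ ℂ} {A : ℝ} (hA : Cov Λ A) (hw : ∀ x ∈ Λ, (1 + θ l) / 2 * x ∈ Λ) :
    ∃ (c : ℂ) (I : Ideal (𝓞 K)), c ≠ 0 ∧ I ≠ ⊥ ∧ Λ = sc c (L φ I) := by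
  obtain ⟨x0, hx0, h0⟩ : ∃ x0 ∈ Λ, x0 ≠ 0 := by
    obtain ⟨hp, a, b, rfl, rfl⟩ := hA
    refine ⟨a, mem_latt.2 ⟨1, 0, by simp⟩, ?_⟩
    rintro rfl; simp at hp
  have hA1 := hA.sc (inv_ne_zero h0)
  obtain ⟨A0, hA0⟩ := (sp_base hl4).pt.cov
  rw [← L_top hE] at hA0
  have hmem : ∀ y, y ∈ sc x0⁻¹ Λ ↔ x0 * y ∈ Λ := fun y => by
    rw [mem_sc_iff (inv_ne_zero h0), inv_inv]
  obtain ⟨k, hk, -, hkx⟩ := hA0.le hA1 (by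
    rintro _ ⟨x, -, rfl⟩
    obtain ⟨a, b, e⟩ := hE.out x
    rw [hmem, e, mul_comm]; exact ab_mem hw hx0 a b)
  have hk0 : (k : ℂ) ≠ 0 := by exact_mod_cast hk.ne'
  let I : Ideal (𝓞 K) :=
    { carrier := {x | x0 * ((k : ℂ)⁻¹ * φ (x : K)) ∈ Λ}
      zero_mem' := by simp
      add_mem' := by
        intro x y hx hy
        have := Λ.add_mem hx hy
        show x0 * ((k : ℂ)⁻¹ * φ ((x + y : 𝓞 K) : K)) ∈ Λ
        convert this using 1; simp; ring
      smul_mem' := by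
        intro c x hx
        obtain ⟨a, b, e⟩ := hE.out c
        have := ab_mem hw hx a b
        show x0 * ((k : ℂ)⁻¹ * φ ((c * x : 𝓞 K) : K)) ∈ Λ
        convert this using 1
        rw [← e]; simp; ring }
  have hI : ∀ x, x ∈ I ↔ x0 * ((k : ℂ)⁻¹ * φ (x : K)) ∈ Λ := fun x => Iff.rfl
  refine ⟨x0 * (k : ℂ)⁻¹, I, mul_ne_zero h0 (inv_ne_zero hk0), ?_, ?_⟩
  · intro hbot
    have h1 : (k : 𝓞 K) ∈ I := by
      rw [hI]; simp [hk0, hx0]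
    rw [hbot] at h1
    have h2 : (k : 𝓞 K) = 0 := h1
    exact hk.ne' (by exact_mod_cast h2)
  · ext y
    rw [mem_sc_iff (mul_ne_zero h0 (inv_ne_zero hk0))]
    constructor
    · intro hy
      have h1 := hkx (x0⁻¹ * y) ((hmem _).2 (by rwa [mul_inv_cancel_left₀ h0]))
      obtain ⟨x, -, hx⟩ := h1
      refine ⟨x, (hI x).2 ?_, ?_⟩
      · rw [hx]; rw [show x0 * ((k : ℂ)⁻¹ * (k * (x0⁻¹ * y))) = y by field_simp]; exact hy
      · rw [hx]; field_simp
    · rintro ⟨x, hx, e⟩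
      have h1 := (hI x).1 hx
      rw [e] at h1
      convert h1 using 1
      field_simp

open nonZeroDivisors in
lemma class_eq {K : Type} [Field K] [NumberField K] {φ : K →+* ℂ} {I J : (Ideal (𝓞 K))⁰} :
    ClassGroup.mk0 I = ClassGroup.mk0 J ↔ ∃ c : ℂ, c ≠ 0 ∧ L φ (J : Ideal (𝓞 K)) = sc c (L φ (I : Ideal (𝓞 K))) := by
  have hne : ∀ x : 𝓞 K, x ≠ 0 → φ (x : K) ≠ 0 := by
    intro x hx h
    exact hx (φ_inj φ (by simpa using h))
  rw [ClassGroup.mk0_eq_mk0_iff]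
  constructor
  · rintro ⟨x, y, hx, hy, e⟩
    have hx' := hne x hx
    have hy' := hne y hy
    have hc : φ (x : K) / φ (y : K) ≠ 0 := div_ne_zero hx' hy'
    refine ⟨φ (x : K) / φ (y : K), hc, ?_⟩
    ext w
    rw [mem_sc_iff hc]
    constructor
    · rintro ⟨j, hj, rfl⟩
      have h1 : y * j ∈ Ideal.span {x} * (I : Ideal (𝓞 K)) := by
        rw [e, Ideal.mem_span_singleton_mul]; exact ⟨j, hj, rfl⟩
      obtain ⟨i, hi, h2⟩ := Ideal.mem_span_singleton_mul.1 h1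
      refine ⟨i, hi, ?_⟩
      have h3 := congrArg (fun t : 𝓞 K => φ (t : K)) h2
      simp at h3
      field_simp
      linear_combination h3
    · rintro ⟨i, hi, h1⟩
      have h2 : x * i ∈ Ideal.span {y} * (J : Ideal (𝓞 K)) := by
        rw [← e, Ideal.mem_span_singleton_mul]; exact ⟨i, hi, rfl⟩
      obtain ⟨j, hj, h2⟩ := Ideal.mem_span_singleton_mul.1 h2
      refine ⟨j, hj, ?_⟩
      have h3 := congrArg (fun t : 𝓞 K => φ (t : K)) h2
      simp at h3
      rw [h1] at h3
      field_simp at h3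
      exact h3
  · rintro ⟨c, hc, e⟩
    obtain ⟨i, hi, hi0⟩ := Submodule.exists_mem_ne_zero_of_ne_bot (nonZeroDivisors.coe_ne_zero I)
    have h1 : c * φ (i : K) ∈ L φ (J : Ideal (𝓞 K)) := by
      rw [e]; exact mul_mem_sc hc |>.2 ⟨i, hi, rfl⟩
    obtain ⟨j, hj, h2⟩ := h1
    have hi' := hne i hi0
    have hj0 : j ≠ 0 := by
      rintro rfl
      simp at h2
      rcases h2 with h2 | h2
      · exact hc h2
      · exact hi' (by simp [h2])
    refine ⟨j, i, hj0, hi0, ?_⟩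
    ext w
    rw [Ideal.mem_span_singleton_mul, Ideal.mem_span_singleton_mul]
    constructor
    · rintro ⟨a, ha, rfl⟩
      have h3 : c * φ (a : K) ∈ L φ (J : Ideal (𝓞 K)) := by
        rw [e]; exact mul_mem_sc hc |>.2 ⟨a, ha, rfl⟩
      obtain ⟨b, hb, h4⟩ := h3
      refine ⟨b, hb, φ_inj φ ?_⟩
      simp [h4, h2]; ring
    · rintro ⟨b, hb, rfl⟩
      have h3 : φ (b : K) ∈ L φ (J : Ideal (𝓞 K)) := ⟨b, hb, rfl⟩
      rw [e, mem_sc_iff hc] at h3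
      obtain ⟨a, ha, h4⟩ := h3
      refine ⟨a, ha, φ_inj φ ?_⟩
      simp [h4, h2]; field_simp

lemma integral_quad {x : ℂ} {u v : ℤ} (h : x ^ 2 - u * x + v = 0) : IsIntegral ℤ x := by
  refine ⟨Polynomial.X ^ 2 - Polynomial.C u * Polynomial.X + Polynomial.C v, ?_, ?_⟩
  · monicity!
  · simp only [Polynomial.eval₂_add, Polynomial.eval₂_sub, Polynomial.eval₂_mul, Polynomial.eval₂_C,
      Polynomial.eval₂_X, Polynomial.eval₂_pow]
    simpa using h

lemma auto_pm {l : ℕ} (hl5 : 5 < l) {K : Type} [Field K] [NumberField K] {φ : K →+* ℂ} (hE : Em l φ)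
    {I : Ideal (𝓞 K)} (hI : I ≠ ⊥) {A : ℝ} (hA : Cov (L φ I) A) {c : ℂ} (hc : c ≠ 0)
    (e : L φ I = sc c (L φ I)) : c = 1 ∨ c = -1 := by
  have hn : normSq c = 1 := by
    have h1 := hA.sc hc
    rw [← e] at h1
    have := hA.unique h1
    have hA0 := hA.1.ne'
    field_simp at this
    exact this.symm
  have hst : ∀ x ∈ L φ I, c * x ∈ L φ I := by
    intro x hx; rw [e]; exact mul_mem_sc hc |>.2 hx
  obtain ⟨i, hi, hi0⟩ := Submodule.exists_mem_ne_zero_of_ne_bot hI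
  have hi' : φ (i : K) ≠ 0 := fun h => hi0 (φ_inj φ (by simpa using h))
  obtain ⟨j, hj, h2⟩ := hst _ ⟨i, hi, rfl⟩
  have h3 : c = φ ((j : K) / (i : K)) := by
    rw [map_div₀, h2]; field_simp
  have hInt : IsIntegral ℤ c := by
    obtain ⟨hA0, a, b, hab, hab'⟩ := hA
    rw [hab] at hst
    obtain ⟨m, n, e1⟩ := mem_latt.1 (hst a (mem_latt.2 ⟨1, 0, by simp⟩))
    obtain ⟨r, s, e2⟩ := mem_latt.1 (hst b (mem_latt.2 ⟨0, 1, by simp⟩))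
    have ha : a ≠ 0 := by rintro rfl; simp at hab'; exact hA0.ne hab'
    refine integral_quad (u := m + s) (v := m * s - n * r) ?_
    refine mul_right_cancel₀ ha ?_
    push_cast
    linear_combination (s - c) * e1 - n * e2
  have h4 : IsIntegral ℤ ((j : K) / (i : K)) := by
    rw [h3] at hInt
    exact (isIntegral_algHom_iff φ.toIntAlgHom φ.injective).1 hInt
  obtain ⟨a, b, h5⟩ := hE.out ⟨(j : K) / (i : K), h4⟩
  have h6 : c = a + b * ((1 + θ l) / 2) := by rw [h3]; exact h5
  have h7 := normSq_ab l a b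
  rw [← h6, hn] at h7
  have h8 : (4 : ℤ) = (2 * a + b) ^ 2 + 5 * l * b ^ 2 := by
    have : (4 : ℝ) = (2 * a + b) ^ 2 + 5 * l * b ^ 2 := by rw [← h7]; norm_num
    exact_mod_cast this
  have hb : b = 0 := by
    by_contra hb
    have : 1 ≤ b ^ 2 := by have := sq_nonneg b; have := pow_ne_zero 2 hb; omega
    have hl : (5 : ℤ) < l := by exact_mod_cast hl5
    nlinarith [sq_nonneg (2 * a + b)]
  subst hb
  have ha : (a - 1) * (a + 1) = 0 := by linarith
  rcases mul_eq_zero.1 ha with h | h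
  · left; rw [h6, show a = 1 by omega]; simp
  · right; rw [h6, show a = -1 by omega]; simp

end RR

namespace RR
open Filter Topology Complex


open NumberField Polynomial

/-- parametrization of `S l` by ideal classes and a sign -/
lemma S_param {l : ℕ} (hl5 : 5 < l) (h5 : ¬ 5 ∣ l) (hl4 : l % 4 = 3) {K : Type} [Field K] [NumberField K]
    {φ : K →+* ℂ} (hE : Em l φ) :
    ∃ f : ClassGroup (𝓞 K) × Bool → ℂ, Function.Injective f ∧ Set.range f = S l := by
  have h1 : ∀ C : ClassGroup (𝓞 K), ∃ I : nonZeroDivisors (Ideal (𝓞 K)), ClassGroup.mk0 I = C :=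
    ClassGroup.mk0_surjective
  choose I hI using h1
  have hne : ∀ C, (I C : Ideal (𝓞 K)) ≠ ⊥ := fun C => nonZeroDivisors.coe_ne_zero (I C)
  have h2 : ∀ C, ∃ z, SP l (L φ (I C : Ideal (𝓞 K))) z := by
    intro C
    obtain ⟨A, hA⟩ := L_cov hl4 hE (hne C)
    exact exists_SP h5 hA (L_w hE _)
  choose z hz using h2
  have key : ∀ C (u : ℤ) (v : ℤ), ¬ (5 ∣ u) → ¬ (5 ∣ v) → ∀ c : ℂ, c = 1 ∨ c = -1 →
      (v * z C - c * (u * z C) ∈ L φ (I C : Ideal (𝓞 K)) ∨ v * z C + c * (u * z C) ∈ L φ (I C : Ideal (𝓞 K))) →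
      (5 : ℤ) ∣ v - u ∨ (5 : ℤ) ∣ v + u := by
    intro C u v hu hv c hc h
    have e1 : (v : ℂ) * z C - u * z C = ((v - u : ℤ) : ℂ) * z C := by push_cast; ring
    have e2 : (v : ℂ) * z C + u * z C = ((v + u : ℤ) : ℂ) * z C := by push_cast; ring
    have i1 := (hz C).pt.int_mul_mem (v - u)
    have i2 := (hz C).pt.int_mul_mem (v + u)
    rw [← e1] at i1; rw [← e2] at i2
    rcases hc with rfl | rfl
    · simp only [one_mul] at h
      exact h.imp i1.1 i2.1
    · simp only [neg_mul, one_mul, sub_neg_eq_add, ← sub_eq_add_neg] at h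
      exact h.symm.imp i1.1 i2.1
  let g : ClassGroup (𝓞 K) × Bool → ℤ := fun x => if x.2 then 1 else 2
  have hg5 : ∀ x, ¬ (5 : ℤ) ∣ g x := by
    rintro ⟨C, _ | _⟩ <;> simp [g]
  refine ⟨fun x => T (L φ (I x.1 : Ideal (𝓞 K))) (g x * z x.1), ?_, ?_⟩
  · intro x y e
    have hx : ∀ x, SP l (L φ (I x.1 : Ideal (𝓞 K))) (g x * z x.1) := by
      rintro ⟨C, _ | _⟩
      · simpa [g] using (hz C).two
      · simpa [g] using hz C
    obtain ⟨c, hc, e1, e2⟩ := injectivity (hx x).pt (hx y).pt e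
    have e3 := class_eq.2 ⟨c, hc, e1⟩
    rw [hI, hI] at e3
    obtain ⟨C, b⟩ := x
    obtain ⟨C', b'⟩ := y
    simp only at e3
    subst e3
    obtain ⟨A, hA⟩ := L_cov hl4 hE (hne C)
    have hc1 := auto_pm hl5 hE (hne C) hA hc e1
    have := key C _ _ (hg5 (C, b)) (hg5 (C, b')) c hc1 e2
    rcases b with _ | _ <;> rcases b' with _ | _ <;> simp [g] at this ⊢
  · ext y
    constructor
    · rintro ⟨⟨C, _ | _⟩, rfl⟩
      · exact ⟨_, _, (hz C).two, by simp [g]⟩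
      · exact ⟨_, _, hz C, by simp [g]⟩
    · rintro ⟨Λ, w, h, rfl⟩
      obtain ⟨A, hA⟩ := h.pt.cov
      obtain ⟨c, J, hc, hJ, rfl⟩ := exists_ideal hl4 hE hA h.w
      let J' : nonZeroDivisors (Ideal (𝓞 K)) := ⟨J, mem_nonZeroDivisors_of_ne_zero hJ⟩
      obtain ⟨d, hd, e⟩ := (class_eq (φ := φ)).1 (hI (ClassGroup.mk0 J'))
      have e' : L φ J = sc d (L φ (I (ClassGroup.mk0 J') : Ideal (𝓞 K))) := e
      set C := ClassGroup.mk0 J' with hC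
      rw [e', sc_sc] at h ⊢
      have hcd : c * d ≠ 0 := mul_ne_zero hc hd
      have h2 := h.scale (inv_ne_zero hcd)
      rw [sc_inv hcd] at h2
      have e3 : T (sc (c * d) (L φ (I C : Ideal (𝓞 K)))) w = T (L φ (I C : Ideal (𝓞 K))) ((c * d)⁻¹ * w) := by
        rw [← T_sc hcd _ ((c * d)⁻¹ * w), mul_inv_cancel_left₀ hcd]
      rw [e3]
      clear e3
      rcases (hz C).unique_T h5 h2 with e4 | e4
      · exact ⟨(C, true), by rw [e4]; simp [g]⟩
      · exact ⟨(C, false), by rw [e4]; simp [g]⟩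

lemma S_root {l : ℕ} (hl5 : 5 < l) (h5 : ¬ 5 ∣ l) (hl4 : l % 4 = 3) {K : Type} [Field K] [NumberField K]
    {φ : K →+* ℂ} (hE : Em l φ) (hS : (S l).Finite) (F : ℤ[X]) (hF : aeval (t (τ₁ l)) F = 0)
    {y : ℂ} (hy : y ∈ S l) : aeval y F = 0 := by
  have hι : ∀ Λ z, SP l Λ z → aeval (T Λ z) F = 0 → aeval (T Λ (2 * z)) F = 0 :=
    fun Λ z h h' => iota_root h5 hl4 hS F h h'
  obtain ⟨Λ, w, h, rfl⟩ := hy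
  obtain ⟨A, hA⟩ := h.pt.cov
  obtain ⟨c, J, hc, hJ, rfl⟩ := exists_ideal hl4 hE hA h.w
  obtain ⟨M, hM0, hM5, hM⟩ := exists_M hl4 hS F
  obtain ⟨N, hNd⟩ : ∃ N, N = 5 * M := ⟨_, rfl⟩
  obtain ⟨B, hB⟩ := L_cov hl4 hE hJ
  have hN : ((N : ℕ) : 𝓞 K) ≠ 0 := by exact_mod_cast (by omega : N ≠ 0)
  have hne : Ideal.span {((N : ℕ) : 𝓞 K)} * J ≠ 0 := by
    refine mul_ne_zero ?_ hJ
    rw [Ideal.zero_eq_bot, Ne, Ideal.span_singleton_eq_bot]; exact hN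
  obtain ⟨μ, hμ⟩ := IsDedekindDomain.exists_sup_span_eq
    (Ideal.mul_le_right : Ideal.span {((N : ℕ) : 𝓞 K)} * J ≤ J) hne
  have hμJ : μ ∈ J := by
    rw [← hμ]; exact Ideal.mem_sup_right (Ideal.mem_span_singleton_self μ)
  have hdec : ∀ i ∈ J, ∃ j ∈ J, ∃ r : 𝓞 K, i = ((N : ℕ) : 𝓞 K) * j + μ * r := by
    intro i hi
    rw [← hμ] at hi
    obtain ⟨a, ha, b, hb, rfl⟩ := Submodule.mem_sup.1 hi
    obtain ⟨j, hj, rfl⟩ := Ideal.mem_span_singleton_mul.1 ha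
    obtain ⟨r, rfl⟩ := Ideal.mem_span_singleton.1 hb
    exact ⟨j, hj, r, rfl⟩
  have hNC : ((N : ℕ) : ℂ) ≠ 0 := by exact_mod_cast (by omega : N ≠ 0)
  have hμ0 : μ ≠ 0 := by
    rintro rfl
    have e : L φ J = sc ((N : ℕ) : ℂ) (L φ J) := by
      ext y
      rw [mem_sc_iff hNC]
      constructor
      · rintro ⟨i, hi, rfl⟩
        obtain ⟨j, hj, r, rfl⟩ := hdec i hi
        refine ⟨j, hj, ?_⟩
        rw [eq_inv_mul_iff_mul_eq₀ hNC]; simp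
      · rintro ⟨j, hj, e⟩
        refine ⟨((N : ℕ) : 𝓞 K) * j, J.mul_mem_left _ hj, ?_⟩
        rw [eq_inv_mul_iff_mul_eq₀ hNC] at e
        rw [← e]; simp
    rcases auto_pm hl5 hE hJ hB hNC e with h | h
    · have : N = 1 := by exact_mod_cast h
      omega
    · have : ((N : ℕ) : ℤ) = -1 := by exact_mod_cast h
      omega
  set m := φ (μ : K) with hm
  have hm0 : m ≠ 0 := fun h => hμ0 (φ_inj φ (by rw [← hm, h]; simp))
  set Λ' := sc m⁻¹ (L φ J) with hΛ'
  have mem' : ∀ x, x ∈ Λ' ↔ m * x ∈ L φ J := by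
    intro x; rw [hΛ', mem_sc_iff (inv_ne_zero hm0), inv_inv]
  have hw' : ∀ x ∈ Λ', (1 + θ l) / 2 * x ∈ Λ' := by
    intro x hx
    rw [mem'] at hx ⊢
    have := L_w hE J _ hx
    convert this using 1; ring
  have hA' : Cov Λ' (normSq m⁻¹ * B) := hB.sc (inv_ne_zero hm0)
  have hb := sp_base hl4 (l := l)
  have htop : ∀ r : 𝓞 K, φ (r : K) ∈ latt 1 (5 * τ₁ l) := by
    intro r; rw [← L_top hE]; exact ⟨r, trivial, rfl⟩
  have hle : latt 1 (5 * τ₁ l) ≤ Λ' := by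
    rw [← L_top hE]
    rintro _ ⟨r, -, rfl⟩
    rw [mem']
    exact ⟨μ * r, J.mul_mem_right _ hμJ, by simp [hm]⟩
  obtain ⟨A0, hA0⟩ := hb.pt.cov
  obtain ⟨k, hk0, hk, -⟩ := hA0.le hA' hle
  have hP : ∀ p : ℕ, p.Prime → p ∣ k → Good l F p := by
    intro p hp hpk
    have hnd : ¬ p ∣ N := by
      rintro ⟨n, hn⟩
      refine cov_index hA0 hA' hle hk hp ?_ hpk
      intro x hx
      obtain ⟨i, hi, e⟩ := (mem' x).1 hx
      obtain ⟨j, hj, r, rfl⟩ := hdec i hi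
      refine ⟨n * (m⁻¹ * φ (j : K)), ?_, φ (r : K), htop r, ?_⟩
      · rw [mem']
        refine ⟨n * j, J.mul_mem_left _ hj, ?_⟩
        simp; field_simp
      · have e' : m * x = ((N : ℕ) : ℂ) * φ (j : K) + m * φ (r : K) := by rw [← e]; simp [hm]
        rw [hn] at e'
        push_cast at e'
        have : x = m⁻¹ * (m * x) := by field_simp
        rw [this, e']; field_simp
    refine hM p hp ?_ ?_
    · rintro rfl; exact hnd (hNd ▸ dvd_mul_right _ _)
    · intro h; exact hnd (hNd ▸ h.mul_left _)
  obtain ⟨s1, s2⟩ := chain_two hb hF hA0 hA' hle hw' hk hP hι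
  have s3 := hι _ _ s1 s2
  have hcm : c * m ≠ 0 := mul_ne_zero hc hm0
  have e5 : sc c (L φ J) = sc (c * m) Λ' := by
    rw [hΛ', sc_sc]; congr 1; field_simp
  rw [e5] at h ⊢
  have h2 := s1.scale hcm
  rcases h2.unique_T h5 h with e6 | e6
  · rw [e6, T_sc hcm]; exact s2
  · rw [e6, show (2 : ℂ) * (c * m * τ₁ l) = c * m * (2 * τ₁ l) by ring, T_sc hcm]; exact s3

lemma degree {l : ℕ} (hl5 : 5 < l) (h5 : ¬ 5 ∣ l) (hl4 : l % 4 = 3) {K : Type} [Field K] [NumberField K]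
    {φ : K →+* ℂ} (hE : Em l φ) :
    (minpoly ℚ (t (τ₁ l))).natDegree = 2 * NumberField.classNumber K := by
  obtain ⟨f, hf, hfr⟩ := S_param hl5 h5 hl4 hE
  have hS : (S l).Finite := by rw [← hfr]; exact Set.finite_range f
  have hcard : Nat.card (S l) = 2 * NumberField.classNumber K := by
    rw [← hfr, Nat.card_range_of_injective hf, Nat.card_prod, NumberField.classNumber, mul_comm]
    simp
  have hInt : IsIntegral ℚ (t (τ₁ l)) := (alg hl5 hl4).isIntegral
  set P := minpoly ℚ (t (τ₁ l)) with hP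
  have hP0 : P ≠ 0 := minpoly.ne_zero hInt
  obtain ⟨b, hb⟩ := IsLocalization.integerNormalization_map_to_map (nonZeroDivisors ℤ) P
  set F := IsLocalization.integerNormalization (nonZeroDivisors ℤ) P with hFdef
  have hev : ∀ x : ℂ, aeval x F = ((b : ℤ) : ℂ) * aeval x P := by
    intro x
    rw [← aeval_map_algebraMap ℚ x F, hb]
    simp
  have hb0 : ((b : ℤ) : ℂ) ≠ 0 := by exact_mod_cast nonZeroDivisors.coe_ne_zero b
  have hF : aeval (t (τ₁ l)) F = 0 := by rw [hev, hP, minpoly.aeval, mul_zero]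
  have hset : P.rootSet ℂ = S l := by
    ext y
    rw [mem_rootSet_of_ne hP0]
    constructor
    · intro h; exact root_mem_S hl5 hl4 h
    · intro h
      have := S_root hl5 h5 hl4 hE hS F hF h
      rw [hev] at this
      exact (mul_eq_zero.1 this).resolve_left hb0
  have h1 := card_rootSet_eq_natDegree (K := ℂ) (minpoly.irreducible hInt).separable (IsAlgClosed.splits _)
  rw [← hcard, ← hset, ← h1, Nat.card_eq_fintype_card]

end RR

theorem rogers_ramanujan_value_degree_three_mod_four
    (l : ℕ) (hl : Nat.Prime l) (hl5 : 5 < l) (hmod4 : l % 4 = 3)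
    (K : Type) [Field K] [NumberField K] (θ : K)
    (hθ : θ ^ 2 = -((5 * l : ℕ) : K))
    (hK : Module.finrank ℚ K = 2)
    (τ : ℂ) (hτ : τ = (5 + Complex.I * (Real.sqrt (5 * l) : ℂ)) / 10)
    (q : ℂ) (hq : q = Complex.exp (2 * (Real.pi : ℂ) * Complex.I * τ))
    (ρ : ℂ)
    (hρ : ρ = q * ∏' n : ℕ, (1 - q ^ (n + 1)) ^ (5 * jacobiSym (n + 1) 5)) :
    Multipliable (fun n : ℕ => (1 - q ^ (n + 1)) ^ (5 * jacobiSym (n + 1) 5)) ∧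
    ρ.im = 0 ∧
    IsAlgebraic ℚ ρ ∧
    (minpoly ℚ ρ).natDegree = 2 * NumberField.classNumber K := by
  have h5 : ¬ 5 ∣ l := by
    intro h
    have := (Nat.prime_dvd_prime_iff_eq Nat.prime_five hl).1 h
    omega
  have hτ' : τ = RR.τ₁ l := hτ
  have hq' : q = RR.ex (RR.τ₁ l) := by rw [hq, hτ']; rfl
  have hn : ‖q‖ < 1 := by
    rw [hq']; exact (RR.q_small hl5 hmod4).trans_lt (by norm_num)
  have hp := RR.hasProd_rr hn
  have hρ1 : ρ = q * RR.tB q := by rw [hρ, hp.tprod_eq]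
  have hρ2 : ρ = RR.t (RR.τ₁ l) := by
    rw [hρ1, RR.t_eq_tB (RR.τ₁_im (by omega)), hq']
  obtain ⟨φ, hE⟩ := RR.exists_Em hl hl5 hmod4 K θ hθ hK
  refine ⟨hp.multipliable, ?_, ?_, ?_⟩
  · rw [hρ1]; exact RR.im_rr hn (by rw [hq']; exact RR.q_real l)
  · rw [hρ2]; exact RR.alg hl5 hmod4
  · rw [hρ2]; exact RR.degree hl5 h5 hmod4 hE
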